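/- Under the assumptions and notation of the Geometric Lemma, let V₁, V₂ be the open sets it provides for R' ∈ Tree_WSBC(R), and for i = 1 or 2 let Q ∈ Stop_WSBC(R) ∩ D_μ(R') ∩ G and let q ∈ V_i be a corkscrew point for Q. Set r := 2ℓ(R') and, for δ ∈ (0, 1/100), A_r^δ := {x ∈ A(q, r, 2r) ∩ Ω : δ_Ω(x) > δ r}, where A(q, r, 2r) denotes the open annulus B(q,2r) \ cl(B(q,r)). Then g(p,q) ≲ (1/r) · sup_{y ∈ A_r^δ ∩ V_i} (g(p,y)/δ_Ω(y)) · ∫_{A_r^δ} g(q,x) dx + (δ^{α/2}/r^{n+3}) · ∫_{A(q,r,2r)} g(p,x) dx · ∫_{A(q,r,2r)} g(q,x) dx + ∑_{I ∈ Bdy(R')} (1/ℓ(I)) ∫_{2I} |g(p,x) ∇_x g(q,x) − ∇_x g(p,x) g(q,x)| dx, where α ∈ (0,1) is the boundary Hölder continuity exponent for nonnegative harmonic functions vanishing on ∂Ω (depending only on n and the AD-regularity constant) and Bdy(R') := ⋃ {W_P : P ∈ ~End(R') with 2B_P ∩ 10B_{R'} ≠ ∅}, with W_P the family of Whitney cubes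 I ⊂ V₁ ∪ V₂ such that 1.1·cl(I) ∩ ∂(V₁ ∪ V₂) ∩ 2B_P ≠ ∅. -/

import Mathlib

open Metric MeasureTheory Set Filter Topology

noncomputable section

/-- Euclidean space `ℝ^d`. -/
abbrev Euc (d : ℕ) : Type := EuclideanSpace ℝ (Fin d)

namespace HarmMeas

/-- Distance between two sets. -/
def setD {d : ℕ} (s t : Set (Euc d)) : ℝ := sInf (Set.image2 dist s t)

/-- A continuous function is subharmonic on `U` if it satisfies the sub-mean-value
property on every ball whose closure is contained in `U`. -/
def SubharmonicOn {d : ℕ} (u : Euc d → ℝ) (U : Set (Euc d)) : Prop :=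
  ContinuousOn u U ∧ ∀ x ∈ U, ∀ r : ℝ, 0 < r → closedBall x r ⊆ U →
    u x ≤ ⨍ y in ball x r, u y

/-- Harmonic (continuous) functions: both `u` and `-u` are subharmonic. -/
def HarmonicOnS {d : ℕ} (u : Euc d → ℝ) (U : Set (Euc d)) : Prop :=
  SubharmonicOn u U ∧ SubharmonicOn (fun y => -u y) U

/-- The upper (Perron) class associated to boundary data `f` on the open set `Ω`:
superharmonic functions on `Ω`, bounded below, whose liminf at each boundary point
dominates `f` there. -/
def upperFamily {d : ℕ} (Ω : Set (Euc d)) (f : Euc d → ℝ) : Set (Euc d → ℝ) :=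
  {u | SubharmonicOn (fun y => -u y) Ω ∧ BddBelow (u '' Ω) ∧
       ∀ ξ ∈ frontier Ω, f ξ ≤ Filter.liminf u (nhdsWithin ξ Ω)}

/-- The (upper) Perron solution of the Dirichlet problem in `Ω` with boundary data `f`,
evaluated at `p`. -/
def perron {d : ℕ} (Ω : Set (Euc d)) (f : Euc d → ℝ) (p : Euc d) : ℝ :=
  sInf ((fun u => u p) '' upperFamily Ω f)

/-- Harmonic measure `ω^p(A)` of `A` for the open set `Ω` with pole `p`: the value at `p`
of the Perron solution with boundary data the characteristic function of `A`. -/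
def hMeasure {d : ℕ} (Ω : Set (Euc d)) (p : Euc d) (A : Set (Euc d)) : ℝ :=
  perron Ω (A.indicator fun _ => 1) p

/-- The Green function `g(p,x)` of `Ω ⊆ ℝ^{n+1}` with pole `p`: the fundamental solution
`|x-p|^{1-n}` minus the Perron solution with the fundamental solution as boundary data. -/
def greenFn (n : ℕ) (Ω : Set (Euc (n+1))) (p x : Euc (n+1)) : ℝ :=
  ‖x - p‖ ^ ((1 : ℤ) - n) - perron Ω (fun ξ => ‖ξ - p‖ ^ ((1 : ℤ) - n)) x

/-- `F ⊆ ℝ^{n+1}` is `n`-AD-regular with constant `C₀`. -/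
def ADRegular (n : ℕ) (C₀ : ℝ) (F : Set (Euc (n+1))) : Prop :=
  ∀ x ∈ F, ∀ r : ℝ, 0 < r → ENNReal.ofReal r ≤ EMetric.diam F →
    ENNReal.ofReal (C₀⁻¹ * r ^ n) ≤ μH[n] (F ∩ ball x r) ∧
      μH[n] (F ∩ ball x r) ≤ ENNReal.ofReal (C₀ * r ^ n)

/-- A `λ`-carrot curve from `x` to `y` in `Ω`: a curve `γ ⊆ Ω ∪ {y}` with endpoints `x`
and `y` such that `dist(z, ∂Ω) ≥ λ ⋅ ℋ¹(γ(y,z))` for every point `z = γ(t)` of the curve,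
where `γ(y,z)` is the arc of `γ` between `y` and `z`. -/
def CarrotCurve {d : ℕ} (Ω : Set (Euc d)) (lam : ℝ) (x y : Euc d) : Prop :=
  ∃ γ : ℝ → Euc d, ContinuousOn γ (Icc 0 1) ∧ γ 0 = x ∧ γ 1 = y ∧
    γ '' Icc 0 1 ⊆ Ω ∪ {y} ∧
    ∀ t ∈ Icc (0:ℝ) 1,
      ENNReal.ofReal lam * μH[1] (γ '' Icc t 1) ≤
        ENNReal.ofReal (infDist (γ t) (frontier Ω))

/-- A `C`-good Harnack chain from `x ∈ Ω` to `y ∈ cl Ω`, all of whose balls are moreover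
contained in the set `W`: consecutive balls meet, each ball has radius comparable (with
constant `C`) to its distance to `∂Ω`, radii are quasi-monotone, and for each `t > 0`
there are at most `C` balls of radius in `(t, 2t]`.  If `y ∈ Ω` the chain is finite and
`y` lies in its last ball; if `y ∈ ∂Ω` the chain is infinite and the balls converge
to `y`. -/
def GoodChainIn {d : ℕ} (Ω W : Set (Euc d)) (C : ℝ) (x y : Euc d) : Prop :=
  (y ∈ Ω ∧ ∃ (N : ℕ) (c : ℕ → Euc d) (r : ℕ → ℝ),
    x ∈ ball (c 0) (r 0) ∧ y ∈ ball (c N) (r N) ∧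
    (∀ j ≤ N, 0 < r j ∧ ball (c j) (r j) ⊆ Ω ∩ W) ∧
    (∀ j < N, (ball (c j) (r j) ∩ ball (c (j+1)) (r (j+1))).Nonempty) ∧
    (∀ j ≤ N, C⁻¹ * setD (ball (c j) (r j)) (frontier Ω) ≤ r j ∧
      r j ≤ C * setD (ball (c j) (r j)) (frontier Ω)) ∧
    (∀ i j, i ≤ N → j ≤ N → i < j → r j ≤ C * r i) ∧
    (∀ t : ℝ, 0 < t →
      {j | j ≤ N ∧ t < r j ∧ r j ≤ 2 * t}.Finite ∧
      (Nat.card {j | j ≤ N ∧ t < r j ∧ r j ≤ 2 * t} : ℝ) ≤ C))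
  ∨ (y ∈ frontier Ω ∧ ∃ (c : ℕ → Euc d) (r : ℕ → ℝ),
    x ∈ ball (c 0) (r 0) ∧
    Filter.Tendsto (fun j => infDist y (ball (c j) (r j))) atTop (nhds 0) ∧
    (∀ j, 0 < r j ∧ ball (c j) (r j) ⊆ Ω ∩ W) ∧
    (∀ j, (ball (c j) (r j) ∩ ball (c (j+1)) (r (j+1))).Nonempty) ∧
    (∀ j, C⁻¹ * setD (ball (c j) (r j)) (frontier Ω) ≤ r j ∧
      r j ≤ C * setD (ball (c j) (r j)) (frontier Ω)) ∧
    (∀ i j : ℕ, i < j → r j ≤ C * r i) ∧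
    (∀ t : ℝ, 0 < t →
      {j | t < r j ∧ r j ≤ 2 * t}.Finite ∧
      (Nat.card {j | t < r j ∧ r j ≤ 2 * t} : ℝ) ≤ C))

/-- A `C`-good Harnack chain from `x` to `y`. -/
def GoodChain {d : ℕ} (Ω : Set (Euc d)) (C : ℝ) (x y : Euc d) : Prop :=
  GoodChainIn Ω Set.univ C x y


/-- The harmonic measure of the open set `Ω` satisfies the weak-`A∞` condition: for every
`ε₀ ∈ (0,1)` there is `δ₀ ∈ (0,1)` such that for every ball `B` centered on `∂Ω`, every
pole `p ∈ Ω \ 4B` and every Borel `E ⊆ B ∩ ∂Ω`, `ℋⁿ(E) ≤ δ₀ ℋⁿ(B ∩ ∂Ω)` implies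
`ω^p(E) ≤ ε₀ ω^p(2B)`. -/
def WeakAInfty (n : ℕ) (Ω : Set (Euc (n+1))) : Prop :=
  ∀ ε₀ ∈ Set.Ioo (0:ℝ) 1, ∃ δ₀ ∈ Set.Ioo (0:ℝ) 1,
    ∀ x₀ ∈ frontier Ω, ∀ r₀ : ℝ, 0 < r₀ →
      ∀ p ∈ Ω \ closedBall x₀ (4 * r₀),
        ∀ A : Set (Euc (n+1)), MeasurableSet A → A ⊆ ball x₀ r₀ ∩ frontier Ω →
          μH[n] A ≤ ENNReal.ofReal δ₀ * μH[n] (ball x₀ r₀ ∩ frontier Ω) →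
          hMeasure Ω p A ≤ ε₀ * hMeasure Ω p (ball x₀ (2 * r₀))

/-- `ω^p` satisfies the weak-`A∞` condition in the ball `B(x₀,r₀)`, with gauge `D`
(i.e. `δ₀ = D ε₀` is a witness for each `ε₀ ∈ (0,1)`). -/
def WeakAInftyBallWith (n : ℕ) (Ω : Set (Euc (n+1))) (p x₀ : Euc (n+1)) (r₀ : ℝ)
    (D : ℝ → ℝ) : Prop :=
  ∀ ε₀ ∈ Set.Ioo (0:ℝ) 1, D ε₀ ∈ Set.Ioo (0:ℝ) 1 ∧
    ∀ A : Set (Euc (n+1)), MeasurableSet A → A ⊆ ball x₀ r₀ ∩ frontier Ω →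
      μH[n] A ≤ ENNReal.ofReal (D ε₀) * μH[n] (ball x₀ r₀ ∩ frontier Ω) →
      hMeasure Ω p A ≤ ε₀ * hMeasure Ω p (ball x₀ (2 * r₀))

/-- The weak local John condition for `Ω ⊆ ℝ^{n+1}`: there are `λ, θ ∈ (0,1)` and `Λ ≥ 2`
such that every `x ∈ Ω` sees (through `λ`-carrot curves) a Borel subset `F` of
`B(x, Λ δ_Ω(x)) ∩ ∂Ω` of surface measure at least `θ ℋⁿ(B(x, Λ δ_Ω(x)) ∩ ∂Ω)`. -/
def WeakLocalJohn (n : ℕ) (Ω : Set (Euc (n+1))) : Prop :=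
  ∃ lam ∈ Set.Ioo (0:ℝ) 1, ∃ θ ∈ Set.Ioo (0:ℝ) 1, ∃ Λ : ℝ, 2 ≤ Λ ∧
    ∀ x ∈ Ω, ∃ F : Set (Euc (n+1)), MeasurableSet F ∧
      F ⊆ ball x (Λ * infDist x (frontier Ω)) ∩ frontier Ω ∧
      ENNReal.ofReal θ * μH[n] (ball x (Λ * infDist x (frontier Ω)) ∩ frontier Ω) ≤
        μH[n] F ∧
      ∀ y ∈ F, CarrotCurve Ω lam x y

/-- The corkscrew condition for `Ω`. -/
def CorkscrewCond {d : ℕ} (Ω : Set (Euc d)) : Prop :=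
  ∃ c > (0:ℝ), ∀ x ∈ frontier Ω, ∀ ρ : ℝ, 0 < ρ → ENNReal.ofReal ρ ≤ EMetric.diam Ω →
    ∃ (y : Euc d) (r : ℝ), c * ρ ≤ r ∧ ball y r ⊆ ball x ρ ∩ Ω

/-- `F ⊆ ℝ^{n+1}` is uniformly `n`-rectifiable, with AD-regularity constant `C₀` and
big-pieces-of-Lipschitz-images constants `θ`, `M`. -/
def UnifRectifiable (n : ℕ) (C₀ θ M : ℝ) (F : Set (Euc (n+1))) : Prop :=
  ADRegular n C₀ F ∧ 0 < θ ∧ 0 < M ∧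
    ∀ x ∈ F, ∀ r : ℝ, 0 < r → ENNReal.ofReal r ≤ EMetric.diam F →
      ∃ g : Euc n → Euc (n+1), LipschitzOnWith (Real.toNNReal M) g (ball 0 r) ∧
        ENNReal.ofReal (θ * r ^ n) ≤ μH[n] (F ∩ ball x r ∩ g '' ball 0 r)

/-- The set `WA(p,Λ)` of boundary points `x ∈ B(p, 10 δ_Ω(p)) ∩ ∂Ω` at which the harmonic
measure `ω^p` is comparable (with constant `Λ`) to the normalized surface measure
`μ(B(x,r))/μ(B(x,δ_Ω(p)))` at every scale `0 < r ≤ δ_Ω(p)`. -/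
def WAset (n : ℕ) (Ω : Set (Euc (n+1))) (p : Euc (n+1)) (Λ : ℝ) : Set (Euc (n+1)) :=
  {x | x ∈ ball p (10 * infDist p (frontier Ω)) ∩ frontier Ω ∧
    ∀ r : ℝ, 0 < r → r ≤ infDist p (frontier Ω) →
      Λ⁻¹ * ((μH[n] (frontier Ω ∩ ball x r)).toReal /
          (μH[n] (frontier Ω ∩ ball x (infDist p (frontier Ω)))).toReal) ≤
        hMeasure Ω p (ball x r) ∧
      hMeasure Ω p (ball x r) ≤
        Λ * ((μH[n] (frontier Ω ∩ ball x r)).toReal /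
          (μH[n] (frontier Ω ∩ ball x (infDist p (frontier Ω)))).toReal)}


/-- A David–Semmes dyadic lattice associated to a measure `μ` supported on the set `F`,
with comparability constant `Cl`: for each generation `j ∈ ℤ` a partition of `F` into
Borel "cubes" of side length `2^{-j}`, nested across generations, with
`diam Q ≤ ℓ(Q)`, `μ(Q) ≈ ℓ(Q)ⁿ`, centers deep inside the cubes, and small boundaries. -/
structure DSLattice (n : ℕ) (F : Set (Euc (n+1))) (μ : Measure (Euc (n+1))) (Cl : ℝ) where
  cube : ℤ → Set (Set (Euc (n+1)))
  center : Set (Euc (n+1)) → Euc (n+1)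
  one_le_Cl : 1 ≤ Cl
  subset_F : ∀ j, ∀ Q ∈ cube j, Q ⊆ F
  nonempty : ∀ j, ∀ Q ∈ cube j, Q.Nonempty
  measurableSet : ∀ j, ∀ Q ∈ cube j, MeasurableSet Q
  cover : ∀ j : ℤ, ENNReal.ofReal ((2:ℝ) ^ (-j)) ≤ EMetric.diam F →
    ∀ x ∈ F, ∃ Q ∈ cube j, x ∈ Q
  disj : ∀ j, ∀ Q ∈ cube j, ∀ Q' ∈ cube j, Q ≠ Q' → Disjoint Q Q'
  nested : ∀ j k : ℤ, k ≤ j → ∀ Q ∈ cube j, ∀ Q' ∈ cube k, (Q ∩ Q').Nonempty → Q ⊆ Q'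
  diam_le : ∀ j, ∀ Q ∈ cube j, EMetric.diam Q ≤ ENNReal.ofReal ((2:ℝ) ^ (-j))
  measure_lb : ∀ j, ∀ Q ∈ cube j, ENNReal.ofReal (Cl⁻¹ * ((2:ℝ) ^ (-j)) ^ n) ≤ μ Q
  measure_ub : ∀ j, ∀ Q ∈ cube j, μ Q ≤ ENNReal.ofReal (Cl * ((2:ℝ) ^ (-j)) ^ n)
  center_mem : ∀ j, ∀ Q ∈ cube j, center Q ∈ Q
  center_far : ∀ j, ∀ Q ∈ cube j, ∀ y ∈ F \ Q, Cl⁻¹ * (2:ℝ) ^ (-j) ≤ dist (center Q) y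
  small_boundary : ∀ j, ∀ Q ∈ cube j, ∀ τ : ℝ, 0 < τ → τ < 1 →
    μ {x ∈ Q | infDist x (F \ Q) ≤ τ * (2:ℝ) ^ (-j)} +
        μ {x ∈ F \ Q | infDist x Q ≤ τ * (2:ℝ) ^ (-j)} ≤
      ENNReal.ofReal (Cl * τ ^ (1 / Cl) * ((2:ℝ) ^ (-j)) ^ n)

/-- A cube of the lattice, recorded together with its generation. -/
abbrev Cube (n : ℕ) : Type := ℤ × Set (Euc (n+1))

/-- Membership of a (generation, cube) pair in the lattice. -/
def DSLattice.mem {n : ℕ} {F : Set (Euc (n+1))} {μ : Measure (Euc (n+1))} {Cl : ℝ}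
    (L : DSLattice n F μ Cl) (q : Cube n) : Prop := q.2 ∈ L.cube q.1

/-- Side length `ℓ(Q) = 2^{-j}` of a cube of generation `j`. -/
def sideLen {n : ℕ} (q : Cube n) : ℝ := (2:ℝ) ^ (-q.1)

/-- The ball `t·B_Q = B(z_Q, t · 4 ℓ(Q))` associated to the cube `q`. -/
def cubeBall {n : ℕ} {F : Set (Euc (n+1))} {μ : Measure (Euc (n+1))} {Cl : ℝ}
    (L : DSLattice n F μ Cl) (t : ℝ) (q : Cube n) : Set (Euc (n+1)) :=
  ball (L.center q.2) (t * (4 * sideLen q))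

/-- The dilated cube `λQ = {x ∈ F : dist(x,Q) ≤ (λ-1) ℓ(Q)}`. -/
def dilCube {n : ℕ} (F : Set (Euc (n+1))) (lam : ℝ) (q : Cube n) : Set (Euc (n+1)) :=
  {x ∈ F | infDist x q.2 ≤ (lam - 1) * sideLen q}

/-- The bilateral beta coefficient `bβ_F(B(x,r))`: infimum over affine `n`-planes `L`
meeting `B(x,r)` of `r⁻¹ (sup_{y ∈ F ∩ B} dist(y,L) + sup_{y ∈ L ∩ B} dist(y,F))`. -/
def bbeta (n : ℕ) (F : Set (Euc (n+1))) (x : Euc (n+1)) (r : ℝ) : ℝ :=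
  sInf {t | ∃ L : AffineSubspace ℝ (Euc (n+1)),
    Module.finrank ℝ L.direction = n ∧ ((L : Set (Euc (n+1))) ∩ ball x r).Nonempty ∧
    t = r⁻¹ * ((⨆ y ∈ F ∩ ball x r, infDist y (L : Set (Euc (n+1)))) +
      ⨆ y ∈ (L : Set (Euc (n+1))) ∩ ball x r, infDist y F)}

/-- `q` belongs to `D_μ(R)`: a lattice cube contained in `R` of generation at least that
of `R`. -/
def InD {n : ℕ} {F : Set (Euc (n+1))} {μ : Measure (Euc (n+1))} {Cl : ℝ}
    (L : DSLattice n F μ Cl) (R q : Cube n) : Prop :=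
  L.mem q ∧ q.2 ⊆ R.2 ∧ R.1 ≤ q.1


/-- The axis-parallel closed cube with center `c` and side length `l`. -/
def cubeSet {d : ℕ} (c : Euc d) (l : ℝ) : Set (Euc d) :=
  {y | ∀ i, |y i - c i| ≤ l / 2}

/-- The axis-parallel open cube with center `c` and side length `l`. -/
def openCube {d : ℕ} (c : Euc d) (l : ℝ) : Set (Euc d) :=
  {y | ∀ i, |y i - c i| < l / 2}

/-- A Whitney decomposition of the open set `Ω` into axis-parallel cubes (encoded as
(center, side length) pairs), with parameters `M₀` (dilates reaching the boundary) and
`D₀` (bounded overlap). -/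
structure Whitney {d : ℕ} (Ω : Set (Euc d)) (M₀ D₀ : ℝ) where
  fam : Set (Euc d × ℝ)
  pos : ∀ I ∈ fam, 0 < I.2
  cover : ⋃ I ∈ fam, cubeSet I.1 I.2 = Ω
  disj_int : ∀ I ∈ fam, ∀ J ∈ fam, I ≠ J → Disjoint (openCube I.1 I.2) (openCube J.1 J.2)
  inside : ∀ I ∈ fam, cubeSet I.1 (10 * I.2) ⊆ Ω
  near_bd : ∀ I ∈ fam, (cubeSet I.1 (M₀ * I.2) ∩ frontier Ω).Nonempty
  overlap : ∀ I ∈ fam,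
    {J | J ∈ fam ∧ ¬ Disjoint (cubeSet I.1 (10 * I.2)) (cubeSet J.1 (10 * J.2))}.Finite ∧
    (Nat.card {J | J ∈ fam ∧
        ¬ Disjoint (cubeSet I.1 (10 * I.2)) (cubeSet J.1 (10 * J.2))} : ℝ) ≤ D₀
  comparable : ∀ I ∈ fam, ∀ J ∈ fam,
    ¬ Disjoint (cubeSet I.1 (10 * I.2)) (cubeSet J.1 (10 * J.2)) → D₀⁻¹ * I.2 ≤ J.2
  diam_small : ∀ I ∈ fam,
    EMetric.diam (cubeSet I.1 I.2) ≤
      ENNReal.ofReal (setD (cubeSet I.1 I.2) (frontier Ω) / 100)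

section Corona
variable {n : ℕ} {F : Set (Euc (n+1))} {μ : Measure (Euc (n+1))} {Cl : ℝ}

/-- The harmonic-measure density `ω^p(λQ)/μ(λQ)` of the dilated cube `λQ`. -/
def dens (Ω : Set (Euc (n+1))) (μ : Measure (Euc (n+1))) (p : Euc (n+1)) (lam : ℝ)
    (q : Cube n) : ℝ :=
  hMeasure Ω p (dilCube (frontier Ω) lam q) / (μ (dilCube (frontier Ω) lam q)).toReal

/-- Being a high density cube (before maximality): `ω^p(2Q)/μ(2Q) ≥ A ω^p(2R₀)/μ(2R₀)`. -/
def HDcond (Ω : Set (Euc (n+1))) (μ : Measure (Euc (n+1))) (L : DSLattice n F μ Cl)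
    (p : Euc (n+1)) (R₀ : Cube n) (A : ℝ) (q : Cube n) : Prop :=
  L.mem q ∧ q.2 ⊆ R₀.2 ∧ A * dens Ω μ p 2 R₀ ≤ dens Ω μ p 2 q

/-- Being a low density cube (before maximality): `ω^p(Q)/μ(Q) ≤ A⁻¹ ω^p(R₀)/μ(R₀)`. -/
def LDcond (Ω : Set (Euc (n+1))) (μ : Measure (Euc (n+1))) (L : DSLattice n F μ Cl)
    (p : Euc (n+1)) (R₀ : Cube n) (A : ℝ) (q : Cube n) : Prop :=
  L.mem q ∧ q.2 ⊆ R₀.2 ∧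
    hMeasure Ω p q.2 / (μ q.2).toReal ≤ A⁻¹ * (hMeasure Ω p R₀.2 / (μ R₀.2).toReal)

/-- Maximal cubes of the lattice satisfying a given property. -/
def MaximalWith (L : DSLattice n F μ Cl) (P : Cube n → Prop) (q : Cube n) : Prop :=
  P q ∧ ∀ q' : Cube n, L.mem q' → q'.1 < q.1 → q.2 ⊆ q'.2 → ¬ P q'

/-- The family `HD` of maximal high density cubes contained in `R₀`. -/
def HDfam (Ω : Set (Euc (n+1))) (μ : Measure (Euc (n+1))) (L : DSLattice n F μ Cl)
    (p : Euc (n+1)) (R₀ : Cube n) (A : ℝ) : Set (Cube n) :=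
  {q | MaximalWith L (HDcond Ω μ L p R₀ A) q}

/-- The family `LD` of maximal low density cubes contained in `R₀`. -/
def LDfam (Ω : Set (Euc (n+1))) (μ : Measure (Euc (n+1))) (L : DSLattice n F μ Cl)
    (p : Euc (n+1)) (R₀ : Cube n) (A : ℝ) : Set (Cube n) :=
  {q | MaximalWith L (LDcond Ω μ L p R₀ A) q}

/-- `B_H`, the union of the high density cubes. -/
def BHset (Ω : Set (Euc (n+1))) (μ : Measure (Euc (n+1))) (L : DSLattice n F μ Cl)
    (p : Euc (n+1)) (R₀ : Cube n) (A : ℝ) : Set (Euc (n+1)) :=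
  ⋃ q ∈ HDfam Ω μ L p R₀ A, q.2

/-- `B_L`, the union of the low density cubes. -/
def BLset (Ω : Set (Euc (n+1))) (μ : Measure (Euc (n+1))) (L : DSLattice n F μ Cl)
    (p : Euc (n+1)) (R₀ : Cube n) (A : ℝ) : Set (Euc (n+1)) :=
  ⋃ q ∈ LDfam Ω μ L p R₀ A, q.2

/-- The family `G` of cubes of `D_μ(R₀)` not contained in any high or low density cube. -/
def Gfam (Ω : Set (Euc (n+1))) (μ : Measure (Euc (n+1))) (L : DSLattice n F μ Cl)
    (p : Euc (n+1)) (R₀ : Cube n) (A : ℝ) : Set (Cube n) :=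
  {q | InD L R₀ q ∧
    ∀ q' ∈ HDfam Ω μ L p R₀ A ∪ LDfam Ω μ L p R₀ A, ¬ q.2 ⊆ q'.2}

/-- `bβ(Q) := bβ_{∂Ω}(100 B_Q)`. -/
def bbetaQ (n : ℕ) {F : Set (Euc (n+1))} {μ : Measure (Euc (n+1))} {Cl : ℝ}
    (L : DSLattice n F μ Cl) (G : Set (Euc (n+1))) (q : Cube n) : ℝ :=
  bbeta n G (L.center q.2) (100 * (4 * sideLen q))

/-- `q'` is the dyadic parent of `q`. -/
def IsParent (L : DSLattice n F μ Cl) (q' q : Cube n) : Prop :=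
  L.mem q' ∧ q'.1 = q.1 - 1 ∧ q.2 ⊆ q'.2

/-- The stopping condition for the corona decomposition: `Q ∉ G` or `bβ(Q̂) > ε`. -/
def StopBad (Ω : Set (Euc (n+1))) (μ : Measure (Euc (n+1))) (L : DSLattice n F μ Cl)
    (p : Euc (n+1)) (R₀ : Cube n) (A ε : ℝ) (q : Cube n) : Prop :=
  q ∉ Gfam Ω μ L p R₀ A ∨ ∃ q', IsParent L q' q ∧ ε < bbetaQ n L (frontier Ω) q'

/-- `Stop(R)`: the maximal cubes of `D_μ(R) \ {R}` satisfying the stopping condition. -/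
def StopFam (Ω : Set (Euc (n+1))) (μ : Measure (Euc (n+1))) (L : DSLattice n F μ Cl)
    (p : Euc (n+1)) (R₀ : Cube n) (A ε : ℝ) (R : Cube n) : Set (Cube n) :=
  {q | L.mem q ∧ q.2 ⊆ R.2 ∧ R.1 < q.1 ∧ StopBad Ω μ L p R₀ A ε q ∧
    ∀ q' : Cube n, L.mem q' → q'.2 ⊆ R.2 → R.1 < q'.1 → q'.1 < q.1 → q.2 ⊆ q'.2 →
      ¬ StopBad Ω μ L p R₀ A ε q'}

/-- `Tree(R)`: the cubes of `D_μ(R)` not contained in any cube from `Stop(R)`. -/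
def TreeFam (Ω : Set (Euc (n+1))) (μ : Measure (Euc (n+1))) (L : DSLattice n F μ Cl)
    (p : Euc (n+1)) (R₀ : Cube n) (A ε : ℝ) (R : Cube n) : Set (Cube n) :=
  {q | InD L R q ∧ ∀ s ∈ StopFam Ω μ L p R₀ A ε R, ¬ q.2 ⊆ s.2}

/-- The generations `Top_k` of the corona decomposition. -/
def TopFam (Ω : Set (Euc (n+1))) (μ : Measure (Euc (n+1))) (L : DSLattice n F μ Cl)
    (p : Euc (n+1)) (R₀ : Cube n) (A ε : ℝ) : ℕ → Set (Cube n)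
  | 0 => {q | q ∈ Gfam Ω μ L p R₀ A ∧ q.1 = R₀.1 + 10}
  | (k+1) => {q | ∃ R ∈ TopFam Ω μ L p R₀ A ε k,
      q ∈ StopFam Ω μ L p R₀ A ε R ∧ q ∈ Gfam Ω μ L p R₀ A}

/-- `Top := ⋃_k Top_k`. -/
def TopAll (Ω : Set (Euc (n+1))) (μ : Measure (Euc (n+1))) (L : DSLattice n F μ Cl)
    (p : Euc (n+1)) (R₀ : Cube n) (A ε : ℝ) : Set (Cube n) :=
  {q | ∃ k : ℕ, q ∈ TopFam Ω μ L p R₀ A ε k}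

/-- `Tree^{(N)}(R)`: cubes of `Tree(R)` of side length larger than `2^{-N} ℓ(R₀)`. -/
def TreeN (Ω : Set (Euc (n+1))) (μ : Measure (Euc (n+1))) (L : DSLattice n F μ Cl)
    (p : Euc (n+1)) (R₀ : Cube n) (A ε : ℝ) (N : ℕ) (R : Cube n) : Set (Cube n) :=
  {q | q ∈ TreeFam Ω μ L p R₀ A ε R ∧ q.1 < R₀.1 + N}

/-- `Top_b^{(N)}`: the cubes `R` of `Top` of side length larger than `2^{-N} ℓ(R₀)` with
`Tree(R) ≠ {R}`. -/
def TopbN (Ω : Set (Euc (n+1))) (μ : Measure (Euc (n+1))) (L : DSLattice n F μ Cl)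
    (p : Euc (n+1)) (R₀ : Cube n) (A ε : ℝ) (N : ℕ) : Set (Cube n) :=
  {R | R ∈ TopAll Ω μ L p R₀ A ε ∧ R.1 < R₀.1 + N ∧
    ∃ q ∈ TreeFam Ω μ L p R₀ A ε R, q ≠ R}

end Corona

section WSBC

variable {n : ℕ} {F : Set (Euc (n+1))} {Cl : ℝ}

/-- The data of best approximating planes `Lpl Q` and of the two associated big
corkscrews `x1 Q`, `x2 Q`, for all cubes `Q` with `bβ(Q) ≤ C₄ ε`: the plane is an
`n`-plane meeting `100B_Q` which approximates `G = ∂Ω` in `100B_Q` up to `2bβ(Q)`, and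
the big corkscrews lie in `B_Q`, at distance `r(B_Q)/2 = 2ℓ(Q)` from the plane, on
opposite sides of it. -/
def BigCorkData (n : ℕ) {F : Set (Euc (n+1))} {μ : Measure (Euc (n+1))} {Cl : ℝ}
    (L : DSLattice n F μ Cl) (G : Set (Euc (n+1))) (ε C₄ : ℝ)
    (Lpl : Cube n → AffineSubspace ℝ (Euc (n+1))) (x1 x2 : Cube n → Euc (n+1)) : Prop :=
  ∀ q : Cube n, L.mem q → bbetaQ n L G q ≤ C₄ * ε →
    Module.finrank ℝ (Lpl q).direction = n ∧
    ((Lpl q : Set (Euc (n+1))) ∩ ball (L.center q.2) (400 * sideLen q)).Nonempty ∧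
    (∀ y ∈ G ∩ ball (L.center q.2) (400 * sideLen q),
      infDist y (Lpl q : Set (Euc (n+1))) ≤ 2 * bbetaQ n L G q * (400 * sideLen q)) ∧
    (∀ y ∈ (Lpl q : Set (Euc (n+1))) ∩ ball (L.center q.2) (400 * sideLen q),
      infDist y G ≤ 2 * bbetaQ n L G q * (400 * sideLen q)) ∧
    x1 q ∈ ball (L.center q.2) (4 * sideLen q) ∧
    x2 q ∈ ball (L.center q.2) (4 * sideLen q) ∧
    infDist (x1 q) (Lpl q : Set (Euc (n+1))) = 2 * sideLen q ∧
    infDist (x2 q) (Lpl q : Set (Euc (n+1))) = 2 * sideLen q ∧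
    (segment ℝ (x1 q) (x2 q) ∩ (Lpl q : Set (Euc (n+1)))).Nonempty

/-- The family `WSBC(Γ)` of cubes with two well separated big corkscrews. -/
def WSBCfam (Ω : Set (Euc (n+1))) {μ : Measure (Euc (n+1))} (L : DSLattice n F μ Cl) (ε C₄ Γ : ℝ)
    (x1 x2 : Cube n → Euc (n+1)) : Set (Cube n) :=
  {q | L.mem q ∧ bbetaQ n L (frontier Ω) q ≤ C₄ * ε ∧ ¬ GoodChain Ω Γ (x1 q) (x2 q)}

/-- The stopping condition for `Stop_WSBC(R)`: `Q ∉ WSBC(Γ)` or `Q ∉ Tree^{(N)}(R)`. -/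
def StopWbad (Ω : Set (Euc (n+1))) (μ : Measure (Euc (n+1))) (L : DSLattice n F μ Cl)
    (p : Euc (n+1)) (R₀ : Cube n) (A ε C₄ Γ : ℝ) (N : ℕ)
    (x1 x2 : Cube n → Euc (n+1)) (R q : Cube n) : Prop :=
  q ∉ WSBCfam Ω L ε C₄ Γ x1 x2 ∨ q ∉ TreeN Ω μ L p R₀ A ε N R

/-- `Stop_WSBC(R)`: the maximal cubes of `D_μ(R)` satisfying the `WSBC` stopping
condition. -/
def StopW (Ω : Set (Euc (n+1))) (μ : Measure (Euc (n+1))) (L : DSLattice n F μ Cl)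
    (p : Euc (n+1)) (R₀ : Cube n) (A ε C₄ Γ : ℝ) (N : ℕ)
    (x1 x2 : Cube n → Euc (n+1)) (R : Cube n) : Set (Cube n) :=
  {q | InD L R q ∧ StopWbad Ω μ L p R₀ A ε C₄ Γ N x1 x2 R q ∧
    ∀ q' : Cube n, L.mem q' → q'.2 ⊆ R.2 → R.1 ≤ q'.1 → q'.1 < q.1 → q.2 ⊆ q'.2 →
      ¬ StopWbad Ω μ L p R₀ A ε C₄ Γ N x1 x2 R q'}

/-- `Tree_WSBC(R)`: the cubes of `D_μ(R)` not strictly contained in any cube of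
`Stop_WSBC(R)`. -/
def TreeW (Ω : Set (Euc (n+1))) (μ : Measure (Euc (n+1))) (L : DSLattice n F μ Cl)
    (p : Euc (n+1)) (R₀ : Cube n) (A ε C₄ Γ : ℝ) (N : ℕ)
    (x1 x2 : Cube n → Euc (n+1)) (R : Cube n) : Set (Cube n) :=
  {q | InD L R q ∧ ∀ s ∈ StopW Ω μ L p R₀ A ε C₄ Γ N x1 x2 R,
    ¬ (q.2 ⊆ s.2 ∧ s.1 < q.1)}

/-- The regularized distance `d_R(x) = inf_{Q ∈ Tree_WSBC(R)} (ℓ(Q) + dist(x,Q))`. -/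
def dReg (Ω : Set (Euc (n+1))) (μ : Measure (Euc (n+1))) (L : DSLattice n F μ Cl)
    (p : Euc (n+1)) (R₀ : Cube n) (A ε C₄ Γ : ℝ) (N : ℕ)
    (x1 x2 : Cube n → Euc (n+1)) (R : Cube n) (x : Euc (n+1)) : ℝ :=
  sInf {v | ∃ q ∈ TreeW Ω μ L p R₀ A ε C₄ Γ N x1 x2 R, v = sideLen q + infDist x q.2}

/-- The defining condition for the cubes of `End(R)`:
`ℓ(Q) ≤ (1/300) inf_{y ∈ Q} d_R(y)`. -/
def EndCond (Ω : Set (Euc (n+1))) (μ : Measure (Euc (n+1))) (L : DSLattice n F μ Cl)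
    (p : Euc (n+1)) (R₀ : Cube n) (A ε C₄ Γ : ℝ) (N : ℕ)
    (x1 x2 : Cube n → Euc (n+1)) (R : Cube n) (q : Cube n) : Prop :=
  L.mem q ∧ sideLen q ≤ (1/300) * sInf (dReg Ω μ L p R₀ A ε C₄ Γ N x1 x2 R '' q.2)

/-- `End(R)`: the maximal cubes satisfying the regularized stopping condition. -/
def EndFam (Ω : Set (Euc (n+1))) (μ : Measure (Euc (n+1))) (L : DSLattice n F μ Cl)
    (p : Euc (n+1)) (R₀ : Cube n) (A ε C₄ Γ : ℝ) (N : ℕ)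
    (x1 x2 : Cube n → Euc (n+1)) (R : Cube n) : Set (Cube n) :=
  {q | EndCond Ω μ L p R₀ A ε C₄ Γ N x1 x2 R q ∧
    ∀ q' : Cube n, L.mem q' → q'.1 < q.1 → q.2 ⊆ q'.2 →
      ¬ EndCond Ω μ L p R₀ A ε C₄ Γ N x1 x2 R q'}

/-- `~Tree_WSBC(R')`: the cubes of side length at most `ℓ(R')` contained in `100B_{R'}`
and not contained in any cube of `End(R)`. -/
def tTreeW (Ω : Set (Euc (n+1))) (μ : Measure (Euc (n+1))) (L : DSLattice n F μ Cl)
    (p : Euc (n+1)) (R₀ : Cube n) (A ε C₄ Γ : ℝ) (N : ℕ)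
    (x1 x2 : Cube n → Euc (n+1)) (R R' : Cube n) : Set (Cube n) :=
  {q | L.mem q ∧ R'.1 ≤ q.1 ∧ q.2 ⊆ cubeBall L 100 R' ∧
    ∀ e ∈ EndFam Ω μ L p R₀ A ε C₄ Γ N x1 x2 R, ¬ q.2 ⊆ e.2}

/-- `~End(R')`: the cubes of `End(R)` contained in some cube of `~Tree_WSBC(R')`. -/
def tEndFam (Ω : Set (Euc (n+1))) (μ : Measure (Euc (n+1))) (L : DSLattice n F μ Cl)
    (p : Euc (n+1)) (R₀ : Cube n) (A ε C₄ Γ : ℝ) (N : ℕ)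
    (x1 x2 : Cube n → Euc (n+1)) (R R' : Cube n) : Set (Cube n) :=
  {e | e ∈ EndFam Ω μ L p R₀ A ε C₄ Γ N x1 x2 R ∧
    ∃ q ∈ tTreeW Ω μ L p R₀ A ε C₄ Γ N x1 x2 R R', e.2 ⊆ q.2}

end WSBC


/-- The conclusion of the Geometric Lemma for the pair of open sets `V₁, V₂` and the
relabelled big corkscrews `y1, y2`: the `V_i` are connected open subsets of
`CB_{R'} ∩ Ω` with disjoint closures, obtained as unions of dilated Whitney cubes;
each contains a ball of radius `≈ ℓ(R')` to whose center all corkscrew points of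
`2B_{R'} ∩ V_i` can be joined by good Harnack chains inside `V_i`; each cube
`Q ∈ Tree_WSBC(R) ∩ D_μ(R')` has big corkscrews `y1 Q ∈ V₁ ∩ 2B_Q`, `y2 Q ∈ V₂ ∩ 2B_Q`
joined by good chains to those of its ancestors; the boundaries of the `V_i` inside
`10B_{R'}` are covered by the balls `2B_P`, `P ∈ ~End(R')`; and on each such ball the
boundary is covered by a family `W_P` of Whitney cubes on whose dilates the Green
function has average at most `γ ℓ(P)/μ(R₀)`, with Carleson-type packing. -/
def GLProps {n : ℕ} {F : Set (Euc (n+1))} {Cl M₀ D₀ : ℝ}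
    (Ω : Set (Euc (n+1))) (μ : Measure (Euc (n+1))) (L : DSLattice n F μ Cl)
    (Wh : Whitney Ω M₀ D₀) (p : Euc (n+1)) (R₀ : Cube n) (A ε C₄ Γ : ℝ) (N : ℕ)
    (x1 x2 : Cube n → Euc (n+1)) (κ₁ γ C₅ CV Cch cb Cpk CP : ℝ)
    (R R' : Cube n) (V₁ V₂ : Set (Euc (n+1))) (y1 y2 : Cube n → Euc (n+1)) : Prop :=
  IsConnected V₁ ∧ IsConnected V₂ ∧
  V₁ ⊆ ball (L.center R'.2) (CV * sideLen R') ∩ Ω ∧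
  V₂ ⊆ ball (L.center R'.2) (CV * sideLen R') ∩ Ω ∧
  Disjoint (closure V₁) (closure V₂) ∧
  (∃ W₁ ⊆ Wh.fam, V₁ = ⋃ I ∈ W₁, openCube I.1 (1.1 * I.2)) ∧
  (∃ W₂ ⊆ Wh.fam, V₂ = ⋃ I ∈ W₂, openCube I.1 (1.1 * I.2)) ∧
  (∀ V, (V = V₁ ∨ V = V₂) →
    ∃ (z : Euc (n+1)) (r : ℝ), ball z r ⊆ V ∧ cb * sideLen R' ≤ r ∧
      r ≤ cb⁻¹ * sideLen R' ∧
      (∀ x ∈ cubeBall L 2 R' ∩ V, κ₁ * sideLen R' ≤ infDist x (frontier Ω) →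
        GoodChainIn Ω V Cch x z) ∧
      (∀ x ∈ V, GoodChain Ω Cch x z)) ∧
  (∀ q ∈ TreeW Ω μ L p R₀ A ε C₄ Γ N x1 x2 R, InD L R' q →
    ({y1 q, y2 q} : Set (Euc (n+1))) = {x1 q, x2 q} ∧
    y1 q ∈ V₁ ∩ cubeBall L 2 q ∧ y2 q ∈ V₂ ∩ cubeBall L 2 q ∧
    ∀ q' ∈ TreeW Ω μ L p R₀ A ε C₄ Γ N x1 x2 R, InD L R' q' → q.2 ⊆ q'.2 →
      GoodChain Ω Cch (y1 q) (y1 q') ∧ GoodChain Ω Cch (y2 q) (y2 q')) ∧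
  ((frontier V₁ ∪ frontier V₂) ∩ cubeBall L 10 R' ⊆
    ⋃ e ∈ tEndFam Ω μ L p R₀ A ε C₄ Γ N x1 x2 R R', cubeBall L 2 e) ∧
  (∀ e ∈ tEndFam Ω μ L p R₀ A ε C₄ Γ N x1 x2 R R',
    (cubeBall L 2 e ∩ cubeBall L 10 R').Nonempty →
    ∃ WP ⊆ Wh.fam,
      frontier V₁ ∩ cubeBall L 2 e ⊆ (⋃ I ∈ WP, cubeSet I.1 I.2) ∧
      frontier V₂ ∩ cubeBall L 2 e ⊆ (⋃ I ∈ WP, cubeSet I.1 I.2) ∧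
      (∀ I ∈ WP, (⨍ x in cubeSet I.1 (4 * I.2), greenFn n Ω p x) ≤
        γ * sideLen e / (μ R₀.2).toReal) ∧
      (∑' I : WP, ENNReal.ofReal ((I : Euc (n+1) × ℝ).2 ^ n)) ≤
        ENNReal.ofReal (Cpk * sideLen e ^ n) ∧
      (∑' I : WP, ENNReal.ofReal
          (hMeasure Ω p (ball (I : Euc (n+1) × ℝ).1 (C₅ * (I : Euc (n+1) × ℝ).2)))) ≤
        ENNReal.ofReal (Cpk * hMeasure Ω p (ball (L.center e.2) (CP * (4 * sideLen e)))))


/-- The family `W_P` of Whitney cubes `I ⊆ V₁ ∪ V₂` such that `1.1 cl(I)` meets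
`∂(V₁ ∪ V₂) ∩ 2B_P`. -/
def WPfam {n : ℕ} {F : Set (Euc (n+1))} {μ : Measure (Euc (n+1))} {Cl M₀ D₀ : ℝ}
    (Ω : Set (Euc (n+1))) (Wh : Whitney Ω M₀ D₀) (L : DSLattice n F μ Cl)
    (V₁ V₂ : Set (Euc (n+1))) (e : Cube n) : Set (Euc (n+1) × ℝ) :=
  {I | I ∈ Wh.fam ∧ cubeSet I.1 I.2 ⊆ V₁ ∪ V₂ ∧
    (cubeSet I.1 (1.1 * I.2) ∩ frontier (V₁ ∪ V₂) ∩ cubeBall L 2 e).Nonempty}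

/-- `Bdy(R') := ⋃ {W_P : P ∈ ~End(R') with 2B_P ∩ 10B_{R'} ≠ ∅}`. -/
def BdyFam {n : ℕ} {F : Set (Euc (n+1))} {Cl M₀ D₀ : ℝ}
    (Ω : Set (Euc (n+1))) (μ : Measure (Euc (n+1))) (L : DSLattice n F μ Cl)
    (Wh : Whitney Ω M₀ D₀) (p : Euc (n+1)) (R₀ : Cube n) (A ε C₄ Γ : ℝ) (N : ℕ)
    (x1 x2 : Cube n → Euc (n+1)) (R R' : Cube n) (V₁ V₂ : Set (Euc (n+1))) :
    Set (Euc (n+1) × ℝ) :=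
  {I | ∃ e ∈ tEndFam Ω μ L p R₀ A ε C₄ Γ N x1 x2 R R',
    (cubeBall L 2 e ∩ cubeBall L 10 R').Nonempty ∧ I ∈ WPfam Ω Wh L V₁ V₂ e}

/-- Volume of the unit ball. -/
def vB (d : ℕ) : ℝ := volume.real (ball (0 : Euc d) 1)

theorem vB_pos (d : ℕ) : 0 < vB d := by
  unfold vB
  rw [measureReal_def]
  exact ENNReal.toReal_pos (measure_ball_pos _ _ one_pos).ne' measure_ball_lt_top.ne

theorem vol_ball' {d : ℕ} (x : Euc d) {s : ℝ} (hs : 0 < s) :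
    volume.real (ball x s) = s ^ d * vB d := by
  unfold vB
  rw [measureReal_def, measureReal_def, Measure.addHaar_ball_of_pos volume x hs, ENNReal.toReal_mul,
      ENNReal.toReal_ofReal (by positivity)]
  simp

theorem avg_eq {d : ℕ} (u : Euc d → ℝ) (x : Euc d) {s : ℝ} (hs : 0 < s) :
    ⨍ y in ball x s, u y = (s ^ d * vB d)⁻¹ * ∫ y in ball x s, u y := by
  rw [setAverage_eq, vol_ball' x hs]; rfl

/-- supermean inequality at `x` and scale `s` -/
def MeanLE {d : ℕ} (u : Euc d → ℝ) (x : Euc d) (s : ℝ) : Prop :=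
  ∫ y in ball x s, u y ≤ s ^ d * vB d * u x

/-- local supermean property -/
def LSup {d : ℕ} (u : Euc d → ℝ) (U : Set (Euc d)) : Prop :=
  ∀ x ∈ U, ∃ ρ > 0, ∀ s, 0 < s → s < ρ → MeanLE u x s

/-- harmonic: continuous with the mean value property -/
def Har {d : ℕ} (u : Euc d → ℝ) (U : Set (Euc d)) : Prop :=
  ContinuousOn u U ∧ ∀ x ∈ U, ∀ r : ℝ, 0 < r → closedBall x r ⊆ U →
    ∫ y in ball x r, u y = r ^ d * vB d * u x

theorem meanLE_iff {d : ℕ} (u : Euc d → ℝ) (x : Euc d) {s : ℝ} (hs : 0 < s) :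
    MeanLE u x s ↔ -u x ≤ ⨍ y in ball x s, -u y := by
  have h : 0 < s ^ d * vB d := by have := vB_pos d; positivity
  rw [avg_eq _ _ hs, integral_neg, MeanLE, mul_neg, neg_le_neg_iff, inv_mul_le_iff₀ h]

theorem intBall_of_cont {d : ℕ} {u : Euc d → ℝ} {x : Euc d} {s : ℝ}
    (hu : ContinuousOn u (closedBall x s)) : IntegrableOn u (ball x s) :=
  (hu.integrableOn_compact (isCompact_closedBall x s)).mono_set ball_subset_closedBall

theorem intBall_const {d : ℕ} (c : ℝ) (x : Euc d) (s : ℝ) :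
    IntegrableOn (fun _ => c) (ball x s) :=
  integrableOn_const measure_ball_lt_top.ne

theorem min_principle {d : ℕ} [NeZero d] {K U : Set (Euc d)} (hK : IsCompact K) (hU : IsOpen U)
    (hUK : U ⊆ K) {f : Euc d → ℝ} (hf : ContinuousOn f K) (hl : LSup f U)
    (hb : ∀ x ∈ K \ U, 0 ≤ f x) : ∀ x ∈ K, 0 ≤ f x := by
  intro x0 hx0
  by_contra hneg
  push Not at hneg
  obtain ⟨z0, hz0, hmin⟩ := hK.exists_isMinOn ⟨x0, hx0⟩ hf
  set m := f z0 with hm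
  have hm0 : m < 0 := lt_of_le_of_lt (hmin hx0) hneg
  have hKm : IsCompact (K ∩ f ⁻¹' {m}) :=
    hK.of_isClosed_subset (hf.preimage_isClosed_of_isClosed hK.isClosed isClosed_singleton)
      inter_subset_left
  obtain ⟨z, hz, hmax⟩ := hKm.exists_isMaxOn ⟨z0, hz0, rfl⟩
    (f := fun y : Euc d => y 0) (by fun_prop)
  have hzU : z ∈ U := by
    by_contra h
    have := hb z ⟨hz.1, h⟩
    have h2 : f z = m := hz.2
    linarith
  obtain ⟨ρ, hρ, hmean⟩ := hl z hzU
  obtain ⟨ρ', hρ', hball⟩ := Metric.isOpen_iff.1 hU z hzU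
  set s := min ρ ρ' / 2 with hs
  have hs0 : 0 < s := by positivity
  have hs1 : s < ρ := by have := min_le_left ρ ρ'; linarith
  have hs2 : closedBall z s ⊆ U := (closedBall_subset_ball (by
    have := min_le_right ρ ρ'; linarith)).trans hball
  have hc : ContinuousOn f (closedBall z s) := hf.mono (hs2.trans hUK)
  have hi := intBall_of_cont hc
  have h1 := hmean s hs0 hs1
  have h2 : f z = m := hz.2
  have h3 : ∫ y in ball z s, (f y - m) ≤ 0 := by
    rw [integral_sub hi (intBall_const _ _ _), setIntegral_const, vol_ball' z hs0]
    unfold MeanLE at h1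
    rw [h2] at h1
    simp only [smul_eq_mul]
    linarith
  have h4 : ∀ y ∈ ball z s, 0 ≤ f y - m := fun y hy => by
    have := hmin (hUK (hs2 (ball_subset_closedBall hy)))
    simp only [mem_ofPred_eq] at this
    linarith
  have h5 : (fun y => f y - m) =ᵐ[volume.restrict (ball z s)] 0 := by
    rw [← setIntegral_eq_zero_iff_of_nonneg_ae]
    · exact le_antisymm h3 (setIntegral_nonneg measurableSet_ball h4)
    · exact (ae_restrict_iff' measurableSet_ball).2 (Eventually.of_forall h4)
    · exact hi.sub (intBall_const _ _ _)
  have h6 : EqOn (fun y => f y - m) 0 (ball z s) :=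
    Measure.eqOn_open_of_ae_eq h5 isOpen_ball
      ((hc.mono ball_subset_closedBall).sub continuousOn_const) continuousOn_const
  have hy : z + EuclideanSpace.single (0 : Fin d) (s / 2) ∈ ball z s := by
    rw [mem_ball, dist_eq_norm, add_sub_cancel_left, PiLp.norm_single,
      Real.norm_of_nonneg (by positivity)]
    linarith
  have h7 := h6 hy
  simp only [Pi.zero_apply] at h7
  have h8 := hmax (show _ ∈ K ∩ f ⁻¹' {m} from
    ⟨hUK (hs2 (ball_subset_closedBall hy)), by simp; linarith⟩)
  simp at h8
  linarith


/-- coordinate vector -/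
def eB {d : ℕ} (i : Fin d) : Euc d := EuclideanSpace.single i 1

/-- Laplacian in coordinates -/
def lap {d : ℕ} (f : Euc d → ℝ) (x : Euc d) : ℝ :=
  ∑ i, fderiv ℝ (fun y => fderiv ℝ f y (eB i)) x (eB i)

theorem sum_eB {d : ℕ} (y : Euc d) : y = ∑ i, y i • eB i := by
  ext j
  simp [eB, Finset.sum_apply, Pi.single_apply]

theorem kernel_hasFDerivAt {d : ℕ} {K : ℝ → ℝ} (hK : Continuous K) (y : Euc d) :
    HasFDerivAt (fun y : Euc d => ∫ τ in (1:ℝ)..(‖y‖^2), K τ)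
      ((2 * K (‖y‖^2)) • (innerSL ℝ y)) y := by
  have h1 : HasDerivAt (fun s => ∫ τ in (1:ℝ)..s, K τ) (K (‖y‖^2)) (‖y‖^2) :=
    intervalIntegral.integral_hasDerivAt_right (hK.intervalIntegrable _ _)
      (hK.stronglyMeasurableAtFilter _ _) hK.continuousAt
  have h2 : HasFDerivAt (fun y : Euc d => ‖y‖^2) (2 • (innerSL ℝ y)) y :=
    (hasStrictFDerivAt_norm_sq y).hasFDerivAt
  have := h1.comp_hasFDerivAt y h2
  convert! this using 1
  ext v
  simp
  ring

theorem weighted_deriv_zero {d : ℕ} {f : Euc d → ℝ} (hf : ContDiff ℝ 2 f) {K : ℝ → ℝ}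
    (hK : Continuous K) (hK1 : ∀ s, 1 ≤ s → K s = 0) {x0 : Euc d} {r t : ℝ} (ht : 0 ≤ t)
    (htr : t ≤ r) (hl : ∀ x ∈ ball x0 r, lap f x = 0) :
    ∫ y : Euc d, fderiv ℝ f (x0 + t • y) y * K (‖y‖^2) = 0 := by
  rcases ht.eq_or_lt with rfl | ht
  · -- odd integrand
    have h := integral_neg_eq_self (fun y : Euc d => fderiv ℝ f (x0 + (0:ℝ) • y) y * K (‖y‖^2)) volume
    simp only [map_neg, norm_neg, zero_smul, neg_mul, integral_neg] at h ⊢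
    linarith
  set g : Euc d → ℝ := fun y => ∫ τ in (1:ℝ)..(‖y‖^2), K τ with hg
  have hgd : ∀ y, HasFDerivAt g ((2 * K (‖y‖^2)) • (innerSL ℝ y)) y :=
    fun y => kernel_hasFDerivAt hK y
  have hgc : Continuous g := continuous_iff_continuousAt.2 fun y => (hgd y).continuousAt
  have hg0 : ∀ y : Euc d, 1 ≤ ‖y‖ → g y = 0 := by
    intro y hy
    have h1 : (1:ℝ) ≤ ‖y‖^2 := by nlinarith
    simp only [hg]
    rw [intervalIntegral.integral_congr (g := fun _ => (0:ℝ))]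
    · simp
    · intro τ hτ
      rw [uIcc_of_le h1] at hτ
      exact hK1 τ hτ.1
  have hgs : HasCompactSupport g := by
    apply HasCompactSupport.intro (isCompact_closedBall (0 : Euc d) 1)
    intro y hy
    apply hg0
    simp at hy
    exact hy.le
  have hKs : HasCompactSupport (fun y : Euc d => K (‖y‖^2)) := by
    apply HasCompactSupport.intro (isCompact_closedBall (0 : Euc d) 1)
    intro y hy
    apply hK1
    simp at hy
    nlinarith
  have hKc : Continuous (fun y : Euc d => K (‖y‖^2)) := by fun_prop
  have hX : ∀ i : Fin d, ContDiff ℝ 1 (fun y => fderiv ℝ f y (eB i)) := fun i =>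
    (hf.fderiv_right (m := 1) (by norm_num)).clm_apply contDiff_const
  have hXt : ∀ i : Fin d, ContDiff ℝ 1 (fun y => fderiv ℝ f (x0 + t • y) (eB i)) := fun i =>
    (hX i).comp (by fun_prop)
  have hder : ∀ i : Fin d, ∀ y, fderiv ℝ (fun y => fderiv ℝ f (x0 + t • y) (eB i)) y (eB i)
      = t * fderiv ℝ (fun y => fderiv ℝ f y (eB i)) (x0 + t • y) (eB i) := by
    intro i y
    have h1 : HasFDerivAt (fun y : Euc d => x0 + t • y) (t • ContinuousLinearMap.id ℝ (Euc d)) y :=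
      ((hasFDerivAt_id y).const_smul t).const_add x0
    have h2 := (((hX i).differentiable one_ne_zero) (x0 + t • y)).hasFDerivAt.comp y h1
    rw [show (fun y => fderiv ℝ f (x0 + t • y) (eB i)) =
      ((fun y => fderiv ℝ f y (eB i)) ∘ fun y : Euc d => x0 + t • y) from rfl, h2.fderiv]
    simp
  have key : ∀ i : Fin d, ∫ y : Euc d, fderiv ℝ f (x0 + t • y) (eB i) * (2 * K (‖y‖^2) * y i)
      = - ∫ y : Euc d, t * fderiv ℝ (fun y => fderiv ℝ f y (eB i)) (x0 + t • y) (eB i) * g y := by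
    intro i
    have hgi : ∀ y, fderiv ℝ g y (eB i) = 2 * K (‖y‖^2) * y i := by
      intro y
      rw [(hgd y).fderiv]
      simp [eB, PiLp.inner_apply]
    have h := integral_mul_fderiv_eq_neg_fderiv_mul_of_integrable (μ := (volume : Measure (Euc d)))
      (f := fun y => fderiv ℝ f (x0 + t • y) (eB i)) (g := g) (v := eB i) ?_ ?_ ?_
      (fun x _ => (hXt i).differentiable one_ne_zero x) (fun x _ => (hgd x).differentiableAt)
    · simp only [hgi, hder] at h
      exact h
    · apply Continuous.integrable_of_hasCompactSupport
      · exact (((hXt i).continuous_fderiv one_ne_zero).clm_apply continuous_const).mul hgc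
      · exact hgs.mul_left
    · simp only [hgi]
      apply Continuous.integrable_of_hasCompactSupport
      · exact (hXt i).continuous.mul (by fun_prop)
      · exact ((hKs.mul_left (f := fun _ => (2:ℝ))).mul_right).mul_left
    · apply Continuous.integrable_of_hasCompactSupport
      · exact (hXt i).continuous.mul hgc
      · exact hgs.mul_left
  have hsum : ∫ y : Euc d, 2 * (fderiv ℝ f (x0 + t • y) y * K (‖y‖^2)) =
      ∑ i, ∫ y : Euc d, fderiv ℝ f (x0 + t • y) (eB i) * (2 * K (‖y‖^2) * y i) := by
    rw [← integral_finsetSum]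
    · congr 1
      ext y
      conv_lhs => rw [show fderiv ℝ f (x0 + t • y) y = fderiv ℝ f (x0 + t • y) (∑ i, y i • eB i) by
        rw [← sum_eB]]
      rw [map_sum, Finset.sum_mul, Finset.mul_sum]
      apply Finset.sum_congr rfl
      intro i _
      simp
      ring
    · intro i _
      apply Continuous.integrable_of_hasCompactSupport
      · exact (hXt i).continuous.mul (by fun_prop)
      · exact ((hKs.mul_left (f := fun _ => (2:ℝ))).mul_right).mul_left
  rw [integral_const_mul] at hsum
  have hz : ∑ i, ∫ y : Euc d, fderiv ℝ f (x0 + t • y) (eB i) * (2 * K (‖y‖^2) * y i) = 0 := by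
    simp only [key]
    rw [Finset.sum_neg_distrib, ← integral_finsetSum]
    · rw [neg_eq_zero]
      apply integral_eq_zero_of_ae
      refine Eventually.of_forall fun y => ?_
      simp only [Pi.zero_apply]
      rw [← Finset.sum_mul, ← Finset.mul_sum]
      by_cases hy : 1 ≤ ‖y‖
      · rw [hg0 y hy, mul_zero]
      · push Not at hy
        have := hl (x0 + t • y) (by
          rw [mem_ball, dist_eq_norm, add_sub_cancel_left, norm_smul, Real.norm_of_nonneg ht.le]
          nlinarith [norm_nonneg y])
        unfold lap at this
        rw [this]; ring
    · intro i _
      apply Continuous.integrable_of_hasCompactSupport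
      · refine Continuous.mul (continuous_const.mul ?_) hgc
        exact (((hX i).continuous_fderiv one_ne_zero).comp (by fun_prop)).clm_apply continuous_const
      · exact hgs.mul_left
  linarith

theorem weighted_mvp {d : ℕ} {f : Euc d → ℝ} (hf : ContDiff ℝ 2 f) {K : ℝ → ℝ}
    (hK : Continuous K) (hK1 : ∀ s, 1 ≤ s → K s = 0) {x0 : Euc d} {r : ℝ} (hr : 0 ≤ r)
    (hl : ∀ x ∈ ball x0 r, lap f x = 0) :
    ∫ y : Euc d, f (x0 + r • y) * K (‖y‖^2) = f x0 * ∫ y : Euc d, K (‖y‖^2) := by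
  have hKs : HasCompactSupport (fun y : Euc d => K (‖y‖^2)) := by
    apply HasCompactSupport.intro (isCompact_closedBall (0 : Euc d) 1)
    intro y hy
    apply hK1
    simp at hy
    nlinarith
  have hKc : Continuous (fun y : Euc d => K (‖y‖^2)) := by fun_prop
  have hfc := hf.continuous
  have hdc : Continuous (fderiv ℝ f) := hf.continuous_fderiv (by norm_num)
  have hder : ∀ t : ℝ, HasDerivAt (fun t : ℝ => ∫ y : Euc d, f (x0 + t • y) * K (‖y‖^2))
      (∫ y : Euc d, fderiv ℝ f (x0 + t • y) y * K (‖y‖^2)) t := by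
    intro t
    obtain ⟨C, hC⟩ := (isCompact_closedBall x0 (|t| + 1)).exists_bound_of_continuousOn
      hdc.continuousOn
    refine (hasDerivAt_integral_of_dominated_loc_of_deriv_le (μ := (volume : Measure (Euc d)))
      (F := fun (t : ℝ) (y : Euc d) => f (x0 + t • y) * K (‖y‖^2))
      (F' := fun (t : ℝ) (y : Euc d) => fderiv ℝ f (x0 + t • y) y * K (‖y‖^2))
      (ball_mem_nhds t one_pos)
      (bound := fun y : Euc d => C * |K (‖y‖^2)|) ?_ ?_ ?_ ?_ ?_ ?_).2
    · refine Eventually.of_forall fun s => ?_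
      exact Continuous.aestronglyMeasurable (by fun_prop)
    · apply Continuous.integrable_of_hasCompactSupport (by fun_prop)
      exact hKs.mul_left
    · exact Continuous.aestronglyMeasurable (by fun_prop)
    · refine Eventually.of_forall fun y s hs => ?_
      by_cases hy : 1 ≤ ‖y‖
      · rw [hK1 _ (by nlinarith)]; simp
      · push Not at hy
        have hs' : |s| ≤ |t| + 1 := by
          have := abs_sub_abs_le_abs_sub s t
          rw [mem_ball, Real.dist_eq] at hs
          linarith
        have h1 := hC (x0 + s • y) (by
          rw [mem_closedBall, dist_eq_norm, add_sub_cancel_left, norm_smul, Real.norm_eq_abs]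
          nlinarith [norm_nonneg y, abs_nonneg s])
        rw [norm_mul, Real.norm_eq_abs (K _)]
        gcongr
        calc _ ≤ ‖fderiv ℝ f (x0 + s • y)‖ * ‖y‖ := ContinuousLinearMap.le_opNorm _ _
          _ ≤ C * 1 := by gcongr; exact (norm_nonneg _).trans h1
          _ = C := mul_one C
    · apply Continuous.integrable_of_hasCompactSupport (by fun_prop)
      exact (hKs.comp_left (g := fun z => |z|) abs_zero).mul_left
    · refine Eventually.of_forall fun y s hs => ?_
      have h1 : HasDerivAt (fun s : ℝ => x0 + s • y) y s := by
        simpa using ((hasDerivAt_id s).smul_const y).const_add x0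
      have h2 := ((hf.differentiable (by norm_num)) (x0 + s • y)).hasFDerivAt.comp_hasDerivAt s h1
      exact h2.mul_const _
  have hc := constant_of_has_deriv_right_zero (a := 0) (b := r)
    (f := fun t : ℝ => ∫ y : Euc d, f (x0 + t • y) * K (‖y‖^2))
    (fun t _ => (hder t).continuousAt.continuousWithinAt)
    (fun t ht => by
      have := (hder t).hasDerivWithinAt (s := Ici t)
      rwa [weighted_deriv_zero hf hK hK1 ht.1 ht.2.le hl] at this) r ⟨hr, le_rfl⟩
  simp only [zero_smul, add_zero] at hc
  rw [hc, integral_const_mul]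

/-- approximate indicator of `[0,1)` -/
def cutK (j : ℕ) (s : ℝ) : ℝ := max 0 (min 1 (j * (1 - s)))

theorem cutK_tendsto (s : ℝ) :
    Tendsto (fun j : ℕ => cutK j s) atTop (𝓝 (if s < 1 then 1 else 0)) := by
  split_ifs with h
  · apply tendsto_const_nhds.congr'
    obtain ⟨N, hN⟩ := exists_nat_gt (1 / (1 - s))
    filter_upwards [eventually_ge_atTop N] with j hj
    have h0 : 0 < 1 - s := by linarith
    have : 1 ≤ (j:ℝ) * (1 - s) := by
      rw [div_lt_iff₀ h0] at hN
      have : (N:ℝ) ≤ j := by exact_mod_cast hj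
      nlinarith
    simp [cutK, this]
  · apply tendsto_const_nhds.congr
    intro j
    have : (j:ℝ) * (1 - s) ≤ 0 := by
      push Not at h
      have : (0:ℝ) ≤ j := by positivity
      nlinarith
    unfold cutK
    rw [max_eq_left]
    exact (min_le_right _ _).trans this

theorem integral_ball_scale {d : ℕ} (u : Euc d → ℝ) (x : Euc d) {r : ℝ} (hr : 0 < r) :
    ∫ y in ball x r, u y = r ^ d * ∫ y in ball (0 : Euc d) 1, u (x + r • y) := by
  rw [← integral_indicator measurableSet_ball, ← integral_indicator measurableSet_ball]
  have h1 := integral_add_left_eq_self (μ := (volume : Measure (Euc d)))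
    ((ball x r).indicator u) x
  have h2 := Measure.integral_comp_smul (volume : Measure (Euc d))
    (fun y => (ball x r).indicator u (x + y)) r
  rw [← h1]
  rw [abs_of_pos (by positivity)] at h2
  simp only [smul_eq_mul, finrank_euclideanSpace, Fintype.card_fin] at h2
  have h3 : (fun y : Euc d => (ball x r).indicator u (x + r • y)) =
      (ball (0 : Euc d) 1).indicator (fun y => u (x + r • y)) := by
    ext y
    have : x + r • y ∈ ball x r ↔ y ∈ ball (0 : Euc d) 1 := by
      rw [mem_ball, mem_ball, dist_eq_norm, add_sub_cancel_left, norm_smul,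
        Real.norm_of_nonneg hr.le, dist_zero_right]
      constructor
      · intro h; by_contra h'; push Not at h'; nlinarith
      · intro h; nlinarith
    by_cases hy : y ∈ ball (0 : Euc d) 1
    · rw [indicator_of_mem hy, indicator_of_mem (this.2 hy)]
    · rw [indicator_of_notMem hy, indicator_of_notMem (fun h => hy (this.1 h))]
  rw [← h3, h2]
  field_simp

theorem mvp_of_lap {d : ℕ} {f : Euc d → ℝ} (hf : ContDiff ℝ 2 f) {x0 : Euc d} {r : ℝ} (hr : 0 < r)
    (hl : ∀ x ∈ ball x0 r, lap f x = 0) :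
    ∫ y in ball x0 r, f y = r ^ d * vB d * f x0 := by
  have hcont : ∀ j, Continuous (cutK j) := fun j => by unfold cutK; fun_prop
  have hz : ∀ j s, 1 ≤ s → cutK j s = 0 := by
    intro j s hs
    unfold cutK
    rw [max_eq_left]
    refine (min_le_right _ _).trans ?_
    have : (0:ℝ) ≤ j := by positivity
    nlinarith
  have hb : ∀ j s, |cutK j s| ≤ 1 := by
    intro j s
    unfold cutK
    rw [abs_of_nonneg (le_max_left _ _)]
    exact max_le zero_le_one (min_le_left _ _)
  have hfc := hf.continuous
  have gen : ∀ g : Euc d → ℝ, Continuous g →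
      Tendsto (fun j : ℕ => ∫ y : Euc d, g y * cutK j (‖y‖^2)) atTop
        (𝓝 (∫ y in ball (0:Euc d) 1, g y)) := by
    intro g hg
    rw [← integral_indicator measurableSet_ball]
    refine tendsto_integral_of_dominated_convergence
      ((closedBall (0:Euc d) 1).indicator fun y => |g y|) ?_ ?_ ?_ ?_
    · intro j
      have := hcont j
      exact Continuous.aestronglyMeasurable (by fun_prop)
    · rw [integrable_indicator_iff measurableSet_closedBall]
      exact (hg.abs.continuousOn).integrableOn_compact (isCompact_closedBall _ _)
    · intro j
      refine Eventually.of_forall fun y => ?_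
      by_cases hy : y ∈ closedBall (0:Euc d) 1
      · rw [indicator_of_mem hy, norm_mul]
        calc _ ≤ |g y| * 1 := by gcongr; exact le_rfl; exact hb j _
          _ = _ := mul_one _
      · rw [indicator_of_notMem hy]
        simp at hy
        rw [hz j _ (by nlinarith)]; simp
    · refine Eventually.of_forall fun y => ?_
      have h := (cutK_tendsto (‖y‖^2)).const_mul (g y)
      convert! h using 2
      by_cases hy : ‖y‖ < 1
      · rw [if_pos (by nlinarith [norm_nonneg y]), indicator_of_mem (by simpa using hy)]; simp
      · rw [if_neg (by nlinarith [norm_nonneg y]), indicator_of_notMem (by simpa using hy)]; simp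
  have h1 := gen (fun y => f (x0 + r • y)) (by fun_prop)
  have h2 := (gen (fun _ => 1) continuous_const).const_mul (f x0)
  simp only [one_mul] at h2
  have h3 := tendsto_nhds_unique (h1.congr fun j =>
    weighted_mvp hf (hcont j) (hz j) hr.le hl) h2
  rw [integral_ball_scale _ _ hr, h3]
  simp [vB]
  ring


/-- radial `C¹` kernel -/
def kS {d : ℕ} (s : ℝ) (z : Euc d) : ℝ := (max (s^2 - ‖z‖^2) 0)^2

/-- mass of the unit kernel -/
def cK (d : ℕ) : ℝ := ∫ y in ball (0 : Euc d) 1, kS 1 y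

theorem kS_nonneg {d : ℕ} (s : ℝ) (z : Euc d) : 0 ≤ kS s z := by unfold kS; positivity

theorem kS_cont {d : ℕ} (s : ℝ) : Continuous (kS (d := d) s) := by unfold kS; fun_prop

theorem kS_zero {d : ℕ} {s : ℝ} (hs : 0 ≤ s) {z : Euc d} (hz : s ≤ ‖z‖) : kS s z = 0 := by
  unfold kS; rw [max_eq_right (by nlinarith)]; simp

theorem kS_of_le {d : ℕ} {s : ℝ} {z : Euc d} (hz : ‖z‖ ≤ s) : kS s z = (s^2 - ‖z‖^2)^2 := by
  unfold kS; rw [max_eq_left (by nlinarith [norm_nonneg z])]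

theorem kS_neg {d : ℕ} (s : ℝ) (z : Euc d) : kS s (-z) = kS s z := by
  unfold kS; rw [norm_neg]

theorem kS_lip {d : ℕ} {s : ℝ} (hs : 0 ≤ s) (z z' : Euc d) :
    |kS s z - kS s z'| ≤ 4 * s^3 * ‖z - z'‖ := by
  have key : ∀ y : Euc d, kS s y = (s^2 - (min ‖y‖ s)^2)^2 := by
    intro y
    rcases le_total ‖y‖ s with h | h
    · rw [kS_of_le h, min_eq_left h]
    · rw [kS_zero hs h, min_eq_right h]; ring
  rw [key, key]
  set a := min ‖z‖ s
  set b := min ‖z'‖ s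
  have ha : 0 ≤ a := le_min (norm_nonneg _) hs
  have hb : 0 ≤ b := le_min (norm_nonneg _) hs
  have ha' : a ≤ s := min_le_right _ _
  have hb' : b ≤ s := min_le_right _ _
  have hab : |a - b| ≤ ‖z - z'‖ := by
    have h1 := abs_min_sub_min_le_max ‖z‖ s ‖z'‖ s
    have h2 := abs_norm_sub_norm_le z z'
    simp only [sub_self, abs_zero] at h1
    exact h1.trans (max_le h2 (norm_nonneg _))
  have : (s^2 - a^2)^2 - (s^2-b^2)^2 = (b - a) * ((a + b) * (2*s^2 - a^2 - b^2)) := by ring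
  rw [this, abs_mul, abs_sub_comm, mul_comm]
  have h2 : |(a + b) * (2*s^2 - a^2 - b^2)| ≤ 4 * s^3 := by
    have h3 : 0 ≤ 2*s^2 - a^2 - b^2 := by nlinarith
    rw [abs_of_nonneg (by positivity)]
    calc (a + b) * (2*s^2 - a^2 - b^2) ≤ (2*s) * (2 * s^2) := by
          apply mul_le_mul <;> nlinarith
      _ = _ := by ring
  gcongr

theorem kS_contDiff {d : ℕ} (s : ℝ) : ContDiff ℝ 1 (kS (d := d) s) := by
  have h : ContDiff ℝ 1 (fun z : ℝ => (max z 0)^2) := by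
    have hd : ∀ z : ℝ, HasDerivAt (fun z : ℝ => (max z 0)^2) (2 * max z 0) z := by
      intro z
      rcases lt_trichotomy z 0 with hz | hz | hz
      · rw [max_eq_right hz.le, mul_zero]
        refine (hasDerivAt_const z (0:ℝ)).congr_of_eventuallyEq ?_
        filter_upwards [Iio_mem_nhds hz] with y hy
        rw [max_eq_right (le_of_lt hy)]; simp
      · subst hz
        rw [hasDerivAt_iff_isLittleO]
        simp only [max_self, mul_zero, smul_zero, sub_zero]
        rw [Asymptotics.isLittleO_iff]
        intro c hc
        filter_upwards [ball_mem_nhds (0:ℝ) hc] with y hy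
        rw [mem_ball, dist_zero_right] at hy
        have h1 : |max y 0| ≤ |y| := by
          rcases le_total y 0 with h | h
          · rw [max_eq_right h]; simp
          · rw [max_eq_left h]
        simp only [ne_eq, OfNat.ofNat_ne_zero, not_false_eq_true, zero_pow, sub_zero, norm_pow,
          Real.norm_eq_abs] at hy ⊢
        nlinarith [abs_nonneg (max y 0), abs_nonneg y]
      · rw [max_eq_left hz.le]
        have := hasDerivAt_pow 2 z
        simp only [Nat.cast_ofNat, Nat.add_one_sub_one, pow_one] at this
        refine this.congr_of_eventuallyEq ?_
        filter_upwards [Ioi_mem_nhds hz] with y hy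
        rw [max_eq_left (le_of_lt hy)]
    rw [contDiff_one_iff_deriv]
    refine ⟨fun z => (hd z).differentiableAt, ?_⟩
    rw [show deriv (fun z : ℝ => (max z 0)^2) = fun z => 2 * max z 0 from funext fun z => (hd z).deriv]
    fun_prop
  have h2 : ContDiff ℝ 1 (fun z : Euc d => s^2 - ‖z‖^2) := contDiff_const.sub (contDiff_norm_sq ℝ)
  exact h.comp h2

theorem kS_support {d : ℕ} {s : ℝ} (hs : 0 ≤ s) : HasCompactSupport (kS (d := d) s) := by
  apply HasCompactSupport.intro (isCompact_closedBall (0 : Euc d) s)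
  intro y hy
  simp at hy
  exact kS_zero hs hy.le

theorem cK_pos (d : ℕ) : 0 < cK d := by
  unfold cK
  rw [setIntegral_pos_iff_support_of_nonneg_ae (Eventually.of_forall fun y => kS_nonneg 1 y)
    (intBall_of_cont (kS_cont 1).continuousOn)]
  have : Function.support (kS (d := d) 1) ∩ ball 0 1 = ball 0 1 := by
    apply inter_eq_right.2
    intro y hy
    simp at hy
    rw [Function.mem_support, kS_of_le hy.le]
    have : 0 < 1^2 - ‖y‖^2 := by nlinarith [norm_nonneg y]
    positivity
  rw [this]
  exact measure_ball_pos _ _ one_pos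

theorem kS_mass {d : ℕ} (x : Euc d) {s : ℝ} (hs : 0 < s) :
    ∫ y in ball x s, kS s (y - x) = s ^ (d + 4) * cK d := by
  rw [integral_ball_scale _ _ hs]
  simp only [add_sub_cancel_left]
  have : ∀ y : Euc d, kS s (s • y) = s^4 * kS 1 y := by
    intro y
    unfold kS
    rw [norm_smul, Real.norm_of_nonneg hs.le, show s^2 - (s * ‖y‖)^2 = s^2 * (1^2 - ‖y‖^2) by ring,
      show max (s^2 * (1^2 - ‖y‖^2)) 0 = s^2 * max (1^2 - ‖y‖^2) 0 by
        rw [mul_max_of_nonneg _ _ (by positivity), mul_zero]]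
    ring
  simp only [this]
  rw [integral_const_mul, cK]
  ring

theorem rep_aux {d : ℕ} {u : Euc d → ℝ} {x : Euc d} {s : ℝ}
    (hi : IntegrableOn u (ball x s)) :
    ∫ y in ball x s, kS s (y - x) * u y =
      ∫ t in Ioo 0 s, 4 * t * (s^2 - t^2) * ∫ y in ball x t, u y := by
  have h1 : ∀ y ∈ ball x s, kS s (y - x) * u y =
      ∫ t in Ioo 0 s, (ball x t).indicator (fun y => u y * (4 * t * (s^2 - t^2))) y := by
    intro y hy
    rw [mem_ball, dist_eq_norm] at hy
    have h2 : ∀ t, (ball x t).indicator (fun y => u y * (4 * t * (s^2 - t^2))) y =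
        (Ioi ‖y - x‖).indicator (fun t => u y * (4 * t * (s^2 - t^2))) t := by
      intro t
      simp only [indicator, mem_ball, dist_eq_norm, mem_Ioi]
    simp only [h2]
    rw [setIntegral_indicator measurableSet_Ioi]
    have h3 : Ioo 0 s ∩ Ioi ‖y - x‖ = Ioo ‖y - x‖ s := by
      ext t; simp only [mem_inter_iff, mem_Ioo, mem_Ioi]
      have := norm_nonneg (y - x)
      constructor
      · rintro ⟨⟨_, b⟩, c⟩; exact ⟨c, b⟩
      · rintro ⟨a, b⟩; exact ⟨⟨by linarith, b⟩, a⟩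
    rw [h3, integral_const_mul, ← integral_Ioc_eq_integral_Ioo,
      ← intervalIntegral.integral_of_le hy.le]
    rw [intervalIntegral.integral_eq_sub_of_hasDerivAt (f := fun t => - (s^2 - t^2)^2)
      (f' := fun t => 4 * t * (s^2 - t^2))]
    · rw [kS_of_le hy.le]; ring
    · intro t _
      have := (((hasDerivAt_pow 2 t).const_sub (s^2)).pow 2).neg
      convert! this using 1
      simp; ring
    · exact Continuous.intervalIntegrable (by fun_prop) _ _
  rw [setIntegral_congr_fun measurableSet_ball h1, integral_integral_swap]
  · apply setIntegral_congr_fun measurableSet_Ioo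
    intro t ht
    simp only
    rw [setIntegral_indicator measurableSet_ball, inter_eq_right.2 (ball_subset_ball ht.2.le),
      integral_mul_const]
    ring
  · have h4 : Integrable (fun z : Euc d × ℝ => u z.1 * (4 * z.2 * (s^2 - z.2^2)))
      ((volume.restrict (ball x s)).prod (volume.restrict (Ioo 0 s))) := by
      apply Integrable.mul_prod (f := u) (g := fun t : ℝ => 4 * t * (s^2 - t^2)) hi
      exact ((by fun_prop : Continuous fun t : ℝ => 4 * t * (s^2 - t^2)).continuousOn.integrableOn_compact
        (isCompact_Icc (a := 0) (b := s))).mono_set Ioo_subset_Icc_self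
    have h5 : MeasurableSet {z : Euc d × ℝ | dist z.1 x < z.2} :=
      (isOpen_lt (by fun_prop) (by fun_prop)).measurableSet
    refine (h4.indicator h5).congr (Eventually.of_forall fun z => ?_)
    simp only [Function.uncurry, indicator, mem_ball]
    rfl

theorem rep {d : ℕ} {u : Euc d → ℝ} {x : Euc d} {s : ℝ} (hs : 0 < s)
    (hi : IntegrableOn u (ball x s))
    (hm : ∀ t, 0 < t → t < s → ∫ y in ball x t, u y = t ^ d * vB d * u x) :
    ∫ y in ball x s, kS s (y - x) * u y = s ^ (d + 4) * cK d * u x := by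
  have h0 := rep_aux (u := fun _ : Euc d => (1:ℝ)) (x := x) (s := s) (intBall_const _ _ _)
  simp only [mul_one] at h0
  rw [kS_mass x hs] at h0
  rw [rep_aux hi, h0, ← integral_mul_const]
  apply setIntegral_congr_fun measurableSet_Ioo
  intro t ht
  simp only
  rw [hm t ht.1 ht.2, setIntegral_const, vol_ball' x ht.1]
  simp
  ring

theorem Har.mono {d : ℕ} {u : Euc d → ℝ} {U V : Set (Euc d)} (h : Har u U) (hV : V ⊆ U) :
    Har u V :=
  ⟨h.1.mono hV, fun x hx r hr hb => h.2 x (hV hx) r hr (hb.trans hV)⟩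

theorem Har.rep {d : ℕ} {u : Euc d → ℝ} {U : Set (Euc d)} (h : Har u U) {x : Euc d} {s : ℝ}
    (hs : 0 < s) (hb : closedBall x s ⊆ U) :
    ∫ y in ball x s, kS s (y - x) * u y = s ^ (d + 4) * cK d * u x :=
  HarmMeas.rep hs (intBall_of_cont (h.1.mono hb)) fun t ht hts =>
    h.2 x (hb (mem_closedBall_self hs.le)) t ht ((closedBall_subset_closedBall hts.le).trans hb)

theorem Har.sub {d : ℕ} {u v : Euc d → ℝ} {U : Set (Euc d)} (h : Har u U) (h' : Har v U) :
    Har (fun y => u y - v y) U := by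
  refine ⟨h.1.sub h'.1, fun x hx r hr hb => ?_⟩
  rw [integral_sub (intBall_of_cont (h.1.mono hb)) (intBall_of_cont (h'.1.mono hb)),
    h.2 x hx r hr hb, h'.2 x hx r hr hb]
  ring

theorem har_const {d : ℕ} (c : ℝ) (U : Set (Euc d)) : Har (fun _ => c) U := by
  refine ⟨continuousOn_const, fun x _ r hr _ => ?_⟩
  rw [setIntegral_const, vol_ball' x hr]; rfl

theorem Har.congr {d : ℕ} {u v : Euc d → ℝ} {U : Set (Euc d)} (h : Har u U) (h' : EqOn v u U) :
    Har v U := by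
  refine ⟨h.1.congr h', fun x hx r hr hb => ?_⟩
  rw [h' hx, ← h.2 x hx r hr hb]
  exact setIntegral_congr_fun measurableSet_ball fun y hy => h' (hb (ball_subset_closedBall hy))

theorem Har.diff_le {d : ℕ} {u : Euc d → ℝ} {U : Set (Euc d)} (hu : Har u U) {x h : Euc d} {s : ℝ}
    (hs : 0 < s) (hb : closedBall x (2 * s) ⊆ U) (hh : ‖h‖ ≤ s) (a : ℝ) :
    |u (x + h) - u x| ≤ 4 / cK d / s ^ (d + 1) * (∫ y in ball x (2 * s), |u y - a|) * ‖h‖ := by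
  have hv := hu.sub (har_const a U)
  set v := fun y => u y - a with hvdef
  have hcK := cK_pos d
  have hvi : IntegrableOn v (ball x (2*s)) := intBall_of_cont (hv.1.mono hb)
  have gen : ∀ z, ‖z - x‖ ≤ s → s ^ (d + 4) * cK d * v z = ∫ y in ball x (2 * s), kS s (y - z) * v y := by
    intro z hz
    have h1 : closedBall z s ⊆ closedBall x (2 * s) :=
      closedBall_subset_closedBall' (by rw [dist_eq_norm]; linarith)
    have h2 : ball z s ⊆ ball x (2 * s) :=
      ball_subset_ball' (by rw [dist_eq_norm]; linarith)
    rw [← hv.rep hs (h1.trans hb)]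
    symm
    apply setIntegral_eq_of_subset_of_forall_sdiff_eq_zero measurableSet_ball h2
    intro y hy
    have : s ≤ ‖y - z‖ := by simpa [dist_eq_norm] using hy.2
    rw [kS_zero hs.le this, zero_mul]
  have e1 := gen (x + h) (by simpa using hh)
  have e2 := gen x (by simpa using hs.le)
  have hki : ∀ z, IntegrableOn (fun y => kS s (y - z) * v y) (ball x (2*s)) := by
    intro z
    refine intBall_of_cont (ContinuousOn.mul ?_ (hv.1.mono hb))
    exact ((kS_cont s).comp (by fun_prop)).continuousOn
  have e3 : s ^ (d + 4) * cK d * |u (x + h) - u x| ≤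
      4 * s^3 * ‖h‖ * ∫ y in ball x (2 * s), |v y| := by
    have : u (x + h) - u x = v (x+h) - v x := by simp [hvdef]
    rw [this, ← abs_of_pos (show 0 < s ^ (d+4) * cK d by positivity), ← abs_mul, mul_sub, e1, e2,
      ← integral_sub (hki _) (hki _), ← integral_const_mul]
    refine (abs_integral_le_integral_abs).trans ?_
    apply setIntegral_mono_on ((hki _).sub (hki _)).abs (hvi.abs.const_mul _) measurableSet_ball
    intro y _
    simp only [Pi.sub_apply]
    rw [← sub_mul, abs_mul]
    gcongr
    have := kS_lip hs.le (y - (x + h)) (y - x)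
    rwa [show y - (x+h) - (y - x) = -h by abel, norm_neg] at this
  have e4 : |u (x + h) - u x| ≤ (4 * s^3 * ‖h‖ * ∫ y in ball x (2 * s), |v y|) / (s ^ (d+4) * cK d) := by
    rw [le_div_iff₀ (by positivity), mul_comm]; exact e3
  refine e4.trans (le_of_eq ?_)
  change _ = 4 / cK d / s ^ (d + 1) * (∫ y in ball x (2 * s), |v y|) * ‖h‖
  generalize (∫ y in ball x (2 * s), |v y|) = I
  rw [show d + 4 = (d + 1) + 3 by ring, pow_add]
  field_simp

theorem Har.contDiffOn {d : ℕ} {u : Euc d → ℝ} {U : Set (Euc d)} (hu : Har u U) (hU : IsOpen U) :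
    ContDiffOn ℝ 1 u U := by
  intro x hx
  obtain ⟨ρ, hρ, hball⟩ := Metric.isOpen_iff.1 hU x hx
  set s := ρ / 3 with hs
  have hs0 : 0 < s := by positivity
  have hb : closedBall x (2 * s) ⊆ U := (closedBall_subset_ball (by linarith)).trans hball
  have hcK := cK_pos d
  set w := (closedBall x (2 * s)).indicator u with hw
  have hwi : Integrable w := by
    rw [hw, integrable_indicator_iff measurableSet_closedBall]
    exact (hu.1.mono hb).integrableOn_compact (isCompact_closedBall _ _)
  have hconv := HasCompactSupport.contDiff_convolution_left (n := 1) (ContinuousLinearMap.mul ℝ ℝ)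
    (μ := (volume : Measure (Euc d))) (kS_support (d := d) hs0.le) (kS_contDiff s)
    hwi.locallyIntegrable
  have : ContDiffAt ℝ 1 u x := by
    have h2 : ContDiffAt ℝ 1 (fun z => (s ^ (d+4) * cK d)⁻¹ *
        (MeasureTheory.convolution (kS s) w (ContinuousLinearMap.mul ℝ ℝ) volume) z) x :=
      contDiffAt_const.mul hconv.contDiffAt
    refine h2.congr_of_eventuallyEq ?_
    filter_upwards [ball_mem_nhds x hs0] with z hz
    rw [eq_inv_mul_iff_mul_eq₀ (by positivity)]
    rw [mem_ball] at hz
    have h1 : closedBall z s ⊆ closedBall x (2 * s) :=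
      closedBall_subset_closedBall' (by linarith)
    rw [← hu.rep hs0 (h1.trans hb), convolution_mul_swap, ← integral_indicator measurableSet_ball]
    congr 1
    ext y
    by_cases hy : y ∈ ball z s
    · rw [indicator_of_mem hy, hw, indicator_of_mem (h1 (ball_subset_closedBall hy)), ← kS_neg,
        neg_sub]
    · rw [indicator_of_notMem hy]
      have : s ≤ ‖z - y‖ := by simpa [dist_eq_norm, norm_sub_rev] using hy
      rw [kS_zero hs0.le this, zero_mul]
  exact this.contDiffWithinAt

theorem Har.grad_le {d : ℕ} {u : Euc d → ℝ} {U : Set (Euc d)} (hu : Har u U) {x : Euc d} {s : ℝ}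
    (hs : 0 < s) (hb : closedBall x (2 * s) ⊆ U) (a : ℝ) :
    ‖fderiv ℝ u x‖ ≤ 4 / cK d / s ^ (d + 1) * (∫ y in ball x (2 * s), |u y - a|) := by
  have hcK := cK_pos d
  apply norm_fderiv_le_of_lip'
  · have : 0 ≤ ∫ y in ball x (2 * s), |u y - a| := integral_nonneg fun _ => abs_nonneg _
    positivity
  · filter_upwards [ball_mem_nhds x hs] with z hz
    have := hu.diff_le hs hb (h := z - x) (by rw [mem_ball, dist_eq_norm] at hz; exact hz.le) a
    rwa [add_sub_cancel] at this

/-- gradient bound constant -/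
def cG (d : ℕ) : ℝ := 4 / cK d * 4 * 2 ^ d * vB d

theorem cG_pos (d : ℕ) : 0 < cG d := by
  have := cK_pos d; have := vB_pos d; unfold cG; positivity

theorem Har.grad_le_pos {d : ℕ} {u : Euc d → ℝ} {U : Set (Euc d)} (hu : Har u U)
    (hpos : ∀ y ∈ U, 0 ≤ u y) {x : Euc d} {s : ℝ}
    (hs : 0 < s) (hb : ball x s ⊆ U) :
    ‖fderiv ℝ u x‖ ≤ cG d * u x / s := by
  have hcK := cK_pos d
  have hb' : closedBall x (2 * (s/4)) ⊆ U := (closedBall_subset_ball (by linarith)).trans hb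
  have h := hu.grad_le (s := s / 4) (by positivity) hb' 0
  have h2 : ∫ y in ball x (2 * (s/4)), |u y - 0| = (2 * (s/4)) ^ d * vB d * u x := by
    rw [← hu.2 x (hb (mem_ball_self hs)) (2 * (s/4)) (by positivity) hb']
    apply setIntegral_congr_fun measurableSet_ball
    intro y hy
    simp only [sub_zero]
    exact abs_of_nonneg (hpos y (hb' (ball_subset_closedBall hy)))
  rw [h2] at h
  refine h.trans (le_of_eq ?_)
  unfold cG
  rw [show 2 * (s/4) = s / 2 by ring, div_pow, div_pow, pow_succ, pow_succ,
    show (4:ℝ)^d = 2^d * 2^d by rw [← mul_pow]; norm_num]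
  field_simp

/-- Harnack for small displacements, for nonnegative MVP functions. -/
theorem harnack_aux {d : ℕ} {u : Euc d → ℝ} {x y : Euc d} {s : ℝ} (hxy : dist y x < s)
    (hpos : ∀ z ∈ ball x s, 0 ≤ u z) (hi : IntegrableOn u (ball x s))
    (hx : ∫ z in ball x s, u z = s ^ d * vB d * u x)
    (hy : ∫ z in ball y (s - dist y x), u z = (s - dist y x) ^ d * vB d * u y) :
    (s - dist y x) ^ d * u y ≤ s ^ d * u x := by
  have hv := vB_pos d
  have h : ∫ z in ball y (s - dist y x), u z ≤ ∫ z in ball x s, u z := by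
    apply setIntegral_mono_set hi
    · exact (ae_restrict_iff' measurableSet_ball).2 (Eventually.of_forall hpos)
    · exact (ball_subset_ball' (by linarith)).eventuallyLE
  rw [hx, hy] at h
  have : vB d * ((s - dist y x) ^ d * u y) ≤ vB d * (s ^ d * u x) := by nlinarith
  exact le_of_mul_le_mul_left this hv


/-- polynomial functions -/
def pF {d : ℕ} (P : MvPolynomial (Fin d) ℝ) : Euc d → ℝ := fun x => MvPolynomial.eval (fun i => x i) P

theorem pF_contDiff {d : ℕ} (P : MvPolynomial (Fin d) ℝ) : ContDiff ℝ 2 (pF P) := by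
  unfold pF
  induction P using MvPolynomial.induction_on with
  | C a => simpa using contDiff_const
  | add p q hp hq => simpa using hp.add hq
  | mul_X p i hp =>
    simp only [map_mul, MvPolynomial.eval_X]
    exact hp.mul (by fun_prop)

theorem pF_fderiv {d : ℕ} (P : MvPolynomial (Fin d) ℝ) (i : Fin d) (x : Euc d) :
    fderiv ℝ (pF P) x (eB i) = pF (MvPolynomial.pderiv i P) x := by
  induction P using MvPolynomial.induction_on with
  | C a =>
    have : pF (MvPolynomial.C a : MvPolynomial (Fin d) ℝ) = fun _ => a := by ext; simp [pF]
    rw [this]; simp [pF]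
  | add p q hp hq =>
    have : pF (p + q) = fun x => pF p x + pF q x := by ext; simp [pF]
    rw [this, fderiv_fun_add ((pF_contDiff p).differentiable (by norm_num) x)
      ((pF_contDiff q).differentiable (by norm_num) x)]
    simp [pF] at hp hq ⊢
    rw [hp, hq]
  | mul_X p j hp =>
    have : pF (p * MvPolynomial.X j) = fun x => pF p x * (EuclideanSpace.proj j : Euc d →L[ℝ] ℝ) x := by
      ext; simp [pF]
    rw [this, fderiv_fun_mul ((pF_contDiff p).differentiable (by norm_num) x)
      (ContinuousLinearMap.differentiableAt _), ContinuousLinearMap.fderiv]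
    simp only [_root_.add_apply, _root_.smul_apply, hp, smul_eq_mul]
    simp only [pF, Derivation.leibniz, MvPolynomial.pderiv_X, map_add, smul_eq_mul, map_mul,
      MvPolynomial.eval_X, eB, PiLp.proj_apply, Pi.single_apply]
    by_cases h : j = i
    · subst h; simp
    · simp [h]

/-- polynomial laplacian -/
def pLap {d : ℕ} : MvPolynomial (Fin d) ℝ →ₗ[ℝ] MvPolynomial (Fin d) ℝ :=
  ∑ i, (MvPolynomial.pderiv i).toLinearMap ∘ₗ (MvPolynomial.pderiv i).toLinearMap

theorem pF_lap {d : ℕ} (P : MvPolynomial (Fin d) ℝ) (x : Euc d) : lap (pF P) x = pF (pLap P) x := by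
  unfold lap pLap
  simp only [pF_fderiv]
  simp [pF, LinearMap.sum_apply]

theorem deg_pderiv {d k : ℕ} (P : MvPolynomial (Fin d) ℝ) (i : Fin d) (h : P.totalDegree ≤ k + 1) :
    (MvPolynomial.pderiv i P).totalDegree ≤ k := by
  rw [P.as_sum, map_sum]
  apply MvPolynomial.totalDegree_finsetSum_le
  intro s hs
  rw [MvPolynomial.pderiv_monomial]
  by_cases h0 : s i = 0
  · simp [h0]
  · refine (MvPolynomial.totalDegree_monomial_le _ _).trans ?_
    have h1 : s.sum (fun _ e => e) ≤ k + 1 := (MvPolynomial.le_totalDegree hs).trans h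
    have h2 : s - Finsupp.single i 1 + Finsupp.single i 1 = s :=
      tsub_add_cancel_of_le (by simpa using Nat.one_le_iff_ne_zero.2 h0)
    rw [← h2, Finsupp.sum_add_index' (by simp) (by simp)] at h1
    simp at h1
    exact h1

theorem deg_lap {d k : ℕ} (P : MvPolynomial (Fin d) ℝ) (h : P.totalDegree ≤ k + 2) :
    (pLap P).totalDegree ≤ k := by
  unfold pLap
  rw [LinearMap.sum_apply]
  apply MvPolynomial.totalDegree_finsetSum_le
  intro i _
  exact deg_pderiv _ _ (deg_pderiv _ _ h)

/-- defining polynomial of a sphere -/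
def pS {d : ℕ} (x : Euc d) (r : ℝ) : MvPolynomial (Fin d) ℝ :=
  MvPolynomial.C (r^2) - ∑ i, (MvPolynomial.X i - MvPolynomial.C (x i))^2

theorem pS_eval {d : ℕ} (x : Euc d) (r : ℝ) (y : Euc d) : pF (pS x r) y = r^2 - ‖y - x‖^2 := by
  simp [pF, pS, EuclideanSpace.norm_sq_eq]

theorem pS_deg {d : ℕ} (x : Euc d) (r : ℝ) : (pS x r).totalDegree ≤ 2 := by
  unfold pS
  refine (MvPolynomial.totalDegree_sub _ _).trans (max_le (by rw [MvPolynomial.totalDegree_C]; omega) ?_)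
  apply MvPolynomial.totalDegree_finsetSum_le
  intro i _
  refine (MvPolynomial.totalDegree_pow _ _).trans ?_
  have : (MvPolynomial.X i - MvPolynomial.C (x i) : MvPolynomial (Fin d) ℝ).totalDegree ≤ 1 :=
    (MvPolynomial.totalDegree_sub _ _).trans (by simp)
  omega

theorem pF_har {d : ℕ} {P : MvPolynomial (Fin d) ℝ} (h : pLap P = 0) (U : Set (Euc d)) : Har (pF P) U := by
  refine ⟨(pF_contDiff P).continuous.continuousOn, fun x _ r hr _ => mvp_of_lap (pF_contDiff P) hr ?_⟩
  intro y _
  rw [pF_lap, h]; simp [pF]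

theorem Har.lsup {d : ℕ} {u : Euc d → ℝ} {U : Set (Euc d)} (h : Har u U) (hU : IsOpen U) : LSup u U := by
  intro x hx
  obtain ⟨ρ, hρ, hb⟩ := Metric.isOpen_iff.1 hU x hx
  refine ⟨ρ, hρ, fun s hs hsρ => ?_⟩
  unfold MeanLE
  exact (h.2 x hx s hs ((closedBall_subset_ball hsρ).trans hb)).le

theorem Har.neg {d : ℕ} {u : Euc d → ℝ} {U : Set (Euc d)} (h : Har u U) : Har (fun y => - u y) U := by
  have := (har_const 0 U).sub h
  simpa using this

theorem closedBall_diff_ball' {d : ℕ} {x : Euc d} {r : ℝ} : closedBall x r \ ball x r = sphere x r :=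
  closedBall_sdiff_ball

/-- max principle on balls -/
theorem Har.le_of_sphere {d : ℕ} [NeZero d] {u : Euc d → ℝ} {x : Euc d} {r c : ℝ}
    (h : Har u (ball x r)) (hc : ContinuousOn u (closedBall x r)) (hs : ∀ y ∈ sphere x r, u y ≤ c) :
    ∀ y ∈ closedBall x r, u y ≤ c := by
  have := min_principle (isCompact_closedBall x r) isOpen_ball ball_subset_closedBall
    (f := fun y => c - u y) (continuousOn_const.sub hc) (((har_const c _).sub h).lsup isOpen_ball)
    (by
      rw [closedBall_diff_ball']
      intro y hy; have := hs y hy; linarith)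
  intro y hy; have := this y hy; linarith

theorem poly_dirichlet {d : ℕ} [NeZero d] (x : Euc d) {r : ℝ} (hr : 0 < r) (P : MvPolynomial (Fin d) ℝ) :
    ∃ H : MvPolynomial (Fin d) ℝ, pLap H = 0 ∧ ∀ y ∈ sphere x r, pF H y = pF P y := by
  set m := P.totalDegree with hm
  let T : MvPolynomial.restrictTotalDegree (Fin d) ℝ m →ₗ[ℝ] MvPolynomial.restrictTotalDegree (Fin d) ℝ m :=
    LinearMap.codRestrict _ (pLap ∘ₗ LinearMap.mulLeft ℝ (pS x r) ∘ₗ Submodule.subtype _) (by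
      intro Q
      have h := (MvPolynomial.mem_restrictTotalDegree _ _ _).1 Q.2
      rw [MvPolynomial.mem_restrictTotalDegree]
      apply deg_lap
      have := MvPolynomial.totalDegree_mul (pS x r) Q.1
      have := pS_deg x r
      simp only [LinearMap.comp_apply, LinearMap.mulLeft_apply, Submodule.subtype_apply]
      omega)
  have hT : ∀ Q, ((T Q : _) : MvPolynomial (Fin d) ℝ) = pLap (pS x r * Q.1) := fun Q => rfl
  have hmulev : ∀ A B : MvPolynomial (Fin d) ℝ, ∀ y, pF (A * B) y = pF A y * pF B y := by
    intro A B y; simp [pF]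
  have hinj : Function.Injective T := by
    rw [← LinearMap.ker_eq_bot, LinearMap.ker_eq_bot']
    intro Q hQ
    have h0 : pLap (pS x r * Q.1) = 0 := by rw [← hT, hQ]; rfl
    have hh := pF_har h0 (ball x r)
    have hc := (pF_contDiff (pS x r * Q.1)).continuous.continuousOn (s := closedBall x r)
    have hz : ∀ y ∈ sphere x r, pF (pS x r * Q.1) y = 0 := by
      intro y hy
      rw [hmulev, pS_eval]
      rw [mem_sphere, dist_eq_norm] at hy
      rw [hy]; simp
    have h1 := hh.le_of_sphere hc (c := 0) (fun y hy => (hz y hy).le)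
    have h2 := hh.neg.le_of_sphere hc.neg (c := 0) (fun y hy => by simp [hz y hy])
    have h3 : ∀ y ∈ ball x r, pF Q.1 y = 0 := by
      intro y hy
      have a1 := h1 y (ball_subset_closedBall hy)
      have a2 := h2 y (ball_subset_closedBall hy)
      have a3 : pF (pS x r * Q.1) y = 0 := by linarith
      rw [hmulev, pS_eval] at a3
      rw [mem_ball, dist_eq_norm] at hy
      have : r^2 - ‖y - x‖^2 ≠ 0 := by nlinarith [norm_nonneg (y - x)]
      exact (mul_eq_zero.1 a3).resolve_left this
    ext1
    have hsq : 0 < r / (d + 1 : ℝ) := by positivity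
    refine MvPolynomial.funext_set (fun i => Ioo (x i - r / (d+1)) (x i + r / (d + 1)))
      (fun i => Ioo_infinite (by linarith)) ?_
    intro y hy
    have hy' : ∀ i, |y i - x i| < r / (d + 1) := by
      intro i
      have := hy i (mem_univ _)
      rw [abs_lt]; constructor <;> linarith [this.1, this.2]
    have h4 := h3 (WithLp.toLp 2 y) (by
      rw [mem_ball, dist_eq_norm]
      have : ‖WithLp.toLp 2 y - x‖^2 < r^2 := by
        rw [EuclideanSpace.norm_sq_eq]
        calc ∑ i, ‖(WithLp.toLp 2 y - x) i‖^2 ≤ ∑ i : Fin d, (r / (d+1))^2 := by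
              gcongr with i _
              simpa using (hy' i).le
          _ = d * (r/(d+1))^2 := by simp
          _ < r^2 := by
            rw [div_pow, mul_div_assoc', div_lt_iff₀ (by positivity)]
            have : (d:ℝ) < (d+1)^2 := by nlinarith [(Nat.cast_nonneg d : (0:ℝ) ≤ d)]
            have : 0 < r^2 := by positivity
            nlinarith
      exact lt_of_pow_lt_pow_left₀ 2 hr.le this)
    simpa [pF] using h4
  have hsurj := LinearMap.injective_iff_surjective.1 hinj
  have hmem : pLap P ∈ MvPolynomial.restrictTotalDegree (Fin d) ℝ m := by
    rw [MvPolynomial.mem_restrictTotalDegree]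
    exact deg_lap _ (by omega)
  obtain ⟨Q, hQ⟩ := hsurj ⟨pLap P, hmem⟩
  have hQ' : pLap (pS x r * Q.1) = pLap P := by rw [← hT, hQ]
  refine ⟨P - pS x r * Q.1, by rw [map_sub, hQ', sub_self], ?_⟩
  intro y hy
  have : pF (P - pS x r * Q.1) y = pF P y - pF (pS x r) y * pF Q.1 y := by simp [pF]
  rw [this, pS_eval]
  rw [mem_sphere, dist_eq_norm] at hy
  rw [hy]; simp

theorem poly_dense {d : ℕ} (K : Set (Euc d)) (hK : IsCompact K) (f : Euc d → ℝ) (hf : ContinuousOn f K)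
    {ε : ℝ} (hε : 0 < ε) : ∃ P : MvPolynomial (Fin d) ℝ, ∀ y ∈ K, |pF P y - f y| < ε := by
  have : CompactSpace K := isCompact_iff_compactSpace.1 hK
  let co : Fin d → C(K, ℝ) := fun i => ⟨fun y => (y : Euc d) i, by fun_prop⟩
  let φ : MvPolynomial (Fin d) ℝ →ₐ[ℝ] C(K, ℝ) := MvPolynomial.aeval co
  have hφ : ∀ P (y : K), φ P y = pF P y := by
    intro P y
    induction P using MvPolynomial.induction_on with
    | C a => simp [φ, pF]
    | add p q hp hq => simp only [map_add, ContinuousMap.add_apply, hp, hq]; simp [pF]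
    | mul_X p i hp => simp only [map_mul, ContinuousMap.mul_apply, hp]; simp [pF, φ, co]
  obtain ⟨g, hg⟩ := ContinuousMap.exists_mem_subalgebra_near_continuous_of_separatesPoints φ.range (by
      intro a b hab
      have : ∃ i, (a : Euc d) i ≠ (b : Euc d) i := by
        by_contra h
        push Not at h
        exact hab (Subtype.ext (by ext i; exact h i))
      obtain ⟨i, hi⟩ := this
      refine ⟨co i, ⟨co i, ⟨MvPolynomial.X i, by simp [φ]⟩, rfl⟩, hi⟩)
    (fun y : K => f y) (continuousOn_iff_continuous_domRestrict.1 hf) ε hε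
  obtain ⟨P, hP⟩ := g.2
  refine ⟨P, fun y hy => ?_⟩
  have := hg ⟨y, hy⟩
  rw [← hP] at this
  change ‖φ P ⟨y, hy⟩ - f y‖ < ε at this
  rwa [hφ, Real.norm_eq_abs] at this

/-- uniform limits of MVP functions -/
theorem har_of_unif {d : ℕ} {u : ℕ → Euc d → ℝ} {v : Euc d → ℝ} {U : Set (Euc d)}
    (hu : ∀ k, Har (u k) U) (hl : TendstoUniformlyOn u v atTop U) : Har v U := by
  have hc : ContinuousOn v U := hl.continuousOn (Frequently.of_forall fun k => (hu k).1)
  refine ⟨hc, fun x hx r hr hb => ?_⟩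
  have h1 : Tendsto (fun k => ∫ y in ball x r, u k y) atTop (𝓝 (∫ y in ball x r, v y)) := by
    rw [Metric.tendsto_atTop]
    intro ε hε
    rw [Metric.tendstoUniformlyOn_iff] at hl
    have hvol : 0 < r^d * vB d := by have := vB_pos d; positivity
    obtain ⟨N, hN⟩ := eventually_atTop.1 (hl (ε / (2 * (r^d * vB d))) (by positivity))
    refine ⟨N, fun k hk => ?_⟩
    rw [Real.dist_eq, ← integral_sub (intBall_of_cont ((hu k).1.mono hb)) (intBall_of_cont (hc.mono hb))]
    have h2 := norm_setIntegral_le_of_norm_le_const (μ := (volume : Measure (Euc d)))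
      (f := fun y => u k y - v y) (s := ball x r)
      (C := ε / (2 * (r^d * vB d))) measure_ball_lt_top (fun y hy => by
        have := hN k hk y (hb (ball_subset_closedBall hy))
        rw [dist_comm, Real.dist_eq] at this
        exact this.le)
    rw [vol_ball' x hr, Real.norm_eq_abs] at h2
    refine h2.trans_lt ?_
    rw [div_mul_eq_mul_div, div_lt_iff₀ (by positivity)]
    nlinarith
  have h3 : Tendsto (fun k => ∫ y in ball x r, u k y) atTop (𝓝 (r^d * vB d * v x)) := by
    simp only [fun k => (hu k).2 x hx r hr hb]
    exact (hl.tendsto_at hx).const_mul _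
  exact tendsto_nhds_unique h1 h3

theorem dirichlet {d : ℕ} [NeZero d] (x : Euc d) {r : ℝ} (hr : 0 < r) (f : Euc d → ℝ)
    (hf : ContinuousOn f (sphere x r)) :
    ∃ H : Euc d → ℝ, ContinuousOn H (closedBall x r) ∧ EqOn H f (sphere x r) ∧ Har H (ball x r) := by
  have h1 : ∀ k : ℕ, ∃ u : Euc d → ℝ, Continuous u ∧ Har u (ball x r) ∧
      ∀ y ∈ sphere x r, |u y - f y| < 1 / ((k:ℝ) + 1) := by
    intro k
    obtain ⟨P, hP⟩ := poly_dense (sphere x r) (isCompact_sphere x r) f hf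
      (ε := 1 / ((k:ℝ)+1)) (by positivity)
    obtain ⟨H, hH, hHP⟩ := poly_dirichlet x hr P
    exact ⟨pF H, (pF_contDiff H).continuous, pF_har hH _, fun y hy => by rw [hHP y hy]; exact hP y hy⟩
  choose u hu1 hu2 hu3 using h1
  have hcauchy : UniformCauchySeqOn u atTop (closedBall x r) := by
    rw [Metric.uniformCauchySeqOn_iff]
    intro ε hε
    obtain ⟨N, hN⟩ := exists_nat_one_div_lt (show 0 < ε / 4 by positivity)
    have key : ∀ k ≥ N, ∀ j ≥ N, ∀ y ∈ closedBall x r, u k y - u j y ≤ ε / 2 := by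
      intro k hk j hj
      apply ((hu2 k).sub (hu2 j)).le_of_sphere ((hu1 k).sub (hu1 j)).continuousOn
      intro y hy
      have a1 := abs_lt.1 (hu3 k y hy)
      have a2 := abs_lt.1 (hu3 j y hy)
      have b1 : 1 / ((k:ℝ)+1) ≤ 1 / ((N:ℝ) + 1) := by gcongr
      have b2 : 1 / ((j:ℝ)+1) ≤ 1 / ((N:ℝ) + 1) := by gcongr
      linarith [a1.2, a2.1]
    refine ⟨N, fun k hk j hj y hy => ?_⟩
    rw [Real.dist_eq, abs_lt]
    constructor <;> linarith [key k hk j hj y hy, key j hj k hk y hy]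
  have hlim : ∀ y ∈ closedBall x r, ∃ l, Tendsto (fun k => u k y) atTop (𝓝 l) := fun y hy =>
    cauchySeq_tendsto_of_complete (hcauchy.cauchySeq hy)
  classical
  let H : Euc d → ℝ := fun y => if h : y ∈ closedBall x r then (hlim y h).choose else 0
  have hH : ∀ y ∈ closedBall x r, Tendsto (fun k => u k y) atTop (𝓝 (H y)) := by
    intro y hy
    simp only [H, hy, dif_pos]
    exact (hlim y hy).choose_spec
  have hunif := hcauchy.tendstoUniformlyOn_of_tendsto hH
  refine ⟨H, hunif.continuousOn (Frequently.of_forall fun k => (hu1 k).continuousOn), ?_,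
    har_of_unif hu2 (hunif.mono ball_subset_closedBall)⟩
  intro y hy
  refine tendsto_nhds_unique (hH y (sphere_subset_closedBall hy)) ?_
  rw [tendsto_iff_dist_tendsto_zero]
  refine squeeze_zero (fun _ => dist_nonneg) (fun k => ?_) tendsto_one_div_add_atTop_nhds_zero_nat
  rw [Real.dist_eq]
  exact (hu3 k y hy).le


theorem vol_ball0 {d : ℕ} [NeZero d] (x : Euc d) {s : ℝ} (hs : 0 ≤ s) :
    volume.real (ball x s) = s ^ d * vB d := by
  rcases hs.eq_or_lt with h | h
  · subst h; simp [zero_pow (NeZero.ne d)]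
  · exact vol_ball' x h

theorem LSup.mono {d : ℕ} {u : Euc d → ℝ} {U V : Set (Euc d)} (h : LSup u U) (hV : V ⊆ U) : LSup u V :=
  fun x hx => h x (hV hx)

theorem LSup.add {d : ℕ} {u v : Euc d → ℝ} {U : Set (Euc d)} (hU : IsOpen U) (hu : LSup u U) (hv : LSup v U)
    (hcu : ContinuousOn u U) (hcv : ContinuousOn v U) : LSup (fun y => u y + v y) U := by
  intro x hx
  obtain ⟨ρ1, h1, hb1⟩ := hu x hx
  obtain ⟨ρ2, h2, hb2⟩ := hv x hx
  obtain ⟨ρ3, h3, hb3⟩ := Metric.isOpen_iff.1 hU x hx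
  refine ⟨min ρ1 (min ρ2 ρ3), by positivity, fun s hs hsρ => ?_⟩
  simp only [lt_min_iff] at hsρ
  have hb : closedBall x s ⊆ U := (closedBall_subset_ball hsρ.2.2).trans hb3
  have a1 := hb1 s hs hsρ.1
  have a2 := hb2 s hs hsρ.2.1
  unfold MeanLE at *
  rw [integral_add (intBall_of_cont (hcu.mono hb)) (intBall_of_cont (hcv.mono hb))]
  linarith

theorem LSup.sub_har {d : ℕ} {u v : Euc d → ℝ} {U : Set (Euc d)} (hU : IsOpen U) (hu : LSup u U)
    (hcu : ContinuousOn u U) (hv : Har v U) : LSup (fun y => u y - v y) U := by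
  have := hu.add hU (hv.neg.lsup hU) hcu hv.neg.1
  simpa [sub_eq_add_neg] using this

theorem MeanLE.min {d : ℕ} {u v : Euc d → ℝ} {x : Euc d} {s : ℝ} (hu : MeanLE u x s) (hv : MeanLE v x s)
    (hcu : IntegrableOn u (ball x s)) (hcv : IntegrableOn v (ball x s)) :
    MeanLE (fun y => min (u y) (v y)) x s := by
  unfold MeanLE at *
  have hi : IntegrableOn (fun y => Min.min (u y) (v y)) (ball x s) := Integrable.inf hcu hcv
  rcases le_total (u x) (v x) with h | h
  · simp only [min_eq_left h]
    exact (setIntegral_mono hi hcu fun y => min_le_left _ _).trans hu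
  · simp only [min_eq_right h]
    exact (setIntegral_mono hi hcv fun y => min_le_right _ _).trans hv

theorem shell_int {d : ℕ} {v : Euc d → ℝ} {x : Euc d} {r t t' : ℝ} (hv : IntegrableOn v (ball x r))
    (h : t' ≤ t) (h2 : t ≤ r) :
    ∫ y in ball x t \ ball x t', v y = (∫ y in ball x t, v y) - ∫ y in ball x t', v y :=
  setIntegral_sdiff measurableSet_ball (hv.mono_set (ball_subset_ball h2)) (ball_subset_ball h)

/-- local supermean implies global supermean -/
theorem glob {d : ℕ} [NeZero d] {u : Euc d → ℝ} {x : Euc d} {r : ℝ} (hr : 0 < r)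
    (hc : ContinuousOn u (closedBall x r)) (hl : LSup u (ball x r)) : MeanLE u x r := by
  have hvB := vB_pos d
  have hd : d ≠ 0 := NeZero.ne d
  have hiu := intBall_of_cont hc
  set E : ℝ → ℝ := fun t => ∫ y in ball x t, u y with hE
  -- one step
  have step : ∀ ε > 0, ∀ t, 0 < t → t ≤ r → ∃ η > 0, ∀ t', 0 ≤ t' → t - η < t' → t' ≤ t →
      E t - E t' ≤ (t^d - t'^d) * vB d * (u x + ε) := by
    intro ε hε t ht htr
    have hcb : closedBall x t ⊆ closedBall x r := closedBall_subset_closedBall htr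
    obtain ⟨H, hH1, hH2, hH3⟩ := dirichlet x ht u (hc.mono (sphere_subset_closedBall.trans hcb))
    have hcomp := min_principle (isCompact_closedBall x t) isOpen_ball ball_subset_closedBall
      (f := fun y => u y - H y) ((hc.mono hcb).sub hH1)
      ((hl.mono (ball_subset_ball htr)).sub_har isOpen_ball
        (hc.mono (ball_subset_closedBall.trans hcb)) hH3)
      (by
        rw [closedBall_diff_ball']
        intro y hy; rw [hH2 hy]; simp)
    have hx0 : H x ≤ u x := by have := hcomp x (mem_closedBall_self ht.le); linarith
    have huc := (isCompact_closedBall x t).uniformContinuousOn_of_continuous ((hc.mono hcb).sub hH1)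
    rw [Metric.uniformContinuousOn_iff] at huc
    obtain ⟨η, hη, hηb⟩ := huc ε hε
    refine ⟨min η t, by positivity, fun t' ht'0 ht' htt' => ?_⟩
    have hηle := min_le_left η t
    have htle := min_le_right η t
    have hHi : IntegrableOn H (ball x t) := intBall_of_cont hH1
    have e1 := shell_int (hiu) htt' htr
    have e2 := shell_int hHi htt' le_rfl
    have hsh : ∀ y ∈ ball x t \ ball x t', u y ≤ H y + ε := by
      intro y hy
      have hy1 : dist y x < t := hy.1
      have hy2 : t' ≤ dist y x := not_lt.1 hy.2
      have hy0 : 0 < dist y x := by linarith [show min η t ≤ t from htle]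
      -- projection to the sphere
      set z := x + (t / dist y x) • (y - x) with hz
      have hzs : z ∈ sphere x t := by
        rw [mem_sphere, dist_eq_norm, hz, add_sub_cancel_left, norm_smul, ← dist_eq_norm,
          Real.norm_of_nonneg (by positivity)]
        field_simp
      have hyz : dist y z < η := by
        rw [dist_eq_norm, hz, show y - (x + (t / dist y x) • (y - x)) = (1 - t / dist y x) • (y - x) by
          rw [sub_smul, one_smul]; abel, norm_smul, ← dist_eq_norm y x, Real.norm_eq_abs, abs_sub_comm,
          abs_of_nonneg (by rw [sub_nonneg, le_div_iff₀ hy0]; linarith), sub_mul,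
          div_mul_cancel₀ _ hy0.ne']
        linarith
      have := hηb y (mem_closedBall.2 hy1.le) z (sphere_subset_closedBall hzs) hyz
      simp only [Real.dist_eq, Pi.sub_apply] at this
      rw [hH2 hzs, sub_self, sub_zero] at this
      linarith [(abs_lt.1 this).2]
    have hmeas : MeasurableSet (ball x t \ ball x t') := measurableSet_ball.diff measurableSet_ball
    have hvolsh : volume.real (ball x t \ ball x t') = (t^d - t'^d) * vB d := by
      rw [measureReal_sdiff (ball_subset_ball htt') measurableSet_ball, vol_ball0 x ht.le, vol_ball0 x ht'0]
      ring
    have hfin : volume (ball x t \ ball x t') ≠ ⊤ :=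
      (measure_mono sdiff_subset).trans_lt measure_ball_lt_top |>.ne
    have hconst : IntegrableOn (fun _ : Euc d => ε) (ball x t \ ball x t') :=
      integrableOn_const hfin
    have e3 : ∫ y in ball x t \ ball x t', u y ≤ ∫ y in ball x t \ ball x t', (H y + ε) :=
      setIntegral_mono_on (hiu.mono_set (sdiff_subset.trans (ball_subset_ball htr)))
        ((hHi.mono_set sdiff_subset).add hconst) hmeas hsh
    rw [integral_add (hHi.mono_set sdiff_subset) hconst, setIntegral_const, hvolsh, e1, e2, smul_eq_mul] at e3
    have e4 : ∫ y in ball x t, H y = t^d * vB d * H x := by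
      -- the MVP on the full ball by continuity
      have h1 : Tendsto (fun k : ℕ => ∫ y in ball x (t * (1 - 1/((k:ℝ)+2))), H y) atTop
          (𝓝 (∫ y in ⋃ k : ℕ, ball x (t * (1 - 1/((k:ℝ)+2))), H y)) := by
        apply tendsto_setIntegral_of_monotone (fun _ => measurableSet_ball)
        · intro i j hij
          apply ball_subset_ball
          have : (i:ℝ) ≤ j := by exact_mod_cast hij
          gcongr
        · apply hHi.mono_set
          apply iUnion_subset
          intro k
          apply ball_subset_ball
          have : 0 < 1/((k:ℝ)+2) := by positivity
          nlinarith
      have h2 : (⋃ k : ℕ, ball x (t * (1 - 1/((k:ℝ)+2)))) = ball x t := by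
        apply subset_antisymm
        · apply iUnion_subset
          intro k
          apply ball_subset_ball
          have : 0 < 1/((k:ℝ)+2) := by positivity
          nlinarith
        · intro y hy
          rw [mem_ball] at hy
          obtain ⟨k, hk⟩ := exists_nat_one_div_lt (show 0 < 1 - dist y x / t by
            rw [sub_pos, div_lt_one ht]; exact hy)
          rw [mem_iUnion]
          refine ⟨k, ?_⟩
          rw [mem_ball]
          have : 1/((k:ℝ)+2) ≤ 1/((k:ℝ)+1) := by gcongr; linarith
          have h3 : dist y x / t < 1 - 1/((k:ℝ)+2) := by linarith
          rw [div_lt_iff₀ ht] at h3; linarith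
      rw [h2] at h1
      have h3 : Tendsto (fun k : ℕ => ∫ y in ball x (t * (1 - 1/((k:ℝ)+2))), H y) atTop
          (𝓝 (t^d * vB d * H x)) := by
        have h4 : ∀ k : ℕ, ∫ y in ball x (t * (1 - 1/((k:ℝ)+2))), H y =
            (t * (1 - 1/((k:ℝ)+2)))^d * vB d * H x := by
          intro k
          have h0 : 0 < 1/((k:ℝ)+2) := by positivity
          have h1 : 1/((k:ℝ)+2) < 1 := by
            rw [div_lt_one (by positivity)]; linarith [(Nat.cast_nonneg k : (0:ℝ) ≤ k)]
          refine hH3.2 x (mem_ball_self ht) _ (mul_pos ht (by linarith)) (closedBall_subset_ball ?_)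
          nlinarith
        simp only [h4]
        have h5 : Tendsto (fun k : ℕ => 1/((k:ℝ)+2)) atTop (𝓝 0) := by
          have := (tendsto_one_div_add_atTop_nhds_zero_nat (𝕜 := ℝ)).comp (tendsto_add_atTop_nat 1)
          refine this.congr fun k => ?_
          simp only [Function.comp]; push_cast; ring
        have h6 := (((tendsto_const_nhds (x := (1:ℝ))).sub h5).const_mul t).pow d
        have h7 := (h6.mul_const (vB d)).mul_const (H x)
        simpa using h7
      exact tendsto_nhds_unique h1 h3
    have e5 : ∫ y in ball x t', H y = t'^d * vB d * H x := by
      rcases htt'.eq_or_lt with h | h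
      · rw [h]; exact e4
      · rcases ht'0.eq_or_lt with h0 | h0
        · rw [← h0]; simp [hd]
        · exact hH3.2 x (mem_ball_self ht) t' h0 (closedBall_subset_ball h)
    rw [e4, e5] at e3
    have hge : 0 ≤ t^d - t'^d := sub_nonneg.2 (by gcongr)
    have : (t^d - t'^d) * vB d * H x ≤ (t^d - t'^d) * vB d * u x := by gcongr
    simp only [hE]
    nlinarith
  -- continuity of E
  obtain ⟨M, hM⟩ := (isCompact_closedBall x r).exists_bound_of_continuousOn hc
  have hEc : ContinuousOn E (Icc 0 r) := by
    have hlip : ∀ t t', 0 ≤ t' → t' ≤ t → t ≤ r → |E t - E t'| ≤ M * ((t^d - t'^d) * vB d) := by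
      intro t t' h0 h1 h2
      have hfin : volume (ball x t \ ball x t') < ⊤ :=
        (measure_mono sdiff_subset).trans_lt measure_ball_lt_top
      have hvolsh : volume.real (ball x t \ ball x t') = (t^d - t'^d) * vB d := by
        rw [measureReal_sdiff (ball_subset_ball h1) measurableSet_ball, vol_ball0 x (h0.trans h1),
          vol_ball0 x h0]
        ring
      have := norm_setIntegral_le_of_norm_le_const hfin (f := u) (C := M) (fun y hy =>
        hM y ((ball_subset_closedBall.trans (closedBall_subset_closedBall h2)) hy.1))
      rw [shell_int hiu h1 h2, hvolsh] at this
      exact this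
    have hlip' : ∀ t ∈ Icc 0 r, ∀ t' ∈ Icc 0 r, |E t' - E t| ≤ |M * ((t'^d - t^d) * vB d)| := by
      intro t ht t' ht'
      rcases le_total t' t with h | h
      · rw [abs_sub_comm]
        refine (hlip t t' ht'.1 h ht.2).trans ?_
        rw [show M * ((t'^d - t^d) * vB d) = - (M * ((t^d - t'^d) * vB d)) by ring, abs_neg]
        exact le_abs_self _
      · exact (hlip t' t ht.1 h ht'.2).trans (le_abs_self _)
    intro t ht
    rw [ContinuousWithinAt, tendsto_iff_dist_tendsto_zero]
    have hz : Tendsto (fun t' => |M * ((t'^d - t^d) * vB d)|) (𝓝[Icc 0 r] t) (𝓝 0) := by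
      have : ContinuousAt (fun t' : ℝ => |M * ((t'^d - t^d) * vB d)|) t := by fun_prop
      have h2 := this.tendsto
      simp only [sub_self, zero_mul, mul_zero, abs_zero] at h2
      exact h2.mono_left nhdsWithin_le_nhds
    refine squeeze_zero' (Eventually.of_forall fun _ => dist_nonneg) ?_ hz
    filter_upwards [self_mem_nhdsWithin] with t' ht'
    rw [Real.dist_eq]
    exact hlip' t ht t' ht'
  -- continuous induction
  have main : ∀ ε > 0, E r ≤ r^d * vB d * (u x + ε) := by
    intro ε hε
    set S : Set ℝ := {τ | E r - E (r - τ) ≤ (r^d - (r-τ)^d) * vB d * (u x + ε)} with hS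
    have hsub : Icc 0 r ⊆ S := by
      apply IsClosed.Icc_subset_of_forall_exists_gt
      · have hcomp : ContinuousOn (fun τ => E (r - τ)) (Icc 0 r) :=
          hEc.comp (by fun_prop) (fun τ hτ => ⟨by linarith [hτ.2], by linarith [hτ.1]⟩)
        have := ContinuousOn.preimage_isClosed_of_isClosed
          (f := fun τ => (r^d - (r-τ)^d) * vB d * (u x + ε) - (E r - E (r - τ)))
          (s := Icc 0 r) (t := Ici 0)
          ((by fun_prop : Continuous fun τ : ℝ => (r^d - (r-τ)^d) * vB d * (u x + ε)).continuousOn.sub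
            (continuousOn_const.sub hcomp)) isClosed_Icc isClosed_Ici
        convert! this using 1
        ext τ
        simp only [hS, mem_inter_iff, mem_ofPred_eq, mem_preimage, mem_Ici, sub_nonneg]
        tauto
      · simp [hS]
      · intro τ hτ y hy
        obtain ⟨η, hη, hs⟩ := step ε hε (r - τ) (by linarith [hτ.2.2]) (by linarith [hτ.2.1])
        set σ := min (min (y - τ) (η/2)) (r - τ) with hσ
        have hσ0 : 0 < σ := by
          have := hτ.2.2
          have : τ < y := hy
          simp only [hσ, lt_min_iff]; refine ⟨⟨?_, ?_⟩, ?_⟩ <;> linarith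
        have l1 : σ ≤ y - τ := (min_le_left _ _).trans (min_le_left _ _)
        have l2 : σ ≤ η / 2 := (min_le_left _ _).trans (min_le_right _ _)
        have l3 : σ ≤ r - τ := min_le_right _ _
        refine ⟨τ + σ, ?_, by linarith, by linarith⟩
        have h1 := hs (r - (τ + σ)) (by linarith) (by linarith) (by linarith)
        have h2 : E r - E (r - τ) ≤ (r^d - (r-τ)^d) * vB d * (u x + ε) := hτ.1
        change E r - E (r - (τ + σ)) ≤ (r^d - (r-(τ + σ))^d) * vB d * (u x + ε)
        linarith
    have := hsub (right_mem_Icc.2 hr.le)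
    simp only [hS, mem_ofPred_eq, sub_self, zero_pow hd, sub_zero] at this
    have h0 : E 0 = 0 := by simp [hE]
    linarith
  unfold MeanLE
  change E r ≤ _
  refine le_of_forall_pos_le_add fun ε hε => ?_
  have hp : 0 < r^d * vB d := by positivity
  have := main (ε / (r^d * vB d)) (by positivity)
  refine this.trans (le_of_eq ?_)
  field_simp


/-- fundamental solution -/
def Phi (n : ℕ) (p x : Euc (n+1)) : ℝ := ‖x - p‖ ^ ((1 : ℤ) - n)

theorem Phi_nonneg (n : ℕ) (p x : Euc (n+1)) : 0 ≤ Phi n p x := by unfold Phi; positivity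

theorem Phi_pos (n : ℕ) {p x : Euc (n+1)} (h : x ≠ p) : 0 < Phi n p x := by
  have : 0 < ‖x - p‖ := norm_pos_iff.2 (sub_ne_zero.2 h)
  unfold Phi; positivity

theorem Phi_rpow (n : ℕ) (p x : Euc (n+1)) : Phi n p x = (‖x - p‖^2) ^ ((1 - (n:ℝ))/2) := by
  unfold Phi
  rw [← Real.rpow_natCast, ← Real.rpow_mul (norm_nonneg _), ← Real.rpow_intCast]
  congr 1
  push_cast; ring

theorem hasFDerivAt_sqdist {d : ℕ} (p y : Euc d) :
    HasFDerivAt (fun y : Euc d => ‖y - p‖^2) (2 • innerSL ℝ (y - p)) y := by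
  have := (hasStrictFDerivAt_norm_sq (y - p)).hasFDerivAt.comp y ((hasFDerivAt_id y).sub_const p)
  have h2 : ((2:ℕ) • innerSL ℝ (y - p)) ∘L (ContinuousLinearMap.id ℝ (Euc d)) = (2:ℕ) • innerSL ℝ (y - p) :=
    ContinuousLinearMap.comp_id _
  rw [h2] at this
  exact this

theorem inner_eB {d : ℕ} (z : Euc d) (i : Fin d) : inner ℝ z (eB i) = z i := by
  unfold eB
  rw [EuclideanSpace.inner_single_right]
  simp

theorem fderiv_sqpow {d : ℕ} (p : Euc d) (a : ℝ) {y : Euc d} (hy : y ≠ p) (i : Fin d) :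
    HasFDerivAt (fun y : Euc d => (‖y - p‖^2) ^ a)
      ((a * (‖y - p‖^2)^(a - 1)) • (2 • innerSL ℝ (y - p))) y := by
  have h0 : ‖y - p‖^2 ≠ 0 := by
    have : 0 < ‖y - p‖ := norm_pos_iff.2 (sub_ne_zero.2 hy)
    positivity
  exact (hasFDerivAt_sqdist p y).rpow_const (Or.inl h0)

theorem lap_Phi (n : ℕ) {p x : Euc (n+1)} (hx : x ≠ p) : lap (Phi n p) x = 0 := by
  set a : ℝ := (1 - (n:ℝ))/2 with ha
  have hP : Phi n p = fun y => (‖y - p‖^2)^a := by ext y; exact Phi_rpow n p y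
  unfold lap
  have h1 : ∀ i, ∀ y : Euc (n+1), y ≠ p → fderiv ℝ (Phi n p) y (eB i) =
      2 * a * ((‖y - p‖^2)^(a - 1) * (y i - p i)) := by
    intro i y hy
    rw [hP, (fderiv_sqpow p a hy i).fderiv]
    rw [_root_.smul_apply, _root_.smul_apply, innerSL_apply_apply, inner_eB]
    simp
    ring
  have hs : 0 < ‖x - p‖^2 := by
    have : 0 < ‖x - p‖ := norm_pos_iff.2 (sub_ne_zero.2 hx)
    positivity
  have h2 : ∀ i, fderiv ℝ (fun y => fderiv ℝ (Phi n p) y (eB i)) x (eB i) =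
      2 * a * ((‖x - p‖^2)^(a-1) + 2 * (a - 1) * (‖x - p‖^2)^(a - 2) * (x i - p i)^2) := by
    intro i
    have hev : (fun y => fderiv ℝ (Phi n p) y (eB i)) =ᶠ[𝓝 x]
        fun y => 2 * a * ((‖y - p‖^2)^(a - 1) * (y i - p i)) := by
      filter_upwards [isOpen_ne.mem_nhds hx] with y hy using h1 i y hy
    rw [hev.fderiv_eq]
    have hd2 : HasFDerivAt (fun y : Euc (n+1) => y i - p i) (EuclideanSpace.proj i : Euc (n+1) →L[ℝ] ℝ) x :=
      (ContinuousLinearMap.hasFDerivAt (EuclideanSpace.proj i : Euc (n+1) →L[ℝ] ℝ)).sub_const _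
    have h3 : HasFDerivAt (fun y : Euc (n+1) => 2 * a * ((‖y - p‖^2)^(a - 1) * (y i - p i))) _ x :=
      ((fderiv_sqpow p (a-1) hx i).mul hd2).const_mul (2 * a)
    rw [HasFDerivAt.fderiv h3]
    rw [_root_.smul_apply, _root_.add_apply, _root_.smul_apply, _root_.smul_apply, _root_.smul_apply, _root_.smul_apply, innerSL_apply_apply, inner_eB]
    rw [show a - 1 - 1 = a - 2 by ring]
    have h5 : (EuclideanSpace.proj i : Euc (n+1) →L[ℝ] ℝ) (eB i) = 1 := by simp [eB]
    rw [h5]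
    simp only [smul_eq_mul, nsmul_eq_mul, PiLp.sub_apply, Nat.cast_ofNat]
    ring
  rw [Finset.sum_congr rfl fun i _ => h2 i, ← Finset.mul_sum, Finset.sum_add_distrib, ← Finset.mul_sum]
  have h3 : ∑ i, (x i - p i)^2 = ‖x - p‖^2 := by simp [EuclideanSpace.norm_sq_eq]
  rw [h3]
  have h4 : (‖x - p‖^2)^(a - 1) = (‖x - p‖^2)^(a-2) * ‖x - p‖^2 := by
    rw [show a - 1 = (a - 2) + 1 by ring, Real.rpow_add hs, Real.rpow_one]
  rw [h4]
  simp only [Finset.sum_const, Finset.card_univ, Fintype.card_fin, nsmul_eq_mul]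
  rw [ha]
  push_cast
  ring

theorem Phi_contDiffAt (n : ℕ) {p x : Euc (n+1)} (hx : x ≠ p) : ContDiffAt ℝ 2 (Phi n p) x := by
  rw [show Phi n p = fun y => (‖y - p‖^2) ^ ((1 - (n:ℝ))/2) from funext fun y => Phi_rpow n p y]
  apply ContDiffAt.rpow_const_of_ne
  · exact ((contDiff_norm_sq ℝ).comp (contDiff_id.sub contDiff_const)).contDiffAt
  · have : 0 < ‖x - p‖ := norm_pos_iff.2 (sub_ne_zero.2 hx)
    positivity

theorem Phi_har (n : ℕ) (p : Euc (n+1)) : Har (Phi n p) {p}ᶜ := by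
  refine ⟨fun x hx => (Phi_contDiffAt n hx).continuousAt.continuousWithinAt, fun x hx r hr hb => ?_⟩
  have hp : r < dist p x := by
    by_contra h
    exact hb (mem_closedBall.2 (not_lt.1 h)) rfl
  set m := dist p x - r with hm
  have hm0 : 0 < m := by linarith
  let b : ContDiffBump p := ⟨m/3, m/2, by positivity, by linarith⟩
  have hf : ContDiff ℝ 2 (fun y => (1 - b y) * Phi n p y) := by
    rw [contDiff_iff_contDiffAt]
    intro y
    by_cases hy : y = p
    · subst hy
      refine (contDiffAt_const (𝕜 := ℝ) (c := (0:ℝ))).congr_of_eventuallyEq ?_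
      filter_upwards [b.eventuallyEq_one] with z hz
      rw [hz]; simp
    · exact ((contDiffAt_const (𝕜 := ℝ)).sub (b.contDiff (n := 2)).contDiffAt).mul (Phi_contDiffAt n hy)
  have hz : ∀ y ∈ ball p (m/2), y ∉ ball x r := by
    intro y hy hy2
    rw [mem_ball] at hy hy2
    have := dist_triangle p y x
    rw [dist_comm p y] at this
    linarith
  have heq : ∀ y ∈ ball x r, (1 - b y) * Phi n p y = Phi n p y := by
    intro y hy
    have : b y = 0 := by
      rw [← Function.notMem_support, b.support_eq]
      exact fun h => hz y h hy
    rw [this]; ring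
  have hx0 := heq x (mem_ball_self hr)
  have := mvp_of_lap hf (x0 := x) hr (by
    intro y hy
    have hyp : y ≠ p := fun h => hb (ball_subset_closedBall hy) h
    rw [← lap_Phi n hyp]
    have hev : (fun y => (1 - b y) * Phi n p y) =ᶠ[𝓝 y] Phi n p := by
      filter_upwards [isOpen_ball.mem_nhds hy] with z hz using heq z hz
    unfold lap
    refine Finset.sum_congr rfl fun i _ => ?_
    have h2 : (fun z => fderiv ℝ (fun y => (1 - b y) * Phi n p y) z (eB i)) =ᶠ[𝓝 y]
        fun z => fderiv ℝ (Phi n p) z (eB i) := by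
      filter_upwards [hev.fderiv (𝕜 := ℝ)] with z hz
      rw [hz]
    rw [h2.fderiv_eq])
  rw [hx0] at this
  rw [← this]
  exact setIntegral_congr_fun measurableSet_ball fun y hy => (heq y hy).symm

/-- truncated fundamental solution -/
def PhiT (n : ℕ) (s : ℝ) (p x : Euc (n+1)) : ℝ := (max ‖x - p‖ s) ^ ((1 : ℤ) - n)

theorem PhiT_cont (n : ℕ) {s : ℝ} (hs : 0 < s) (p : Euc (n+1)) : Continuous (PhiT n s p) := by
  unfold PhiT
  apply Continuous.zpow₀ (by fun_prop)
  intro x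
  exact Or.inl (lt_of_lt_of_le hs (le_max_right _ _)).ne'

theorem PhiT_eq {n : ℕ} {s : ℝ} {p x : Euc (n+1)} (h : s ≤ ‖x - p‖) : PhiT n s p x = Phi n p x := by
  unfold PhiT Phi; rw [max_eq_left h]

theorem PhiT_eq' {n : ℕ} {s : ℝ} {p x : Euc (n+1)} (h : ‖x - p‖ ≤ s) : PhiT n s p x = s ^ ((1 : ℤ) - n) := by
  unfold PhiT; rw [max_eq_right h]

theorem PhiT_pos (n : ℕ) {s : ℝ} (hs : 0 < s) (p x : Euc (n+1)) : 0 < PhiT n s p x := by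
  have : 0 < max ‖x - p‖ s := lt_of_lt_of_le hs (le_max_right _ _)
  unfold PhiT; positivity

theorem zpow_anti {n : ℕ} (hn : 1 ≤ n) {a b : ℝ} (ha : 0 < a) (h : a ≤ b) :
    b ^ ((1 : ℤ) - n) ≤ a ^ ((1 : ℤ) - n) := by
  obtain ⟨m, rfl⟩ := Nat.exists_eq_add_of_le hn
  rw [show (1:ℤ) - ((1 + m : ℕ) : ℤ) = -(m:ℤ) by push_cast; ring, zpow_neg, zpow_neg]
  simp only [zpow_natCast]
  gcongr

theorem PhiT_le {n : ℕ} (hn : 1 ≤ n) {s : ℝ} (hs : 0 < s) (p x : Euc (n+1)) :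
    PhiT n s p x ≤ s ^ ((1 : ℤ) - n) := zpow_anti hn hs (le_max_right _ _)

theorem PhiT_le_Phi {n : ℕ} (hn : 1 ≤ n) (s : ℝ) {p x : Euc (n+1)} (h : x ≠ p) :
    PhiT n s p x ≤ Phi n p x :=
  zpow_anti hn (norm_pos_iff.2 (sub_ne_zero.2 h)) (le_max_left _ _)

theorem PhiT_lsup {n : ℕ} (hn : 1 ≤ n) {s : ℝ} (hs : 0 < s) (p : Euc (n+1)) : LSup (PhiT n s p) univ := by
  intro x _
  rcases le_or_gt ‖x - p‖ s with h | h
  · refine ⟨1, one_pos, fun r hr _ => ?_⟩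
    unfold MeanLE
    rw [PhiT_eq' h, ← vol_ball' x hr, ← smul_eq_mul, ← setIntegral_const]
    exact setIntegral_mono (intBall_of_cont (PhiT_cont n hs p).continuousOn) (intBall_const _ _ _)
      fun y => PhiT_le hn hs p y
  · refine ⟨‖x - p‖ - s, by linarith, fun r hr hrs => ?_⟩
    unfold MeanLE
    rw [PhiT_eq h.le, ← (Phi_har n p).2 x (by rintro rfl; simp at h; linarith) r hr ?_]
    · refine le_of_eq (setIntegral_congr_fun measurableSet_ball fun y hy => PhiT_eq ?_)
      rw [mem_ball, dist_eq_norm] at hy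
      have := norm_sub_norm_le (x - p) (x - y)
      rw [sub_sub_sub_cancel_left, norm_sub_rev x y] at this
      linarith
    · intro y hy hyp
      rw [mem_singleton_iff] at hyp
      subst hyp
      rw [mem_closedBall, dist_eq_norm, norm_sub_rev] at hy
      linarith


/-- bounded upper class -/
def Up {d : ℕ} (Ω : Set (Euc d)) (f : Euc d → ℝ) (h : Euc d → ℝ) : Prop :=
  ContinuousOn h Ω ∧ LSup h Ω ∧ (∃ M, ∀ x ∈ Ω, |h x| ≤ M) ∧
    ∀ ξ ∈ frontier Ω, ∀ ε > 0, ∀ᶠ x in 𝓝[Ω] ξ, f ξ - ε < h x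

theorem Up.meanLE {d : ℕ} [NeZero d] {Ω : Set (Euc d)} {h : Euc d → ℝ}
    (hc : ContinuousOn h Ω) (hl : LSup h Ω) {x : Euc d} {r : ℝ} (hr : 0 < r) (hb : closedBall x r ⊆ Ω) :
    MeanLE h x r :=
  glob hr (hc.mono hb) (hl.mono (ball_subset_closedBall.trans hb))

theorem Up.mem_upper {d : ℕ} [NeZero d] {Ω : Set (Euc d)} {f h : Euc d → ℝ}
    (hu : Up Ω f h) : h ∈ upperFamily Ω f := by
  obtain ⟨hc, hl, ⟨M, hM⟩, hb⟩ := hu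
  refine ⟨⟨hc.neg, fun x hx r hr hbr => ?_⟩, ⟨-M, ?_⟩, fun ξ hξ => ?_⟩
  · exact (meanLE_iff h x hr).1 (Up.meanLE hc hl hr hbr)
  · rintro _ ⟨x, hx, rfl⟩
    exact (abs_le.1 (hM x hx)).1
  · have : (𝓝[Ω] ξ).NeBot := mem_closure_iff_nhdsWithin_neBot.1 (frontier_subset_closure hξ)
    refine le_of_forall_pos_sub_le fun ε hε => ?_
    refine le_liminf_of_le ?_ ?_
    · refine IsBoundedUnder.isCoboundedUnder_ge ⟨M, ?_⟩
      rw [eventually_map]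
      filter_upwards [self_mem_nhdsWithin] with x hx using (abs_le.1 (hM x hx)).2
    · filter_upwards [hb ξ hξ ε hε] with x hx using hx.le

theorem lsup_const {d : ℕ} (c : ℝ) (U : Set (Euc d)) : LSup (fun _ => c) U := by
  intro x _
  refine ⟨1, one_pos, fun s hs _ => ?_⟩
  unfold MeanLE
  rw [setIntegral_const, vol_ball' x hs, smul_eq_mul]

theorem LSup.min' {d : ℕ} {u v : Euc d → ℝ} {U : Set (Euc d)} (hU : IsOpen U) (hu : LSup u U) (hv : LSup v U)
    (hcu : ContinuousOn u U) (hcv : ContinuousOn v U) : LSup (fun y => min (u y) (v y)) U := by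
  intro x hx
  obtain ⟨ρ1, h1, hb1⟩ := hu x hx
  obtain ⟨ρ2, h2, hb2⟩ := hv x hx
  obtain ⟨ρ3, h3, hb3⟩ := Metric.isOpen_iff.1 hU x hx
  refine ⟨min ρ1 (min ρ2 ρ3), by positivity, fun s hs hlt => ?_⟩
  rw [lt_min_iff, lt_min_iff] at hlt
  have hb : closedBall x s ⊆ U := (closedBall_subset_ball hlt.2.2).trans hb3
  exact (hb1 s hs hlt.1).min (hb2 s hs hlt.2.1) (intBall_of_cont (hcu.mono hb)) (intBall_of_cont (hcv.mono hb))

theorem LSup.smul {d : ℕ} {u : Euc d → ℝ} {U : Set (Euc d)} (hu : LSup u U) {c : ℝ} (hc : 0 ≤ c) :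
    LSup (fun y => c * u y) U := by
  intro x hx
  obtain ⟨ρ1, h1, hb1⟩ := hu x hx
  refine ⟨ρ1, h1, fun s hs hlt => ?_⟩
  have := hb1 s hs hlt
  unfold MeanLE at *
  rw [integral_const_mul]
  have := mul_le_mul_of_nonneg_left this hc
  linarith

theorem up_of_upper {d : ℕ} {Ω : Set (Euc d)} (hΩ : IsOpen Ω) {f h : Euc d → ℝ}
    (hh : h ∈ upperFamily Ω f) {M : ℝ} (hM : ∀ ξ ∈ frontier Ω, f ξ ≤ M) :
    Up Ω f (fun y => min (h y) M) := by
  obtain ⟨⟨hc, hs⟩, ⟨m, hm⟩, hb⟩ := hh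
  have hc' : ContinuousOn h Ω := by
    have h0 := hc.neg
    exact h0.congr fun y _ => by simp
  have hl : LSup h Ω := by
    intro x hx
    obtain ⟨ρ, hρ, hbρ⟩ := Metric.isOpen_iff.1 hΩ x hx
    exact ⟨ρ, hρ, fun s h0 hlt => (meanLE_iff h x h0).2
      (hs x hx s h0 ((closedBall_subset_ball hlt).trans hbρ))⟩
  refine ⟨hc'.inf continuousOn_const, hl.min' hΩ (lsup_const M Ω) hc' continuousOn_const,
    ⟨max |m| |M|, fun x hx => ?_⟩, fun ξ hξ ε hε => ?_⟩
  · have h1 : m ≤ h x := hm ⟨x, hx, rfl⟩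
    rw [abs_le]
    constructor
    · have := neg_abs_le m
      have := neg_abs_le M
      have := le_max_left |m| |M|
      have := le_max_right |m| |M|
      apply le_min <;> linarith
    · exact (min_le_right _ _).trans ((le_abs_self _).trans (le_max_right _ _))
  · have key : ∀ᶠ x in 𝓝[Ω] ξ, f ξ - ε < h x := by
      have h1 := hb ξ hξ
      have hbd : IsBoundedUnder (· ≥ ·) (𝓝[Ω] ξ) h := by
        refine ⟨m, ?_⟩
        rw [eventually_map]
        filter_upwards [self_mem_nhdsWithin] with x hx using hm ⟨x, hx, rfl⟩
      by_cases hcb : IsCoboundedUnder (· ≥ ·) (𝓝[Ω] ξ) h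
      · exact eventually_lt_of_lt_liminf (lt_of_lt_of_le (by linarith) h1) hbd
      · by_contra hne
        apply hcb
        refine ⟨f ξ - ε, fun a ha => ?_⟩
        by_contra hlt
        apply hne
        rw [eventually_map] at ha
        filter_upwards [ha] with x hx
        exact lt_of_lt_of_le (not_le.1 hlt) hx
    filter_upwards [key] with x hx
    exact lt_min hx (by have := hM ξ hξ; linarith)

theorem Up.min {d : ℕ} {Ω : Set (Euc d)} (hΩ : IsOpen Ω) {f h k : Euc d → ℝ} (hh : Up Ω f h) (hk : Up Ω f k) :
    Up Ω f (fun y => min (h y) (k y)) := by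
  obtain ⟨hc, hl, ⟨M, hM⟩, hb⟩ := hh
  obtain ⟨hc', hl', ⟨M', hM'⟩, hb'⟩ := hk
  refine ⟨hc.inf hc', hl.min' hΩ hl' hc hc', ⟨max M M', fun x hx => ?_⟩, fun ξ hξ ε hε => ?_⟩
  · exact (abs_min_le_max_abs_abs).trans (max_le_max (hM x hx) (hM' x hx))
  · filter_upwards [hb ξ hξ ε hε, hb' ξ hξ ε hε] with x h1 h2 using lt_min h1 h2

theorem up_const {d : ℕ} {Ω : Set (Euc d)} {f : Euc d → ℝ} {M : ℝ} (hM : ∀ ξ ∈ frontier Ω, f ξ ≤ M) :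
    Up Ω f (fun _ => M) :=
  ⟨continuousOn_const, lsup_const _ _, ⟨|M|, fun _ _ => le_rfl⟩, fun ξ hξ ε hε => by
    filter_upwards with x
    have := hM ξ hξ; linarith⟩

theorem Up.mono {d : ℕ} {Ω : Set (Euc d)} {f f' h : Euc d → ℝ} (hh : Up Ω f h)
    (hf : ∀ ξ ∈ frontier Ω, f' ξ ≤ f ξ) : Up Ω f' h := by
  obtain ⟨hc, hl, hM, hb⟩ := hh
  refine ⟨hc, hl, hM, fun ξ hξ ε hε => ?_⟩
  filter_upwards [hb ξ hξ ε hε] with x h1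
  have := hf ξ hξ; linarith

theorem poisson_mod {d : ℕ} [NeZero d] {Ω : Set (Euc d)} (hΩ : IsOpen Ω) {f h : Euc d → ℝ} (hh : Up Ω f h)
    {x : Euc d} {r : ℝ} (hr : 0 < r) (hb : closedBall x r ⊆ Ω) :
    ∃ h', Up Ω f h' ∧ (∀ y ∈ Ω, h' y ≤ h y) ∧ Har h' (ball x r) := by
  classical
  obtain ⟨hc, hl, ⟨M, hM⟩, hbd⟩ := hh
  obtain ⟨H, hHc, hHe, hHh⟩ := dirichlet x hr h (hc.mono (sphere_subset_closedBall.trans hb))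
  set h' := (ball x r).piecewise H h with hh'
  have e1 : ∀ y ∈ ball x r, h' y = H y := fun y hy => piecewise_eq_of_mem _ _ _ hy
  have e2 : ∀ y, y ∉ ball x r → h' y = h y := fun y hy => piecewise_eq_of_notMem _ _ _ hy
  have e3 : ∀ y ∈ closedBall x r, h' y = H y := by
    intro y hy
    by_cases h1 : y ∈ ball x r
    · exact e1 y h1
    · rw [e2 y h1, hHe]
      rw [← closedBall_diff_ball']; exact ⟨hy, h1⟩
  have har : Har h' (ball x r) := hHh.congr e1
  have hle0 : ∀ y ∈ closedBall x r, 0 ≤ h y - H y := by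
    refine min_principle (isCompact_closedBall x r) isOpen_ball ball_subset_closedBall
      ((hc.mono hb).sub hHc) ?_ ?_
    · exact (hl.mono (ball_subset_closedBall.trans hb)).sub_har isOpen_ball
        (hc.mono (ball_subset_closedBall.trans hb)) hHh
    · intro y hy
      rw [closedBall_diff_ball'] at hy
      rw [hHe hy]; simp
  have hle : ∀ y ∈ Ω, h' y ≤ h y := by
    intro y hy
    by_cases h1 : y ∈ ball x r
    · rw [e1 y h1]; linarith [hle0 y (ball_subset_closedBall h1)]
    · rw [e2 y h1]
  have hc' : ContinuousOn h' Ω := by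
    have hA : ContinuousOn h' (closedBall x r) := hHc.congr e3
    have hB : ContinuousOn h' (Ω \ ball x r) := (hc.mono sdiff_subset).congr fun y hy => e2 y hy.2
    intro y hy
    have hsub : Ω ⊆ closedBall x r ∪ (Ω \ ball x r) := by
      intro z hz
      by_cases h1 : z ∈ ball x r
      · exact Or.inl (ball_subset_closedBall h1)
      · exact Or.inr ⟨hz, h1⟩
    refine ContinuousWithinAt.mono ?_ hsub
    refine ContinuousWithinAt.union ?_ ?_
    · by_cases h1 : y ∈ closedBall x r
      · exact hA y h1
      · exact continuousWithinAt_of_notMem_closure (by rwa [isClosed_closedBall.closure_eq])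
    · by_cases h1 : y ∈ ball x r
      · have : ContinuousAt h' y := (har.1 y h1).continuousAt (isOpen_ball.mem_nhds h1)
        exact this.continuousWithinAt
      · exact hB y ⟨hy, h1⟩
  refine ⟨h', ⟨hc', ?_, ?_, ?_⟩, hle, har⟩
  · intro y hy
    by_cases h1 : y ∈ ball x r
    · exact har.lsup isOpen_ball y h1
    · obtain ⟨ρ1, hρ1, hb1⟩ := hl y hy
      obtain ⟨ρ2, hρ2, hb2⟩ := Metric.isOpen_iff.1 hΩ y hy
      refine ⟨Min.min ρ1 ρ2, by positivity, fun s hs hlt => ?_⟩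
      rw [lt_min_iff] at hlt
      have hbs : closedBall y s ⊆ Ω := (closedBall_subset_ball hlt.2).trans hb2
      have := hb1 s hs hlt.1
      unfold MeanLE at *
      rw [e2 y h1]
      refine le_trans (setIntegral_mono_on (intBall_of_cont (hc'.mono hbs)) (intBall_of_cont (hc.mono hbs))
        measurableSet_ball fun z hz => hle z (hbs (ball_subset_closedBall hz))) this
  · obtain ⟨C, hC⟩ := (isCompact_closedBall x r).exists_bound_of_continuousOn (hc'.mono hb)
    refine ⟨max M C, fun y hy => ?_⟩
    by_cases h1 : y ∈ ball x r
    · exact (hC y (ball_subset_closedBall h1)).trans (le_max_right _ _)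
    · rw [e2 y h1]; exact (hM y hy).trans (le_max_left _ _)
  · intro ξ hξ ε hε
    have hξ' : ξ ∉ closedBall x r := fun h0 => by
      rw [hΩ.frontier_eq] at hξ
      exact hξ.2 (hb h0)
    filter_upwards [hbd ξ hξ ε hε, mem_nhdsWithin_of_mem_nhds (isClosed_closedBall.isOpen_compl.mem_nhds hξ')] with y h1 h2
    rw [e2 y fun h0 => h2 (ball_subset_closedBall h0)]
    exact h1

theorem har_of_local {d : ℕ} [NeZero d] {u : Euc d → ℝ} {U : Set (Euc d)}
    (h : ∀ x ∈ U, ∃ ρ > 0, Har u (ball x ρ)) : Har u U := by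
  have hc : ContinuousOn u U := fun x hx => by
    obtain ⟨ρ, hρ, h1⟩ := h x hx
    exact ((h1.1 x (mem_ball_self hρ)).continuousAt (ball_mem_nhds x hρ)).continuousWithinAt
  have h1 : LSup u U := fun x hx => by
    obtain ⟨ρ, hρ, h1⟩ := h x hx
    exact h1.lsup isOpen_ball x (mem_ball_self hρ)
  have h2 : LSup (fun y => -u y) U := fun x hx => by
    obtain ⟨ρ, hρ, h1⟩ := h x hx
    exact h1.neg.lsup isOpen_ball x (mem_ball_self hρ)
  refine ⟨hc, fun x hx r hr hb => le_antisymm (Up.meanLE hc h1 hr hb) ?_⟩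
  have := Up.meanLE hc.neg h2 hr hb
  unfold MeanLE at this
  simp only [Pi.neg_apply] at this
  rw [integral_neg] at this
  linarith

theorem har_of_ptwise {d : ℕ} [NeZero d] {u : ℕ → Euc d → ℝ} {v : Euc d → ℝ} {U : Set (Euc d)} (hU : IsOpen U)
    (hu : ∀ k, Har (u k) U) {M : ℝ} (hM : ∀ k, ∀ x ∈ U, |u k x| ≤ M)
    (hl : ∀ x ∈ U, Tendsto (fun k => u k x) atTop (𝓝 (v x))) : Har v U := by
  have hcK := cK_pos d
  have hc : ContinuousOn v U := by
    intro x hx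
    obtain ⟨ρ, hρ, hb⟩ := Metric.isOpen_iff.1 hU x hx
    have hb' : closedBall x (2 * (ρ/3)) ⊆ U := (closedBall_subset_ball (by linarith)).trans hb
    have hs : 0 < ρ/3 := by positivity
    set C := 4 / cK d / (ρ/3) ^ (d + 1) * (∫ y in ball x (2 * (ρ/3)), M) with hC
    have h1 : ∀ y ∈ ball x (ρ/3), |v y - v x| ≤ C * ‖y - x‖ := by
      intro y hy
      have hyU : y ∈ U := hb (ball_subset_ball (by linarith) hy)
      have ht : Tendsto (fun k => |u k y - u k x|) atTop (𝓝 |v y - v x|) :=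
        ((hl y hyU).sub (hl x hx)).abs
      refine le_of_tendsto' ht fun k => ?_
      rw [mem_ball, dist_eq_norm] at hy
      have := (hu k).diff_le hs hb' (h := y - x) hy.le 0
      rw [add_sub_cancel] at this
      refine this.trans ?_
      rw [hC]
      gcongr
      · exact (intBall_of_cont (((hu k).1.mono hb').sub continuousOn_const)).abs
      · exact intBall_const _ _ _
      · exact measurableSet_ball.nullMeasurableSet
      · rename_i hz
        rw [sub_zero]
        exact hM k _ (hb' (ball_subset_closedBall hz))
    refine ContinuousAt.continuousWithinAt ?_
    rw [ContinuousAt, tendsto_iff_dist_tendsto_zero]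
    have h2 : Tendsto (fun y => C * ‖y - x‖) (𝓝 x) (𝓝 0) := by
      have : ContinuousAt (fun y => C * ‖y - x‖) x := by fun_prop
      simpa [ContinuousAt] using this
    refine squeeze_zero' (Eventually.of_forall fun _ => dist_nonneg) ?_ h2
    filter_upwards [ball_mem_nhds x hs] with y hy
    rw [Real.dist_eq]; exact h1 y hy
  refine ⟨hc, fun x hx r hr hb => ?_⟩
  have h1 : Tendsto (fun k => ∫ y in ball x r, u k y) atTop (𝓝 (∫ y in ball x r, v y)) := by
    refine tendsto_integral_of_dominated_convergence (fun _ => M) ?_ (intBall_const _ _ _) ?_ ?_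
    · intro k
      exact (intBall_of_cont ((hu k).1.mono hb)).aestronglyMeasurable
    · intro k
      filter_upwards [ae_restrict_mem measurableSet_ball] with y hy
        using hM k y (hb (ball_subset_closedBall hy))
    · filter_upwards [ae_restrict_mem measurableSet_ball] with y hy
        using hl y (hb (ball_subset_closedBall hy))
  have h2 : Tendsto (fun k => ∫ y in ball x r, u k y) atTop (𝓝 (r^d * vB d * v x)) := by
    rw [funext fun k => (hu k).2 x hx r hr hb]
    exact (hl x hx).const_mul _
  exact tendsto_nhds_unique h1 h2


/-- the part of the domain on which the Perron classes are bounded below -/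
def OSet {d : ℕ} (Ω : Set (Euc d)) : Set (Euc d) := {x | x ∈ Ω ∧ ∀ h, Up Ω (fun _ => 0) h → 0 ≤ h x}

theorem OSet_subset {d : ℕ} (Ω : Set (Euc d)) : OSet Ω ⊆ Ω := fun _ h => h.1

theorem OSet_open {d : ℕ} [NeZero d] {Ω : Set (Euc d)} (hΩ : IsOpen Ω) : IsOpen (OSet Ω) := by
  rw [Metric.isOpen_iff]
  intro x hx
  obtain ⟨ρ, hρ, hb⟩ := Metric.isOpen_iff.1 hΩ x hx.1
  have hr : 0 < ρ/2 := by positivity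
  have hb' : closedBall x (ρ/2) ⊆ Ω := (closedBall_subset_ball (by linarith)).trans hb
  refine ⟨ρ/2, hr, fun y hy => ⟨hb' (ball_subset_closedBall hy), fun h hh => ?_⟩⟩
  have hk : Up Ω (fun _ => 0) (fun y => min (h y) 0) := hh.min hΩ (up_const fun _ _ => le_rfl)
  obtain ⟨k, hk1, hk2, hk3⟩ := poisson_mod hΩ hk hr hb'
  have hx0 : k x = 0 := le_antisymm ((hk2 x hx.1).trans (min_le_right _ _)) (hx.2 k hk1)
  have hyd : dist y x < ρ/2 := hy
  set s := (dist y x + ρ/2)/2 with hs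
  have hs1 : dist y x < s := by rw [hs]; linarith
  have hs2 : s < ρ/2 := by rw [hs]; linarith
  have hs0 : 0 < s := dist_nonneg.trans_lt hs1
  have hcb : closedBall x s ⊆ ball x (ρ/2) := closedBall_subset_ball hs2
  have hcb2 : closedBall y (s - dist y x) ⊆ ball x (ρ/2) := by
    refine subset_trans ?_ hcb
    apply closedBall_subset_closedBall'
    linarith
  have hn := hk3.neg
  have := harnack_aux (u := fun y => -k y) hs1 (fun z hz => by
    have := hk2 z (hb' (ball_subset_closedBall (hcb (ball_subset_closedBall hz))))
    have h2 := this.trans (min_le_right _ _)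
    linarith) (intBall_of_cont (hn.1.mono hcb)) (hn.2 x (mem_ball_self hr) s hs0 hcb)
    (hn.2 y hy (s - dist y x) (by linarith) hcb2)
  simp only [hx0] at this
  have hpos : 0 < (s - dist y x)^d := pow_pos (by linarith) _
  have h3 : -k y ≤ 0 := by
    by_contra h4
    push Not at h4
    have := mul_pos hpos h4
    linarith
  have h5 := hk2 y (hb' (ball_subset_closedBall hy))
  have := h5.trans (min_le_left _ _)
  linarith

theorem UB_open {d : ℕ} {Ω : Set (Euc d)} (hΩ : IsOpen Ω) : IsOpen (Ω \ OSet Ω) := by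
  have : Ω \ OSet Ω = ⋃ h ∈ {h | Up Ω (fun _ => 0) h}, (Ω ∩ h ⁻¹' Iio 0) := by
    ext x
    simp only [OSet, Set.mem_sdiff, mem_ofPred_eq, mem_iUnion, mem_inter_iff, mem_preimage, mem_Iio]
    constructor
    · rintro ⟨h1, h2⟩
      by_contra h3
      apply h2
      refine ⟨h1, fun h hh => ?_⟩
      by_contra h4
      exact h3 ⟨h, hh, h1, not_le.1 h4⟩
    · rintro ⟨h, hh, h1, h2⟩
      exact ⟨h1, fun h3 => absurd (h3.2 h hh) (not_le.2 h2)⟩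
  rw [this]
  exact isOpen_biUnion fun h hh => ContinuousOn.isOpen_inter_preimage hh.1 hΩ isOpen_Iio

theorem perron_le {d : ℕ} [NeZero d] {Ω : Set (Euc d)} (hΩ : IsOpen Ω) {f : Euc d → ℝ} {M : ℝ}
    (hf0 : ∀ ξ ∈ frontier Ω, 0 ≤ f ξ) (hM : ∀ ξ ∈ frontier Ω, f ξ ≤ M) {x : Euc d} (hx : x ∈ OSet Ω)
    {h : Euc d → ℝ} (hh : Up Ω f h) : perron Ω f x ≤ h x := by
  refine csInf_le ⟨0, ?_⟩ ⟨h, hh.mem_upper, rfl⟩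
  rintro _ ⟨k, hk, rfl⟩
  have h1 := hx.2 _ ((up_of_upper hΩ hk hM).mono hf0)
  exact h1.trans (min_le_left _ _)

theorem perron_nonneg {d : ℕ} {Ω : Set (Euc d)} (hΩ : IsOpen Ω) {f : Euc d → ℝ} {M : ℝ}
    (hf0 : ∀ ξ ∈ frontier Ω, 0 ≤ f ξ) (hM : ∀ ξ ∈ frontier Ω, f ξ ≤ M) {x : Euc d} (hx : x ∈ OSet Ω) :
    0 ≤ perron Ω f x := by
  apply Real.sInf_nonneg
  rintro _ ⟨k, hk, rfl⟩
  have h1 := hx.2 _ ((up_of_upper hΩ hk hM).mono hf0)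
  exact h1.trans (min_le_left _ _)

theorem perron_lt {d : ℕ} [NeZero d] {Ω : Set (Euc d)} (hΩ : IsOpen Ω) {f : Euc d → ℝ} {M : ℝ}
    (hM : ∀ ξ ∈ frontier Ω, f ξ ≤ M) {x : Euc d}
    {a : ℝ} (h : perron Ω f x < a) : ∃ h, Up Ω f h ∧ h x < a := by
  have hne : ((fun u => u x) '' upperFamily Ω f).Nonempty := ⟨M, fun _ => M, (up_const hM).mem_upper, rfl⟩
  obtain ⟨_, ⟨k, hk, rfl⟩, hka⟩ := exists_lt_of_csInf_lt hne h
  exact ⟨_, up_of_upper hΩ hk hM, (min_le_left _ _).trans_lt hka⟩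

theorem perron_UB {d : ℕ} [NeZero d] {Ω : Set (Euc d)} (hΩ : IsOpen Ω) {f : Euc d → ℝ} {M : ℝ}
    (hM : ∀ ξ ∈ frontier Ω, f ξ ≤ M) {x : Euc d} (hx : x ∈ Ω \ OSet Ω) :
    perron Ω f x = 0 := by
  apply Real.sInf_of_not_bddBelow
  rintro ⟨b, hb⟩
  have : ∃ h, Up Ω (fun _ => 0) h ∧ h x < 0 := by
    by_contra h3
    apply hx.2
    refine ⟨hx.1, fun h hh => ?_⟩
    by_contra h4
    exact h3 ⟨h, hh, not_le.1 h4⟩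
  obtain ⟨h, hh, hneg⟩ := this
  obtain ⟨k, hk⟩ := exists_nat_gt ((M - b) / (-h x))
  obtain ⟨hc, hl, ⟨M', hM'⟩, hbd⟩ := hh
  have hup : Up Ω f (fun y => ((k:ℝ) + 1) * h y + M) := by
    have hk0 : (0:ℝ) < (k:ℝ) + 1 := by positivity
    refine ⟨(continuousOn_const.mul hc).add continuousOn_const,
      (hl.smul hk0.le).add hΩ (lsup_const M Ω) (continuousOn_const.mul hc) continuousOn_const,
      ⟨((k:ℝ) + 1) * M' + |M|, fun y hy => ?_⟩, fun ξ hξ ε hε => ?_⟩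
    · refine (abs_add_le _ _).trans ?_
      rw [abs_mul, abs_of_pos hk0]
      gcongr
      exact hM' y hy
    · filter_upwards [hbd ξ hξ (ε/((k:ℝ)+1)) (by positivity)] with y hy
      have h1 := mul_lt_mul_of_pos_left hy hk0
      have h2 : ((k:ℝ)+1) * (0 - ε/((k:ℝ)+1)) = -ε := by field_simp; ring
      have := hM ξ hξ
      linarith
  have h1 := hb ⟨_, hup.mem_upper, rfl⟩
  simp only at h1
  rw [div_lt_iff₀ (by linarith)] at hk
  nlinarith

theorem perron_har {d : ℕ} [NeZero d] {Ω : Set (Euc d)} (hΩ : IsOpen Ω) {f : Euc d → ℝ} {M : ℝ}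
    (hf0 : ∀ ξ ∈ frontier Ω, 0 ≤ f ξ) (hM : ∀ ξ ∈ frontier Ω, f ξ ≤ M) :
    Har (perron Ω f) (OSet Ω) := by
  -- countable subfamily
  have h1 : ∀ a : ℚ, ∃ T : Set (Euc d → ℝ), T.Countable ∧ (∀ h ∈ T, Up Ω f h) ∧
      ∀ x ∈ Ω, ∀ h, Up Ω f h → h x < a → ∃ h' ∈ T, h' x < a := by
    intro a
    obtain ⟨T, hT1, hT2⟩ := TopologicalSpace.isOpen_iUnion_countable
      (fun h : {h // Up Ω f h} => Ω ∩ h.1 ⁻¹' Iio (a:ℝ))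
      (fun h => ContinuousOn.isOpen_inter_preimage h.2.1 hΩ isOpen_Iio)
    refine ⟨Subtype.val '' T, hT1.image _, ?_, ?_⟩
    · rintro _ ⟨h, _, rfl⟩; exact h.2
    · intro x hx h hh hlt
      have : x ∈ ⋃ i : {h // Up Ω f h}, (Ω ∩ i.1 ⁻¹' Iio (a:ℝ)) := mem_iUnion.2 ⟨⟨h, hh⟩, hx, hlt⟩
      rw [← hT2] at this
      simp only [mem_iUnion] at this
      obtain ⟨i, hi, h3⟩ := this
      exact ⟨i.1, ⟨i, hi, rfl⟩, h3.2⟩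
  choose T hT1 hT2 hT3 using h1
  have hTc : ((⋃ a, T a) ∪ {fun _ => M}).Countable := (countable_iUnion hT1).union (countable_singleton _)
  obtain ⟨e, he⟩ := hTc.exists_eq_range ⟨fun _ => M, Or.inr rfl⟩
  have hue : ∀ k, Up Ω f (e k) := by
    intro k
    have : e k ∈ (⋃ a, T a) ∪ {fun _ => M} := by rw [he]; exact mem_range_self k
    rcases this with h | h
    · obtain ⟨a, ha⟩ := mem_iUnion.1 h
      exact hT2 a _ ha
    · rw [mem_singleton_iff.1 h]; exact up_const hM
  let g : ℕ → Euc d → ℝ := fun k => Nat.rec (e 0) (fun j gj => fun y => min (gj y) (e (j+1) y)) k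
  have g0 : g 0 = e 0 := rfl
  have gs : ∀ k, g (k+1) = fun y => min (g k y) (e (k+1) y) := fun k => rfl
  have hug : ∀ k, Up Ω f (g k) := by
    intro k
    induction k with
    | zero => rw [g0]; exact hue 0
    | succ k ih => rw [gs]; exact ih.min hΩ (hue _)
  have hga : ∀ x, Antitone (fun k => g k x) := fun x => antitone_nat_of_succ_le fun k => by
    rw [gs]; exact min_le_left _ _
  have hge : ∀ k x, g k x ≤ e k x := by
    intro k x
    cases k with
    | zero => rw [g0]
    | succ k => rw [gs]; exact min_le_right _ _
  have hlim : ∀ x ∈ OSet Ω, ∀ ε > 0, ∃ k, ∀ j ≥ k, g j x < perron Ω f x + ε := by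
    intro x hx ε hε
    obtain ⟨a, ha1, ha2⟩ := exists_rat_btwn (show perron Ω f x < perron Ω f x + ε by linarith)
    obtain ⟨h, hh, hlt⟩ := perron_lt hΩ hM ha1
    obtain ⟨h', hh', hlt'⟩ := hT3 a x hx.1 h hh hlt
    have : h' ∈ range e := by rw [← he]; exact Or.inl (mem_iUnion.2 ⟨a, hh'⟩)
    obtain ⟨k, rfl⟩ := this
    refine ⟨k, fun j hj => ?_⟩
    have := hga x hj
    have := hge k x
    simp only at *
    linarith
  apply har_of_local
  intro x hx
  obtain ⟨ρ, hρ, hb⟩ := Metric.isOpen_iff.1 (OSet_open hΩ) x hx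
  have hr : 0 < ρ/2 := by positivity
  have hbO : closedBall x (ρ/2) ⊆ OSet Ω := (closedBall_subset_ball (by linarith)).trans hb
  have hb' := hbO.trans (OSet_subset Ω)
  refine ⟨ρ/2, hr, ?_⟩
  choose g' hg1 hg2 hg3 using fun k => poisson_mod hΩ (hug k) hr hb'
  obtain ⟨M', hM'⟩ := (hug 0).2.2.1
  have hlow : ∀ k, ∀ y ∈ OSet Ω, perron Ω f y ≤ g' k y := fun k y hy => perron_le hΩ hf0 hM hy (hg1 k)
  refine har_of_ptwise (u := g') (M := M') isOpen_ball hg3 ?_ ?_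
  · intro k y hy
    have hyO := hbO (ball_subset_closedBall hy)
    have h2 := hlow k y hyO
    have h3 := perron_nonneg hΩ hf0 hM hyO
    have h4 := hg2 k y hyO.1
    have h5 := hga y (Nat.zero_le k)
    have h6 := hM' y hyO.1
    simp only at h5
    rw [abs_of_nonneg (h3.trans h2)]
    exact h4.trans (h5.trans ((le_abs_self _).trans h6))
  · intro y hy
    have hyO := hbO (ball_subset_closedBall hy)
    rw [Metric.tendsto_atTop]
    intro ε hε
    obtain ⟨k, hk⟩ := hlim y hyO ε hε
    refine ⟨k, fun j hj => ?_⟩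
    have h2 := hlow j y hyO
    have h4 := hg2 j y hyO.1
    have := hk j hj
    rw [Real.dist_eq, abs_of_nonneg (by linarith)]
    linarith


theorem green_eq (n : ℕ) (Ω : Set (Euc (n+1))) (p x : Euc (n+1)) :
    greenFn n Ω p x = Phi n p x - perron Ω (Phi n p) x := rfl

theorem Phi_bdry {n : ℕ} (hn : 1 ≤ n) {Ω : Set (Euc (n+1))} (hΩ : IsOpen Ω) {p : Euc (n+1)} {t : ℝ} (ht : 0 < t)
    (hp : ball p t ⊆ Ω) : ∀ ξ ∈ frontier Ω, t ≤ ‖ξ - p‖ ∧ Phi n p ξ ≤ t ^ ((1:ℤ) - n) := by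
  intro ξ hξ
  rw [hΩ.frontier_eq] at hξ
  have h1 : t ≤ ‖ξ - p‖ := by
    by_contra h
    push Not at h
    exact hξ.2 (hp (by rw [mem_ball, dist_eq_norm]; exact h))
  exact ⟨h1, zpow_anti hn ht h1⟩

theorem exists_ball' {n : ℕ} {Ω : Set (Euc (n+1))} (hΩ : IsOpen Ω) {p : Euc (n+1)} (hp : p ∈ Ω) :
    ∃ t > 0, ball p t ⊆ Ω := Metric.isOpen_iff.1 hΩ p hp

theorem P_har {n : ℕ} (hn : 1 ≤ n) {Ω : Set (Euc (n+1))} (hΩ : IsOpen Ω) {p : Euc (n+1)} (hp : p ∈ Ω) :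
    Har (perron Ω (Phi n p)) Ω := by
  obtain ⟨t, ht, hb⟩ := exists_ball' hΩ hp
  have hbd := Phi_bdry hn hΩ ht hb
  have h1 := perron_har hΩ (f := Phi n p) (fun ξ _ => Phi_nonneg n p ξ) (fun ξ hξ => (hbd ξ hξ).2)
  apply har_of_local
  intro x hx
  by_cases hxO : x ∈ OSet Ω
  · obtain ⟨ρ, hρ, hbρ⟩ := Metric.isOpen_iff.1 (OSet_open hΩ) x hxO
    exact ⟨ρ, hρ, h1.mono hbρ⟩
  · obtain ⟨ρ, hρ, hbρ⟩ := Metric.isOpen_iff.1 (UB_open hΩ) x ⟨hx, hxO⟩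
    exact ⟨ρ, hρ, (har_const 0 _).congr fun y hy => perron_UB hΩ (fun ξ hξ => (hbd ξ hξ).2) (hbρ hy)⟩

theorem P_nonneg {n : ℕ} (hn : 1 ≤ n) {Ω : Set (Euc (n+1))} (hΩ : IsOpen Ω) {p : Euc (n+1)} (hp : p ∈ Ω)
    {x : Euc (n+1)} (hx : x ∈ Ω) : 0 ≤ perron Ω (Phi n p) x := by
  obtain ⟨t, ht, hb⟩ := exists_ball' hΩ hp
  have hbd := Phi_bdry hn hΩ ht hb
  by_cases hxO : x ∈ OSet Ω
  · exact perron_nonneg hΩ (fun ξ _ => Phi_nonneg n p ξ) (fun ξ hξ => (hbd ξ hξ).2) hxO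
  · exact (perron_UB hΩ (fun ξ hξ => (hbd ξ hξ).2) ⟨hx, hxO⟩).ge

theorem P_le_PhiT {n : ℕ} (hn : 1 ≤ n) {Ω : Set (Euc (n+1))} (hΩ : IsOpen Ω) {p : Euc (n+1)} {t : ℝ} (ht : 0 < t)
    (hb : ball p t ⊆ Ω) {x : Euc (n+1)} (hx : x ∈ Ω) : perron Ω (Phi n p) x ≤ PhiT n t p x := by
  have hbd := Phi_bdry hn hΩ ht hb
  by_cases hxO : x ∈ OSet Ω
  · refine perron_le hΩ (fun ξ _ => Phi_nonneg n p ξ) (fun ξ hξ => (hbd ξ hξ).2) hxO ?_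
    refine ⟨(PhiT_cont n ht p).continuousOn, (PhiT_lsup hn ht p).mono (subset_univ _),
      ⟨t ^ ((1:ℤ) - n), fun y _ => ?_⟩, fun ξ hξ ε hε => ?_⟩
    · rw [abs_of_pos (PhiT_pos n ht p y)]; exact PhiT_le hn ht p y
    · rw [← PhiT_eq (hbd ξ hξ).1]
      have : ContinuousAt (PhiT n t p) ξ := (PhiT_cont n ht p).continuousAt
      exact mem_nhdsWithin_of_mem_nhds (this.eventually (lt_mem_nhds (by linarith)))
  · rw [perron_UB hΩ (fun ξ hξ => (hbd ξ hξ).2) ⟨hx, hxO⟩]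
    exact (PhiT_pos n ht p x).le

theorem green_nonneg {n : ℕ} (hn : 1 ≤ n) {Ω : Set (Euc (n+1))} (hΩ : IsOpen Ω) {p : Euc (n+1)} (hp : p ∈ Ω)
    {x : Euc (n+1)} (hx : x ∈ Ω) (hxp : x ≠ p) : 0 ≤ greenFn n Ω p x := by
  obtain ⟨t, ht, hb⟩ := exists_ball' hΩ hp
  have h1 := P_le_PhiT hn hΩ ht hb hx
  have h2 := PhiT_le_Phi hn t hxp
  rw [green_eq]; linarith

theorem green_le {n : ℕ} (hn : 1 ≤ n) {Ω : Set (Euc (n+1))} (hΩ : IsOpen Ω) {p : Euc (n+1)} (hp : p ∈ Ω)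
    {x : Euc (n+1)} (hx : x ∈ Ω) : greenFn n Ω p x ≤ Phi n p x := by
  have h1 := P_nonneg hn hΩ hp hx
  rw [green_eq]; linarith

theorem green_UB {n : ℕ} (hn : 1 ≤ n) {Ω : Set (Euc (n+1))} (hΩ : IsOpen Ω) {p : Euc (n+1)} (hp : p ∈ Ω)
    {x : Euc (n+1)} (hx : x ∈ Ω \ OSet Ω) : greenFn n Ω p x = Phi n p x := by
  obtain ⟨t, ht, hb⟩ := exists_ball' hΩ hp
  have hbd := Phi_bdry hn hΩ ht hb
  rw [green_eq, perron_UB hΩ (fun ξ hξ => (hbd ξ hξ).2) hx, sub_zero]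

theorem green_har {n : ℕ} (hn : 1 ≤ n) {Ω : Set (Euc (n+1))} (hΩ : IsOpen Ω) {p : Euc (n+1)} (hp : p ∈ Ω) :
    Har (greenFn n Ω p) (Ω \ {p}) :=
  ((Phi_har n p).mono (fun _ h => h.2)).sub ((P_har hn hΩ hp).mono sdiff_subset)

/-- the Green function on the bounded part, extended by zero -/
def gO (n : ℕ) (Ω : Set (Euc (n+1))) (p : Euc (n+1)) : Euc (n+1) → ℝ :=
  (OSet Ω \ {p}).indicator (greenFn n Ω p)

theorem gO_nonneg {n : ℕ} (hn : 1 ≤ n) {Ω : Set (Euc (n+1))} (hΩ : IsOpen Ω) {p : Euc (n+1)} (hp : p ∈ Ω)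
    (x : Euc (n+1)) : 0 ≤ gO n Ω p x :=
  indicator_nonneg (fun y hy => green_nonneg hn hΩ hp hy.1.1 hy.2) x

theorem gO_le {n : ℕ} (hn : 1 ≤ n) {Ω : Set (Euc (n+1))} (hΩ : IsOpen Ω) {p : Euc (n+1)} (hp : p ∈ Ω)
    (x : Euc (n+1)) : gO n Ω p x ≤ Phi n p x := by
  unfold gO
  refine indicator_le' (fun y hy => green_le hn hΩ hp hy.1.1) (fun y _ => Phi_nonneg n p y) x

theorem gO_meas {n : ℕ} (hn : 1 ≤ n) {Ω : Set (Euc (n+1))} (hΩ : IsOpen Ω) {p : Euc (n+1)} (hp : p ∈ Ω) :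
    AEStronglyMeasurable (gO n Ω p) volume := by
  have ho : IsOpen (OSet Ω \ {p}) := (OSet_open hΩ).sdiff isClosed_singleton
  unfold gO
  rw [aestronglyMeasurable_indicator_iff ho.measurableSet]
  exact ((green_har hn hΩ hp).1.mono (sdiff_subset_sdiff_left (OSet_subset Ω))).aestronglyMeasurable ho.measurableSet

theorem gO_int {n : ℕ} (hn : 1 ≤ n) {Ω : Set (Euc (n+1))} (hΩ : IsOpen Ω) {p : Euc (n+1)} (hp : p ∈ Ω)
    {x : Euc (n+1)} {s : ℝ} (hps : p ∉ closedBall x s) : IntegrableOn (gO n Ω p) (ball x s) := by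
  have hsub : closedBall x s ⊆ {p}ᶜ := fun y hy h => hps (mem_singleton_iff.1 h ▸ hy)
  refine Integrable.mono' (intBall_of_cont ((Phi_har n p).1.mono hsub)) (gO_meas hn hΩ hp).restrict ?_
  refine Eventually.of_forall fun y => ?_
  rw [Real.norm_of_nonneg (gO_nonneg hn hΩ hp y)]
  exact gO_le hn hΩ hp y

theorem gO_submean {n : ℕ} (hn : 1 ≤ n) {Ω : Set (Euc (n+1))} (hΩ : IsOpen Ω) {p : Euc (n+1)} (hp : p ∈ Ω)
    {x : Euc (n+1)} {s : ℝ} (hs : 0 < s) (hps : p ∉ closedBall x s) :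
    s ^ (n+1) * vB (n+1) * gO n Ω p x ≤ ∫ y in ball x s, gO n Ω p y := by
  classical
  have hvB := vB_pos (n+1)
  have hsub : closedBall x s ⊆ {p}ᶜ := fun y hy h => hps (mem_singleton_iff.1 h ▸ hy)
  have hgin := gO_int hn hΩ hp hps
  have hI0 : 0 ≤ ∫ y in ball x s, gO n Ω p y := integral_nonneg fun y => gO_nonneg hn hΩ hp y
  by_cases hxO : x ∈ OSet Ω
  swap
  · have : gO n Ω p x = 0 := indicator_of_notMem (fun h => hxO h.1) _
    rw [this, mul_zero]; exact hI0
  have hxp : x ≠ p := fun h => hsub (mem_closedBall_self hs.le) h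
  obtain ⟨t, ht, hb⟩ := exists_ball' hΩ hp
  have hbd := Phi_bdry hn hΩ ht hb
  have key : ∀ h, Up Ω (Phi n p) h → ∀ ε > 0,
      s ^ (n+1) * vB (n+1) * (Phi n p x - h x - ε) ≤ ∫ y in ball x s, gO n Ω p y := by
    intro h hh ε hε
    set w : Euc (n+1) → ℝ := (OSet Ω).indicator (fun y => min (h y + ε - Phi n p y) 0) with hw
    have hw0 : ∀ y, w y ≤ 0 := fun y => by
      rw [hw]; exact indicator_nonpos (fun y _ => min_le_right _ _) y
    have hOp : IsOpen (OSet Ω \ {p}) := (OSet_open hΩ).sdiff isClosed_singleton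
    have hcb : ContinuousOn (fun y => h y + ε - Phi n p y) (OSet Ω \ {p}) :=
      ((hh.1.mono fun y hy => hy.1.1).add continuousOn_const).sub ((Phi_har n p).1.mono fun y hy => hy.2)
    have hcO : ContinuousOn w (OSet Ω \ {p}) := by
      refine (hcb.inf continuousOn_const (g := fun _ => (0:ℝ))).congr fun y hy => ?_
      exact indicator_of_mem hy.1 _
    have hwc : ContinuousOn w {p}ᶜ := by
      intro y hy
      refine ContinuousAt.continuousWithinAt ?_
      by_cases hyO : y ∈ OSet Ω
      · exact (hcO y ⟨hyO, hy⟩).continuousAt (hOp.mem_nhds ⟨hyO, hy⟩)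
      have hz : ∀ᶠ z in 𝓝 y, w z = 0 := by
        by_cases hyΩ : y ∈ Ω
        · filter_upwards [(UB_open hΩ).mem_nhds ⟨hyΩ, hyO⟩] with z hz
          exact indicator_of_notMem hz.2 _
        by_cases hyf : y ∈ frontier Ω
        · have h1 := hh.2.2.2 y hyf (ε/2) (by positivity)
          rw [eventually_nhdsWithin_iff] at h1
          have h2 : ∀ᶠ z in 𝓝 y, Phi n p z < Phi n p y + ε/2 :=
            (Phi_contDiffAt n hy).continuousAt.eventually (gt_mem_nhds (by linarith))
          filter_upwards [h1, h2] with z hz1 hz2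
          by_cases hzO : z ∈ OSet Ω
          · rw [hw, indicator_of_mem hzO]
            have := hz1 hzO.1
            exact min_eq_right (by linarith)
          · exact indicator_of_notMem hzO _
        · have : y ∉ closure Ω := fun h => hyf (by rw [hΩ.frontier_eq]; exact ⟨h, hyΩ⟩)
          filter_upwards [isClosed_closure.isOpen_compl.mem_nhds this] with z hz
          exact indicator_of_notMem (fun h => hz (subset_closure h.1)) _
      have hy0 : w y = 0 := hz.self_of_nhds
      rw [ContinuousAt, hy0]
      exact tendsto_const_nhds.congr' (hz.mono fun z hz => hz.symm)
    have hwl : LSup w {p}ᶜ := by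
      intro y hy
      by_cases hyO : y ∈ OSet Ω
      · have hl : LSup (fun y => min (h y + ε - Phi n p y) 0) (OSet Ω \ {p}) := by
          refine LSup.min' hOp ?_ (lsup_const 0 _) hcb continuousOn_const
          refine LSup.sub_har hOp ?_ ((hh.1.mono fun y hy => hy.1.1).add continuousOn_const)
            ((Phi_har n p).mono fun y hy => hy.2)
          exact (hh.2.1.mono fun y hy => hy.1.1).add hOp (lsup_const ε _) (hh.1.mono fun y hy => hy.1.1) continuousOn_const
        obtain ⟨ρ, hρ, h1⟩ := hl y ⟨hyO, hy⟩
        obtain ⟨ρ', hρ', h2⟩ := Metric.isOpen_iff.1 (OSet_open hΩ) y hyO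
        refine ⟨min ρ ρ', by positivity, fun s hs hlt => ?_⟩
        rw [lt_min_iff] at hlt
        have h3 := h1 s hs hlt.1
        unfold MeanLE at *
        rw [hw, indicator_of_mem hyO]
        refine le_trans (le_of_eq (setIntegral_congr_fun measurableSet_ball fun z hz => ?_)) h3
        exact indicator_of_mem (h2 (ball_subset_ball hlt.2.le hz)) _
      · refine ⟨1, one_pos, fun s hs _ => ?_⟩
        unfold MeanLE
        have : w y = 0 := indicator_of_notMem hyO _
        rw [this, mul_zero]
        exact integral_nonpos fun z => hw0 z
    have hm := glob hs (hwc.mono hsub) (hwl.mono (ball_subset_closedBall.trans hsub))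
    unfold MeanLE at hm
    have hle : ∀ y ∈ ball x s, -gO n Ω p y ≤ w y := by
      intro y hy
      by_cases hyO : y ∈ OSet Ω
      · have h1 : gO n Ω p y = greenFn n Ω p y :=
          indicator_of_mem (show y ∈ OSet Ω \ {p} from ⟨hyO, hsub (ball_subset_closedBall hy)⟩) _
        have h2 : perron Ω (Phi n p) y ≤ h y :=
          perron_le hΩ (fun ξ _ => Phi_nonneg n p ξ) (fun ξ hξ => (hbd ξ hξ).2) hyO hh
        have h3 := gO_nonneg hn hΩ hp y
        rw [hw, indicator_of_mem hyO]
        refine le_min ?_ (by linarith)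
        rw [h1, green_eq]; linarith
      · have h3 := gO_nonneg hn hΩ hp y
        have : w y = 0 := indicator_of_notMem hyO _
        rw [this]; linarith
    have h4 : ∫ y in ball x s, -gO n Ω p y ≤ ∫ y in ball x s, w y :=
      setIntegral_mono_on hgin.neg (intBall_of_cont (hwc.mono hsub)) measurableSet_ball hle
    rw [integral_neg] at h4
    have h5 : w x ≤ h x + ε - Phi n p x := by
      rw [hw, indicator_of_mem hxO]; exact min_le_left _ _
    have h6 := mul_le_mul_of_nonneg_left h5 (show 0 ≤ s^(n+1) * vB (n+1) by positivity)
    linarith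
  have hV : 0 < s^(n+1) * vB (n+1) := by positivity
  have hgx : gO n Ω p x = greenFn n Ω p x := indicator_of_mem (show x ∈ OSet Ω \ {p} from ⟨hxO, hxp⟩) _
  rw [← le_div_iff₀' hV]
  refine le_of_forall_pos_sub_le fun ε hε => ?_
  have hlt : perron Ω (Phi n p) x < perron Ω (Phi n p) x + ε/2 := by linarith
  obtain ⟨h, hh, hlt⟩ := perron_lt hΩ (fun ξ hξ => (hbd ξ hξ).2) hlt
  have := key h hh (ε/2) (by positivity)
  rw [← le_div_iff₀' hV] at this
  rw [hgx, green_eq]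
  linarith

theorem gO_sq_int {n : ℕ} (hn : 1 ≤ n) {Ω : Set (Euc (n+1))} (hΩ : IsOpen Ω) {p : Euc (n+1)} (hp : p ∈ Ω)
    {x : Euc (n+1)} {s : ℝ} (hps : p ∉ closedBall x s) : IntegrableOn (fun y => gO n Ω p y ^ 2) (ball x s) := by
  have hsub : closedBall x s ⊆ {p}ᶜ := fun y hy h => hps (mem_singleton_iff.1 h ▸ hy)
  refine Integrable.mono' (intBall_of_cont (((Phi_har n p).1.mono hsub).pow 2)) ((gO_meas hn hΩ hp).restrict.pow 2) ?_
  refine Eventually.of_forall fun y => ?_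
  have h0 := gO_nonneg hn hΩ hp y
  have := gO_le hn hΩ hp y
  rw [Real.norm_of_nonneg (by positivity)]
  show _ ≤ Phi n p y ^ 2
  gcongr

theorem gO_sq_submean {n : ℕ} (hn : 1 ≤ n) {Ω : Set (Euc (n+1))} (hΩ : IsOpen Ω) {p : Euc (n+1)} (hp : p ∈ Ω)
    {x : Euc (n+1)} {s : ℝ} (hs : 0 < s) (hps : p ∉ closedBall x s) :
    s ^ (n+1) * vB (n+1) * gO n Ω p x ^ 2 ≤ ∫ y in ball x s, gO n Ω p y ^ 2 := by
  have h1 := gO_submean hn hΩ hp hs hps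
  set a := gO n Ω p x with ha
  have ha0 : 0 ≤ a := gO_nonneg hn hΩ hp x
  have hgin := gO_int hn hΩ hp hps
  have h2 : ∫ y in ball x s, (2 * a * gO n Ω p y - a^2) ≤ ∫ y in ball x s, gO n Ω p y ^ 2 := by
    refine setIntegral_mono_on ((hgin.const_mul _).sub (intBall_const _ _ _)) (gO_sq_int hn hΩ hp hps)
      measurableSet_ball fun y _ => ?_
    nlinarith [sq_nonneg (gO n Ω p y - a)]
  rw [integral_sub (hgin.const_mul _) (intBall_const _ _ _), integral_const_mul, setIntegral_const,
    vol_ball' x hs, smul_eq_mul] at h2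
  nlinarith


/-- second moment of the unit ball in direction `a` -/
def qM {d : ℕ} (a : Euc d) : ℝ := ∫ z in ball (0 : Euc d) 1, (inner ℝ a z)^2

theorem qM_eq_of_norm {d : ℕ} {a b : Euc d} (h : ‖a‖ = ‖b‖) : qM a = qM b := by
  have hR := Submodule.reflection_sub h
  set R := (ℝ ∙ (a - b))ᗮ.reflection with hRd
  have mp := R.measurePreserving
  unfold qM
  have h1 := mp.setIntegral_preimage_emb R.toHomeomorph.measurableEmbedding
    (fun z => (inner ℝ b z)^2) (ball (0 : Euc d) 1)
  rw [← h1]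
  have h2 : R ⁻¹' ball (0 : Euc d) 1 = ball 0 1 := by
    ext z; simp
  rw [h2]
  refine integral_congr_ae (Eventually.of_forall fun z => ?_)
  simp only
  rw [← hR, R.inner_map_map]

/-- constant of the second moment -/
def cM (n : ℕ) : ℝ := qM (eB (0 : Fin (n+1)))

theorem qM_eq {n : ℕ} (a : Euc (n+1)) : qM a = cM n * ‖a‖^2 := by
  have h : ‖a‖ = ‖‖a‖ • (eB (0 : Fin (n+1)) : Euc (n+1))‖ := by
    rw [norm_smul, norm_norm, eB, PiLp.norm_single]; simp
  rw [qM_eq_of_norm h]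
  unfold cM qM
  rw [← integral_mul_const]
  refine integral_congr_ae (Eventually.of_forall fun z => ?_)
  simp only [real_inner_smul_left]
  ring

theorem cM_pos (n : ℕ) : 0 < cM n := by
  unfold cM qM
  have hc : Continuous fun z : Euc (n+1) => (inner ℝ (eB (0 : Fin (n+1)) : Euc (n+1)) z)^2 := by
    fun_prop
  rw [setIntegral_pos_iff_support_of_nonneg_ae (Eventually.of_forall fun y => by positivity)
    (intBall_of_cont hc.continuousOn)]
  have ho : IsOpen (Function.support (fun z : Euc (n+1) =>
      (inner ℝ (eB (0 : Fin (n+1)) : Euc (n+1)) z)^2) ∩ ball 0 1) :=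
    (hc.isOpen_support).inter isOpen_ball
  refine ho.measure_pos volume ⟨(1/2 : ℝ) • eB 0, ?_, ?_⟩
  · simp [eB, real_inner_smul_right]
  · simp [eB, norm_smul]; norm_num

theorem int_inner_mul {n : ℕ} (a b : Euc (n+1)) :
    ∫ z in ball (0 : Euc (n+1)) 1, inner ℝ a z * inner ℝ b z = cM n * inner ℝ a b := by
  have h1 : ∀ z : Euc (n+1), inner ℝ a z * inner ℝ b z =
      ((inner ℝ (a+b) z)^2 - (inner ℝ (a-b) z)^2) / 4 := by
    intro z; rw [inner_add_left, inner_sub_left]; ring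
  simp_rw [h1]
  rw [integral_div, integral_sub]
  · have e1 := qM_eq (a+b)
    have e2 := qM_eq (a-b)
    unfold qM at e1 e2
    rw [e1, e2, norm_add_sq_real, norm_sub_sq_real]; ring
  · apply intBall_of_cont; fun_prop
  · apply intBall_of_cont; fun_prop

theorem cc_bound {d : ℕ} {f : Euc d → ℝ} (hf : ContDiff ℝ 1 f) (hc : HasCompactSupport f) :
    ∃ C, 0 ≤ C ∧ ∀ x y, |f x - f y| ≤ C * ‖x - y‖ := by
  obtain ⟨C, hC⟩ := hf.lipschitzWith_of_hasCompactSupport hc (by norm_num)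
  exact ⟨C, C.2, fun x y => by simpa [Real.dist_eq, dist_eq_norm] using hC.dist_le_mul x y⟩

/-- limit of symmetric finite differences -/
theorem fd_limit {n : ℕ} {f g : Euc (n+1) → ℝ} (hf : ContDiff ℝ 1 f) (hfc : HasCompactSupport f)
    (hg : ContDiff ℝ 1 g) (hgc : HasCompactSupport g) :
    Tendsto (fun k : ℕ => ∫ z in ball (0 : Euc (n+1)) 1, ∫ x : Euc (n+1),
      ((k:ℝ)+1) * (f (x + (1/((k:ℝ)+1)) • z) - f x) *
        (((k:ℝ)+1) * (g (x + (1/((k:ℝ)+1)) • z) - g x))) atTop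
      (𝓝 (cM n * ∫ x, inner ℝ (gradient f x) (gradient g x))) := by
  obtain ⟨Cf, hCf, hLf⟩ := cc_bound hf hfc
  obtain ⟨Cg, hCg, hLg⟩ := cc_bound hg hgc
  set K := cthickening 1 (tsupport f) with hK
  have hKc : IsCompact K := hfc.isCompact.cthickening
  set ν := (volume.restrict (ball (0 : Euc (n+1)) 1)).prod (volume : Measure (Euc (n+1))) with hν
  have hfc' := hf.continuous
  have hgc' := hg.continuous
  have hdf : ∀ x z, fderiv ℝ f x z = inner ℝ (gradient f x) z := by
    intro x z; rw [gradient, InnerProductSpace.toDual_symm_apply]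
  have hdg : ∀ x z, fderiv ℝ g x z = inner ℝ (gradient g x) z := by
    intro x z; rw [gradient, InnerProductSpace.toDual_symm_apply]
  have hcf' := hf.continuous_fderiv (by norm_num)
  have hcg' := hg.continuous_fderiv (by norm_num)
  -- bound
  have hbd : Integrable (fun w : Euc (n+1) × Euc (n+1) =>
      K.indicator (fun _ => Cf * Cg) w.2) ν := by
    have hin : Integrable (K.indicator (fun _ : Euc (n+1) => Cf * Cg)) volume := by
      rw [integrable_indicator_iff hKc.measurableSet]
      exact integrableOn_const hKc.measure_lt_top.ne
    have : IsFiniteMeasure (volume.restrict (ball (0 : Euc (n+1)) 1)) :=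
      ⟨by simpa using measure_ball_lt_top⟩
    have h2 := (integrable_const (μ := volume.restrict (ball (0 : Euc (n+1)) 1)) (1:ℝ)).mul_prod hin
    simpa using h2
  have hzb : ∀ᵐ w ∂ν, w.1 ∈ ball (0 : Euc (n+1)) 1 := by
    have : ∀ᵐ z ∂(volume.restrict (ball (0 : Euc (n+1)) 1)), z ∈ ball (0 : Euc (n+1)) 1 :=
      ae_restrict_mem measurableSet_ball
    exact Measure.quasiMeasurePreserving_fst.ae this
  have hmeas : ∀ k : ℕ, AEStronglyMeasurable (fun w : Euc (n+1) × Euc (n+1) =>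
      ((k:ℝ)+1) * (f (w.2 + (1/((k:ℝ)+1)) • w.1) - f w.2) *
        (((k:ℝ)+1) * (g (w.2 + (1/((k:ℝ)+1)) • w.1) - g w.2))) ν := fun k =>
    Continuous.aestronglyMeasurable (by fun_prop)
  have hle : ∀ k : ℕ, ∀ᵐ w ∂ν, ‖((k:ℝ)+1) * (f (w.2 + (1/((k:ℝ)+1)) • w.1) - f w.2) *
        (((k:ℝ)+1) * (g (w.2 + (1/((k:ℝ)+1)) • w.1) - g w.2))‖ ≤
      K.indicator (fun _ => Cf * Cg) w.2 := by
    intro k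
    filter_upwards [hzb] with w hw
    have hk : (0:ℝ) < (k:ℝ)+1 := by positivity
    have hw1 : ‖w.1‖ ≤ 1 := by simpa using (mem_ball_zero_iff.1 hw).le
    have key : ∀ (F : Euc (n+1) → ℝ) (C : ℝ), 0 ≤ C → (∀ x y, |F x - F y| ≤ C * ‖x - y‖) →
        |((k:ℝ)+1) * (F (w.2 + (1/((k:ℝ)+1)) • w.1) - F w.2)| ≤ C := by
      intro F C hC hL
      rw [abs_mul, abs_of_pos hk]
      have := hL (w.2 + (1/((k:ℝ)+1)) • w.1) w.2
      rw [add_sub_cancel_left, norm_smul, Real.norm_of_nonneg (by positivity)] at this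
      calc _ ≤ ((k:ℝ)+1) * (C * (1/((k:ℝ)+1) * ‖w.1‖)) := by gcongr
        _ = C * ‖w.1‖ := by field_simp
        _ ≤ C * 1 := by gcongr
        _ = C := mul_one C
    by_cases hx : w.2 ∈ K
    · rw [indicator_of_mem hx, norm_mul, Real.norm_eq_abs, Real.norm_eq_abs]
      have h1 := key f Cf hCf hLf
      have h2 := key g Cg hCg hLg
      gcongr
    · rw [indicator_of_notMem hx]
      have h1 : f w.2 = 0 := by
        by_contra h
        exact hx (self_subset_cthickening _ (subset_tsupport f h))
      have h2 : f (w.2 + (1/((k:ℝ)+1)) • w.1) = 0 := by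
        by_contra h
        apply hx
        refine mem_cthickening_of_dist_le _ _ _ _ (subset_tsupport f h) ?_
        rw [dist_eq_norm, sub_add_cancel_left, norm_neg, norm_smul,
          Real.norm_of_nonneg (by positivity)]
        have : 1/((k:ℝ)+1) ≤ 1 := by rw [div_le_one hk]; linarith [(Nat.cast_nonneg k : (0:ℝ) ≤ k)]
        nlinarith [norm_nonneg w.1]
      rw [h1, h2]; simp
  have hlim : ∀ᵐ w ∂ν, Tendsto (fun k : ℕ => ((k:ℝ)+1) * (f (w.2 + (1/((k:ℝ)+1)) • w.1) - f w.2) *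
        (((k:ℝ)+1) * (g (w.2 + (1/((k:ℝ)+1)) • w.1) - g w.2))) atTop
        (𝓝 (inner ℝ (gradient f w.2) w.1 * inner ℝ (gradient g w.2) w.1)) := by
    refine Eventually.of_forall fun w => ?_
    have key : ∀ F : Euc (n+1) → ℝ, ContDiff ℝ 1 F → Tendsto (fun k : ℕ =>
        ((k:ℝ)+1) * (F (w.2 + (1/((k:ℝ)+1)) • w.1) - F w.2)) atTop (𝓝 (fderiv ℝ F w.2 w.1)) := by
      intro F hF
      have h1 : HasLineDerivAt ℝ F (fderiv ℝ F w.2 w.1) w.2 w.1 :=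
        ((hF.differentiable (by norm_num)) w.2).hasFDerivAt.hasLineDerivAt w.1
      have h2 := h1.tendsto_slope_zero_right
      have h3 : Tendsto (fun k : ℕ => 1/((k:ℝ)+1)) atTop (𝓝[>] 0) := by
        rw [tendsto_nhdsWithin_iff]
        exact ⟨tendsto_one_div_add_atTop_nhds_zero_nat, Eventually.of_forall fun k => by
          rw [mem_Ioi]; positivity⟩
      have h4 := h2.comp h3
      refine h4.congr fun k => ?_
      simp
    rw [← hdf, ← hdg]
    exact (key f hf).mul (key g hg)
  have hT := tendsto_integral_of_dominated_convergence _ hmeas hbd hle hlim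
  have hG : Integrable (fun w : Euc (n+1) × Euc (n+1) =>
      inner ℝ (gradient f w.2) w.1 * inner ℝ (gradient g w.2) w.1) ν := by
    refine hbd.mono' ?_ ?_
    · simp_rw [← hdf, ← hdg]
      exact Continuous.aestronglyMeasurable (by fun_prop)
    · filter_upwards [ae_all_iff.2 hle, hlim] with w h1 h2
      exact le_of_tendsto h2.norm (Eventually.of_forall h1)
  have hI : ∀ k : ℕ, Integrable (fun w : Euc (n+1) × Euc (n+1) =>
      ((k:ℝ)+1) * (f (w.2 + (1/((k:ℝ)+1)) • w.1) - f w.2) *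
        (((k:ℝ)+1) * (g (w.2 + (1/((k:ℝ)+1)) • w.1) - g w.2))) ν := fun k =>
    hbd.mono' (hmeas k) (hle k)
  have hval : ∫ w, inner ℝ (gradient f w.2) w.1 * inner ℝ (gradient g w.2) w.1 ∂ν =
      cM n * ∫ x, inner ℝ (gradient f x) (gradient g x) := by
    rw [hν, integral_prod_symm _ hG, ← integral_const_mul]
    refine integral_congr_ae (Eventually.of_forall fun x => ?_)
    exact int_inner_mul (gradient f x) (gradient g x)
  rw [hval] at hT
  refine hT.congr fun k => ?_
  rw [hν, integral_prod _ (hI k)]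

theorem cutoff_ext {d : ℕ} {u : Euc d → ℝ} {U K : Set (Euc d)} (hU : IsOpen U)
    (hu : ContDiffOn ℝ 1 u U) (hK : IsCompact K) (hKU : K ⊆ U) :
    ∃ v : Euc d → ℝ, ContDiff ℝ 1 v ∧ HasCompactSupport v ∧
      ∃ s > 0, cthickening s K ⊆ U ∧ ∀ x ∈ cthickening s K, v x = u x := by
  obtain ⟨ε, hε, hεU⟩ := hK.exists_cthickening_subset_open hU hKU
  obtain ⟨f, hf0, hf1, hf⟩ := exists_contMDiffMap_zero_one_of_isClosed (n := 1)
    (modelWithCornersSelf ℝ (Euc d)) (isOpen_thickening (δ := 2*ε/3) (E := K)).isClosed_compl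
    (isClosed_cthickening (δ := ε/3) (E := K)) (by
      rw [disjoint_compl_left_iff_subset]
      exact cthickening_subset_thickening' (by positivity) (by linarith) K)
  have hfc : ContDiff ℝ 1 f := f.contMDiff.contDiff
  have hz : ∀ x, x ∉ cthickening (2*ε/3) K → f x = 0 := fun x hx =>
    hf0 (fun h => hx (thickening_subset_cthickening _ _ h))
  have hsub : cthickening (2*ε/3) K ⊆ U :=
    (cthickening_mono (by linarith) K).trans hεU
  refine ⟨fun x => f x * u x, ?_, ?_, ε/3, by positivity,
    (cthickening_mono (by linarith) K).trans hεU, fun x hx => ?_⟩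
  · rw [contDiff_iff_contDiffAt]
    intro x
    by_cases hx : x ∈ U
    · exact hfc.contDiffAt.mul (hu.contDiffAt (hU.mem_nhds hx))
    · have h1 : x ∈ (cthickening (2*ε/3) K)ᶜ := fun h => hx (hsub h)
      have h2 : (fun x => f x * u x) =ᶠ[𝓝 x] fun _ => 0 := by
        filter_upwards [isClosed_cthickening.isOpen_compl.mem_nhds h1] with y hy
        rw [hz y hy, zero_mul]
      exact contDiffAt_const.congr_of_eventuallyEq h2
  · apply HasCompactSupport.intro (hK.cthickening (r := 2*ε/3))
    intro x hx
    rw [hz x hx, zero_mul]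
  · have := hf1 hx
    simp only [Pi.one_apply] at this
    simp [this]

theorem weak_har {n : ℕ} {u ψ : Euc (n+1) → ℝ} {U : Set (Euc (n+1))} (hU : IsOpen U)
    (hu : Har u U) (hψ : ContDiff ℝ 1 ψ) (hc : HasCompactSupport ψ) (hs : tsupport ψ ⊆ U) :
    ∫ x, inner ℝ (gradient ψ x) (gradient u x) = 0 := by
  obtain ⟨v, hv, hvc, s, hs0, hsU, hvu⟩ :=
    cutoff_ext hU (hu.contDiffOn hU) hc.isCompact hs
  have hgr : ∀ x, inner ℝ (gradient ψ x) (gradient u x) =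
      inner ℝ (gradient ψ x) (gradient v x) := by
    intro x
    by_cases hx : x ∈ tsupport ψ
    · have : u =ᶠ[𝓝 x] v := by
        filter_upwards [isOpen_thickening.mem_nhds (self_subset_thickening hs0 _ hx)] with y hy
        exact (hvu y (thickening_subset_cthickening _ _ hy)).symm
      rw [gradient, gradient, gradient, this.fderiv_eq]
    · have : gradient ψ x = 0 := by
        rw [gradient, image_eq_zero_of_notMem_tsupport (f := fderiv ℝ ψ)
          (fun h => hx (tsupport_fderiv_subset ℝ h)), map_zero]
      rw [this, inner_zero_left, inner_zero_left]
  simp_rw [hgr]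
  have hlim := fd_limit hψ hc hv hvc
  have hψc := hψ.continuous
  have hvc' := hv.continuous
  have hzero : ∀ᶠ k : ℕ in atTop, (∫ z in ball (0 : Euc (n+1)) 1, ∫ x : Euc (n+1),
      ((k:ℝ)+1) * (ψ (x + (1/((k:ℝ)+1)) • z) - ψ x) *
        (((k:ℝ)+1) * (v (x + (1/((k:ℝ)+1)) • z) - v x))) = 0 := by
    have h0 : ∀ᶠ k : ℕ in atTop, 1/((k:ℝ)+1) < s :=
      tendsto_one_div_add_atTop_nhds_zero_nat.eventually (gt_mem_nhds hs0)
    filter_upwards [h0] with k hk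
    set t := 1/((k:ℝ)+1) with ht
    have ht0 : 0 < t := by positivity
    have hi : ∀ (f g : Euc (n+1) → ℝ), Continuous f → HasCompactSupport f → Continuous g →
        Integrable (fun x => f x * g x) := fun f g h1 h2 h3 =>
      (h1.mul h3).integrable_of_hasCompactSupport h2.mul_right
    -- G z
    set G : Euc (n+1) → ℝ := fun z => ∫ x, ψ x * (v (x + t • z) - v x) with hG
    have hsym : ∀ z, ∫ x : Euc (n+1), ((k:ℝ)+1) * (ψ (x + t • z) - ψ x) *
        (((k:ℝ)+1) * (v (x + t • z) - v x)) = -((k:ℝ)+1)^2 * (G z + G (-z)) := by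
      intro z
      have e1 : ∫ x, ψ x * (v (x + t • (-z)) - v x) =
          ∫ x, ψ (x + t • z) * (v x - v (x + t • z)) := by
        rw [← integral_add_right_eq_self _ (t • z)]
        refine integral_congr_ae (Eventually.of_forall fun x => ?_)
        simp
      simp only [hG]
      rw [e1, ← integral_add, ← integral_const_mul]
      · refine integral_congr_ae (Eventually.of_forall fun x => ?_)
        simp only; ring
      · exact hi _ _ hψc hc (by fun_prop)
      · refine hi (fun x => ψ (x + t • z)) _ (by fun_prop) ?_ (by fun_prop)
        exact hc.comp_homeomorph (Homeomorph.addRight (t • z))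
    simp_rw [hsym]
    -- integrability of product
    have : IsFiniteMeasure (volume.restrict (ball (0 : Euc (n+1)) 1)) :=
      ⟨by simpa using measure_ball_lt_top⟩
    obtain ⟨M, hM⟩ := hvc'.bounded_above_of_compact_support hvc
    have hprod : Integrable (fun w : Euc (n+1) × Euc (n+1) => ψ w.2 * (v (w.2 + t • w.1) - v w.2))
        ((volume.restrict (ball (0 : Euc (n+1)) 1)).prod volume) := by
      have hb : Integrable (fun w : Euc (n+1) × Euc (n+1) => (2*M) * |ψ w.2|)
          ((volume.restrict (ball (0 : Euc (n+1)) 1)).prod volume) :=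
        (integrable_const (2*M)).mul_prod
          ((hψc.integrable_of_hasCompactSupport hc).abs)
      refine hb.mono' (Continuous.aestronglyMeasurable (by fun_prop))
        (Eventually.of_forall fun w => ?_)
      rw [norm_mul, mul_comm, Real.norm_eq_abs (ψ _)]
      gcongr
      calc _ ≤ ‖v (w.2 + t • w.1)‖ + ‖v w.2‖ := norm_sub_le _ _
        _ ≤ 2 * M := by linarith [hM (w.2 + t • w.1), hM w.2]
    have hGi : IntegrableOn G (ball 0 1) := hprod.integral_prod_left
    have hG0 : ∫ z in ball (0 : Euc (n+1)) 1, G z = 0 := by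
      rw [hG]
      rw [integral_integral_swap hprod]
      rw [integral_eq_zero_of_ae]
      refine Eventually.of_forall fun x => ?_
      simp only [Pi.zero_apply]
      rw [integral_const_mul]
      by_cases hx : x ∈ tsupport ψ
      · have hcb : closedBall x t ⊆ cthickening s (tsupport ψ) :=
          (closedBall_subset_cthickening hx t).trans (cthickening_mono hk.le _)
        have hm := hu.2 x (hs hx) t ht0 (hcb.trans hsU)
        have h2 : ∫ y in ball x t, v y = ∫ y in ball x t, u y :=
          setIntegral_congr_fun measurableSet_ball fun y hy =>
            hvu y (hcb (ball_subset_closedBall hy))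
        rw [← h2, integral_ball_scale _ _ ht0, mul_assoc] at hm
        have h3 := mul_left_cancel₀ (by positivity) hm
        rw [integral_sub, h3, setIntegral_const, ← hvu x (hcb (mem_closedBall_self ht0.le))]
        · rw [vol_ball' 0 one_pos]; simp
        · apply intBall_of_cont; fun_prop
        · exact intBall_const _ _ _
      · rw [image_eq_zero_of_notMem_tsupport hx, zero_mul]
    have hneg : ∫ z in ball (0 : Euc (n+1)) 1, G (-z) = ∫ z in ball (0 : Euc (n+1)) 1, G z := by
      have h1 := (Measure.measurePreserving_neg (volume : Measure (Euc (n+1)))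
        ).setIntegral_preimage_emb (Homeomorph.neg (Euc (n+1))).measurableEmbedding G (ball 0 1)
      rw [← h1]
      congr 2
      ext z; simp
    have hGi' : IntegrableOn (fun z => G (-z)) (ball 0 1) := by
      have h1 := (Measure.measurePreserving_neg (volume : Measure (Euc (n+1)))
        ).integrableOn_comp_preimage (Homeomorph.neg (Euc (n+1))).measurableEmbedding
        (f := G) (s := ball 0 1)
      have h2 := h1.2 hGi
      have h3 : (fun z : Euc (n+1) => -z) ⁻¹' ball 0 1 = ball 0 1 := by ext z; simp
      convert! h2 using 1
      exact h3.symm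
    rw [integral_const_mul, integral_add hGi hGi', hneg, hG0]; simp
  have h1 := tendsto_nhds_unique (tendsto_const_nhds.congr' (hzero.mono fun k hk => hk.symm)) hlim
  rcases mul_eq_zero.1 h1.symm with h | h
  · exact absurd h (cM_pos n).ne'
  · exact h


theorem inner_grad {d : ℕ} (f : Euc d → ℝ) (x z : Euc d) :
    inner ℝ (gradient f x) z = fderiv ℝ f x z := by
  rw [gradient, InnerProductSpace.toDual_symm_apply]

theorem norm_grad {d : ℕ} (f : Euc d → ℝ) (x : Euc d) :
    ‖gradient f x‖ = ‖fderiv ℝ f x‖ := by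
  rw [gradient, LinearIsometryEquiv.norm_map]

theorem grad_contOn {d : ℕ} {f : Euc d → ℝ} {U : Set (Euc d)} (hU : IsOpen U)
    (hf : ContDiffOn ℝ 1 f U) : ContinuousOn (gradient f) U := by
  have := hf.continuousOn_fderiv_of_isOpen hU (by norm_num)
  exact (InnerProductSpace.toDual ℝ (Euc d)).symm.continuous.comp_continuousOn this

theorem grad_cont {d : ℕ} {f : Euc d → ℝ} (hf : ContDiff ℝ 1 f) : Continuous (gradient f) := by
  rw [← continuousOn_univ]
  exact grad_contOn isOpen_univ hf.contDiffOn

theorem tsupport_grad {d : ℕ} (f : Euc d → ℝ) : tsupport (gradient f) ⊆ tsupport f := by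
  refine closure_minimal (fun x hx => ?_) (isClosed_tsupport f)
  by_contra h
  apply hx
  rw [gradient, image_eq_zero_of_notMem_tsupport (f := fderiv ℝ f)
          (fun h' => h (tsupport_fderiv_subset ℝ h')), map_zero]

theorem int_inner_cont {d : ℕ} {X Y : Euc d → Euc d} {V : Set (Euc d)} (hV : IsOpen V)
    (hX : Continuous X) (hXc : HasCompactSupport X) (hY : ContinuousOn Y V) (h : tsupport X ⊆ V) :
    Integrable (fun x => inner ℝ (X x) (Y x)) := by
  apply Continuous.integrable_of_hasCompactSupport
  · rw [continuous_iff_continuousAt]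
    intro x
    by_cases hx : x ∈ tsupport X
    · exact hX.continuousAt.inner (hY.continuousAt (hV.mem_nhds (h hx)))
    · have : (fun x => inner ℝ (X x) (Y x)) =ᶠ[𝓝 x] fun _ => 0 := by
        filter_upwards [(isClosed_tsupport X).isOpen_compl.mem_nhds hx] with y hy
        rw [image_eq_zero_of_notMem_tsupport hy, inner_zero_left]
      exact continuousAt_const.congr this.symm
  · apply HasCompactSupport.intro hXc.isCompact
    intro x hx
    rw [image_eq_zero_of_notMem_tsupport hx, inner_zero_left]

theorem mul_cc {d : ℕ} {ψ u : Euc d → ℝ} {U : Set (Euc d)} (hU : IsOpen U)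
    (hψ : ContDiff ℝ 1 ψ) (hs : tsupport ψ ⊆ U) (hu : ContDiffOn ℝ 1 u U) :
    ContDiff ℝ 1 (fun x => ψ x * u x) ∧ tsupport (fun x => ψ x * u x) ⊆ tsupport ψ := by
  constructor
  · rw [contDiff_iff_contDiffAt]
    intro x
    by_cases hx : x ∈ U
    · exact hψ.contDiffAt.mul (hu.contDiffAt (hU.mem_nhds hx))
    · have h2 : (fun x => ψ x * u x) =ᶠ[𝓝 x] fun _ => 0 := by
        filter_upwards [(isClosed_tsupport ψ).isOpen_compl.mem_nhds (fun h => hx (hs h))] with y hy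
        rw [image_eq_zero_of_notMem_tsupport hy, zero_mul]
      exact contDiffAt_const.congr_of_eventuallyEq h2
  · refine closure_minimal (fun x hx => ?_) (isClosed_tsupport ψ)
    by_contra h
    apply hx
    simp only
    rw [image_eq_zero_of_notMem_tsupport h, zero_mul]

/-- Green's second identity tested against a compactly supported function. -/
theorem green_id {n : ℕ} {u v ψ : Euc (n+1) → ℝ} {U : Set (Euc (n+1))} (hU : IsOpen U)
    (hu : Har u U) (hv : Har v U) (hψ : ContDiff ℝ 1 ψ) (hc : HasCompactSupport ψ)
    (hs : tsupport ψ ⊆ U) :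
    ∫ x, inner ℝ (gradient ψ x) (u x • gradient v x - v x • gradient u x) = 0 := by
  have hu1 := hu.contDiffOn hU
  have hv1 := hv.contDiffOn hU
  obtain ⟨a1, a2⟩ := mul_cc hU hψ hs hu1
  obtain ⟨b1, b2⟩ := mul_cc hU hψ hs hv1
  have ac : HasCompactSupport (fun x => ψ x * u x) := hc.mul_right
  have bc : HasCompactSupport (fun x => ψ x * v x) := hc.mul_right
  have e1 := weak_har hU hv a1 ac (a2.trans hs)
  have e2 := weak_har hU hu b1 bc (b2.trans hs)
  have gc : ∀ f : Euc (n+1) → ℝ, HasCompactSupport f → HasCompactSupport (gradient f) :=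
    fun f hf => hf.isCompact.of_isClosed_subset (isClosed_tsupport _) (tsupport_grad f)
  have i1 := int_inner_cont hU (grad_cont a1) (gc _ ac) (grad_contOn hU hv1)
    ((tsupport_grad _).trans (a2.trans hs))
  have i2 := int_inner_cont hU (grad_cont b1) (gc _ bc) (grad_contOn hU hu1)
    ((tsupport_grad _).trans (b2.trans hs))
  have e3 := integral_sub i1 i2
  rw [e1, e2, sub_zero] at e3
  rw [← e3]
  refine integral_congr_ae (Eventually.of_forall fun x => ?_)
  simp only
  by_cases hx : x ∈ U
  · have du : DifferentiableAt ℝ u x := (hu1.contDiffAt (hU.mem_nhds hx)).differentiableAt (by norm_num)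
    have dv : DifferentiableAt ℝ v x := (hv1.contDiffAt (hU.mem_nhds hx)).differentiableAt (by norm_num)
    have dψ : DifferentiableAt ℝ ψ x := hψ.differentiable (by norm_num) x
    have g1 : fderiv ℝ (fun x => ψ x * u x) x = ψ x • fderiv ℝ u x + u x • fderiv ℝ ψ x :=
      (dψ.hasFDerivAt.mul du.hasFDerivAt).fderiv
    have g2 : fderiv ℝ (fun x => ψ x * v x) x = ψ x • fderiv ℝ v x + v x • fderiv ℝ ψ x :=
      (dψ.hasFDerivAt.mul dv.hasFDerivAt).fderiv
    have g1' : gradient (fun x => ψ x * u x) x = ψ x • gradient u x + u x • gradient ψ x := by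
      rw [gradient, g1, map_add, map_smulₛₗ, map_smulₛₗ]; rfl
    have g2' : gradient (fun x => ψ x * v x) x = ψ x • gradient v x + v x • gradient ψ x := by
      rw [gradient, g2, map_add, map_smulₛₗ, map_smulₛₗ]; rfl
    rw [g1', g2']
    simp only [inner_add_left, inner_sub_right, real_inner_smul_left, real_inner_smul_right]
    rw [real_inner_comm (gradient u x) (gradient v x)]
    ring
  · have z : ∀ f : Euc (n+1) → ℝ, tsupport f ⊆ U → gradient f x = 0 := fun f hf =>
      image_eq_zero_of_notMem_tsupport fun h => hx (hf (tsupport_grad f h))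
    rw [z ψ hs, z _ (a2.trans hs), z _ (b2.trans hs)]
    simp

/-- radial function with profile `K` -/
def radF {d : ℕ} (K : ℝ → ℝ) (q : Euc d) (σ : ℝ) (x : Euc d) : ℝ :=
  -∫ τ in (1:ℝ)..(‖σ⁻¹ • (x - q)‖^2), K τ

theorem radF_hasFDerivAt {d : ℕ} {K : ℝ → ℝ} (hK : Continuous K) (q : Euc d) (σ : ℝ) (x : Euc d) :
    HasFDerivAt (radF K q σ) ((-(2 * K (‖σ⁻¹ • (x - q)‖^2) * σ⁻¹)) •
      innerSL ℝ (σ⁻¹ • (x - q))) x := by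
  have h1 := kernel_hasFDerivAt hK (σ⁻¹ • (x - q))
  have h2 : HasFDerivAt (fun x : Euc d => σ⁻¹ • (x - q))
      (σ⁻¹ • ContinuousLinearMap.id ℝ (Euc d)) x :=
    ((hasFDerivAt_id x).sub_const q).const_smul σ⁻¹
  have h3 : HasFDerivAt (radF K q σ) _ x := (h1.comp x h2).neg
  convert! h3 using 1
  ext z
  simp
  ring

theorem radF_grad {d : ℕ} {K : ℝ → ℝ} (hK : Continuous K) (q : Euc d) (σ : ℝ) (x : Euc d) :
    gradient (radF K q σ) x = (-(2 * K (‖σ⁻¹ • (x - q)‖^2) * σ⁻¹)) • (σ⁻¹ • (x - q)) := by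
  apply ext_inner_right ℝ
  intro z
  rw [inner_grad, (radF_hasFDerivAt hK q σ x).fderiv, real_inner_smul_left]
  rw [_root_.smul_apply, innerSL_apply_apply, smul_eq_mul]

theorem radF_contDiff {d : ℕ} {K : ℝ → ℝ} (hK : Continuous K) (q : Euc d) (σ : ℝ) :
    ContDiff ℝ 1 (radF K q σ) := by
  rw [contDiff_one_iff_fderiv]
  refine ⟨fun x => (radF_hasFDerivAt hK q σ x).differentiableAt, ?_⟩
  have : fderiv ℝ (radF K q σ) = fun x => (-(2 * K (‖σ⁻¹ • (x - q)‖^2) * σ⁻¹)) •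
      innerSL ℝ (σ⁻¹ • (x - q)) := funext fun x => (radF_hasFDerivAt hK q σ x).fderiv
  rw [this]
  fun_prop

theorem radF_zero {d : ℕ} {K : ℝ → ℝ} (hK1 : ∀ s, 1 ≤ s → K s = 0) {q : Euc d} {σ : ℝ}
    (hσ : 0 < σ) {x : Euc d} (hx : σ ≤ ‖x - q‖) : radF K q σ x = 0 := by
  unfold radF
  have h1 : 1 ≤ ‖σ⁻¹ • (x - q)‖^2 := by
    rw [norm_smul, norm_inv, Real.norm_of_nonneg hσ.le, ← div_eq_inv_mul]
    exact one_le_pow₀ ((one_le_div hσ).2 hx)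
  rw [intervalIntegral.integral_congr (g := fun _ => (0:ℝ))]
  · simp
  · intro τ hτ
    rw [uIcc_of_le h1] at hτ
    exact hK1 τ hτ.1

theorem radF_tsupport {d : ℕ} {K : ℝ → ℝ} (hK1 : ∀ s, 1 ≤ s → K s = 0) (q : Euc d) {σ : ℝ}
    (hσ : 0 < σ) : tsupport (radF K q σ) ⊆ closedBall q σ := by
  refine closure_minimal (fun x hx => ?_) isClosed_closedBall
  by_contra h
  rw [mem_closedBall, dist_eq_norm, not_le] at h
  exact hx (radF_zero hK1 hσ h.le)

theorem radF_const {d : ℕ} {K : ℝ → ℝ} (hK : Continuous K) (hK0 : ∀ s, s ≤ 1/4 → K s = 0)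
    {q : Euc d} {σ : ℝ}
    (hσ : 0 < σ) {x : Euc d} (hx : ‖x - q‖ ≤ σ/2) : radF K q σ x = ∫ τ in (1/4:ℝ)..1, K τ := by
  unfold radF
  have h1 : ‖σ⁻¹ • (x - q)‖^2 ≤ 1/4 := by
    rw [norm_smul, norm_inv, Real.norm_of_nonneg hσ.le, ← div_eq_inv_mul]
    have : ‖x - q‖ / σ ≤ 1/2 := by rw [div_le_iff₀ hσ]; linarith
    calc _ ≤ (1/2:ℝ)^2 := by gcongr
      _ = _ := by norm_num
  rw [← intervalIntegral.integral_symm,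
    ← intervalIntegral.integral_add_adjacent_intervals (b := 1/4)
      (hK.intervalIntegrable _ _) (hK.intervalIntegrable _ _),
    intervalIntegral.integral_congr (a := ‖σ⁻¹ • (x - q)‖^2) (b := 1/4) (g := fun _ => (0:ℝ))]
  · simp
  · intro τ hτ
    rw [uIcc_of_le h1] at hτ
    exact hK0 τ hτ.2


theorem int_norm_cont {d : ℕ} {X Y : Euc d → Euc d} {V : Set (Euc d)} (hV : IsOpen V)
    (hX : Continuous X) (hXc : HasCompactSupport X) (hY : ContinuousOn Y V) (h : tsupport X ⊆ V) :
    Integrable (fun x => ‖X x‖ * ‖Y x‖) := by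
  apply Continuous.integrable_of_hasCompactSupport
  · rw [continuous_iff_continuousAt]
    intro x
    by_cases hx : x ∈ tsupport X
    · exact hX.continuousAt.norm.mul (hY.continuousAt (hV.mem_nhds (h hx))).norm
    · have : (fun x => ‖X x‖ * ‖Y x‖) =ᶠ[𝓝 x] fun _ => 0 := by
        filter_upwards [(isClosed_tsupport X).isOpen_compl.mem_nhds hx] with y hy
        rw [image_eq_zero_of_notMem_tsupport hy, norm_zero, zero_mul]
      exact continuousAt_const.congr this.symm
  · apply HasCompactSupport.intro hXc.isCompact
    intro x hx
    rw [image_eq_zero_of_notMem_tsupport hx, norm_zero, zero_mul]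

/-- basic profile -/
def K0 (τ : ℝ) : ℝ := max 0 (min (τ - 1/4) (1 - τ))

theorem K0_cont : Continuous K0 := by unfold K0; fun_prop

theorem K0_nonneg (τ : ℝ) : 0 ≤ K0 τ := le_max_left _ _

theorem K0_one {s : ℝ} (h : 1 ≤ s) : K0 s = 0 := by
  unfold K0; rw [max_eq_left]; exact (min_le_right _ _).trans (by linarith)

theorem K0_quarter {s : ℝ} (h : s ≤ 1/4) : K0 s = 0 := by
  unfold K0; rw [max_eq_left]; exact (min_le_left _ _).trans (by linarith)

/-- weighted profile -/
def K1 (n : ℕ) (τ : ℝ) : ℝ := K0 τ * (Real.sqrt τ)^(n-1)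

theorem K1_cont (n : ℕ) : Continuous (K1 n) := by
  have := K0_cont
  unfold K1; fun_prop

theorem K1_one (n : ℕ) (s : ℝ) (h : 1 ≤ s) : K1 n s = 0 := by unfold K1; rw [K0_one h, zero_mul]

theorem K1_quarter (n : ℕ) (s : ℝ) (h : s ≤ 1/4) : K1 n s = 0 := by
  unfold K1; rw [K0_quarter h, zero_mul]

/-- mass constants -/
def mK (n : ℕ) : ℝ := ∫ τ in (1/4:ℝ)..1, K1 n τ

theorem mK_nonneg (n : ℕ) : 0 ≤ mK n :=
  intervalIntegral.integral_nonneg (by norm_num) fun τ _ =>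
    mul_nonneg (K0_nonneg _) (by positivity)

def kap (n : ℕ) : ℝ := ∫ y in ball (0 : Euc (n+1)) 1, K0 (‖y‖^2)

theorem kap_pos (n : ℕ) : 0 < kap n := by
  unfold kap
  have hc : Continuous fun z : Euc (n+1) => K0 (‖z‖^2) := by
    have := K0_cont
    fun_prop
  rw [setIntegral_pos_iff_support_of_nonneg_ae (Eventually.of_forall fun y => K0_nonneg _)
    (intBall_of_cont hc.continuousOn)]
  refine ((hc.isOpen_support).inter isOpen_ball).measure_pos volume ⟨(3/4 : ℝ) • eB 0, ?_, ?_⟩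
  · simp [eB, norm_smul, K0]; norm_num
  · simp [eB, norm_smul]; norm_num

theorem fderiv_Phi_self (n : ℕ) {q x : Euc (n+1)} (hx : x ≠ q) :
    fderiv ℝ (Phi n q) x (x - q) = (1 - (n:ℝ)) * Phi n q x := by
  have hP : Phi n q = fun y => (‖y - q‖^2)^((1 - (n:ℝ))/2) := by ext y; exact Phi_rpow n q y
  have h := fderiv_sqpow q ((1 - (n:ℝ))/2) hx (0 : Fin (n+1))
  rw [← hP] at h
  rw [h.fderiv, Phi_rpow]
  have h0 : 0 < ‖x - q‖^2 := by
    have : 0 < ‖x - q‖ := norm_pos_iff.2 (sub_ne_zero.2 hx)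
    positivity
  rw [Real.rpow_sub_one h0.ne']
  simp only [_root_.smul_apply, innerSL_apply_apply, smul_eq_mul, nsmul_eq_mul,
    real_inner_self_eq_norm_sq]
  have hne : ‖x - q‖ ≠ 0 := norm_ne_zero_iff.2 (sub_ne_zero.2 hx)
  push_cast
  field_simp

theorem K1_Phi {n : ℕ} (hn : 1 ≤ n) {q x : Euc (n+1)} {σ : ℝ} (hσ : 0 < σ) (hx : x ≠ q) :
    K1 n (‖σ⁻¹ • (x - q)‖^2) * Phi n q x = K0 (‖σ⁻¹ • (x - q)‖^2) * (σ⁻¹)^(n-1) := by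
  obtain ⟨m, rfl⟩ := Nat.exists_eq_add_of_le hn
  have h0 : 0 < ‖x - q‖ := norm_pos_iff.2 (sub_ne_zero.2 hx)
  unfold K1 Phi
  rw [Real.sqrt_sq (norm_nonneg _), norm_smul, norm_inv, Real.norm_of_nonneg hσ.le,
    show (1:ℤ) - ((1 + m : ℕ) : ℤ) = -(m:ℤ) by push_cast; ring, zpow_neg, zpow_natCast,
    Nat.add_sub_cancel_left, mul_pow]
  have h2 : ‖x - q‖^m * (‖x - q‖^m)⁻¹ = 1 := mul_inv_cancel₀ (pow_ne_zero _ h0.ne')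
  generalize K0 _ = k
  linear_combination (k * (σ⁻¹)^m) * h2

/-- flux constant -/
def cF (n : ℕ) : ℝ := mK n * 2^(n+1) / (2 * ((n:ℝ) - 1) * kap n)

theorem flux {n : ℕ} (hn : 2 ≤ n) {U : Set (Euc (n+1))} (hU : IsOpen U) {u P φ : Euc (n+1) → ℝ}
    (hu : Har u U) (hpos : ∀ x ∈ U, 0 ≤ u x) (hP : Har P U) {q : Euc (n+1)} {ρ : ℝ} (hρ : 0 < ρ)
    (hb : ball q ρ ⊆ U) (hφ : ContDiff ℝ 1 φ) (hc : HasCompactSupport φ) (hs : tsupport φ ⊆ U)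
    (h1 : ∀ x ∈ ball q ρ, φ x = 1) :
    u q ≤ cF n * ∫ x, ‖gradient φ x‖ *
      ‖u x • gradient (fun y => Phi n q y - P y) x - (Phi n q x - P x) • gradient u x‖ := by
  set w : Euc (n+1) → ℝ := fun y => Phi n q y - P y with hw
  set σ := ρ / 4 with hσ
  have hσ0 : 0 < σ := by positivity
  set f0 := radF (K1 n) q σ with hf0
  set G := radF K0 q σ with hGd
  have hf0c : ContDiff ℝ 1 f0 := radF_contDiff (K1_cont n) q σ
  have hGc : ContDiff ℝ 1 G := radF_contDiff K0_cont q σ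
  have hcb : closedBall q σ ⊆ U := (closedBall_subset_ball (by linarith)).trans hb
  have hf0t : tsupport f0 ⊆ closedBall q σ := radF_tsupport (K1_one n) q hσ0
  have hGt : tsupport G ⊆ closedBall q σ := radF_tsupport (fun s => K0_one) q hσ0
  have hf0s : HasCompactSupport f0 :=
    (isCompact_closedBall q σ).of_isClosed_subset (isClosed_tsupport _) hf0t
  have hGs : HasCompactSupport G :=
    (isCompact_closedBall q σ).of_isClosed_subset (isClosed_tsupport _) hGt
  set U' := U \ {q} with hU'
  have hU'o : IsOpen U' := hU.sdiff isClosed_singleton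
  have hu' : Har u U' := hu.mono sdiff_subset
  have hwH : Har w U' := ((Phi_har n q).mono (fun x hx => hx.2)).sub (hP.mono sdiff_subset)
  have hqU : q ∈ U := hb (mem_ball_self hρ)
  set J : Euc (n+1) → Euc (n+1) := fun x => u x • gradient w x - w x • gradient u x with hJ
  have hu1 := hu.contDiffOn hU
  have hP1 := hP.contDiffOn hU
  have hw1 := hwH.contDiffOn hU'o
  have hJc : ContinuousOn J U' :=
    (hu'.1.smul (grad_contOn hU'o hw1)).sub (hwH.1.smul (grad_contOn hU'o (hu'.contDiffOn hU'o)))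
  -- difference
  set ψ : Euc (n+1) → ℝ := fun x => mK n * φ x - f0 x with hψ
  have hψc : ContDiff ℝ 1 ψ := (contDiff_const.mul hφ).sub hf0c
  have hψ0 : ∀ x ∈ ball q (σ/2), ψ x = 0 := by
    intro x hx
    rw [mem_ball, dist_eq_norm] at hx
    have e1 : f0 x = mK n := radF_const (K1_cont n) (K1_quarter n) hσ0 hx.le
    have e2 : φ x = 1 := h1 x (by rw [mem_ball, dist_eq_norm]; linarith)
    simp [hψ, e1, e2]
  have hψt : tsupport ψ ⊆ tsupport φ ∪ tsupport f0 := by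
    refine closure_minimal (fun x hx => ?_) ((isClosed_tsupport _).union (isClosed_tsupport _))
    by_contra h
    rw [mem_union, not_or] at h
    apply hx
    simp [hψ, image_eq_zero_of_notMem_tsupport h.1, image_eq_zero_of_notMem_tsupport h.2]
  have nq : ∀ (F : Euc (n+1) → ℝ), (∀ x ∈ ball q (σ/2), F x = 0) → q ∉ tsupport F := by
    intro F hF h
    refine (notMem_tsupport_iff_eventuallyEq.2 ?_) h
    filter_upwards [ball_mem_nhds q (half_pos hσ0)] with y hy using hF y hy
  have hψU : tsupport ψ ⊆ U' := by
    intro x hx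
    refine ⟨(hψt hx).elim (fun h => hs h) (fun h => hcb (hf0t h)), fun h => ?_⟩
    rw [mem_singleton_iff] at h
    exact nq ψ hψ0 (h ▸ hx)
  have hψs : HasCompactSupport ψ :=
    (hc.isCompact.union hf0s.isCompact).of_isClosed_subset (isClosed_tsupport _) hψt
  have E1 := green_id hU'o hu' hwH hψc hψs hψU
  -- gradients vanish near q
  have gφ : ∀ x ∈ ball q (σ/2), gradient φ x = 0 := by
    intro x hx
    have : φ =ᶠ[𝓝 x] fun _ => 1 := by
      filter_upwards [isOpen_ball.mem_nhds hx] with y hy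
      exact h1 y (ball_subset_ball (by linarith) hy)
    rw [gradient, this.fderiv_eq]; simp
  have gf0 : ∀ x ∈ ball q (σ/2), gradient f0 x = 0 := by
    intro x hx
    have : f0 =ᶠ[𝓝 x] fun _ => mK n := by
      filter_upwards [isOpen_ball.mem_nhds hx] with y hy
      rw [mem_ball, dist_eq_norm] at hy
      exact radF_const (K1_cont n) (K1_quarter n) hσ0 hy.le
    rw [gradient, this.fderiv_eq]; simp
  have nqg : ∀ (F : Euc (n+1) → Euc (n+1)), (∀ x ∈ ball q (σ/2), F x = 0) → q ∉ tsupport F := by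
    intro F hF h
    refine (notMem_tsupport_iff_eventuallyEq.2 ?_) h
    filter_upwards [ball_mem_nhds q (half_pos hσ0)] with y hy using hF y hy
  have gc : ∀ f : Euc (n+1) → ℝ, HasCompactSupport f → HasCompactSupport (gradient f) :=
    fun f hf => hf.isCompact.of_isClosed_subset (isClosed_tsupport _) (tsupport_grad f)
  have gU : ∀ f : Euc (n+1) → ℝ, tsupport f ⊆ U → (∀ x ∈ ball q (σ/2), gradient f x = 0) →
      tsupport (gradient f) ⊆ U' := by
    intro f hf h0 x hx
    refine ⟨hf (tsupport_grad f hx), fun h => ?_⟩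
    rw [mem_singleton_iff] at h
    exact nqg _ h0 (h ▸ hx)
  have iφ := int_inner_cont hU'o (grad_cont hφ) (gc _ hc) hJc (gU _ hs gφ)
  have if0 := int_inner_cont hU'o (grad_cont hf0c) (gc _ hf0s) hJc (gU _ (hf0t.trans hcb) gf0)
  have E2 : mK n * ∫ x, inner ℝ (gradient φ x) (J x) = ∫ x, inner ℝ (gradient f0 x) (J x) := by
    have : ∫ x, (mK n * inner ℝ (gradient φ x) (J x) - inner ℝ (gradient f0 x) (J x)) = 0 := by
      rw [← E1]
      refine integral_congr_ae (Eventually.of_forall fun x => ?_)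
      have dφ : DifferentiableAt ℝ φ x := hφ.differentiable (by norm_num) x
      have df : DifferentiableAt ℝ f0 x := hf0c.differentiable (by norm_num) x
      have g1 : fderiv ℝ ψ x = mK n • fderiv ℝ φ x - fderiv ℝ f0 x :=
        ((dφ.hasFDerivAt.const_mul (mK n)).sub df.hasFDerivAt).fderiv
      have g2 : gradient ψ x = mK n • gradient φ x - gradient f0 x := by
        rw [gradient, g1, map_sub, map_smulₛₗ]; rfl
      simp only
      rw [g2, inner_sub_left, real_inner_smul_left]
    rw [integral_sub (iφ.const_mul _) if0, integral_const_mul] at this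
    linarith
  -- evaluation of the radial flux
  have E3 := green_id hU hu hP hf0c hf0s (hf0t.trans hcb)
  have E4 := weak_har hU hu hGc hGs (hGt.trans hcb)
  have i3 : Integrable (fun x => inner ℝ (gradient f0 x)
      (u x • gradient P x - P x • gradient u x)) := int_inner_cont hU (grad_cont hf0c) (gc _ hf0s)
    ((hu.1.smul (grad_contOn hU hP1)).sub (hP.1.smul (grad_contOn hU hu1)))
    ((tsupport_grad _).trans (hf0t.trans hcb))
  have i4 := int_inner_cont hU (grad_cont hGc) (gc _ hGs) (grad_contOn hU hu1)
    ((tsupport_grad _).trans (hGt.trans hcb))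
  set k : Euc (n+1) → ℝ := fun x => K0 (‖σ⁻¹ • (x - q)‖^2) with hk
  have hkz : ∀ x, x ∉ closedBall q σ → k x = 0 := by
    intro x hx
    rw [mem_closedBall, dist_eq_norm, not_le] at hx
    apply K0_one
    rw [norm_smul, norm_inv, Real.norm_of_nonneg hσ0.le, ← div_eq_inv_mul]
    exact one_le_pow₀ ((one_le_div hσ0).2 hx.le)
  have E5 : ∫ x, inner ℝ (gradient f0 x) (J x) =
      ∫ x, (2 * ((n:ℝ) - 1) * (σ⁻¹)^(n+1)) * (k x * u x) := by
    have : ∫ x, inner ℝ (gradient f0 x) (J x) = ∫ x, (inner ℝ (gradient f0 x) (J x) +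
        inner ℝ (gradient f0 x) (u x • gradient P x - P x • gradient u x) +
        (σ⁻¹)^(n-1) * inner ℝ (gradient G x) (gradient u x)) := by
      have hadd : Integrable (fun x => inner ℝ (gradient f0 x) (J x) +
        inner ℝ (gradient f0 x) (u x • gradient P x - P x • gradient u x)) := if0.add i3
      rw [integral_add hadd (i4.const_mul _), integral_add if0 i3, integral_const_mul,
        E3, E4]
      simp
    rw [this]
    refine integral_congr_ae (Eventually.of_forall fun x => ?_)
    simp only
    by_cases hxq : x = q
    · subst hxq
      have a1 : gradient f0 x = 0 := gf0 x (mem_ball_self (half_pos hσ0))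
      have a2 : gradient G x = 0 := by rw [hGd, radF_grad K0_cont]; simp
      have a3 : k x = 0 := by simp [hk, K0]
      rw [a1, a2, a3]; simp
    · by_cases hxU : x ∈ closedBall q σ
      · have dP : DifferentiableAt ℝ P x :=
          (hP1.contDiffAt (hU.mem_nhds (hcb hxU))).differentiableAt (by norm_num)
        have dF : DifferentiableAt ℝ (Phi n q) x := (Phi_contDiffAt n hxq).differentiableAt (by norm_num)
        have gw : gradient w x = gradient (Phi n q) x - gradient P x := by
          have : fderiv ℝ w x = fderiv ℝ (Phi n q) x - fderiv ℝ P x :=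
            (dF.hasFDerivAt.sub dP.hasFDerivAt).fderiv
          rw [gradient, this, map_sub]; rfl
        have e1 : inner ℝ (x - q) (gradient (Phi n q) x) = (1 - (n:ℝ)) * Phi n q x := by
          rw [real_inner_comm, inner_grad, fderiv_Phi_self n hxq]
        have e2 := K1_Phi (by omega : 1 ≤ n) (q := q) (x := x) hσ0 hxq
        have e3 : (σ⁻¹)^(n+1) = σ⁻¹ * σ⁻¹ * (σ⁻¹)^(n-1) := by
          rw [show n + 1 = 2 + (n-1) by omega, pow_add]; ring
        simp only [hJ, gw]
        rw [hf0, hGd, radF_grad (K1_cont n), radF_grad K0_cont]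
        simp only [real_inner_smul_left, inner_sub_right, real_inner_smul_right, e1]
        simp only [hw, hk, e3]
        linear_combination (2 * σ⁻¹ * σ⁻¹ * (((n:ℝ) - 1) * u x + inner ℝ (x - q) (gradient u x))) * e2
      · have a1 : gradient f0 x = 0 := image_eq_zero_of_notMem_tsupport
          (fun h => hxU (hf0t (tsupport_grad _ h)))
        have a2 : gradient G x = 0 := image_eq_zero_of_notMem_tsupport
          (fun h => hxU (hGt (tsupport_grad _ h)))
        rw [a1, a2, hkz x hxU]; simp
  -- lower bound
  have hkc : Continuous k := by have := K0_cont; fun_prop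
  have hk0 : ∀ x, 0 ≤ k x := fun x => K0_nonneg _
  have hkint : ∫ x in closedBall q σ, k x = σ^(n+1) * kap n := by
    have : ∫ x in closedBall q σ, k x = ∫ x in ball q σ, k x := by
      refine (setIntegral_eq_of_subset_of_forall_sdiff_eq_zero measurableSet_closedBall
        ball_subset_closedBall fun x hx => ?_)
      have h2 := hx.2
      rw [mem_ball, dist_eq_norm, not_lt] at h2
      apply K0_one
      rw [norm_smul, norm_inv, Real.norm_of_nonneg hσ0.le, ← div_eq_inv_mul]
      exact one_le_pow₀ ((one_le_div hσ0).2 h2)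
    rw [this, integral_ball_scale _ _ hσ0]
    congr 1
    simp only [hk, kap]
    refine integral_congr_ae (Eventually.of_forall fun y => ?_)
    simp only
    rw [add_sub_cancel_left, smul_smul, inv_mul_cancel₀ hσ0.ne', one_smul]
  have hlow : ∀ x ∈ closedBall q σ, (1/2^(n+1)) * u q ≤ u x := by
    intro x hx
    rw [mem_closedBall] at hx
    have hb1 : closedBall x (ρ/2) ⊆ U := by
      refine Subset.trans ?_ hb
      apply closedBall_subset_ball'
      linarith
    have hd : dist q x ≤ σ := by rw [dist_comm]; exact hx
    have hb2 : closedBall q (ρ/2 - dist q x) ⊆ U :=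
      (closedBall_subset_ball (by linarith [dist_nonneg (x := q) (y := x)])).trans hb
    have h := harnack_aux (u := u) (x := x) (y := q) (s := ρ/2) (by linarith)
      (fun z hz => hpos z (hb1 (ball_subset_closedBall hz))) (intBall_of_cont (hu.1.mono hb1))
      (hu.2 x (hb1 (mem_closedBall_self (by linarith))) _ (by linarith) hb1)
      (hu.2 q hqU _ (by linarith) hb2)
    have hq0 := hpos q hqU
    have h3 : (ρ/4)^(n+1) * u q ≤ (ρ/2)^(n+1) * u x := by
      refine le_trans ?_ h
      gcongr
      linarith
    have h4 : (ρ/2)^(n+1) = (ρ/4)^(n+1) * 2^(n+1) := by rw [← mul_pow]; congr 1; ring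
    rw [h4, mul_assoc] at h3
    have h5 := le_of_mul_le_mul_left h3 (by positivity)
    rw [div_mul_eq_mul_div, one_mul, div_le_iff₀ (by positivity)]
    linarith
  have E6 : (1/2^(n+1)) * u q * (σ^(n+1) * kap n) ≤ ∫ x, k x * u x := by
    rw [← setIntegral_eq_integral_of_forall_compl_eq_zero (s := closedBall q σ)
      (fun x hx => by rw [hkz x hx, zero_mul]), ← hkint, ← integral_const_mul]
    refine setIntegral_mono_on ?_ ?_ measurableSet_closedBall fun x hx => ?_
    · exact (continuous_const.mul hkc).continuousOn.integrableOn_compact (isCompact_closedBall _ _)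
    · exact (hkc.continuousOn.mul (hu.1.mono hcb)).integrableOn_compact (isCompact_closedBall _ _)
    · rw [mul_comm]
      exact mul_le_mul_of_nonneg_left (hlow x hx) (hk0 x)
  rw [integral_const_mul] at E5
  have hn1 : (0:ℝ) < (n:ℝ) - 1 := by
    have : (2:ℝ) ≤ n := by exact_mod_cast hn
    linarith
  have hkp := kap_pos n
  have E7 : 2 * ((n:ℝ) - 1) * kap n * ((1/2^(n+1)) * u q) ≤
      mK n * ∫ x, inner ℝ (gradient φ x) (J x) := by
    rw [E2, E5]
    calc _ = (2 * ((n:ℝ) - 1) * (σ⁻¹)^(n+1)) * ((1/2^(n+1)) * u q * (σ^(n+1) * kap n)) := by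
          rw [inv_pow]; field_simp
      _ ≤ _ := by gcongr
  have E8 : ∫ x, inner ℝ (gradient φ x) (J x) ≤ ∫ x, ‖gradient φ x‖ * ‖J x‖ := by
    exact integral_mono iφ (int_norm_cont hU'o (grad_cont hφ) (gc _ hc) hJc (gU _ hs gφ))
      fun x => real_inner_le_norm _ _
  have E9 := mul_le_mul_of_nonneg_left E8 (mK_nonneg n)
  have E10 := E7.trans E9
  unfold cF
  rw [div_mul_eq_mul_div, le_div_iff₀ (by positivity)]
  have : u q * (2 * ((n:ℝ) - 1) * kap n) =
      2^(n+1) * (2 * ((n:ℝ) - 1) * kap n * ((1/2^(n+1)) * u q)) := by field_simp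
  rw [this]
  calc _ ≤ (2:ℝ)^(n+1) * (mK n * ∫ x, ‖gradient φ x‖ * ‖J x‖) := by gcongr
    _ = _ := by ring


theorem cs_set {d : ℕ} {f : Euc d → ℝ} {B : Set (Euc d)} (hB : volume B ≠ ⊤)
    (hf : IntegrableOn f B) (hf2 : IntegrableOn (fun x => f x ^ 2) B) :
    (∫ x in B, f x)^2 ≤ volume.real B * ∫ x in B, f x ^ 2 := by
  have hc : ∀ c : ℝ, IntegrableOn (fun _ : Euc d => c) B := fun c => integrableOn_const hB
  have key : ∀ t : ℝ, 0 ≤ (∫ x in B, f x ^ 2) - 2 * t * (∫ x in B, f x) + t^2 * volume.real B := by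
    intro t
    have h1 : 0 ≤ ∫ x in B, (f x ^ 2 - 2 * t * f x + t^2) :=
      integral_nonneg fun x => by
        show (0:ℝ) ≤ _
        nlinarith [sq_nonneg (f x - t)]
    have hs : IntegrableOn (fun x => f x ^ 2 - 2 * t * f x) B := hf2.sub (hf.const_mul _)
    rw [integral_add hs (hc _), integral_sub hf2 (hf.const_mul _), integral_const_mul,
      setIntegral_const, smul_eq_mul] at h1
    linarith
  set m := volume.real B with hm
  have hm0 : 0 ≤ m := measureReal_nonneg
  rcases hm0.eq_or_lt with h | h
  · have hv : volume B = 0 := by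
      rw [hm, Measure.real] at h
      exact ((ENNReal.toReal_eq_zero_iff _).1 h.symm).resolve_right hB
    have : ∫ x in B, f x = 0 := setIntegral_measure_zero _ hv
    rw [this, ← h]; simp
  · have := key ((∫ x in B, f x) / m)
    have e : (∫ x in B, f x ^ 2) - 2 * ((∫ x in B, f x) / m) * (∫ x in B, f x) +
        ((∫ x in B, f x) / m)^2 * m = (m * (∫ x in B, f x ^ 2) - (∫ x in B, f x)^2) / m := by
      field_simp
      ring
    rw [e] at this
    have := (div_nonneg_iff.1 this).resolve_right (fun h' => by linarith [h'.2])
    linarith [this.1]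

theorem swap_avg {d : ℕ} {η W : Euc d → ℝ} (hη : Continuous η) (hc : HasCompactSupport η)
    (hW : Measurable W) {M : ℝ} (hM : ∀ x, |W x| ≤ M) (s : ℝ) :
    Integrable (fun x => η x * ∫ y in ball (0 : Euc d) 1, W (x + s • y)) ∧
    Integrable (fun z => W z * ∫ y in ball (0 : Euc d) 1, η (z + s • y)) ∧
    ∫ x, η x * ∫ y in ball (0 : Euc d) 1, W (x + s • y) =
      ∫ z, W z * ∫ y in ball (0 : Euc d) 1, η (z + s • y) := by
  have : IsFiniteMeasure (volume.restrict (ball (0 : Euc d) 1)) :=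
    ⟨by simpa using measure_ball_lt_top⟩
  have hηi : Integrable η := hη.integrable_of_hasCompactSupport hc
  set ν := volume.restrict (ball (0 : Euc d) 1) with hν
  have hM0 : 0 ≤ M := (abs_nonneg _).trans (hM 0)
  have base : Integrable (fun z : Euc d × Euc d => η z.1 * M) (volume.prod ν) :=
    hηi.mul_prod (integrable_const M)
  have I1 : Integrable (Function.uncurry fun x y => η x * W (x + s • y)) (volume.prod ν) := by
    refine base.mono ?_ (Eventually.of_forall fun z => ?_)
    · apply Measurable.aestronglyMeasurable
      exact (hη.measurable.comp measurable_fst).mul (hW.comp (by fun_prop))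
    · simp only [Function.uncurry, norm_mul, Real.norm_eq_abs]
      exact mul_le_mul_of_nonneg_left ((hM _).trans (le_abs_self _)) (abs_nonneg _)
  have J1 : ∫ x, η x * ∫ y, W (x + s • y) ∂ν = ∫ y, ∫ x, η x * W (x + s • y) ∂volume ∂ν := by
    rw [← integral_integral_swap I1]
    simp_rw [integral_const_mul]
  have A1 : ∀ y, ∫ x, η x * W (x + s • y) = ∫ z, η (z - s • y) * W z := by
    intro y
    rw [← integral_add_right_eq_self (fun z => η (z - s • y) * W z) (s • y)]
    simp
  -- the second order
  have I2 : Integrable (Function.uncurry fun y z => η (z - s • y) * W z) (ν.prod volume) := by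
    rw [integrable_prod_iff]
    · constructor
      · refine Eventually.of_forall fun y => ?_
        have : Integrable fun z => η (z - s • y) := hηi.comp_sub_right (s • y)
        refine (this.mul_const M).mono ?_ (Eventually.of_forall fun z => ?_)
        · exact ((hη.measurable.comp (by fun_prop)).mul hW).aestronglyMeasurable
        · simp only [Function.uncurry, norm_mul, Real.norm_eq_abs]
          exact mul_le_mul_of_nonneg_left ((hM _).trans (le_abs_self _)) (abs_nonneg _)
      · refine Integrable.mono' (integrable_const (M * ∫ z, |η z|)) ?_
          (Eventually.of_forall fun y => ?_)
        · apply AEStronglyMeasurable.integral_prod_right' (f := fun z : Euc d × Euc d => ‖Function.uncurry (fun y z => η (z - s • y) * W z) z‖)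
          apply Measurable.aestronglyMeasurable
          exact ((hη.measurable.comp (by fun_prop)).mul (hW.comp measurable_snd)).norm
        · rw [Real.norm_of_nonneg (integral_nonneg fun _ => norm_nonneg _)]
          have : Integrable fun z => η (z - s • y) := hηi.comp_sub_right (s • y)
          calc _ ≤ ∫ z, M * |η (z - s • y)| := by
                refine integral_mono_of_nonneg (Eventually.of_forall fun _ => norm_nonneg _)
                  (this.abs.const_mul M) (Eventually.of_forall fun z => ?_)
                simp only [Function.uncurry, norm_mul, Real.norm_eq_abs]
                rw [mul_comm]
                gcongr
                exact hM _
            _ = _ := by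
                rw [integral_const_mul, integral_sub_right_eq_self (fun z => |η z|)]
    · apply Measurable.aestronglyMeasurable
      exact (hη.measurable.comp (by fun_prop)).mul (hW.comp measurable_snd)
  have A2 : ∀ z, ∫ y, η (z - s • y) * W z ∂ν = W z * ∫ y, η (z + s • y) ∂ν := by
    intro z
    rw [integral_mul_const, mul_comm]
    congr 1
    simp only [hν]
    rw [← integral_indicator measurableSet_ball, ← integral_indicator measurableSet_ball,
      ← integral_neg_eq_self]
    refine integral_congr_ae (Eventually.of_forall fun y => ?_)
    simp only [indicator, mem_ball, dist_zero_right, norm_neg, smul_neg, sub_neg_eq_add]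
  refine ⟨?_, ?_, ?_⟩
  · refine I1.integral_prod_left.congr (Eventually.of_forall fun x => ?_)
    simp only [Function.uncurry]
    rw [integral_const_mul]
  · refine I2.swap.integral_prod_left.congr (Eventually.of_forall fun z => ?_)
    simp only [Function.comp, Function.uncurry, Prod.swap]
    exact A2 z
  · rw [J1]
    simp_rw [A1]
    rw [integral_integral_swap I2]
    simp_rw [A2]

/-- profile -/
def fP (τ : ℝ) : ℝ := (τ - 1.3225) * (3.4225 - τ)

def hPr (τ : ℝ) : ℝ := (max 0 (fP τ))^2

def gPr (τ : ℝ) : ℝ := 2 * max 0 (fP τ) * (4.745 - 2 * τ)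

theorem fP_pos {τ : ℝ} (h : 0 < fP τ) : 1.3225 < τ ∧ τ < 3.4225 := by
  unfold fP at h
  constructor
  · by_contra hh; push Not at hh; nlinarith
  · by_contra hh; push Not at hh; nlinarith

theorem fP_tan (s t : ℝ) : fP s ≤ fP t + (4.745 - 2 * t) * (s - t) := by
  unfold fP; nlinarith [sq_nonneg (s - t)]

theorem hPr_quad (s t : ℝ) : hPr s ≤ hPr t + gPr t * (s - t) + 4.41 * (s - t)^2 := by
  unfold hPr gPr
  have hst := fP_tan s t
  have sl : ∀ t, 0 < fP t → (4.745 - 2 * t)^2 ≤ 4.41 := by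
    intro t h
    obtain ⟨h1, h2⟩ := fP_pos h
    nlinarith
  rcases le_or_gt (fP t) 0 with ht | ht
  · rw [max_eq_left ht]
    rcases le_or_gt (fP s) 0 with hs | hs
    · rw [max_eq_left hs]; nlinarith [sq_nonneg (s - t)]
    · rw [max_eq_right hs.le]
      have h1 := fP_tan t s
      have h2 := sl s hs
      have h3 : fP s ≤ (4.745 - 2 * s) * (s - t) + 2 * (s-t)^2 := by unfold fP at *; nlinarith
      have h4 : fP s ≤ 2.1 * |s - t| := by
        obtain ⟨a1, a2⟩ := fP_pos hs
        rcases le_total s t with hh | hh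
        · rw [abs_of_nonpos (by linarith)]
          have : 3.4225 ≤ t := by
            by_contra h'; push Not at h'
            unfold fP at ht; nlinarith
          unfold fP; nlinarith
        · rw [abs_of_nonneg (by linarith)]
          have : t ≤ 1.3225 := by
            by_contra h'; push Not at h'
            unfold fP at ht; nlinarith
          unfold fP; nlinarith
      have h5 : fP s ^ 2 ≤ (2.1 * |s - t|)^2 := by gcongr
      rw [mul_pow, sq_abs] at h5
      nlinarith
  · rw [max_eq_right ht.le]
    have h2 := sl t ht
    have h3 : ((4.745 - 2 * t) * (s - t))^2 ≤ 4.41 * (s-t)^2 := by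
      rw [mul_pow]; nlinarith [sq_nonneg (s-t)]
    rcases le_or_gt (fP s) 0 with hs | hs
    · rw [max_eq_left hs]
      nlinarith [sq_nonneg (fP t + (4.745 - 2 * t) * (s - t))]
    · rw [max_eq_right hs.le]
      have : fP s ^ 2 ≤ (fP t + (4.745 - 2 * t) * (s - t))^2 := by gcongr
      nlinarith

theorem gPr_le (t : ℝ) : |gPr t| ≤ 5 := by
  unfold gPr
  rcases le_or_gt (fP t) 0 with ht | ht
  · rw [max_eq_left ht]; norm_num
  · rw [max_eq_right ht.le]
    obtain ⟨h1, h2⟩ := fP_pos ht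
    have h3 : fP t ≤ 1.1025 := by unfold fP; nlinarith [sq_nonneg (t - 2.3725)]
    have h4 : |4.745 - 2 * t| ≤ 2.1 := abs_le.2 ⟨by linarith, by linarith⟩
    rw [abs_mul, abs_of_nonneg (by positivity)]
    nlinarith [abs_nonneg (4.745 - 2 * t)]

theorem hPr_cont : Continuous hPr := by unfold hPr fP; fun_prop

theorem hPr_nonneg (t : ℝ) : 0 ≤ hPr t := by unfold hPr; positivity

theorem hPr_le (t : ℝ) : hPr t ≤ 2 := by
  unfold hPr
  have h3 : fP t ≤ 1.1025 := by unfold fP; nlinarith [sq_nonneg (t - 2.3725)]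
  have h4 : max 0 (fP t) ≤ 1.1025 := max_le (by norm_num) h3
  have h5 : 0 ≤ max 0 (fP t) := le_max_left _ _
  nlinarith

theorem hPr_ge {t : ℝ} (h1 : 1.44 ≤ t) (h2 : t ≤ 3.24) : 1/20 ≤ hPr t := by
  unfold hPr
  have h3 : 0.23 ≤ fP t := by unfold fP; nlinarith
  have : 0.23 ≤ max 0 (fP t) := h3.trans (le_max_right _ _)
  nlinarith

theorem hPr_zero {t : ℝ} (h : ¬ (1.3225 < t ∧ t < 3.4225)) : hPr t = 0 := by
  unfold hPr
  have : fP t ≤ 0 := by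
    by_contra hh; push Not at hh
    exact h (fP_pos hh)
  rw [max_eq_left this]; simp

theorem int_inner_ball {d : ℕ} (a : Euc d) : ∫ y in ball (0 : Euc d) 1, inner ℝ a y = 0 := by
  have : ∫ y in ball (0 : Euc d) 1, inner ℝ a y = - ∫ y in ball (0 : Euc d) 1, inner ℝ a y := by
    conv_lhs => rw [← integral_indicator measurableSet_ball, ← integral_neg_eq_self]
    rw [← integral_neg, ← integral_indicator measurableSet_ball]
    refine integral_congr_ae (Eventually.of_forall fun y => ?_)
    simp only [indicator, mem_ball, dist_zero_right, norm_neg, inner_neg_right]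
  linarith

theorem eta_avg {d : ℕ} {q z : Euc d} {r s : ℝ} (hr : 0 < r) (hs : 0 ≤ s) (hsr : s ≤ r)
    (hz : ‖z - q‖ ≤ 2 * r) :
    ∫ y in ball (0 : Euc d) 1, hPr (‖z + s • y - q‖^2 / r^2) ≤
      vB d * (hPr (‖z - q‖^2 / r^2) + 120 * (s^2 / r^2)) := by
  set t := ‖z - q‖^2 / r^2 with ht
  have h1 : ∀ y ∈ ball (0 : Euc d) 1, hPr (‖z + s • y - q‖^2 / r^2) ≤
      (hPr t + 120 * (s^2 / r^2)) + (gPr t * 2 * s / r^2) * inner ℝ (z - q) y := by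
    intro y hy
    rw [mem_ball, dist_zero_right] at hy
    have e : ‖z + s • y - q‖^2 / r^2 - t =
        (2 * s * inner ℝ (z - q) y + s^2 * ‖y‖^2) / r^2 := by
      rw [ht, show z + s • y - q = (z - q) + s • y by abel, norm_add_sq_real, norm_smul,
        real_inner_smul_right, mul_pow, Real.norm_eq_abs, sq_abs]
      ring
    have h2 := hPr_quad (‖z + s • y - q‖^2 / r^2) t
    rw [e] at h2
    have hi : |inner ℝ (z - q) y| ≤ 2 * r := by
      refine (abs_real_inner_le_norm _ _).trans ?_
      nlinarith [norm_nonneg (z - q), norm_nonneg y]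
    have hy2 : ‖y‖^2 ≤ 1 := by nlinarith [norm_nonneg y]
    have hA : |2 * s * inner ℝ (z - q) y + s^2 * ‖y‖^2| ≤ 5 * s * r := by
      refine (abs_add_le _ _).trans ?_
      rw [abs_mul, abs_of_nonneg (by positivity : 0 ≤ 2 * s),
        abs_of_nonneg (by positivity : 0 ≤ s^2 * ‖y‖^2)]
      have a1 : 2 * s * |inner ℝ (z - q) y| ≤ 2 * s * (2 * r) := by gcongr
      have a2 : s^2 * ‖y‖^2 ≤ s * r := by
        calc s^2 * ‖y‖^2 ≤ s^2 * 1 := by gcongr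
          _ ≤ s * r := by nlinarith
      linarith
    have hB : ((2 * s * inner ℝ (z - q) y + s^2 * ‖y‖^2) / r^2)^2 ≤ 25 * (s^2 / r^2) := by
      rw [div_pow, ← sq_abs, show (25:ℝ) * (s^2 / r^2) = (5 * s * r)^2 / (r^2)^2 by field_simp; ring]
      gcongr
    have hg := gPr_le t
    have hC : gPr t * (s^2 * ‖y‖^2 / r^2) ≤ 5 * (s^2 / r^2) := by
      have : gPr t ≤ 5 := (le_abs_self _).trans hg
      have a1 : s^2 * ‖y‖^2 / r^2 ≤ s^2 / r^2 := by
        gcongr; nlinarith [sq_nonneg s]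
      have a0 : 0 ≤ s^2 * ‖y‖^2 / r^2 := by positivity
      nlinarith
    have e2 : gPr t * ((2 * s * inner ℝ (z - q) y + s^2 * ‖y‖^2) / r^2) =
        (gPr t * 2 * s / r^2) * inner ℝ (z - q) y + gPr t * (s^2 * ‖y‖^2 / r^2) := by ring
    rw [e2] at h2
    have : 0 ≤ s^2 / r^2 := by positivity
    linarith
  have c1 : Continuous fun y : Euc d => hPr (‖z + s • y - q‖^2 / r^2) := by
    have := hPr_cont
    fun_prop
  have c2 : Continuous fun y : Euc d => (gPr t * 2 * s / r^2) * inner ℝ (z - q) y := by fun_prop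
  refine (setIntegral_mono_on (intBall_of_cont c1.continuousOn)
    ((intBall_const _ _ _).add (intBall_of_cont c2.continuousOn)) measurableSet_ball h1).trans ?_
  simp only [Pi.add_apply]
  rw [integral_add (intBall_const _ _ _) (intBall_of_cont c2.continuousOn), integral_const_mul,
    int_inner_ball, setIntegral_const, vol_ball' _ one_pos, smul_eq_mul]
  simp


theorem gO_measurable {n : ℕ} (hn : 1 ≤ n) {Ω : Set (Euc (n+1))} (hΩ : IsOpen Ω) {p : Euc (n+1)}
    (hp : p ∈ Ω) : Measurable (gO n Ω p) := by
  classical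
  have ho : IsOpen (OSet Ω \ {p}) := (OSet_open hΩ).sdiff isClosed_singleton
  have h := ((green_har hn hΩ hp).1.mono
    (sdiff_subset_sdiff_left (OSet_subset Ω))).measurable_piecewise
      (continuousOn_const (c := (0:ℝ)) (s := (OSet Ω \ {p})ᶜ)) ho.measurableSet
  convert h using 1
  ext x
  simp [gO, indicator, piecewise]

/-- the open annulus -/
def Anl {d : ℕ} (q : Euc d) (r : ℝ) : Set (Euc d) := ball q (2 * r) \ closedBall q r

theorem Anl_meas {d : ℕ} (q : Euc d) (r : ℝ) : MeasurableSet (Anl q r) :=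
  measurableSet_ball.diff measurableSet_closedBall

theorem mem_Anl {d : ℕ} {q x : Euc d} {r : ℝ} : x ∈ Anl q r ↔ r < dist x q ∧ dist x q < 2 * r := by
  unfold Anl
  rw [Set.mem_sdiff, mem_ball, mem_closedBall, not_le, and_comm]

theorem ball_Anl {d : ℕ} {q x : Euc d} {r : ℝ} (hr : 0 < r) (h1 : 1.1 * r ≤ dist x q)
    (h2 : dist x q ≤ 1.9 * r) : closedBall x (r/20) ⊆ Anl q r := by
  intro y hy
  rw [mem_closedBall] at hy
  rw [mem_Anl]
  have := dist_triangle x y q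
  have := dist_triangle y x q
  rw [dist_comm x y] at *
  constructor <;> linarith

theorem Phi_le_of {n : ℕ} (hn : 1 ≤ n) {p x : Euc (n+1)} {r : ℝ} (hr : 0 < r) (h : r ≤ dist x p) :
    Phi n p x ≤ r^((1:ℤ) - n) := by
  unfold Phi
  rw [← dist_eq_norm]
  exact zpow_anti hn hr h

theorem gO_int_Anl {n : ℕ} (hn : 1 ≤ n) {Ω : Set (Euc (n+1))} (hΩ : IsOpen Ω) {p : Euc (n+1)}
    (hp : p ∈ Ω) {q : Euc (n+1)} {r : ℝ} (hr : 0 < r) (hd : ∀ x ∈ Anl q r, r ≤ dist x p) :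
    IntegrableOn (gO n Ω p) (Anl q r) := by
  have hv : volume (Anl q r) < ⊤ := (measure_mono sdiff_subset).trans_lt measure_ball_lt_top
  refine Integrable.mono' (g := fun _ => r^((1:ℤ) - n)) (integrableOn_const hv.ne) (gO_meas hn hΩ hp).restrict ?_
  refine (ae_restrict_iff' (Anl_meas q r)).2 (Eventually.of_forall fun y hy => ?_)
  rw [Real.norm_of_nonneg (gO_nonneg hn hΩ hp y)]
  exact (gO_le hn hΩ hp y).trans (Phi_le_of hn hr (hd y hy))

/-- sup constant -/
def cS (n : ℕ) : ℝ := 20^(n+1) / vB (n+1)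

theorem cS_pos (n : ℕ) : 0 < cS n := by have := vB_pos (n+1); unfold cS; positivity

theorem gO_sup {n : ℕ} (hn : 1 ≤ n) {Ω : Set (Euc (n+1))} (hΩ : IsOpen Ω) {p : Euc (n+1)}
    (hp : p ∈ Ω) {q : Euc (n+1)} {r : ℝ} (hr : 0 < r) (hd : ∀ x ∈ Anl q r, r ≤ dist x p)
    {x : Euc (n+1)} (h1 : 1.1 * r ≤ dist x q) (h2 : dist x q ≤ 1.9 * r) :
    gO n Ω p x ≤ cS n / r^(n+1) * ∫ y in Anl q r, gO n Ω p y := by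
  have hvB := vB_pos (n+1)
  have hb := ball_Anl hr h1 h2
  have hps : p ∉ closedBall x (r/20) := fun h => by
    have := hd p (hb h); rw [dist_self] at this; linarith
  have h := gO_submean hn hΩ hp (by positivity) hps
  have h3 : ∫ y in ball x (r/20), gO n Ω p y ≤ ∫ y in Anl q r, gO n Ω p y :=
    setIntegral_mono_set (gO_int_Anl hn hΩ hp hr hd)
      (Eventually.of_forall fun y => gO_nonneg hn hΩ hp y)
      (LE.le.eventuallyLE (ball_subset_closedBall.trans hb))
  have h4 := h.trans h3
  have e : cS n / r^(n+1) = ((r/20)^(n+1) * vB (n+1))⁻¹ := by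
    unfold cS; rw [div_pow]; field_simp
  rw [e, inv_mul_eq_div, le_div_iff₀ (by positivity)]
  linarith

/-- gradient constant -/
def cE (n : ℕ) : ℝ := (4 / cK (n+1))^2 * 2^(2 * n + 4) * 2^(n+1) * vB (n+1)

theorem cE_pos (n : ℕ) : 0 < cE n := by
  have := cK_pos (n+1)
  have := vB_pos (n+1)
  unfold cE; positivity

theorem grad_sq {n : ℕ} {w : Euc (n+1) → ℝ} {U : Set (Euc (n+1))} (hw : Har w U) {x : Euc (n+1)}
    {S : ℝ} (hS : 0 < S) (hb : closedBall x S ⊆ U) :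
    ‖fderiv ℝ w x‖^2 ≤ cE n / S^2 *
      ((∫ y in ball (0 : Euc (n+1)) 1, w (x + S • y)^2) - vB (n+1) * w x ^ 2) := by
  have hcK := cK_pos (n+1)
  have hvB := vB_pos (n+1)
  have hb' : closedBall x (2 * (S/2)) ⊆ U := by rwa [show 2 * (S/2) = S by ring]
  have h := hw.grad_le (half_pos hS) hb' (w x)
  rw [show 2 * (S/2) = S by ring] at h
  have c1 : ContinuousOn w (closedBall x S) := hw.1.mono hb
  have i1 : IntegrableOn (fun y => |w y - w x|) (ball x S) :=
    intBall_of_cont (c1.sub continuousOn_const).abs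
  have i2 : IntegrableOn (fun y => |w y - w x|^2) (ball x S) :=
    intBall_of_cont ((c1.sub continuousOn_const).abs.pow 2)
  have hcs := cs_set measure_ball_lt_top.ne i1 i2
  have e1 : ∫ y in ball x S, |w y - w x|^2 = (∫ y in ball x S, w y ^ 2) - S^(n+1) * vB (n+1) * w x ^ 2 := by
    have j1 : IntegrableOn (fun y => w y ^ 2) (ball x S) := intBall_of_cont (c1.pow 2)
    have j2 : IntegrableOn (fun y => 2 * w x * w y) (ball x S) :=
      intBall_of_cont (continuousOn_const.mul c1)
    have j3 : IntegrableOn (fun y => w y ^ 2 - 2 * w x * w y) (ball x S) := j1.sub j2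
    have : ∫ y in ball x S, |w y - w x|^2 =
        ∫ y in ball x S, (w y ^ 2 - 2 * w x * w y + w x ^ 2) := by
      refine integral_congr_ae (Eventually.of_forall fun y => ?_)
      simp only [sq_abs]; ring
    rw [this, integral_add j3 (intBall_const _ _ _), integral_sub j1 j2, integral_const_mul,
      hw.2 x (hb (mem_closedBall_self hS.le)) S hS hb, setIntegral_const, vol_ball' _ hS, smul_eq_mul]
    ring
  rw [e1, vol_ball' _ hS, integral_ball_scale (fun y => w y ^ 2) _ hS] at hcs
  calc ‖fderiv ℝ w x‖^2 ≤ (4 / cK (n+1) / (S/2)^(n+1+1) * (∫ y in ball x S, |w y - w x|))^2 := by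
        gcongr
    _ = (4 / cK (n+1) / (S/2)^(n+1+1))^2 * (∫ y in ball x S, |w y - w x|)^2 := by ring
    _ ≤ (4 / cK (n+1) / (S/2)^(n+1+1))^2 * (S^(n+1) * vB (n+1) * ((S^(n+1) * ∫ y in ball (0 : Euc (n+1)) 1, w (x + S • y)^2) - S^(n+1) * vB (n+1) * w x ^ 2)) :=
        mul_le_mul_of_nonneg_left hcs (sq_nonneg _)
    _ = ((4 / cK (n+1))^2 * 2^(2 * n + 4) * vB (n+1) / S^2) *
      ((∫ y in ball (0 : Euc (n+1)) 1, w (x + S • y)^2) - vB (n+1) * w x ^ 2) := by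
        rw [div_pow S]
        have : S^(n+1+1) ≠ 0 := by positivity
        have h2 : (2:ℝ)^(2*n+4) = (2^(n+1+1))^2 := by rw [← pow_mul]; congr 1; ring
        rw [h2]
        field_simp
        ring
    _ ≤ _ := by
        have h0 : 0 ≤ (∫ y in ball (0 : Euc (n+1)) 1, w (x + S • y)^2) - vB (n+1) * w x ^ 2 := by
          have hS' : 0 < S^(n+1) := by positivity
          have hh : 0 ≤ S^(n+1) * vB (n+1) * (S^(n+1) * (∫ y in ball (0 : Euc (n+1)) 1, w (x + S • y)^2) - S^(n+1) * vB (n+1) * w x ^ 2) :=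
            (sq_nonneg _).trans hcs
          have : S^(n+1) * vB (n+1) * (S^(n+1) * (∫ y in ball (0 : Euc (n+1)) 1, w (x + S • y)^2) - S^(n+1) * vB (n+1) * w x ^ 2) = (S^(n+1) * vB (n+1) * S^(n+1)) * ((∫ y in ball (0 : Euc (n+1)) 1, w (x + S • y)^2) - vB (n+1) * w x ^ 2) := by ring
          rw [this] at hh
          exact nonneg_of_mul_nonneg_right hh (by positivity)
        gcongr ?_ / _ * _
        unfold cE
        have : (1:ℝ) ≤ 2^(n+1) := one_le_pow₀ (by norm_num)
        have h5 : 0 ≤ (4 / cK (n+1))^2 * 2^(2 * n + 4) := by positivity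
        have h6 : (4 / cK (n+1))^2 * 2^(2 * n + 4) * vB (n+1) * 1 ≤
          (4 / cK (n+1))^2 * 2^(2 * n + 4) * vB (n+1) * 2^(n+1) := by gcongr
        linarith

theorem ball_OSet {n : ℕ} {Ω : Set (Euc (n+1))} (hΩ : IsOpen Ω) {T : Set (Euc (n+1))}
    (hT : IsPreconnected T) (hTΩ : T ⊆ Ω) {x : Euc (n+1)} (hx : x ∈ T) (hxO : x ∈ OSet Ω) :
    T ⊆ OSet Ω := by
  refine hT.subset_left_of_subset_union (OSet_open hΩ) (UB_open hΩ)
    (disjoint_sdiff_self_right) (fun y hy => ?_) ⟨x, hx, hxO⟩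
  by_cases h : y ∈ OSet Ω
  · exact Or.inl h
  · exact Or.inr ⟨hTΩ hy, h⟩

/-- Caccioppoli constant -/
def cCa (n : ℕ) : ℝ := 20 * cE n * (120 * vB (n+1)) * (2^(n+1) * vB (n+1)) * cS n ^ 2

theorem cCa_pos (n : ℕ) : 0 < cCa n := by
  have := cE_pos n
  have := cS_pos n
  have := vB_pos (n+1)
  unfold cCa; positivity

theorem caccio {n : ℕ} (hn : 1 ≤ n) {Ω : Set (Euc (n+1))} (hΩ : IsOpen Ω) {p : Euc (n+1)}
    (hp : p ∈ Ω) {q : Euc (n+1)} {r : ℝ} (hr : 0 < r) (hd : ∀ x ∈ Anl q r, r ≤ dist x p)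
    {S : ℝ} (hS : 0 < S) (hSr : S ≤ r / 100) {K : Set (Euc (n+1))} (hK : IsCompact K)
    (hK1 : ∀ x ∈ K, 1.2 * r ≤ dist x q ∧ dist x q ≤ 1.8 * r) (hKO : K ⊆ OSet Ω)
    (hKS : ∀ x ∈ K, closedBall x S ⊆ Ω) :
    ∫ x in K, ‖fderiv ℝ (greenFn n Ω p) x‖^2 ≤
      cCa n / r^(n+3) * (∫ x in Anl q r, gO n Ω p x)^2 := by
  classical
  set T := ∫ x in Anl q r, gO n Ω p x with hT
  have hT0 : 0 ≤ T := integral_nonneg fun y => gO_nonneg hn hΩ hp y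
  have hvB := vB_pos (n+1)
  have hcE := cE_pos n
  have hcS := cS_pos n
  set A2 : Set (Euc (n+1)) := closedBall q (1.9 * r) \ ball q (1.1 * r) with hA2
  have memA2 : ∀ x, x ∈ A2 ↔ 1.1 * r ≤ dist x q ∧ dist x q ≤ 1.9 * r := by
    intro x; rw [hA2, Set.mem_sdiff, mem_ball, mem_closedBall, not_lt, and_comm]
  have mA2 : MeasurableSet A2 := measurableSet_closedBall.diff measurableSet_ball
  set W : Euc (n+1) → ℝ := A2.indicator (fun x => gO n Ω p x ^ 2) with hW
  have hWm : Measurable W := ((gO_measurable hn hΩ hp).pow_const 2).indicator mA2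
  have hW0 : ∀ x, 0 ≤ W x := fun x => indicator_nonneg (fun y _ => sq_nonneg _) x
  set M := cS n / r^(n+1) * T with hM
  have hM0 : 0 ≤ M := by positivity
  have hWM : ∀ x, W x ≤ M^2 := by
    intro x
    by_cases hx : x ∈ A2
    · rw [hW, indicator_of_mem hx]
      have h2 := (memA2 x).1 hx
      have := gO_sup hn hΩ hp hr hd h2.1 h2.2
      have := gO_nonneg hn hΩ hp x
      gcongr
    · rw [hW, indicator_of_notMem hx]; positivity
  have hWa : ∀ x, |W x| ≤ M^2 := fun x => by rw [abs_of_nonneg (hW0 x)]; exact hWM x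
  have hWz : ∀ x, x ∉ ball q (2 * r) → W x = 0 := by
    intro x hx
    rw [hW, indicator_of_notMem]
    intro h
    have := ((memA2 x).1 h).2
    rw [mem_ball, not_lt] at hx; linarith
  have hWi : Integrable W := by
    have : IntegrableOn W (ball q (2*r)) :=
      Integrable.mono' (g := fun _ => M^2) (integrableOn_const measure_ball_lt_top.ne)
        hWm.aestronglyMeasurable (Eventually.of_forall fun x => hWa x)
    exact (integrableOn_iff_integrable_of_support_subset
      (fun x hx => by by_contra h; exact hx (hWz x h))).1 this
  have hWint : ∫ x, W x ≤ M^2 * ((2*r)^(n+1) * vB (n+1)) := by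
    rw [← setIntegral_eq_integral_of_forall_compl_eq_zero (s := ball q (2*r)) hWz]
    calc ∫ x in ball q (2*r), W x ≤ ∫ x in ball q (2*r), M^2 :=
          setIntegral_mono_on hWi.integrableOn (integrableOn_const measure_ball_lt_top.ne)
            measurableSet_ball fun x _ => hWM x
      _ = _ := by rw [setIntegral_const, vol_ball' _ (by positivity), smul_eq_mul]; ring
  set η : Euc (n+1) → ℝ := fun x => hPr (‖x - q‖^2 / r^2) with hη
  have hηc : Continuous η := by have := hPr_cont; fun_prop
  have hη0 : ∀ x, 0 ≤ η x := fun x => hPr_nonneg _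
  have hηA : ∀ x, η x ≠ 0 → 1.15 * r < dist x q ∧ dist x q < 1.85 * r := by
    intro x hx
    have : 1.3225 < ‖x - q‖^2 / r^2 ∧ ‖x - q‖^2 / r^2 < 3.4225 := by
      by_contra h; exact hx (hPr_zero h)
    rw [lt_div_iff₀ (by positivity), div_lt_iff₀ (by positivity)] at this
    rw [dist_eq_norm]
    constructor
    · by_contra h; push Not at h
      have : ‖x - q‖^2 ≤ (1.15 * r)^2 := by gcongr
      nlinarith
    · by_contra h; push Not at h
      have : (1.85 * r)^2 ≤ ‖x - q‖^2 := by gcongr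
      nlinarith
  have hηs : HasCompactSupport η := by
    apply HasCompactSupport.intro (isCompact_closedBall q (2*r))
    intro x hx
    by_contra h
    have := (hηA x h).2
    rw [mem_closedBall, not_le] at hx
    linarith
  obtain ⟨I1, I2, E⟩ := swap_avg hηc hηs hWm hWa S
  set Av : Euc (n+1) → ℝ := fun x => ∫ y in ball (0 : Euc (n+1)) 1, W (x + S • y) with hAv
  have I3 : Integrable (fun x => η x * (vB (n+1) * W x)) := by
    refine Integrable.mono' ((hWi.const_mul (2 * vB (n+1)))) ?_ (Eventually.of_forall fun x => ?_)
    · exact (hηc.measurable.mul (hWm.const_mul _)).aestronglyMeasurable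
    · have h1 := hη0 x
      have h2 := hW0 x
      have h3 : η x ≤ 2 := hPr_le _
      rw [Real.norm_of_nonneg (by positivity)]
      calc η x * (vB (n+1) * W x) ≤ 2 * (vB (n+1) * W x) := by gcongr
        _ = _ := by ring
  -- the global inequality
  have G1 : ∫ x, (η x * Av x - η x * (vB (n+1) * W x)) ≤
      120 * (S^2 / r^2) * vB (n+1) * ∫ x, W x := by
    rw [integral_sub I1 I3, E, ← integral_sub I2 I3, ← integral_const_mul]
    refine integral_mono (I2.sub I3) (hWi.const_mul _) fun z => ?_
    show W z * _ - η z * (vB (n+1) * W z) ≤ _ * W z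
    by_cases hz : z ∈ ball q (2*r)
    · rw [mem_ball, dist_eq_norm] at hz
      have h1 := eta_avg (d := n+1) (q := q) (z := z) hr hS.le (by linarith) hz.le
      have h2 := mul_le_mul_of_nonneg_left h1 (hW0 z)
      simp only [hη]
      linarith
    · rw [hWz z hz]; simp
  -- values near the support
  have hnear : ∀ x, 1.15 * r < dist x q → dist x q < 1.85 * r → ∀ y ∈ closedBall x S,
      W y = gO n Ω p y ^ 2 := by
    intro x h1 h2 y hy
    rw [mem_closedBall] at hy
    rw [hW, indicator_of_mem]
    rw [memA2]
    have := dist_triangle x y q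
    have := dist_triangle y x q
    rw [dist_comm x y] at *
    constructor <;> linarith
  have hAvB : ∀ x, Av x * S^(n+1) = ∫ y in ball x S, W y := by
    intro x; rw [integral_ball_scale _ _ hS, mul_comm]
  have G2 : ∀ x, 0 ≤ η x * Av x - η x * (vB (n+1) * W x) := by
    intro x
    by_cases hx : η x = 0
    · rw [hx]; simp
    · obtain ⟨h1, h2⟩ := hηA x hx
      have hps : p ∉ closedBall x S := fun h => by
        have := hd p (ball_Anl hr (by linarith) (by linarith)
          (closedBall_subset_closedBall (by linarith) h))
        rw [dist_self] at this; linarith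
      have h3 := gO_sq_submean hn hΩ hp hS hps
      have h4 : ∫ y in ball x S, gO n Ω p y ^ 2 = ∫ y in ball x S, W y :=
        setIntegral_congr_fun measurableSet_ball fun y hy =>
          (hnear x h1 h2 y (ball_subset_closedBall hy)).symm
      rw [h4, ← hnear x h1 h2 x (mem_closedBall_self hS.le), ← hAvB] at h3
      have h5 : vB (n+1) * W x ≤ Av x := by
        have : 0 < S^(n+1) := by positivity
        refine le_of_mul_le_mul_right ?_ this
        linarith
      rw [← mul_sub]
      exact mul_nonneg (hη0 x) (by linarith)
  have G3 : ∀ x ∈ K, ‖fderiv ℝ (greenFn n Ω p) x‖^2 ≤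
      20 * cE n / S^2 * (η x * Av x - η x * (vB (n+1) * W x)) := by
    intro x hx
    obtain ⟨h1, h2⟩ := hK1 x hx
    have hb : closedBall x S ⊆ OSet Ω :=
      ball_OSet hΩ (convex_closedBall x S).isPreconnected (hKS x hx)
        (mem_closedBall_self hS.le) (hKO hx)
    have hps : p ∉ closedBall x S := fun h => by
      have := hd p (ball_Anl hr (by linarith) (by linarith)
        (closedBall_subset_closedBall (by linarith) h))
      rw [dist_self] at this; linarith
    have hb2 : closedBall x S ⊆ OSet Ω \ {p} := fun y hy => ⟨hb hy, fun h => hps (h ▸ hy)⟩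
    have h3 := grad_sq (green_har hn hΩ hp) hS
      (hb2.trans (sdiff_subset_sdiff_left (OSet_subset Ω)))
    have hgW : ∀ y ∈ closedBall x S, greenFn n Ω p y ^ 2 = W y := by
      intro y hy
      rw [hnear x (by linarith) (by linarith) y hy, gO, indicator_of_mem (hb2 hy)]
    have h4 : ∫ y in ball (0 : Euc (n+1)) 1, greenFn n Ω p (x + S • y)^2 = Av x := by
      refine setIntegral_congr_fun measurableSet_ball fun y hy => hgW _ ?_
      rw [mem_ball, dist_zero_right] at hy
      rw [mem_closedBall, dist_eq_norm, add_sub_cancel_left, norm_smul, Real.norm_of_nonneg hS.le]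
      nlinarith
    rw [h4, hgW x (mem_closedBall_self hS.le)] at h3
    have h5 : 1/20 ≤ η x := by
      apply hPr_ge
      · rw [le_div_iff₀ (by positivity), ← dist_eq_norm]; nlinarith
      · rw [div_le_iff₀ (by positivity), ← dist_eq_norm]; nlinarith [dist_nonneg (x := x) (y := q)]
    have h6 : 0 ≤ Av x - vB (n+1) * W x := by
      have := G2 x
      rw [← mul_sub] at this
      exact nonneg_of_mul_nonneg_right this (by linarith)
    refine h3.trans ?_
    calc cE n / S^2 * (Av x - vB (n+1) * W x) = 20 * cE n / S^2 * (1/20 * (Av x - vB (n+1) * W x)) := by ring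
      _ ≤ 20 * cE n / S^2 * (η x * (Av x - vB (n+1) * W x)) := by gcongr
      _ = _ := by ring
  have hKp : K ⊆ Ω \ {p} := by
    intro x hx
    refine ⟨OSet_subset Ω (hKO hx), fun h => ?_⟩
    rw [mem_singleton_iff] at h
    obtain ⟨h1, h2⟩ := hK1 x hx
    have := hd x (ball_Anl (x := x) hr (by linarith) (by linarith) (mem_closedBall_self (by positivity)))
    rw [h, dist_self] at this; linarith
  have hUo : IsOpen (Ω \ {p}) := hΩ.sdiff isClosed_singleton
  have iK : IntegrableOn (fun x => ‖fderiv ℝ (greenFn n Ω p) x‖^2) K := by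
    have := ((green_har hn hΩ hp).contDiffOn hUo).continuousOn_fderiv_of_isOpen hUo (by norm_num)
    exact ContinuousOn.integrableOn_compact hK ((this.mono hKp).norm.pow 2)
  have IG : Integrable (fun x => η x * Av x - η x * (vB (n+1) * W x)) := I1.sub I3
  calc ∫ x in K, ‖fderiv ℝ (greenFn n Ω p) x‖^2
      ≤ ∫ x in K, 20 * cE n / S^2 * (η x * Av x - η x * (vB (n+1) * W x)) :=
        setIntegral_mono_on iK (IG.const_mul _).integrableOn hK.measurableSet G3
    _ = 20 * cE n / S^2 * ∫ x in K, (η x * Av x - η x * (vB (n+1) * W x)) := integral_const_mul _ _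
    _ ≤ 20 * cE n / S^2 * ∫ x, (η x * Av x - η x * (vB (n+1) * W x)) := by
        exact mul_le_mul_of_nonneg_left (setIntegral_le_integral IG (Eventually.of_forall G2))
          (by positivity)
    _ ≤ 20 * cE n / S^2 * (120 * (S^2 / r^2) * vB (n+1) * (M^2 * ((2*r)^(n+1) * vB (n+1)))) := by
        gcongr
        exact G1.trans (by gcongr)
    _ = cCa n / r^(n+3) * T^2 := by
        rw [hM, cCa, mul_pow 2 r, show n + 3 = (n+1) + 2 by ring, pow_add r (n+1) 2]
        field_simp


lemma vol_ballE {d : ℕ} (x : Euc d) {s : ℝ} (hs : 0 < s) :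
    volume (ball x s) = ENNReal.ofReal (s^d * vB d) := by
  rw [← vol_ball' x hs, ofReal_measureReal measure_ball_lt_top.ne]

lemma ton {d : ℕ} (ν : Measure (Euc d)) [IsFiniteMeasure ν] (E : Set (Euc d)) (ρ : ℝ) :
    ∫⁻ x in E, ν (ball x ρ) = ∫⁻ ξ, volume.restrict E (ball ξ ρ) ∂ν := by
  have hS : MeasurableSet {z : Euc d × Euc d | dist z.1 z.2 < ρ} :=
    (isOpen_lt (continuous_fst.dist continuous_snd) continuous_const).measurableSet
  have h1 := Measure.prod_apply (μ := volume.restrict E) (ν := ν) hS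
  have h2 := Measure.prod_apply_symm (μ := volume.restrict E) (ν := ν) hS
  rw [h1] at h2
  convert! h2 using 4
  · rename_i x
    ext y
    simp [mem_ball, dist_comm]

lemma ad_upper {n : ℕ} (hn : 1 ≤ n) {C₀ : ℝ} (hC : 1 ≤ C₀) {F : Set (Euc (n+1))} (hF : IsClosed F)
    (hA : ADRegular n C₀ F) {z : Euc (n+1)} (hz : z ∈ F) {ρ : ℝ} (hρ : 0 < ρ) :
    μH[n] (F ∩ ball z ρ) ≤ ENNReal.ofReal (4^(n+1) * C₀ * ρ^n) := by
  have hvB := vB_pos (n+1)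
  unfold ADRegular at hA
  by_cases hd : ENNReal.ofReal ρ ≤ EMetric.diam F
  · refine (hA z hz ρ hρ hd).2.trans (ENNReal.ofReal_le_ofReal ?_)
    have : (1:ℝ) ≤ 4^(n+1) := one_le_pow₀ (by norm_num)
    have h2 : 0 ≤ C₀ * ρ^n := by positivity
    nlinarith
  push Not at hd
  have hbd : Metric.ediam F ≠ ⊤ := (lt_trans hd ENNReal.ofReal_lt_top).ne
  by_cases hs : F.Subsingleton
  · haveI : NullSingletonClass (μH[(n:ℝ)] : Measure (Euc (n+1))) :=
      Measure.nullSingletonClass_hausdorff _ (by exact_mod_cast hn)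
    rw [(hs.anti inter_subset_left).measure_zero]
    exact zero_le'
  have hD0 : 0 < Metric.ediam F := Metric.ediam_pos_iff.2 (by rwa [Set.not_subsingleton_iff] at hs)
  obtain ⟨D, hDD⟩ : ∃ D : ℝ, D = (Metric.ediam F).toReal := ⟨_, rfl⟩
  have hD : 0 < D := by rw [hDD]; exact ENNReal.toReal_pos hD0.ne' hbd
  have hDe : ENNReal.ofReal D = Metric.ediam F := by rw [hDD]; exact ENNReal.ofReal_toReal hbd
  have hDρ : D ≤ ρ := by
    have : ENNReal.ofReal D ≤ ENNReal.ofReal ρ := by rw [hDe]; exact hd.le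
    exact (ENNReal.ofReal_le_ofReal_iff hρ.le).1 this
  have hub : ∀ ξ ∈ F, μH[n] (F ∩ ball ξ D) ≤ ENNReal.ofReal (C₀ * D^n) := fun ξ hξ =>
    (hA ξ hξ D hD hDe.le).2
  have hcpt : IsCompact F := Metric.isCompact_of_isClosed_isBounded hF
    (Metric.isBounded_iff_ediam_ne_top.2 hbd)
  have hfin : μH[(n:ℝ)] F < ⊤ := by
    refine hcpt.measure_lt_top_of_nhdsWithin fun x hx => ?_
    exact ⟨F ∩ ball x D, inter_mem_nhdsWithin _ (ball_mem_nhds _ hD),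
      (hub x hx).trans_lt ENNReal.ofReal_lt_top⟩
  haveI : IsFiniteMeasure ((μH[(n:ℝ)] : Measure (Euc (n+1))).restrict F) := ⟨by simpa using hfin⟩
  have hT := ton ((μH[(n:ℝ)] : Measure (Euc (n+1))).restrict F) (ball z (2*D)) (D/2)
  have hdist : ∀ ξ ∈ F, ∀ y ∈ F, dist ξ y ≤ D := fun ξ hξ y hy => by
    have := Metric.edist_le_ediam_of_mem hξ hy
    rw [← hDe, edist_dist] at this
    exact (ENNReal.ofReal_le_ofReal_iff hD.le).1 this
  have h1 : ∫⁻ x in ball z (2*D), (μH[(n:ℝ)] : Measure (Euc (n+1))).restrict F (ball x (D/2))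
      ≤ ENNReal.ofReal (C₀ * D^n) * ENNReal.ofReal ((2*D)^(n+1) * vB (n+1)) := by
    rw [← vol_ballE z (by positivity), ← setLIntegral_const]
    refine lintegral_mono fun x => ?_
    rw [Measure.restrict_apply measurableSet_ball]
    by_cases hne : (ball x (D/2) ∩ F).Nonempty
    · obtain ⟨ξ, hξ, hξF⟩ := hne
      refine le_trans (measure_mono fun y hy => ?_) (hub ξ hξF)
      refine ⟨hy.2, ?_⟩
      have a := mem_ball.1 hξ
      have b := mem_ball.1 hy.1
      rw [mem_ball]
      have := dist_triangle_right y ξ x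
      linarith
    · rw [Set.not_nonempty_iff_eq_empty.1 hne]; simp
  have h2 : ENNReal.ofReal ((D/2)^(n+1) * vB (n+1)) * μH[(n:ℝ)] F ≤
      ∫⁻ ξ, volume.restrict (ball z (2*D)) (ball ξ (D/2)) ∂((μH[(n:ℝ)] : Measure (Euc (n+1))).restrict F) := by
    rw [← setLIntegral_const]
    refine setLIntegral_mono' hF.measurableSet fun ξ hξ => ?_
    rw [Measure.restrict_apply measurableSet_ball, ← vol_ballE ξ (by positivity)]
    refine measure_mono fun y hy => ⟨hy, ?_⟩
    rw [mem_ball] at hy ⊢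
    have := hdist ξ hξ z hz
    have := dist_triangle y ξ z
    linarith
  have h3 := h2.trans (hT ▸ h1)
  have hk : 0 < (D/2)^(n+1) * vB (n+1) := by positivity
  rw [← ENNReal.ofReal_mul (by positivity)] at h3
  have h4 : C₀ * D^n * ((2*D)^(n+1) * vB (n+1)) = ((D/2)^(n+1) * vB (n+1)) * (4^(n+1) * C₀ * D^n) := by
    have : (2*D) = 4 * (D/2) := by ring
    rw [this, mul_pow]; ring
  rw [h4, ENNReal.ofReal_mul hk.le] at h3
  have h5 := (ENNReal.mul_le_mul_iff_right (by simpa using hk) ENNReal.ofReal_ne_top).1 h3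
  refine (measure_mono inter_subset_left).trans (h5.trans (ENNReal.ofReal_le_ofReal ?_))
  gcongr

lemma ad_lower {n : ℕ} {C₀ Cl : ℝ} (hC : 1 ≤ C₀) (hCl : 1 ≤ Cl) {F R : Set (Euc (n+1))}
    (hA : ADRegular n C₀ F) (hRF : R ⊆ F) {l : ℝ} (hl : 0 < l)
    (hR : ENNReal.ofReal (Cl⁻¹ * l^n) ≤ μH[n] R)
    {z : Euc (n+1)} (hz : z ∈ F) {ρ : ℝ} (hρ : 0 < ρ) (hρl : ρ ≤ l) :
    ENNReal.ofReal ((C₀ * Cl)⁻¹ * ρ^n) ≤ μH[n] (F ∩ ball z ρ) := by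
  unfold ADRegular at hA
  have hC' : C₀ ≤ C₀ * Cl := by nlinarith
  have hCl' : Cl ≤ C₀ * Cl := by nlinarith
  by_cases hd : ENNReal.ofReal ρ ≤ EMetric.diam F
  · refine le_trans (ENNReal.ofReal_le_ofReal ?_) (hA z hz ρ hρ hd).1
    gcongr
  · push Not at hd
    have hsub : R ⊆ F ∩ ball z ρ := fun y hy => by
      refine ⟨hRF hy, ?_⟩
      have h := (Metric.edist_le_ediam_of_mem (hRF hy) hz).trans_lt hd
      rw [edist_dist] at h
      exact mem_ball.2 (ENNReal.ofReal_lt_ofReal_iff hρ |>.1 h)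
    refine le_trans (ENNReal.ofReal_le_ofReal ?_) (hR.trans (measure_mono hsub))
    gcongr

/-- Constant in the layer estimate. -/
def cLay (n : ℕ) (C₀ Cl : ℝ) : ℝ := 4^(n+1) * C₀ * 20^n * 2^(n+1) * vB (n+1) * (C₀ * Cl) * 2

lemma cLay_pos (n : ℕ) {C₀ Cl : ℝ} (hC : 1 ≤ C₀) (hCl : 1 ≤ Cl) : 0 < cLay n C₀ Cl := by
  have := vB_pos (n+1)
  unfold cLay; positivity

lemma layer {n : ℕ} (hn : 1 ≤ n) {C₀ Cl : ℝ} (hC : 1 ≤ C₀) (hCl : 1 ≤ Cl) {F R : Set (Euc (n+1))}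
    (hF : IsClosed F) (hA : ADRegular n C₀ F) (hRF : R ⊆ F) {l : ℝ} (hl : 0 < l)
    (hR : ENNReal.ofReal (Cl⁻¹ * l^n) ≤ μH[n] R)
    {z : Euc (n+1)} (hz : z ∈ F) {t : ℝ} (ht : 0 < t) (htl : 2 * t ≤ l) :
    volume.real {x ∈ ball z (13 * l) | infDist x F ≤ t} ≤ cLay n C₀ Cl * t * l^n := by
  have hvB := vB_pos (n+1)
  obtain ⟨s, hs⟩ : ∃ s, s = 2 * t := ⟨_, rfl⟩
  have hs0 : 0 < s := by linarith
  set E : Set (Euc (n+1)) := {x ∈ ball z (13 * l) | infDist x F ≤ t} with hE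
  have hEm : MeasurableSet E := by
    have : E = ball z (13*l) ∩ {x | infDist x F ≤ t} := rfl
    rw [this]
    exact measurableSet_ball.inter (isClosed_le (continuous_infDist_pt F) continuous_const).measurableSet
  set F' : Set (Euc (n+1)) := F ∩ ball z (20*l) with hF'
  have hub := ad_upper hn hC hF hA hz (ρ := 20 * l) (by positivity)
  haveI : IsFiniteMeasure ((μH[(n:ℝ)] : Measure (Euc (n+1))).restrict F') :=
    ⟨by simpa using hub.trans_lt ENNReal.ofReal_lt_top⟩
  have hT := ton ((μH[(n:ℝ)] : Measure (Euc (n+1))).restrict F') E (2*s)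
  have h1 : ENNReal.ofReal ((C₀ * Cl)⁻¹ * s^n) * volume E ≤
      ∫⁻ x in E, (μH[(n:ℝ)] : Measure (Euc (n+1))).restrict F' (ball x (2*s)) := by
    rw [← setLIntegral_const]
    refine setLIntegral_mono' hEm fun x hx => ?_
    obtain ⟨hxz, hxF⟩ := hx
    obtain ⟨ξ, hξ, hξd⟩ := (infDist_lt_iff ⟨z, hz⟩).1 (lt_of_le_of_lt hxF (show t < s by linarith))
    refine (ad_lower hC hCl hA hRF hl hR hξ hs0 (by linarith)).trans ?_
    rw [Measure.restrict_apply measurableSet_ball]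
    refine measure_mono fun y hy => ?_
    obtain ⟨hyF, hyb⟩ := hy
    rw [mem_ball] at hyb hxz
    have a := dist_triangle y ξ x
    rw [dist_comm ξ x] at a
    have b := dist_triangle y x z
    exact ⟨mem_ball.2 (by linarith), hyF, mem_ball.2 (by linarith)⟩
  have h2 : ∫⁻ ξ, volume.restrict E (ball ξ (2*s)) ∂((μH[(n:ℝ)] : Measure (Euc (n+1))).restrict F') ≤
      ENNReal.ofReal ((2*s)^(n+1) * vB (n+1)) * ENNReal.ofReal (4^(n+1) * C₀ * (20*l)^n) := by
    refine le_trans ?_ (mul_le_mul_right hub _)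
    rw [← setLIntegral_const]
    refine lintegral_mono fun ξ => ?_
    rw [← vol_ballE ξ (by positivity)]
    exact Measure.restrict_apply_le _ _
  have h3 := h1.trans (hT ▸ h2)
  have hk : 0 < (C₀ * Cl)⁻¹ * s^n := by positivity
  rw [← ENNReal.ofReal_mul (by positivity)] at h3
  have h4 : (2*s)^(n+1) * vB (n+1) * (4^(n+1) * C₀ * (20*l)^n) =
      ((C₀ * Cl)⁻¹ * s^n) * (cLay n C₀ Cl * t * l^n) := by
    unfold cLay
    rw [mul_pow, mul_pow, pow_succ s n, hs]
    field_simp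
  rw [h4, ENNReal.ofReal_mul hk.le] at h3
  have h5 := (ENNReal.mul_le_mul_iff_right (by simpa using hk) ENNReal.ofReal_ne_top).1 h3
  have hc := cLay_pos n hC hCl
  exact ENNReal.toReal_le_of_le_ofReal (by positivity) h5

lemma layer_null {n : ℕ} (hn : 1 ≤ n) {C₀ Cl : ℝ} (hC : 1 ≤ C₀) (hCl : 1 ≤ Cl) {F R : Set (Euc (n+1))}
    (hF : IsClosed F) (hA : ADRegular n C₀ F) (hRF : R ⊆ F) {l : ℝ} (hl : 0 < l)
    (hR : ENNReal.ofReal (Cl⁻¹ * l^n) ≤ μH[n] R)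
    {z : Euc (n+1)} (hz : z ∈ F) : volume (F ∩ ball z (13 * l)) = 0 := by
  have hc := cLay_pos n hC hCl
  have hfin : volume (F ∩ ball z (13*l)) ≠ ⊤ :=
    ((measure_mono inter_subset_right).trans_lt measure_ball_lt_top).ne
  have h0 : volume.real (F ∩ ball z (13*l)) ≤ 0 := by
    refine le_of_forall_pos_le_add fun e he => ?_
    have hk : 0 < cLay n C₀ Cl * l^n := by positivity
    have hmin : 0 < min (l/2) (e / (cLay n C₀ Cl * l^n)) := lt_min (by positivity) (by positivity)
    have h := layer hn hC hCl hF hA hRF hl hR hz (t := min (l/2) (e / (cLay n C₀ Cl * l^n))) hmin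
      (by have := min_le_left (l/2) (e / (cLay n C₀ Cl * l^n)); linarith)
    have h1 : volume.real (F ∩ ball z (13*l)) ≤ volume.real {x ∈ ball z (13 * l) | infDist x F ≤ min (l/2) (e / (cLay n C₀ Cl * l^n))} := by
      refine measureReal_mono (fun x hx => ⟨hx.2, ?_⟩)
        ((measure_mono (fun x hx => hx.1)).trans_lt (measure_ball_lt_top (x := z) (r := 13*l))).ne
      rw [infDist_zero_of_mem hx.1]; exact hmin.le
    have h2 : cLay n C₀ Cl * min (l/2) (e / (cLay n C₀ Cl * l^n)) * l^n ≤ e := by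
      have := min_le_right (l/2) (e / (cLay n C₀ Cl * l^n))
      calc _ = (cLay n C₀ Cl * l^n) * min (l/2) (e / (cLay n C₀ Cl * l^n)) := by ring
        _ ≤ (cLay n C₀ Cl * l^n) * (e / (cLay n C₀ Cl * l^n)) := by gcongr
        _ = e := by field_simp
    linarith
  have h1 : volume.real (F ∩ ball z (13*l)) = 0 := le_antisymm h0 measureReal_nonneg
  rw [measureReal_def, ENNReal.toReal_eq_zero_iff] at h1
  exact h1.resolve_right hfin


lemma cut_ex {d : ℕ} {s t : Set (Euc d)} (hs : IsClosed s) (ht : IsClosed t) (hst : Disjoint s t)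
    (hb : Bornology.IsBounded sᶜ) :
    ∃ f : Euc d → ℝ, ContDiff ℝ 1 f ∧ (∀ x ∈ s, f x = 0) ∧ (∀ x ∈ t, f x = 1) ∧
      (∀ x, 0 ≤ f x ∧ f x ≤ 1) ∧ ∃ C > 0, ∀ x, ‖fderiv ℝ f x‖ ≤ C := by
  obtain ⟨f, hf0, hf1, hf⟩ := exists_contMDiffMap_zero_one_of_isClosed (n := 1)
    (modelWithCornersSelf ℝ (Euc d)) hs ht hst
  have hfc : ContDiff ℝ 1 f := f.contMDiff.contDiff
  have hc : HasCompactSupport f := by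
    refine HasCompactSupport.intro hb.isCompact_closure fun x hx => ?_
    by_contra h
    exact hx (subset_closure fun hxs => h (hf0 hxs))
  obtain ⟨C, hC⟩ := (hc.fderiv (𝕜 := ℝ)).exists_bound_of_continuous
    (hfc.continuous_fderiv (by norm_num))
  refine ⟨f, hfc, fun x hx => hf0 hx, fun x hx => hf1 hx, fun x => ⟨(hf x).1, (hf x).2⟩,
    |C| + 1, by positivity, fun x => (hC x).trans (by have := le_abs_self C; linarith)⟩

lemma cut_scale {d : ℕ} {f : Euc d → ℝ} (hf : ContDiff ℝ 1 f) {C : ℝ} (hC : ∀ x, ‖fderiv ℝ f x‖ ≤ C)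
    (c : Euc d) {l : ℝ} (hl : 0 < l) :
    ContDiff ℝ 1 (fun x => f (l⁻¹ • (x - c))) ∧
      ∀ x, ‖fderiv ℝ (fun x => f (l⁻¹ • (x - c))) x‖ ≤ C / l := by
  refine ⟨hf.comp (by fun_prop), fun x => ?_⟩
  have h1 : HasFDerivAt (fun x : Euc d => l⁻¹ • (x - c)) (l⁻¹ • ContinuousLinearMap.id ℝ (Euc d)) x :=
    ((hasFDerivAt_id x).sub_const c).const_smul l⁻¹
  have h2 := ((hf.differentiable (by norm_num)) (l⁻¹ • (x - c))).hasFDerivAt.comp x h1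
  have h3 : fderiv ℝ (fun x => f (l⁻¹ • (x - c))) x = l⁻¹ • fderiv ℝ f (l⁻¹ • (x - c)) := by
    rw [show (fun x => f (l⁻¹ • (x - c))) = f ∘ (fun x => l⁻¹ • (x - c)) from rfl, h2.fderiv]
    ext v; simp
  rw [h3, norm_smul, Real.norm_of_nonneg (by positivity), div_eq_inv_mul]
  exact mul_le_mul_of_nonneg_left (hC _) (by positivity)

lemma chi_ex (d : ℕ) : ∃ C > 0, ∀ (q : Euc d) (s : ℝ), 0 < s → ∃ χ : Euc d → ℝ, ContDiff ℝ 1 χ ∧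
    (∀ x, dist x q ≤ 1.2 * s → χ x = 1) ∧ (∀ x, 1.8 * s ≤ dist x q → χ x = 0) ∧
    (∀ x, 0 ≤ χ x ∧ χ x ≤ 1) ∧ ∀ x, ‖fderiv ℝ χ x‖ ≤ C / s := by
  obtain ⟨f, h1, h2, h3, h4, C, hC, h5⟩ := cut_ex (d := d) (s := (ball 0 1.8)ᶜ)
    (t := closedBall 0 1.2) isOpen_ball.isClosed_compl isClosed_closedBall
    (by rw [disjoint_compl_left_iff_subset]; exact closedBall_subset_ball (by norm_num))
    (by rw [compl_compl]; exact isBounded_ball)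
  refine ⟨C, hC, fun q s hs => ?_⟩
  obtain ⟨g1, g2⟩ := cut_scale h1 h5 q hs
  have hn : ∀ x, ‖s⁻¹ • (x - q)‖ = dist x q / s := fun x => by
    rw [norm_smul, Real.norm_of_nonneg (by positivity), dist_eq_norm, div_eq_inv_mul]
  refine ⟨_, g1, fun x hx => h3 _ ?_, fun x hx => h2 _ ?_, fun x => h4 _, g2⟩
  · rw [mem_closedBall_zero_iff, hn, div_le_iff₀ hs]; exact hx
  · rw [mem_compl_iff, mem_ball_zero_iff, hn, not_lt, le_div_iff₀ hs]; exact hx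

lemma isClosed_cubeSet {d : ℕ} (c : Euc d) (l : ℝ) : IsClosed (cubeSet c l) := by
  have : cubeSet c l = ⋂ i, {y : Euc d | |y i - c i| ≤ l/2} := by
    ext y; simp [cubeSet]
  rw [this]
  exact isClosed_iInter fun i => isClosed_le (by fun_prop) continuous_const

lemma isOpen_openCube {d : ℕ} (c : Euc d) (l : ℝ) : IsOpen (openCube c l) := by
  have : openCube c l = ⋂ i, {y : Euc d | |y i - c i| < l/2} := by
    ext y; simp [openCube]
  rw [this]
  exact isOpen_iInter_of_finite fun i => isOpen_lt (by fun_prop) continuous_const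

lemma openCube_subset {d : ℕ} (c : Euc d) (l : ℝ) : openCube c l ⊆ cubeSet c l :=
  fun _ hy i => (hy i).le

lemma cubeSet_sub_open {d : ℕ} (c : Euc d) {l l' : ℝ} (h : l < l') : cubeSet c l ⊆ openCube c l' :=
  fun _ hy i => (hy i).trans_lt (by linarith)

lemma cubeSet_mono {d : ℕ} (c : Euc d) {l l' : ℝ} (h : l ≤ l') : cubeSet c l ⊆ cubeSet c l' :=
  fun _ hy i => (hy i).trans (by linarith)

lemma cube_norm {d : ℕ} {c y : Euc d} {l : ℝ} (h : y ∈ cubeSet c l) : dist y c ≤ Real.sqrt d * (l/2) := by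
  by_cases hd : Nonempty (Fin d)
  · obtain ⟨i0⟩ := hd
    have hl : 0 ≤ l/2 := (abs_nonneg _).trans (h i0)
    rw [EuclideanSpace.dist_eq]
    rw [← Real.sqrt_sq hl, ← Real.sqrt_mul (by positivity)]
    refine Real.sqrt_le_sqrt ?_
    calc ∑ i, dist (y i) (c i)^2 ≤ ∑ i : Fin d, (l/2)^2 := by
          refine Finset.sum_le_sum fun i _ => ?_
          rw [Real.dist_eq]
          exact pow_le_pow_left₀ (abs_nonneg _) (h i) 2
      _ = _ := by simp
  · rw [EuclideanSpace.dist_eq]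
    have : IsEmpty (Fin d) := not_nonempty_iff.1 hd
    have hd0 : d = 0 := by
      by_contra h
      exact hd ⟨⟨0, Nat.pos_of_ne_zero h⟩⟩
    subst hd0
    simp

lemma isCompact_cubeSet {d : ℕ} (c : Euc d) (l : ℝ) : IsCompact (cubeSet c l) :=
  Metric.isCompact_of_isClosed_isBounded (isClosed_cubeSet c l)
    (isBounded_closedBall.subset fun _ hy => mem_closedBall.2 (cube_norm hy))

lemma tau_ex (d : ℕ) : ∃ C > 0, ∀ (c : Euc d) (l : ℝ), 0 < l → ∃ τ : Euc d → ℝ, ContDiff ℝ 1 τ ∧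
    (∀ x ∈ cubeSet c (1.2 * l), τ x = 0) ∧ (∀ x, x ∉ openCube c (1.9 * l) → τ x = 1) ∧
    (∀ x, 0 ≤ τ x ∧ τ x ≤ 1) ∧ ∀ x, ‖fderiv ℝ τ x‖ ≤ C / l := by
  obtain ⟨f, h1, h2, h3, h4, C, hC, h5⟩ := cut_ex (d := d) (s := (openCube 0 1.9)ᶜ)
    (t := cubeSet 0 1.2) (isOpen_openCube _ _).isClosed_compl (isClosed_cubeSet _ _)
    (by rw [disjoint_compl_left_iff_subset]; exact cubeSet_sub_open _ (by norm_num))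
    (by rw [compl_compl]; exact (isCompact_cubeSet _ _).isBounded.subset (openCube_subset _ _))
  refine ⟨C, hC, fun c l hl => ?_⟩
  obtain ⟨g1, g2⟩ := cut_scale h1 h5 c hl
  have hn : ∀ (x : Euc d) i, |(l⁻¹ • (x - c)) i - (0 : Euc d) i| = |x i - c i| / l := fun x i => by
    simp only [PiLp.smul_apply, PiLp.sub_apply, smul_eq_mul, PiLp.zero_apply, sub_zero]
    rw [abs_mul, abs_of_pos (inv_pos.2 hl), div_eq_inv_mul]
  refine ⟨fun x => 1 - f (l⁻¹ • (x - c)), contDiff_const.sub g1, fun x hx => ?_, fun x hx => ?_,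
    fun x => ?_, fun x => ?_⟩
  · show 1 - f (l⁻¹ • (x - c)) = 0
    rw [h3, sub_self]
    intro i
    rw [hn, div_le_iff₀ hl]
    have := hx i; linarith
  · show 1 - f (l⁻¹ • (x - c)) = 1
    rw [h2, sub_zero]
    intro h
    apply hx
    intro i
    have := h i
    rw [hn, div_lt_iff₀ hl] at this; linarith
  · have := h4 (l⁻¹ • (x - c)); constructor <;> linarith [this.1, this.2]
  · rw [fderiv_const_sub, norm_neg]; exact g2 x

lemma fderiv_zero_of_eqOn {d : ℕ} {f : Euc d → ℝ} {U : Set (Euc d)} (hU : IsOpen U) {a : ℝ}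
    (h : ∀ x ∈ U, f x = a) {x : Euc d} (hx : x ∈ U) : fderiv ℝ f x = 0 := by
  have : f =ᶠ[𝓝 x] fun _ => a := by
    filter_upwards [hU.mem_nhds hx] with y hy using h y hy
  rw [this.fderiv_eq (𝕜 := ℝ)]; simp

lemma prod_fderiv {d : ℕ} {ι : Type*} [DecidableEq ι] (B : Finset ι) {τ : ι → Euc d → ℝ}
    (h : ∀ i ∈ B, ContDiff ℝ 1 (τ i)) (h1 : ∀ i ∈ B, ∀ x, 0 ≤ τ i x ∧ τ i x ≤ 1) (x : Euc d) :
    ‖fderiv ℝ (fun x => ∏ i ∈ B, τ i x) x‖ ≤ ∑ i ∈ B, ‖fderiv ℝ (τ i) x‖ := by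
  have := HasFDerivAt.finsetProd (u := B) (g := τ) (g' := fun i => fderiv ℝ (τ i) x) (x := x)
    (fun i hi => ((h i hi).differentiable (by norm_num) x).hasFDerivAt)
  rw [this.fderiv]
  refine (norm_sum_le _ _).trans (Finset.sum_le_sum fun i hi => ?_)
  rw [norm_smul, Real.norm_eq_abs, abs_of_nonneg
    (Finset.prod_nonneg fun j hj => (h1 j (Finset.mem_of_mem_erase hj) x).1)]
  exact mul_le_of_le_one_left (norm_nonneg _) (Finset.prod_le_one
    (fun j hj => (h1 j (Finset.mem_of_mem_erase hj) x).1) fun j hj => (h1 j (Finset.mem_of_mem_erase hj) x).2)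

open Classical in
lemma phi_ex (d : ℕ) : ∃ C > 0, ∀ (V : Set (Euc d)), IsOpen V → ∀ (B : Finset (Euc d × ℝ)),
    (∀ I ∈ B, 0 < I.2) → ∀ q ∈ V, ∀ r : ℝ, 0 < r →
    (∀ x ∈ frontier V, dist x q ≤ 1.9 * r → ∃ I ∈ B, x ∈ openCube I.1 (1.2 * I.2)) →
    (∀ I ∈ B, q ∉ cubeSet I.1 (1.9 * I.2)) →
    ∃ (φ : Euc d → ℝ) (ρ : ℝ), ContDiff ℝ 1 φ ∧ HasCompactSupport φ ∧ tsupport φ ⊆ V ∧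
      tsupport φ ⊆ closedBall q (1.8 * r) ∧ 0 < ρ ∧ ball q ρ ⊆ V ∧ (∀ x ∈ ball q ρ, φ x = 1) ∧
      ∀ x, ‖gradient φ x‖ ≤ C * ((∑ I ∈ B, (cubeSet I.1 (2 * I.2)).indicator (fun _ => 1 / I.2) x) +
        {x | 1.2 * r ≤ dist x q ∧ dist x q ≤ 1.8 * r}.indicator (fun _ => 1 / r) x) := by
  obtain ⟨C1, hC1, H1⟩ := chi_ex d
  obtain ⟨C2, hC2, H2⟩ := tau_ex d
  refine ⟨C1 + C2, by positivity, fun V hV B hB q hq r hr hcov hqB => ?_⟩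
  obtain ⟨χ, χc, χ1, χ0, χb, χd⟩ := H1 q r hr
  have H2' : ∀ I : Euc d × ℝ, ∃ τ : Euc d → ℝ, I ∈ B → ContDiff ℝ 1 τ ∧
    (∀ x ∈ cubeSet I.1 (1.2 * I.2), τ x = 0) ∧ (∀ x, x ∉ openCube I.1 (1.9 * I.2) → τ x = 1) ∧
    (∀ x, 0 ≤ τ x ∧ τ x ≤ 1) ∧ ∀ x, ‖fderiv ℝ τ x‖ ≤ C2 / I.2 := fun I => by
    by_cases hI : I ∈ B
    · obtain ⟨τ, h⟩ := H2 I.1 I.2 (hB I hI)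
      exact ⟨τ, fun _ => h⟩
    · exact ⟨0, fun h => absurd h hI⟩
  choose τ hτ using H2'
  set ψ : Euc d → ℝ := fun x => ∏ I ∈ B, τ I x with hψ
  have ψc : ContDiff ℝ 1 ψ := contDiff_prod fun I hI => (hτ I hI).1
  have ψb : ∀ x, 0 ≤ ψ x ∧ ψ x ≤ 1 := fun x =>
    ⟨Finset.prod_nonneg fun I hI => ((hτ I hI).2.2.2.1 x).1,
      Finset.prod_le_one (fun I hI => ((hτ I hI).2.2.2.1 x).1) fun I hI => ((hτ I hI).2.2.2.1 x).2⟩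
  set φ : Euc d → ℝ := V.indicator (fun x => χ x * ψ x) with hφ
  have hz : ∀ x, x ∉ V → φ =ᶠ[𝓝 x] fun _ => 0 := by
    intro x hx
    by_cases hcl : x ∈ closure V
    · have hfr : x ∈ frontier V := by rw [hV.frontier_eq]; exact ⟨hcl, hx⟩
      by_cases hd : dist x q ≤ 1.9 * r
      · obtain ⟨I, hI, hxI⟩ := hcov x hfr hd
        filter_upwards [(isOpen_openCube _ _).mem_nhds hxI] with y hy
        have : ψ y = 0 := Finset.prod_eq_zero hI ((hτ I hI).2.1 y (openCube_subset _ _ hy))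
        simp [hφ, indicator, this]
      · push Not at hd
        have : {y | 1.8 * r < dist y q} ∈ 𝓝 x :=
          (isOpen_lt continuous_const (by fun_prop)).mem_nhds (show 1.8 * r < dist x q by nlinarith)
        filter_upwards [this] with y hy
        have : χ y = 0 := χ0 y (le_of_lt hy)
        simp [hφ, indicator, this]
    · filter_upwards [isClosed_closure.isOpen_compl.mem_nhds hcl] with y hy
      exact indicator_of_notMem (fun h => hy (subset_closure h)) _
  have hin : ∀ x ∈ V, φ =ᶠ[𝓝 x] fun x => χ x * ψ x := fun x hx => by
    filter_upwards [hV.mem_nhds hx] with y hy using indicator_of_mem hy _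
  have φc : ContDiff ℝ 1 φ := by
    rw [contDiff_iff_contDiffAt]
    intro x
    by_cases hx : x ∈ V
    · exact (χc.mul ψc).contDiffAt.congr_of_eventuallyEq (hin x hx)
    · exact (contDiffAt_const (𝕜 := ℝ)).congr_of_eventuallyEq (hz x hx)
  have hsV : tsupport φ ⊆ V := by
    intro x hx
    by_contra h
    exact (notMem_tsupport_iff_eventuallyEq.2 (hz x h)) hx
  have hsB : tsupport φ ⊆ closedBall q (1.8 * r) := by
    refine closure_minimal (fun x hx => ?_) isClosed_closedBall
    by_contra h
    rw [mem_closedBall, not_le] at h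
    apply hx
    simp [hφ, indicator, χ0 x h.le]
  have hnq : ∀ᶠ x in 𝓝 q, x ∈ V ∧ χ x = 1 ∧ ψ x = 1 := by
    refine Filter.Eventually.and (hV.mem_nhds hq) (Filter.Eventually.and ?_ ?_)
    · filter_upwards [ball_mem_nhds q (show 0 < 1.2 * r by positivity)] with y hy
      exact χ1 y (mem_ball.1 hy).le
    · have : ∀ᶠ x in 𝓝 q, ∀ I ∈ B, τ I x = 1 := by
        rw [Filter.eventually_all_finset]
        intro I hI
        filter_upwards [(isClosed_cubeSet _ _).isOpen_compl.mem_nhds (hqB I hI)] with y hy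
        exact (hτ I hI).2.2.1 y fun h => hy (openCube_subset _ _ h)
      filter_upwards [this] with y hy
      exact Finset.prod_eq_one hy
  obtain ⟨ρ, hρ, hρb⟩ := Metric.eventually_nhds_iff_ball.1 hnq
  refine ⟨φ, ρ, φc, HasCompactSupport.of_support_subset_isCompact (isCompact_closedBall q (1.8*r))
    (subset_closure.trans hsB), hsV, hsB, hρ, fun x hx => (hρb x hx).1, fun x hx => ?_, fun x => ?_⟩
  · obtain ⟨a, b, c⟩ := hρb x hx
    rw [hφ, indicator_of_mem a, b, c, mul_one]
  rw [norm_grad]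
  have hS : 0 ≤ ∑ I ∈ B, (cubeSet I.1 (2 * I.2)).indicator (fun _ => 1 / I.2) x :=
    Finset.sum_nonneg fun I hI => indicator_nonneg (fun _ _ => by have := hB I hI; positivity) _
  have hX : 0 ≤ {x | 1.2 * r ≤ dist x q ∧ dist x q ≤ 1.8 * r}.indicator (fun _ => 1 / r) x :=
    indicator_nonneg (fun _ _ => by positivity) _
  by_cases hx : x ∈ V
  swap
  · rw [(hz x hx).fderiv_eq (𝕜 := ℝ)]
    simp only [fderiv_fun_const, Pi.zero_apply, norm_zero]
    positivity
  rw [(hin x hx).fderiv_eq (𝕜 := ℝ), fderiv_fun_mul (χc.differentiable (by norm_num) x)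
    (ψc.differentiable (by norm_num) x)]
  have n1 : ‖fderiv ℝ ψ x‖ ≤ C2 * ∑ I ∈ B, (cubeSet I.1 (2 * I.2)).indicator (fun _ => 1 / I.2) x := by
    refine (prod_fderiv B (fun I hI => (hτ I hI).1) (fun I hI => (hτ I hI).2.2.2.1) x).trans ?_
    rw [Finset.mul_sum]
    refine Finset.sum_le_sum fun I hI => ?_
    by_cases hxI : x ∈ cubeSet I.1 (2 * I.2)
    · rw [indicator_of_mem hxI]
      refine ((hτ I hI).2.2.2.2 x).trans (le_of_eq (by ring))
    · rw [indicator_of_notMem hxI, mul_zero]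
      rw [fderiv_zero_of_eqOn (isClosed_cubeSet I.1 (1.9 * I.2)).isOpen_compl (a := 1)
        (fun y hy => (hτ I hI).2.2.1 y fun h => hy (openCube_subset _ _ h))
        (fun h => hxI (cubeSet_mono _ (by have := hB I hI; linarith) h))]
      simp
  have n2 : ‖fderiv ℝ χ x‖ ≤ C1 * {x | 1.2 * r ≤ dist x q ∧ dist x q ≤ 1.8 * r}.indicator (fun _ => 1 / r) x := by
    by_cases hxI : x ∈ {x | 1.2 * r ≤ dist x q ∧ dist x q ≤ 1.8 * r}
    · rw [indicator_of_mem hxI]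
      exact (χd x).trans (le_of_eq (by ring))
    · rw [indicator_of_notMem hxI, mul_zero]
      by_cases hlt : dist x q < 1.2 * r
      · rw [fderiv_zero_of_eqOn (isOpen_ball (x := q) (ε := 1.2 * r)) (a := 1)
          (fun y hy => χ1 y (mem_ball.1 hy).le) (mem_ball.2 hlt)]; simp
      · have : 1.8 * r < dist x q := by
          by_contra h
          exact hxI ⟨not_lt.1 hlt, not_lt.1 h⟩
        rw [fderiv_zero_of_eqOn (isClosed_closedBall (x := q) (ε := 1.8 * r)).isOpen_compl (a := 0)
          (fun y hy => χ0 y (by rw [mem_compl_iff, mem_closedBall, not_le] at hy; exact hy.le))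
          (by rw [mem_compl_iff, mem_closedBall, not_le]; exact this)]; simp
  refine (norm_add_le _ _).trans ?_
  rw [norm_smul, norm_smul, Real.norm_of_nonneg (χb x).1, Real.norm_of_nonneg (ψb x).1]
  have m1 := mul_le_of_le_one_left (norm_nonneg (fderiv ℝ ψ x)) (χb x).2
  have m2 := mul_le_of_le_one_left (norm_nonneg (fderiv ℝ χ x)) (ψb x).2
  nlinarith [mul_nonneg hC1.le hS, mul_nonneg hC2.le hX]


/-- The flux density of the pair of Green functions. -/
def JJ (n : ℕ) (Ω : Set (Euc (n+1))) (p q x : Euc (n+1)) : ℝ :=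
  ‖greenFn n Ω p x • gradient (greenFn n Ω q) x - greenFn n Ω q x • gradient (greenFn n Ω p) x‖

lemma JJ_nonneg (n : ℕ) (Ω : Set (Euc (n+1))) (p q x : Euc (n+1)) : 0 ≤ JJ n Ω p q x := norm_nonneg _

lemma int_inv_norm (n : ℕ) (R : ℝ) (q : Euc (n+1)) :
    IntegrableOn (fun x : Euc (n+1) => (‖x - q‖^n)⁻¹) (ball q R) := by
  have h : Integrable (fun x : Euc (n+1) => (Iio R).indicator (fun y : ℝ => (y^n)⁻¹) ‖x‖) := by
    rw [integrable_fun_norm_addHaar volume (f := (Iio R).indicator (fun y : ℝ => (y^n)⁻¹))]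
    have h1 : IntegrableOn ((Iio R).indicator (fun _ : ℝ => (1:ℝ))) (Ioi 0) := by
      rw [IntegrableOn, integrable_indicator_iff measurableSet_Iio, IntegrableOn,
        Measure.restrict_restrict measurableSet_Iio]
      rw [show Iio R ∩ Ioi 0 = Ioo 0 R by ext y; simp [and_comm]]
      exact integrableOn_const (by simp)
    refine h1.congr_fun (fun y hy => ?_) measurableSet_Ioi
    have hy' : (y:ℝ) ≠ 0 := ne_of_gt hy
    simp only [finrank_euclideanSpace, Fintype.card_fin, Nat.add_sub_cancel, smul_eq_mul, indicator]
    split_ifs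
    · field_simp
    · simp
  have h2 := h.comp_sub_right q
  rw [← integrable_indicator_iff measurableSet_ball]
  convert! h2 using 1

lemma grad_Phi_le {n : ℕ} (hn : 1 ≤ n) {q x : Euc (n+1)} (hx : x ≠ q) :
    ‖gradient (Phi n q) x‖ ≤ cG (n+1) * (‖x - q‖^n)⁻¹ := by
  have h0 : 0 < ‖x - q‖ := norm_pos_iff.2 (sub_ne_zero.2 hx)
  rw [norm_grad]
  have h := (Phi_har n q).grad_le_pos (x := x) (fun y _ => Phi_nonneg n q y) h0 (fun y hy => by
    rw [mem_ball] at hy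
    rw [mem_compl_iff, mem_singleton_iff]
    rintro rfl
    rw [dist_comm, dist_eq_norm] at hy
    exact lt_irrefl _ hy)
  refine h.trans (le_of_eq ?_)
  unfold Phi
  obtain ⟨m, rfl⟩ : ∃ m, n = m + 1 := ⟨n - 1, by omega⟩
  rw [show (1:ℤ) - ((m+1 : ℕ) : ℤ) = -(m:ℤ) by push_cast; ring, zpow_neg, zpow_natCast, pow_succ]
  field_simp

lemma Phi_le_inv {n : ℕ} (hn : 1 ≤ n) {q x : Euc (n+1)} (hx : x ≠ q) {R : ℝ} (hR : ‖x - q‖ ≤ R) :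
    Phi n q x ≤ R * (‖x - q‖^n)⁻¹ := by
  have h0 : 0 < ‖x - q‖ := norm_pos_iff.2 (sub_ne_zero.2 hx)
  unfold Phi
  obtain ⟨m, rfl⟩ : ∃ m, n = m + 1 := ⟨n - 1, by omega⟩
  rw [show (1:ℤ) - ((m+1 : ℕ) : ℤ) = -(m:ℤ) by push_cast; ring, zpow_neg, zpow_natCast, pow_succ,
    mul_inv, mul_comm, mul_assoc]
  have : 1 ≤ ‖x - q‖⁻¹ * R := by rw [inv_mul_eq_div, one_le_div h0]; exact hR
  have h2 : 0 ≤ (‖x - q‖^m)⁻¹ := by positivity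
  nlinarith

lemma grad_green {n : ℕ} (hn : 1 ≤ n) {Ω : Set (Euc (n+1))} (hΩ : IsOpen Ω) {q x : Euc (n+1)}
    (hq : q ∈ Ω) (hx : x ∈ Ω) (hxq : x ≠ q) :
    ‖gradient (greenFn n Ω q) x‖ ≤ ‖gradient (Phi n q) x‖ + ‖gradient (perron Ω (Phi n q)) x‖ := by
  rw [norm_grad, norm_grad, norm_grad]
  have e : greenFn n Ω q = fun y => Phi n q y - perron Ω (Phi n q) y := rfl
  have d1 : DifferentiableAt ℝ (Phi n q) x := (Phi_contDiffAt n hxq).differentiableAt (by norm_num)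
  have d2 : DifferentiableAt ℝ (perron Ω (Phi n q)) x :=
    (((P_har hn hΩ hq).contDiffOn hΩ).contDiffAt (hΩ.mem_nhds hx)).differentiableAt (by norm_num)
  rw [e, fderiv_fun_sub d1 d2]
  exact norm_sub_le _ _

lemma JJ_contOn {n : ℕ} (hn : 1 ≤ n) {Ω : Set (Euc (n+1))} (hΩ : IsOpen Ω) {p q : Euc (n+1)}
    (hp : p ∈ Ω) (hq : q ∈ Ω) : ContinuousOn (JJ n Ω p q) ((Ω \ {p}) \ {q}) := by
  have h1 := green_har hn hΩ hp
  have h2 := green_har hn hΩ hq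
  have o1 : IsOpen (Ω \ {p}) := hΩ.sdiff isClosed_singleton
  have o2 : IsOpen (Ω \ {q}) := hΩ.sdiff isClosed_singleton
  have s1 : (Ω \ {p}) \ {q} ⊆ Ω \ {p} := fun x hx => hx.1
  have s2 : (Ω \ {p}) \ {q} ⊆ Ω \ {q} := fun x hx => ⟨hx.1.1, hx.2⟩
  exact (((h1.1.mono s1).smul ((grad_contOn o2 (h2.contDiffOn o2)).mono s2)).sub
    ((h2.1.mono s2).smul ((grad_contOn o1 (h1.contDiffOn o1)).mono s1))).norm

lemma JJ_int {n : ℕ} (hn : 1 ≤ n) {Ω : Set (Euc (n+1))} (hΩ : IsOpen Ω) {p q : Euc (n+1)}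
    (hp : p ∈ Ω) (hq : q ∈ Ω) {K : Set (Euc (n+1))} (hK : IsCompact K) (hKΩ : K ⊆ Ω) (hpK : p ∉ K) :
    IntegrableOn (JJ n Ω p q) K := by
  have h1 := green_har hn hΩ hp
  have hP := P_har hn hΩ hq
  have o1 : IsOpen (Ω \ {p}) := hΩ.sdiff isClosed_singleton
  have s1 : K ⊆ Ω \ {p} := fun x hx => ⟨hKΩ hx, fun h => hpK (by rw [mem_singleton_iff] at h; rwa [← h])⟩
  obtain ⟨a, ha⟩ := hK.exists_bound_of_continuousOn (h1.1.mono s1)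
  obtain ⟨b, hb⟩ := hK.exists_bound_of_continuousOn ((grad_contOn o1 (h1.contDiffOn o1)).mono s1)
  obtain ⟨e, he⟩ := hK.exists_bound_of_continuousOn (hP.1.mono hKΩ)
  obtain ⟨f, hf⟩ := hK.exists_bound_of_continuousOn ((grad_contOn hΩ (hP.contDiffOn hΩ)).mono hKΩ)
  obtain ⟨R, hR⟩ := hK.isBounded.subset_ball q
  have hRn : ∀ x ∈ K, ‖x - q‖ ≤ R := fun x hx => by
    have := hR hx; rw [mem_ball, dist_eq_norm] at this; exact this.le
  have hg : IntegrableOn (fun x : Euc (n+1) => (|a| * cG (n+1) + |b| * |R|) * (‖x - q‖^n)⁻¹ + (|a| * |f| + |b| * |e|)) K :=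
    Integrable.add (((int_inv_norm n R q).mono_set hR).const_mul _)
      (integrableOn_const hK.measure_lt_top.ne)
  have hae : (K \ {q} : Set (Euc (n+1))) =ᵐ[volume] K := by
    refine sdiff_ae_eq_self.2 (measure_mono_null inter_subset_right ?_)
    simp
  refine IntegrableOn.congr_set_ae ?_ hae.symm
  refine Integrable.mono' (hg.mono_set sdiff_subset) ?_ ?_
  · refine ((JJ_contOn hn hΩ hp hq).mono fun x hx => ⟨s1 hx.1, hx.2⟩).aestronglyMeasurable
      (hK.measurableSet.diff (measurableSet_singleton q))
  · refine (ae_restrict_iff' (hK.measurableSet.diff (measurableSet_singleton q))).2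
      (Eventually.of_forall fun x hx => ?_)
    obtain ⟨hxK, hxq⟩ := hx
    have hxq' : x ≠ q := hxq
    rw [Real.norm_of_nonneg (JJ_nonneg _ _ _ _ _)]
    have g1 := grad_green hn hΩ hq (hKΩ hxK) hxq'
    have g2 := grad_Phi_le hn hxq'
    have g3 := Phi_le_inv hn hxq' ((hRn x hxK).trans (le_abs_self R))
    have g4 : |greenFn n Ω q x| ≤ Phi n q x + |perron Ω (Phi n q) x| := by
      rw [green_eq]
      refine (abs_sub _ _).trans ?_
      rw [abs_of_nonneg (Phi_nonneg n q x)]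
    have a1 := (ha x hxK).trans (le_abs_self a)
    have b1 := (hb x hxK).trans (le_abs_self b)
    have e1 := (he x hxK).trans (le_abs_self e)
    have f1 := (hf x hxK).trans (le_abs_self f)
    rw [Real.norm_eq_abs] at a1 e1
    unfold JJ
    refine (norm_sub_le _ _).trans ?_
    rw [norm_smul, norm_smul, Real.norm_eq_abs, Real.norm_eq_abs]
    calc _ ≤ |a| * (cG (n+1) * (‖x - q‖^n)⁻¹ + |f|) + (|R| * (‖x - q‖^n)⁻¹ + |e|) * |b| := by
          refine add_le_add (mul_le_mul a1 (g1.trans (add_le_add g2 f1)) (norm_nonneg _) (abs_nonneg _))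
            (mul_le_mul (g4.trans (add_le_add g3 e1)) b1 (norm_nonneg _) (by positivity))
      _ = _ := by ring


lemma flux_core {n : ℕ} (hn : 2 ≤ n) {Ω : Set (Euc (n+1))} (hΩ : IsOpen Ω) {p q : Euc (n+1)}
    (hp : p ∈ Ω) (hq : q ∈ Ω) {U : Set (Euc (n+1))} (hU : IsOpen U) (hUΩ : U ⊆ Ω \ {p})
    {φ : Euc (n+1) → ℝ} {ρ : ℝ} (hρ : 0 < ρ) (hb : ball q ρ ⊆ U) (hφ : ContDiff ℝ 1 φ)
    (hc : HasCompactSupport φ) (hs : tsupport φ ⊆ U) (h1 : ∀ x ∈ ball q ρ, φ x = 1)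
    {B : Finset (Euc (n+1) × ℝ)} (hB0 : ∀ I ∈ B, 0 < I.2)
    (hB : ∀ I ∈ B, cubeSet I.1 (2*I.2) ⊆ Ω) (hBp : ∀ I ∈ B, p ∉ cubeSet I.1 (2*I.2))
    {K : Set (Euc (n+1))} (hK : IsCompact K) (hKΩ : K ⊆ Ω) (hpK : p ∉ K) {r C : ℝ} (hr : 0 < r)
    (hC : 0 ≤ C)
    (hg : ∀ x, ‖gradient φ x‖ ≤ C * ((∑ I ∈ B, (cubeSet I.1 (2*I.2)).indicator (fun _ => 1/I.2) x)
      + K.indicator (fun _ => 1/r) x)) :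
    greenFn n Ω p q ≤ |cF n| * C * ((∑ I ∈ B, 1/I.2 * ∫ x in cubeSet I.1 (2*I.2), JJ n Ω p q x)
      + 1/r * ∫ x in K, JJ n Ω p q x) := by
  have hn1 : 1 ≤ n := by omega
  have h := flux hn hU ((green_har hn1 hΩ hp).mono hUΩ)
    (fun x hx => green_nonneg hn1 hΩ hp (hUΩ hx).1 (hUΩ hx).2)
    ((P_har hn1 hΩ hq).mono (fun x hx => (hUΩ hx).1)) hρ hb hφ hc hs h1
  have h' : greenFn n Ω p q ≤ |cF n| * ∫ x, ‖gradient φ x‖ * JJ n Ω p q x := by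
    refine h.trans (mul_le_mul_of_nonneg_right (le_abs_self _) ?_)
    exact integral_nonneg (fun x => by positivity)
  refine h'.trans ?_
  rw [mul_assoc]
  refine mul_le_mul_of_nonneg_left ?_ (abs_nonneg _)
  have iI : ∀ I ∈ B, Integrable (fun x => 1/I.2 * (cubeSet I.1 (2*I.2)).indicator (JJ n Ω p q) x) :=
    fun I hI => ((integrable_indicator_iff (isClosed_cubeSet _ _).measurableSet).2
      (JJ_int hn1 hΩ hp hq (isCompact_cubeSet _ _) (hB I hI) (hBp I hI))).const_mul _
  have iK : Integrable (fun x => 1/r * K.indicator (JJ n Ω p q) x) :=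
    ((integrable_indicator_iff hK.isClosed.measurableSet).2
      (JJ_int hn1 hΩ hp hq hK hKΩ hpK)).const_mul _
  have e : C * ((∑ I ∈ B, 1/I.2 * ∫ x in cubeSet I.1 (2*I.2), JJ n Ω p q x)
      + 1/r * ∫ x in K, JJ n Ω p q x) =
      ∫ x, C * ((∑ I ∈ B, 1/I.2 * (cubeSet I.1 (2*I.2)).indicator (JJ n Ω p q) x)
        + 1/r * K.indicator (JJ n Ω p q) x) := by
    rw [integral_const_mul, integral_add (integrable_finsetSum _ iI) iK, integral_finsetSum _ iI,
      integral_const_mul, integral_indicator hK.isClosed.measurableSet]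
    congr 2
    refine Finset.sum_congr rfl (fun I hI => ?_)
    rw [integral_const_mul, integral_indicator (isClosed_cubeSet _ _).measurableSet]
  rw [e]
  refine integral_mono_of_nonneg (Eventually.of_forall (fun x => ?_))
    (((integrable_finsetSum _ iI).add iK).const_mul C) (Eventually.of_forall (fun x => ?_))
  · exact mul_nonneg (norm_nonneg _) (JJ_nonneg _ _ _ _ _)
  · refine (mul_le_mul_of_nonneg_right (hg x) (JJ_nonneg n Ω p q x)).trans (le_of_eq ?_)
    show _ = C * ((∑ I ∈ B, 1/I.2 * (cubeSet I.1 (2*I.2)).indicator (JJ n Ω p q) x)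
        + 1/r * K.indicator (JJ n Ω p q) x)
    rw [mul_assoc, add_mul, Finset.sum_mul]
    congr 2
    · refine Finset.sum_congr rfl (fun I hI => ?_)
      by_cases hx : x ∈ cubeSet I.1 (2*I.2) <;> simp [hx]
    · by_cases hx : x ∈ K <;> simp [hx]

lemma ball_sub_cube {d : ℕ} {c q : Euc d} {a b s : ℝ} (hq : q ∈ cubeSet c a) (hab : a/2 + s ≤ b/2) :
    closedBall q s ⊆ cubeSet c b := by
  intro x hx i
  have h1 := hq i
  have h2 : |x i - q i| ≤ s := by
    have := PiLp.norm_apply_le (x - q) i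
    rw [mem_closedBall, dist_eq_norm] at hx
    exact this.trans hx
  have : x i - c i = (x i - q i) + (q i - c i) := by ring
  rw [this]
  exact (abs_add_le _ _).trans (by linarith)

lemma flux2 (n : ℕ) (hn : 2 ≤ n) : ∃ C > 0, ∀ Ω : Set (Euc (n+1)), IsOpen Ω → ∀ p ∈ Ω, ∀ q ∈ Ω,
    ∀ r : ℝ, 0 < r → (∀ x, dist x q < 2*r → r ≤ dist x p) →
    ∀ V : Set (Euc (n+1)), IsOpen V → V ⊆ Ω → q ∈ V → ∀ B : Set (Euc (n+1) × ℝ),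
    (∀ I ∈ B, 0 < I.2 ∧ cubeSet I.1 (10*I.2) ⊆ Ω) →
    (∀ x ∈ frontier V, dist x q ≤ 1.9*r → ∃ I ∈ B, x ∈ cubeSet I.1 (1.1*I.2) ∧
      p ∉ cubeSet I.1 (2*I.2)) →
    ∃ (B0 : Finset (Euc (n+1) × ℝ)) (K : Set (Euc (n+1))), ↑B0 ⊆ B ∧ IsCompact K ∧ K ⊆ V ∧
      (∀ x ∈ K, 1.2*r ≤ dist x q ∧ dist x q ≤ 1.8*r) ∧
      greenFn n Ω p q ≤ C * ((∑ I ∈ B0, 1/I.2 * ∫ x in cubeSet I.1 (2*I.2), JJ n Ω p q x)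
      + 1/r * ∫ x in K, JJ n Ω p q x) := by
  obtain ⟨C1, hC1, H1⟩ := phi_ex (n+1)
  obtain ⟨C2, hC2, H2⟩ := chi_ex (n+1)
  refine ⟨|cF n| * (C1 + 100*C2) + 1, by positivity, ?_⟩
  intro Ω hΩ p hp q hq r hr hpr V hV hVΩ hqV B hB hcov
  have hfin : ∀ (B0 : Finset (Euc (n+1) × ℝ)) (K : Set (Euc (n+1))) (C : ℝ), 0 ≤ C →
      (∀ I ∈ B0, 0 < I.2) → C ≤ C1 + 100*C2 →
      greenFn n Ω p q ≤ |cF n| * C * ((∑ I ∈ B0, 1/I.2 * ∫ x in cubeSet I.1 (2*I.2), JJ n Ω p q x)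
      + 1/r * ∫ x in K, JJ n Ω p q x) → greenFn n Ω p q ≤ (|cF n| * (C1 + 100*C2) + 1) *
        ((∑ I ∈ B0, 1/I.2 * ∫ x in cubeSet I.1 (2*I.2), JJ n Ω p q x)
      + 1/r * ∫ x in K, JJ n Ω p q x) := by
    intro B0 K C hC hI hle h
    refine h.trans (mul_le_mul_of_nonneg_right ?_ ?_)
    · have := mul_le_mul_of_nonneg_left hle (abs_nonneg (cF n))
      linarith
    · refine add_nonneg (Finset.sum_nonneg (fun I h => mul_nonneg ?_ ?_)) (mul_nonneg ?_ ?_)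
      · have := hI I h
        positivity
      · exact integral_nonneg (fun x => JJ_nonneg _ _ _ _ _)
      · positivity
      · exact integral_nonneg (fun x => JJ_nonneg _ _ _ _ _)
  by_cases hA : ∃ I ∈ B, p ∉ cubeSet I.1 (2*I.2) ∧ q ∈ cubeSet I.1 (1.9*I.2)
  · obtain ⟨I, hI, hpI, hqI⟩ := hA
    have hl := (hB I hI).1
    have hs : 0 < I.2/100 := by positivity
    obtain ⟨χ, c1, c2, c3, c4, c5⟩ := H2 q (I.2/100) hs
    have hsub : closedBall q (2*(I.2/100)) ⊆ cubeSet I.1 (2*I.2) := ball_sub_cube hqI (by linarith)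
    have h2Ω : cubeSet I.1 (2*I.2) ⊆ Ω := (cubeSet_mono _ (by linarith)).trans (hB I hI).2
    have hts : tsupport χ ⊆ closedBall q (1.8*(I.2/100)) := by
      refine closure_minimal (fun x hx => ?_) isClosed_closedBall
      by_contra hh
      rw [mem_closedBall, not_le] at hh
      exact hx (c3 x hh.le)
    refine ⟨{I}, ∅, by simpa using hI, isCompact_empty, empty_subset _, by simp, ?_⟩
    refine hfin _ _ (100*C2) (by positivity) (by simpa using hl) (by linarith) ?_
    refine flux_core hn hΩ hp hq (U := ball q (2*(I.2/100))) isOpen_ball ?_ (ρ := 1.2*(I.2/100))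
      (by positivity) (ball_subset_ball (by linarith)) c1
      ((isCompact_closedBall q (1.8*(I.2/100))).of_isClosed_subset (isClosed_tsupport χ) hts) ?_ (fun x hx => c2 x (le_of_lt hx)) ?_ ?_ ?_
      isCompact_empty (empty_subset _) (by simp) hr (by positivity) ?_
    · intro x hx
      have := hsub (ball_subset_closedBall hx)
      exact ⟨h2Ω this, fun h => hpI (by rw [mem_singleton_iff] at h; rwa [← h])⟩
    · exact hts.trans (closedBall_subset_ball (by linarith))
    · simpa using hl
    · simpa using h2Ω
    · simpa using hpI
    · intro x
      by_cases hx : x ∈ cubeSet I.1 (2*I.2)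
      · rw [norm_grad]
        refine (c5 x).trans (le_of_eq ?_)
        simp [hx]
        field_simp
      · have : x ∉ tsupport (gradient χ) := fun h => hx (hsub
          ((closedBall_subset_closedBall (by linarith)) (hts (tsupport_grad χ h))))
        rw [image_eq_zero_of_notMem_tsupport this]
        simp [hx]
  · push Not at hA
    have hcomp : IsCompact (frontier V ∩ closedBall q (1.9*r)) :=
      (isCompact_closedBall _ _).inter_left isClosed_frontier
    obtain ⟨B0, hB0, hcov0⟩ := hcomp.elim_finite_subcover_image
      (b := {I ∈ B | p ∉ cubeSet I.1 (2*I.2)}) (c := fun I => openCube I.1 (1.2*I.2))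
      (fun I _ => isOpen_openCube _ _) (fun x hx => by
        obtain ⟨I, hI, hxI, hpI⟩ := hcov x hx.1 (mem_closedBall.1 hx.2)
        rw [mem_iUnion₂]
        exact ⟨I, ⟨hI, hpI⟩, cubeSet_sub_open _ (by linarith [(hB I hI).1]) hxI⟩)
    obtain ⟨hfinB, hcov0⟩ := hcov0
    have hmem : ∀ I ∈ hfinB.toFinset, I ∈ B ∧ p ∉ cubeSet I.1 (2*I.2) := fun I hI =>
      hB0 (by simpa using hI)
    obtain ⟨φ, ρ, f1, f2, f3, f4, f5, f6, f7, f8⟩ := H1 V hV hfinB.toFinset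
      (fun I hI => (hB I (hmem I hI).1).1) q hqV r hr
      (fun x hx hxr => by
        have := hcov0 ⟨hx, mem_closedBall.2 hxr⟩
        rw [mem_iUnion₂] at this
        obtain ⟨I, hI, hxI⟩ := this
        exact ⟨I, by simpa using hI, hxI⟩)
      (fun I hI => hA I (hmem I hI).1 (hmem I hI).2)
    have hK : IsClosed {x : Euc (n+1) | 1.2*r ≤ dist x q ∧ dist x q ≤ 1.8*r} := by
      have e1 : IsClosed {x : Euc (n+1) | 1.2*r ≤ dist x q} := isClosed_le (by fun_prop) (by fun_prop)
      have e2 : IsClosed {x : Euc (n+1) | dist x q ≤ 1.8*r} := isClosed_le (by fun_prop) (by fun_prop)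
      exact e1.inter e2
    have hpn : ∀ x, dist x q < 2*r → x ≠ p := by
      rintro x hx rfl
      have := hpr x hx
      rw [dist_self] at this
      linarith
    refine ⟨hfinB.toFinset, tsupport φ ∩ {x | 1.2*r ≤ dist x q ∧ dist x q ≤ 1.8*r},
      fun I hI => (hmem I hI).1, (IsCompact.inter_right f2 hK), (inter_subset_left.trans f3),
      fun x hx => hx.2, ?_⟩
    refine hfin _ _ C1 hC1.le (fun I hI => (hB I (hmem I hI).1).1) (by linarith) ?_
    refine flux_core hn hΩ hp hq (U := V ∩ ball q (2*r)) (hV.inter isOpen_ball) ?_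
      (ρ := min ρ r) (lt_min f5 hr) ?_ f1 f2 ?_ ?_ (fun I hI => (hB I (hmem I hI).1).1)
      (fun I hI => (cubeSet_mono _ (by linarith [(hB I (hmem I hI).1).1])).trans (hB I (hmem I hI).1).2)
      (fun I hI => (hmem I hI).2)
      (IsCompact.inter_right f2 hK) ((inter_subset_left.trans f3).trans hVΩ) ?_ hr hC1.le ?_
    · exact fun x hx => ⟨hVΩ hx.1, hpn x hx.2⟩
    · exact subset_inter ((ball_subset_ball (min_le_left _ _)).trans f6)
        (ball_subset_ball (by linarith [min_le_right ρ r]))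
    · exact subset_inter f3 (f4.trans (closedBall_subset_ball (by linarith)))
    · exact fun x hx => f7 x (ball_subset_ball (min_le_left _ _) hx)
    · exact fun h => hpn p (by linarith [h.2.2]) rfl
    · intro x
      by_cases hx : x ∈ tsupport φ
      · refine (f8 x).trans (le_of_eq ?_)
        congr 2
        by_cases h2 : x ∈ {x : Euc (n+1) | 1.2*r ≤ dist x q ∧ dist x q ≤ 1.8*r}
        · rw [indicator_of_mem h2, indicator_of_mem (show x ∈ tsupport φ ∩ _ from ⟨hx, h2⟩)]
        · rw [indicator_of_notMem h2, indicator_of_notMem (fun h => h2 h.2)]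
      · rw [image_eq_zero_of_notMem_tsupport (fun h => hx (tsupport_grad φ h)), norm_zero]
        refine mul_nonneg hC1.le (add_nonneg (Finset.sum_nonneg (fun I hI => ?_)) ?_)
        · have := (hB I (hmem I hI).1).1
          exact indicator_nonneg (fun _ _ => by positivity) _
        · exact indicator_nonneg (fun _ _ => by positivity) _


/-- The geometric data used in the analytic part of the argument. -/
structure Geo (n : ℕ) (Ω F : Set (Euc (n+1))) (p q : Euc (n+1)) (r A : ℝ) : Prop where
  hn : 2 ≤ n
  hΩ : IsOpen Ω
  hF : Ω = Fᶜ
  ne : F.Nonempty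
  hp : p ∈ Ω
  hq : q ∈ Ω
  hr : 0 < r
  hA : 0 ≤ A
  far : ∀ x, dist x q < 2*r → r ≤ dist x p
  near : ∀ x, dist x q < 2*r → infDist x F ≤ 10*r
  lay : ∀ t, 0 < t → t ≤ r/4 → volume.real {x ∈ ball q (2*r) | infDist x F ≤ t} ≤ A * t * r^n
  null : volume (F ∩ ball q (2*r)) = 0

namespace Geo
variable {n : ℕ} {Ω F : Set (Euc (n+1))} {p q : Euc (n+1)} {r A : ℝ}

lemma hn1 (G : Geo n Ω F p q r A) : 1 ≤ n := by have := G.hn; omega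

lemma clF (G : Geo n Ω F p q r A) : IsClosed F := by
  have := G.hΩ
  rw [G.hF] at this
  exact isOpen_compl_iff.1 this

lemma pos (G : Geo n Ω F p q r A) {x : Euc (n+1)} (hx : x ∈ Ω) : 0 < infDist x F := by
  rw [G.hF] at hx
  exact (G.clF.notMem_iff_infDist_pos G.ne).1 hx

lemma ballsub (G : Geo n Ω F p q r A) {x : Euc (n+1)} {s : ℝ} (hs : s ≤ infDist x F) : ball x s ⊆ Ω := by
  intro y hy
  rw [G.hF]
  intro hyF
  have := infDist_le_dist_of_mem (x := x) hyF
  rw [mem_ball, dist_comm] at hy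
  linarith

lemma dp (G : Geo n Ω F p q r A) : ∀ x ∈ Anl q r, r ≤ dist x p := fun x hx => G.far x (mem_Anl.1 hx).2

lemma dq (_G : Geo n Ω F p q r A) : ∀ x ∈ Anl q r, r ≤ dist x q := fun x hx => (mem_Anl.1 hx).1.le

/-- Pointwise bound for the logarithmic gradient away from the poles. -/
lemma grad_pt (G : Geo n Ω F p q r A) {s x : Euc (n+1)} (hs : s ∈ Ω) (hx : x ∈ Ω) (h2 : dist x q < 2*r)
    (hd : r ≤ dist x s) :
    ‖gradient (greenFn n Ω s) x‖ ≤ 10 * cG (n+1) * greenFn n Ω s x / infDist x F := by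
  have h0 := G.pos hx
  have h10 := G.near x h2
  have hb : ball x (infDist x F / 10) ⊆ Ω \ {s} := by
    intro y hy
    refine ⟨G.ballsub (by linarith) hy, ?_⟩
    rintro rfl
    rw [mem_ball, dist_comm] at hy
    linarith
  rw [norm_grad]
  refine ((green_har G.hn1 G.hΩ hs).grad_le_pos (fun y hy => green_nonneg G.hn1 G.hΩ hs hy.1 hy.2)
    (by positivity) hb).trans (le_of_eq ?_)
  field_simp

lemma JJ_le (G : Geo n Ω F p q r A) {x : Euc (n+1)} (hx : x ∈ Ω) (h : x ∈ Anl q r) :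
    JJ n Ω p q x ≤ 20 * cG (n+1) * (greenFn n Ω p x / infDist x F) * greenFn n Ω q x := by
  have h2 := (mem_Anl.1 h).2
  have h0 := G.pos hx
  have hp := G.grad_pt G.hp hx h2 (G.dp x h)
  have hq := G.grad_pt G.hq hx h2 (G.dq x h)
  have np : x ≠ p := by rintro rfl; have := G.dp x h; rw [dist_self] at this; linarith [G.hr]
  have nq : x ≠ q := by rintro rfl; have := G.dq x h; rw [dist_self] at this; linarith [G.hr]
  have gp := green_nonneg G.hn1 G.hΩ G.hp hx np
  have gq := green_nonneg G.hn1 G.hΩ G.hq hx nq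
  unfold JJ
  refine (norm_sub_le _ _).trans ?_
  rw [norm_smul, norm_smul, Real.norm_of_nonneg gp, Real.norm_of_nonneg gq]
  have e1 := mul_le_mul_of_nonneg_left hq gp
  have e2 := mul_le_mul_of_nonneg_left hp gq
  refine (add_le_add e1 e2).trans (le_of_eq ?_)
  field_simp
  ring

lemma g_le (G : Geo n Ω F p q r A) {s x : Euc (n+1)} (hs : s ∈ Ω) (hx : x ∈ Ω) (hd : r ≤ dist x s) :
    0 ≤ greenFn n Ω s x ∧ greenFn n Ω s x ≤ r^((1:ℤ)-n) := by
  have ns : x ≠ s := by rintro rfl; rw [dist_self] at hd; linarith [G.hr]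
  exact ⟨green_nonneg G.hn1 G.hΩ hs hx ns,
    (green_le G.hn1 G.hΩ hs hx).trans (Phi_le_of G.hn1 G.hr hd)⟩

lemma g_intΩ (G : Geo n Ω F p q r A) {s : Euc (n+1)} (hs : s ∈ Ω) (hd : ∀ x ∈ Anl q r, r ≤ dist x s) :
    IntegrableOn (greenFn n Ω s) (Anl q r ∩ Ω) := by
  have hfin : volume (Anl q r ∩ Ω) < ⊤ :=
    (measure_mono (inter_subset_left.trans sdiff_subset)).trans_lt (measure_ball_lt_top (x := q) (r := 2*r))
  have hm := (Anl_meas q r).inter G.hΩ.measurableSet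
  refine Integrable.mono' (g := fun _ => r^((1:ℤ)-n)) (integrableOn_const hfin.ne) ?_ ?_
  · refine ContinuousOn.aestronglyMeasurable ((green_har G.hn1 G.hΩ hs).1.mono ?_) hm
    intro x hx
    refine ⟨hx.2, ?_⟩
    rintro rfl
    have := hd x hx.1
    rw [dist_self] at this
    linarith [G.hr]
  · refine (ae_restrict_mem hm).mono (fun x hx => ?_)
    obtain ⟨h1, h2⟩ := G.g_le hs hx.2 (hd x hx.1)
    rw [Real.norm_of_nonneg h1]
    exact h2

lemma Ann_ae (G : Geo n Ω F p q r A) : (Anl q r ∩ Ω : Set (Euc (n+1))) =ᵐ[volume] Anl q r := by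
  have e : Anl q r ∩ Ω = Anl q r \ (F ∩ ball q (2*r)) := by
    rw [G.hF]
    ext x
    constructor
    · exact fun hx => ⟨hx.1, fun h => hx.2 h.1⟩
    · exact fun hx => ⟨hx.1, fun h => hx.2 ⟨h, (hx.1).1⟩⟩
  rw [e]
  exact sdiff_null_ae_eq_self G.null

lemma int_Ann (G : Geo n Ω F p q r A) (f : Euc (n+1) → ℝ) :
    ∫ x in Anl q r, f x = ∫ x in Anl q r ∩ Ω, f x := (setIntegral_congr_set G.Ann_ae).symm

lemma gO_le_int (G : Geo n Ω F p q r A) {s : Euc (n+1)} (hs : s ∈ Ω) (hd : ∀ x ∈ Anl q r, r ≤ dist x s) :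
    ∫ x in Anl q r, gO n Ω s x ≤ ∫ x in Anl q r, greenFn n Ω s x := by
  rw [G.int_Ann, G.int_Ann]
  refine setIntegral_mono_on ((gO_int_Anl G.hn1 G.hΩ hs G.hr hd).mono_set inter_subset_left)
    (G.g_intΩ hs hd) ((Anl_meas q r).inter G.hΩ.measurableSet) (fun x hx => ?_)
  unfold gO
  by_cases h : x ∈ OSet Ω \ {s}
  · rw [indicator_of_mem h]
  · rw [indicator_of_notMem h]
    exact (G.g_le hs hx.2 (hd x hx.1)).1

lemma gO_eq (_G : Geo n Ω F p q r A) {s x : Euc (n+1)} (hx : x ∈ OSet Ω) (hs : x ≠ s) :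
    gO n Ω s x = greenFn n Ω s x := by
  unfold gO
  rw [indicator_of_mem]
  exact ⟨hx, hs⟩

/-- The part of the flux far from the boundary. -/
lemma K1_est (G : Geo n Ω F p q r A) {V K : Set (Euc (n+1))} (hVΩ : V ⊆ Ω) (hKV : K ⊆ V)
    (hK : IsCompact K) (hK1 : ∀ x ∈ K, 1.2*r ≤ dist x q ∧ dist x q ≤ 1.8*r) {δ : ℝ} (hδ : 0 < δ)
    {D : Set (Euc (n+1))} (hD : D = {x ∈ Anl q r | x ∈ Ω ∧ δ * r < infDist x F}) :
    ∫ x in K ∩ {x | δ * r < infDist x F}, JJ n Ω p q x ≤ 20 * cG (n+1) *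
      (sSup ((fun y => greenFn n Ω p y / infDist y F) '' (D ∩ V)) * ∫ x in D, greenFn n Ω q x) := by
  have hr := G.hr
  set S := sSup ((fun y => greenFn n Ω p y / infDist y F) '' (D ∩ V)) with hS
  have hDm : MeasurableSet D := by
    have e : D = (Anl q r ∩ Ω) ∩ {x | δ * r < infDist x F} := by
      rw [hD]; ext x; simp only [mem_inter_iff, mem_ofPred_eq, and_assoc]
    rw [e]
    exact ((Anl_meas q r).inter G.hΩ.measurableSet).inter
      (isOpen_lt continuous_const (continuous_infDist_pt F)).measurableSet
  have hDA : D ⊆ Anl q r ∩ Ω := by rw [hD]; exact fun x hx => ⟨hx.1, hx.2.1⟩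
  have hDi : ∀ x ∈ D, δ * r < infDist x F := by rw [hD]; exact fun x hx => hx.2.2
  have hle : ∀ x ∈ D ∩ V, 0 ≤ greenFn n Ω p x / infDist x F ∧ greenFn n Ω p x / infDist x F ≤ S := by
    have hnn : ∀ x ∈ D, 0 ≤ greenFn n Ω p x / infDist x F ∧
        greenFn n Ω p x / infDist x F ≤ r^((1:ℤ)-n) / (δ*r) := by
      intro x hx
      obtain ⟨a, b⟩ := G.g_le G.hp (hDA hx).2 (G.dp x (hDA hx).1)
      have h0 : 0 < δ * r := by positivity
      have hi := hDi x hx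
      exact ⟨div_nonneg a (h0.trans hi).le, div_le_div₀ (by positivity) b h0 hi.le⟩
    intro x hx
    refine ⟨(hnn x hx.1).1, le_csSup ⟨r^((1:ℤ)-n) / (δ*r), ?_⟩ ⟨x, hx, rfl⟩⟩
    rintro _ ⟨y, hy, rfl⟩
    exact (hnn y hy.1).2
  have hS0 : 0 ≤ S := by
    refine Real.sSup_nonneg ?_
    rintro _ ⟨y, hy, rfl⟩
    exact (hle y hy).1
  have hKD : K ∩ {x | δ * r < infDist x F} ⊆ D ∩ V := by
    intro x hx
    refine ⟨?_, hKV hx.1⟩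
    rw [hD]
    refine ⟨mem_Anl.2 ⟨?_, ?_⟩, hVΩ (hKV hx.1), hx.2⟩ <;> linarith [(hK1 x hx.1).1, (hK1 x hx.1).2]
  have hKm : MeasurableSet (K ∩ {x | δ * r < infDist x F}) := hK.isClosed.measurableSet.inter
      (isOpen_lt continuous_const (continuous_infDist_pt F)).measurableSet
  have hpK : p ∉ K := by
    intro h
    have := G.far p (by linarith [(hK1 p h).2])
    rw [dist_self] at this
    linarith
  have hwi := (G.g_intΩ G.hq G.dq).mono_set hDA
  have hcG := cG_pos (n+1)
  calc ∫ x in K ∩ {x | δ * r < infDist x F}, JJ n Ω p q x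
      ≤ ∫ x in K ∩ {x | δ * r < infDist x F}, 20 * cG (n+1) * S * greenFn n Ω q x := by
        refine setIntegral_mono_on ((JJ_int G.hn1 G.hΩ G.hp G.hq hK (hKV.trans hVΩ) hpK).mono_set
          inter_subset_left) ((hwi.mono_set (hKD.trans inter_subset_left)).const_mul _) hKm ?_
        intro x hx
        have hx' := hKD hx
        have hA := hDA hx'.1
        refine (G.JJ_le hA.2 hA.1).trans ?_
        refine mul_le_mul_of_nonneg_right ?_ (G.g_le G.hq hA.2 (G.dq x hA.1)).1
        exact mul_le_mul_of_nonneg_left (hle x hx').2 (by positivity)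
    _ = 20 * cG (n+1) * S * ∫ x in K ∩ {x | δ * r < infDist x F}, greenFn n Ω q x :=
        integral_const_mul _ _
    _ ≤ 20 * cG (n+1) * S * ∫ x in D, greenFn n Ω q x := by
        refine mul_le_mul_of_nonneg_left ?_ (by positivity)
        refine setIntegral_mono_set hwi ?_ (LE.le.eventuallyLE (hKD.trans inter_subset_left))
        exact (ae_restrict_mem hDm).mono (fun x hx => (G.g_le G.hq (hDA hx).2 (G.dq x (hDA hx).1)).1)
    _ = _ := by ring

end Geo


namespace Geo
variable {n : ℕ} {Ω F : Set (Euc (n+1))} {p q : Euc (n+1)} {r A : ℝ}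

lemma ne_of_dist (G : Geo n Ω F p q r A) {x s : Euc (n+1)} (h : r ≤ dist x s) : x ≠ s := by
  rintro rfl
  rw [dist_self] at h
  linarith [G.hr]

lemma K_Anl (G : Geo n Ω F p q r A) {K : Set (Euc (n+1))}
    (hK1 : ∀ x ∈ K, 1.2*r ≤ dist x q ∧ dist x q ≤ 1.8*r) : K ⊆ Anl q r := fun x hx =>
  mem_Anl.2 ⟨by linarith [(hK1 x hx).1, G.hr], by linarith [(hK1 x hx).2, G.hr]⟩

lemma grad_contK (G : Geo n Ω F p q r A) {K : Set (Euc (n+1))}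
    (hK1 : ∀ x ∈ K, 1.2*r ≤ dist x q ∧ dist x q ≤ 1.8*r) (hKΩ : K ⊆ Ω) {s : Euc (n+1)} (hs : s ∈ Ω)
    (hd : ∀ x ∈ Anl q r, r ≤ dist x s) : ContinuousOn (gradient (greenFn n Ω s)) K := by
  have o1 : IsOpen (Ω \ {s}) := G.hΩ.sdiff isClosed_singleton
  exact (grad_contOn o1 ((green_har G.hn1 G.hΩ hs).contDiffOn o1)).mono
    (fun x hx => ⟨hKΩ hx, G.ne_of_dist (hd x (G.K_Anl hK1 hx))⟩)

lemma grad_L1 (G : Geo n Ω F p q r A) {K : Set (Euc (n+1))} (hK : IsCompact K)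
    (hK1 : ∀ x ∈ K, 1.2*r ≤ dist x q ∧ dist x q ≤ 1.8*r) (hKΩ : K ⊆ Ω) (hKO : K ⊆ OSet Ω) {δ : ℝ}
    (hδ : 0 < δ) (hδ1 : δ ≤ 1/100) (hKδ : ∀ x ∈ K, infDist x F ≤ δ * r) {s : Euc (n+1)} (hs : s ∈ Ω)
    (hd : ∀ x ∈ Anl q r, r ≤ dist x s) :
    ∫ x in K, ‖gradient (greenFn n Ω s) x‖ ≤
      √(A * cCa n * δ) * (∫ x in Anl q r, gO n Ω s x) / r := by
  have hr := G.hr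
  have hA := G.hA
  have hca := cCa_pos n
  set T := ∫ x in Anl q r, gO n Ω s x with hT
  have hT0 : 0 ≤ T := integral_nonneg fun y => gO_nonneg G.hn1 G.hΩ hs y
  have hc := G.grad_contK hK1 hKΩ hs hd
  obtain ⟨S, hS, hSK⟩ : ∃ S, 0 < S ∧ ∀ x ∈ K, S < infDist x F := by
    rcases K.eq_empty_or_nonempty with h | h
    · exact ⟨1, one_pos, by simp [h]⟩
    · obtain ⟨x0, hx0, hmin⟩ := hK.exists_isMinOn h (continuous_infDist_pt F).continuousOn
      refine ⟨infDist x0 F / 2, by have := G.pos (hKΩ hx0); positivity, fun x hx => ?_⟩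
      have := hmin hx
      have h3 := G.pos (hKΩ hx0)
      simp only [mem_ofPred_eq] at this
      linarith
  have hcac := caccio G.hn1 G.hΩ hs hr hd (S := min S (r/100)) (lt_min hS (by positivity))
    (min_le_right _ _) hK hK1 hKO (fun x hx => by
      refine (closedBall_subset_ball ?_).trans (G.ballsub (le_refl (infDist x F)))
      exact (min_le_left _ _).trans_lt (hSK x hx))
  have hvol : volume.real K ≤ A * (δ*r) * r^n := by
    refine le_trans (measureReal_mono (fun x hx => ?_) ?_) (G.lay (δ*r) (by positivity) ?_)
    · exact ⟨(G.K_Anl hK1 hx).1, hKδ x hx⟩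
    · exact ((measure_mono (fun x hx => hx.1)).trans_lt (measure_ball_lt_top (x := q) (r := 2*r))).ne
    · nlinarith
  have hcs := cs_set (B := K) hK.measure_lt_top.ne (ContinuousOn.integrableOn_compact hK hc.norm)
    (ContinuousOn.integrableOn_compact hK (hc.norm.pow 2))
  have hcac' : ∫ x in K, ‖gradient (greenFn n Ω s) x‖^2 ≤ cCa n / r^(n+3) * T^2 := by
    simpa only [norm_grad] using hcac
  refine abs_le_of_sq_le_sq' ?_ (by positivity) |>.2
  refine hcs.trans ((mul_le_mul hvol hcac' (integral_nonneg fun x => by positivity)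
    (by positivity)).trans (le_of_eq ?_))
  rw [div_pow, mul_pow, Real.sq_sqrt (by positivity)]
  field_simp
  ring

/-- The flux through the boundary layer. -/
lemma K2_est (G : Geo n Ω F p q r A) {K : Set (Euc (n+1))} (hK : IsCompact K)
    (hK1 : ∀ x ∈ K, 1.2*r ≤ dist x q ∧ dist x q ≤ 1.8*r) (hKΩ : K ⊆ Ω) (hKO : K ⊆ OSet Ω) {δ : ℝ}
    (hδ : 0 < δ) (hδ1 : δ ≤ 1/100) (hKδ : ∀ x ∈ K, infDist x F ≤ δ * r) :
    ∫ x in K, JJ n Ω p q x ≤ 2 * cS n * √(A * cCa n * δ) / r^(n+2) *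
      ((∫ x in Anl q r, greenFn n Ω p x) * ∫ x in Anl q r, greenFn n Ω q x) := by
  have hr := G.hr
  have hcS := cS_pos n
  have key : ∀ s ∈ Ω, (∀ x ∈ Anl q r, r ≤ dist x s) → ∀ x ∈ K,
      ‖greenFn n Ω s x‖ ≤ cS n / r^(n+1) * ∫ y in Anl q r, gO n Ω s y := by
    intro s hs hd x hx
    have hne := G.ne_of_dist (hd x (G.K_Anl hK1 hx))
    rw [Real.norm_of_nonneg (green_nonneg G.hn1 G.hΩ hs (hKΩ hx) hne), ← G.gO_eq (hKO hx) hne]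
    exact gO_sup G.hn1 G.hΩ hs hr hd (by linarith [(hK1 x hx).1]) (by linarith [(hK1 x hx).2])
  have Lp := G.grad_L1 hK hK1 hKΩ hKO hδ hδ1 hKδ G.hp G.dp
  have Lq := G.grad_L1 hK hK1 hKΩ hKO hδ hδ1 hKδ G.hq G.dq
  have kp := key p G.hp G.dp
  have kq := key q G.hq G.dq
  have cp := G.grad_contK hK1 hKΩ G.hp G.dp
  have cq := G.grad_contK hK1 hKΩ G.hq G.dq
  have hTp : 0 ≤ ∫ x in Anl q r, gO n Ω p x := integral_nonneg fun y => gO_nonneg G.hn1 G.hΩ G.hp y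
  have hTq : 0 ≤ ∫ x in Anl q r, gO n Ω q x := integral_nonneg fun y => gO_nonneg G.hn1 G.hΩ G.hq y
  have lp := G.gO_le_int G.hp G.dp
  have lq := G.gO_le_int G.hq G.dq
  set Tp := ∫ x in Anl q r, gO n Ω p x
  set Tq := ∫ x in Anl q r, gO n Ω q x
  have ip : IntegrableOn (fun x => ‖gradient (greenFn n Ω p) x‖) K :=
    ContinuousOn.integrableOn_compact hK cp.norm
  have iq : IntegrableOn (fun x => ‖gradient (greenFn n Ω q) x‖) K :=
    ContinuousOn.integrableOn_compact hK cq.norm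
  have hpK : p ∉ K := fun h => G.ne_of_dist (G.dp p (G.K_Anl hK1 h)) rfl
  calc ∫ x in K, JJ n Ω p q x
      ≤ ∫ x in K, ((cS n / r^(n+1) * Tp) * ‖gradient (greenFn n Ω q) x‖ +
          (cS n / r^(n+1) * Tq) * ‖gradient (greenFn n Ω p) x‖) := by
        refine setIntegral_mono_on (JJ_int G.hn1 G.hΩ G.hp G.hq hK hKΩ hpK)
          ((iq.const_mul _).add (ip.const_mul _)) hK.isClosed.measurableSet (fun x hx => ?_)
        unfold JJ
        refine (norm_sub_le _ _).trans ?_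
        rw [norm_smul, norm_smul]
        exact add_le_add (mul_le_mul_of_nonneg_right (kp x hx) (norm_nonneg _))
          (mul_le_mul_of_nonneg_right (kq x hx) (norm_nonneg _))
    _ = (cS n / r^(n+1) * Tp) * (∫ x in K, ‖gradient (greenFn n Ω q) x‖) +
          (cS n / r^(n+1) * Tq) * ∫ x in K, ‖gradient (greenFn n Ω p) x‖ := by
        rw [integral_add (iq.const_mul _) (ip.const_mul _), integral_const_mul, integral_const_mul]
    _ ≤ (cS n / r^(n+1) * Tp) * (√(A * cCa n * δ) * Tq / r) +
          (cS n / r^(n+1) * Tq) * (√(A * cCa n * δ) * Tp / r) :=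
        add_le_add (mul_le_mul_of_nonneg_left Lq (by positivity))
          (mul_le_mul_of_nonneg_left Lp (by positivity))
    _ = 2 * cS n * √(A * cCa n * δ) / r^(n+2) * (Tp * Tq) := by
        field_simp
        ring
    _ ≤ _ := by
        refine mul_le_mul_of_nonneg_left ?_ (by positivity)
        exact mul_le_mul lp lq hTq (hTp.trans lp)

end Geo


lemma zpow_cmp3 {n : ℕ} (hn : 1 ≤ n) {a b : ℝ} (ha : 0 < a) (hab : a ≤ 3 * b) :
    b^((1:ℤ)-n) ≤ 3^n * a^((1:ℤ)-n) := by
  have h := zpow_anti hn (show 0 < a/3 by positivity) (show a/3 ≤ b by linarith)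
  refine h.trans ?_
  obtain ⟨m, rfl⟩ : ∃ m, n = m + 1 := ⟨n - 1, by omega⟩
  rw [div_zpow, show (1:ℤ) - ((m+1 : ℕ) : ℤ) = -(m:ℤ) by push_cast; ring, zpow_neg, zpow_neg,
    zpow_natCast, zpow_natCast, div_inv_eq_mul, mul_comm, pow_succ]
  have : (0:ℝ) < a^m := by positivity
  have h3 : (0:ℝ) < 3^m := by positivity
  refine mul_le_mul_of_nonneg_right (by linarith) (by positivity)

lemma grad_Phi_r {n : ℕ} {s x : Euc (n+1)} {r : ℝ} (hr : 0 < r) (h : r ≤ dist x s) :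
    ‖gradient (Phi n s) x‖ ≤ cG (n+1) * Phi n s x / r := by
  rw [norm_grad]
  refine (Phi_har n s).grad_le_pos (fun y _ => Phi_nonneg n s y) hr (fun y hy => ?_)
  rw [mem_compl_iff, mem_singleton_iff]
  rintro rfl
  rw [mem_ball, dist_comm] at hy
  linarith

namespace Geo
variable {n : ℕ} {Ω F : Set (Euc (n+1))} {p q : Euc (n+1)} {r A : ℝ}

lemma Phi_up (G : Geo n Ω F p q r A) {x : Euc (n+1)} (hx : dist x q < 2*r) :
    Phi n p x ≤ 3^n * Phi n p q := by
  have hr := G.hr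
  have h1 := G.far x hx
  have h2 := G.far q (by rw [dist_self]; linarith)
  unfold Phi
  rw [← dist_eq_norm, ← dist_eq_norm]
  refine zpow_cmp3 G.hn1 (by linarith) ?_
  have := dist_triangle q x p
  rw [dist_comm q x] at this
  linarith

lemma Phi_low (G : Geo n Ω F p q r A) {x : Euc (n+1)} (hx : dist x q < 2*r) :
    Phi n p q ≤ 3^n * Phi n p x := by
  have hr := G.hr
  have h1 := G.far x hx
  have h2 := G.far q (by rw [dist_self]; linarith)
  unfold Phi
  rw [← dist_eq_norm, ← dist_eq_norm]
  refine zpow_cmp3 G.hn1 (by linarith) ?_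
  have := dist_triangle x q p
  linarith

lemma green_UB_grad (G : Geo n Ω F p q r A) {s x : Euc (n+1)} (hs : s ∈ Ω)
    (hx : x ∈ Ω \ OSet Ω) : gradient (greenFn n Ω s) x = gradient (Phi n s) x := by
  have : greenFn n Ω s =ᶠ[𝓝 x] Phi n s := by
    filter_upwards [(UB_open G.hΩ).mem_nhds hx] with y hy
    exact green_UB G.hn1 G.hΩ hs hy
  unfold gradient
  rw [this.fderiv_eq]

lemma D2_layer (G : Geo n Ω F p q r A) {K : Set (Euc (n+1))} (hK : IsCompact K)
    (hK1 : ∀ x ∈ K, 1.2*r ≤ dist x q ∧ dist x q ≤ 1.8*r) (hKU : K ⊆ Ω \ OSet Ω)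
    (hqU : q ∈ Ω \ OSet Ω) {τ : ℝ} (hτ : 0 < τ) (hτ1 : τ ≤ 1/4) (hKτ : ∀ x ∈ K, infDist x F ≤ τ * r) :
    1/r * ∫ x in K, JJ n Ω p q x ≤ 2 * cG (n+1) * 3^n * A * τ * greenFn n Ω p q := by
  have hr := G.hr
  have hcG := cG_pos (n+1)
  have hA := G.hA
  have hPq := Phi_nonneg n p q
  have hvol : volume.real K ≤ A * (τ*r) * r^n := by
    refine le_trans (measureReal_mono (fun x hx => ?_) ?_) (G.lay (τ*r) (by positivity) ?_)
    · exact ⟨(G.K_Anl hK1 hx).1, hKτ x hx⟩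
    · exact ((measure_mono (fun x hx => hx.1)).trans_lt (measure_ball_lt_top (x := q) (r := 2*r))).ne
    · nlinarith
  have hpt : ∀ x ∈ K, ‖JJ n Ω p q x‖ ≤ 2 * cG (n+1) * 3^n * Phi n p q * r^((1:ℤ)-n) / r := by
    intro x hx
    have hxA := G.K_Anl hK1 hx
    rw [Real.norm_of_nonneg (JJ_nonneg _ _ _ _ _)]
    unfold JJ
    rw [G.green_UB_grad G.hp (hKU hx), G.green_UB_grad G.hq (hKU hx), green_UB G.hn1 G.hΩ G.hp (hKU hx),
      green_UB G.hn1 G.hΩ G.hq (hKU hx)]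
    refine (norm_sub_le _ _).trans ?_
    rw [norm_smul, norm_smul, Real.norm_of_nonneg (Phi_nonneg n p x),
      Real.norm_of_nonneg (Phi_nonneg n q x)]
    have a1 := grad_Phi_r hr (G.dp x hxA)
    have a2 := grad_Phi_r hr (G.dq x hxA)
    have b1 := mul_le_mul_of_nonneg_left a2 (Phi_nonneg n p x)
    have b2 := mul_le_mul_of_nonneg_left a1 (Phi_nonneg n q x)
    have c1 := G.Phi_up (mem_Anl.1 hxA).2
    have c2 := Phi_le_of G.hn1 hr (G.dq x hxA)
    have c3 := mul_le_mul c1 c2 (Phi_nonneg n q x) (by positivity)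
    calc _ ≤ _ := add_le_add b1 b2
      _ = 2 * cG (n+1) / r * (Phi n p x * Phi n q x) := by ring
      _ ≤ 2 * cG (n+1) / r * (3^n * Phi n p q * r^((1:ℤ)-n)) :=
          mul_le_mul_of_nonneg_left c3 (by positivity)
      _ = _ := by ring
  have hI := norm_setIntegral_le_of_norm_le_const (μ := volume) hK.measure_lt_top hpt
  have hI2 := (Real.le_norm_self _).trans hI
  have hz : r^((1:ℤ)-n) * r^n = r := by
    rw [← zpow_natCast r n, ← zpow_add₀ hr.ne']
    simp
  rw [green_UB G.hn1 G.hΩ G.hp hqU]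
  have h3 : ∫ x in K, JJ n Ω p q x ≤
      2 * cG (n+1) * 3^n * Phi n p q * r^((1:ℤ)-n) / r * (A * (τ*r) * r^n) :=
    hI2.trans (mul_le_mul_of_nonneg_left hvol (by positivity))
  calc 1/r * ∫ x in K, JJ n Ω p q x
      ≤ 1/r * (2 * cG (n+1) * 3^n * Phi n p q * r^((1:ℤ)-n) / r * (A * (τ*r) * r^n)) :=
        mul_le_mul_of_nonneg_left h3 (by positivity)
    _ = 2 * cG (n+1) * 3^n * A * τ * Phi n p q * (r^((1:ℤ)-n) * r^n) / r := by
        field_simp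
    _ = _ := by
        rw [hz]
        field_simp

lemma Ann_lower (G : Geo n Ω F p q r A) {y : Euc (n+1)} (hy : y ∈ Ω \ OSet Ω)
    (h1 : 1.2*r ≤ dist y q) (h2 : dist y q ≤ 1.8*r) {τ : ℝ} (hτ : 0 < τ) (hτ1 : τ ≤ 1/20)
    (hyτ : τ * r ≤ infDist y F) {s : Euc (n+1)} (hs : s ∈ Ω) (hd : ∀ x ∈ Anl q r, r ≤ dist x s)
    {m : ℝ} (hm : ∀ x ∈ Anl q r, m ≤ Phi n s x) :
    ((τ*r)^(n+1) * vB (n+1)) * m ≤ ∫ x in Anl q r, greenFn n Ω s x := by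
  have hr := G.hr
  have hbA : ball y (τ*r) ⊆ Anl q r :=
    ((ball_subset_ball (by nlinarith)).trans ball_subset_closedBall).trans
      (ball_Anl hr (by linarith) (by linarith))
  have hbΩ : ball y (τ*r) ⊆ Ω := G.ballsub hyτ
  have hy0 : y ∈ ball y (τ*r) := mem_ball_self (by positivity)
  have hbU : ball y (τ*r) ⊆ Ω \ OSet Ω := by
    intro x hx
    refine ⟨hbΩ hx, fun hxO => hy.2 ?_⟩
    exact ball_OSet G.hΩ (convex_ball y (τ*r)).isPreconnected hbΩ hx hxO hy0
  have hi := G.g_intΩ hs hd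
  rw [G.int_Ann, ← vol_ball' y (by positivity)]
  calc volume.real (ball y (τ*r)) * m = ∫ x in ball y (τ*r), m := by
        rw [setIntegral_const, smul_eq_mul]
    _ ≤ ∫ x in ball y (τ*r), greenFn n Ω s x := by
        refine setIntegral_mono_on (integrableOn_const measure_ball_lt_top.ne)
          (hi.mono_set (subset_inter hbA hbΩ)) measurableSet_ball (fun x hx => ?_)
        rw [green_UB G.hn1 G.hΩ hs (hbU hx)]
        exact hm x (hbA hx)
    _ ≤ _ := by
        refine setIntegral_mono_set hi ?_ (LE.le.eventuallyLE (subset_inter hbA hbΩ))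
        exact (ae_restrict_mem ((Anl_meas q r).inter G.hΩ.measurableSet)).mono
          (fun x hx => (G.g_le hs hx.2 (hd x hx.1)).1)

lemma D2_lower (G : Geo n Ω F p q r A) {y : Euc (n+1)} (hy : y ∈ Ω \ OSet Ω) (hqU : q ∈ Ω \ OSet Ω)
    (h1 : 1.2*r ≤ dist y q) (h2 : dist y q ≤ 1.8*r) {τ : ℝ} (hτ : 0 < τ) (hτ1 : τ ≤ 1/20)
    (hyτ : τ * r ≤ infDist y F) :
    greenFn n Ω p q ≤ 9^n / ((τ^(n+1))^2 * (vB (n+1))^2) / r^(n+3) *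
      ((∫ x in Anl q r, greenFn n Ω p x) * ∫ x in Anl q r, greenFn n Ω q x) := by
  have hr := G.hr
  have hvB := vB_pos (n+1)
  have hPq := Phi_nonneg n p q
  have a1 := G.Ann_lower hy h1 h2 hτ hτ1 hyτ G.hp G.dp (m := Phi n p q / 3^n) (fun x hx => by
    rw [div_le_iff₀ (by positivity), mul_comm]
    exact G.Phi_low (mem_Anl.1 hx).2)
  have a2 := G.Ann_lower hy h1 h2 hτ hτ1 hyτ G.hq G.dq (m := r^((1:ℤ)-n) / 3^n) (fun x hx => by
    have h0 := (mem_Anl.1 hx).1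
    have h3 := (mem_Anl.1 hx).2
    rw [div_le_iff₀ (by positivity), mul_comm]
    unfold Phi
    rw [← dist_eq_norm]
    exact zpow_cmp3 G.hn1 (by linarith) (by linarith))
  have hm := mul_le_mul a1 a2 (by positivity) (le_trans (by positivity) a1)
  have hz : r^((1:ℤ)-n) * r^n = r := by
    rw [← zpow_natCast r n, ← zpow_add₀ hr.ne']
    simp
  rw [green_UB G.hn1 G.hΩ G.hp hqU]
  refine le_trans (le_of_eq ?_) (mul_le_mul_of_nonneg_left hm (by positivity))
  have e9 : (9:ℝ)^n = 3^n * 3^n := by rw [← mul_pow]; norm_num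
  rw [e9]
  have hz' : r^((1:ℤ)-n) = r / r^n := by rw [eq_div_iff (by positivity)]; exact hz
  rw [hz', mul_pow]
  field_simp
  ring

end Geo


set_option maxHeartbeats 1000000 in
lemma main_analytic (n : ℕ) (hn : 2 ≤ n) (A : ℝ) (hA : 0 ≤ A) : ∃ C > 0,
    ∀ (Ω F : Set (Euc (n+1))) (p q : Euc (n+1)) (r : ℝ), Geo n Ω F p q r A →
    ∀ V : Set (Euc (n+1)), IsOpen V → IsPreconnected V → V ⊆ Ω → q ∈ V → ∀ B : Set (Euc (n+1) × ℝ),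
    (∀ I ∈ B, 0 < I.2 ∧ cubeSet I.1 (10*I.2) ⊆ Ω) →
    (∀ x ∈ frontier V, dist x q ≤ 1.9*r → ∃ I ∈ B, x ∈ cubeSet I.1 (1.1*I.2) ∧
      p ∉ cubeSet I.1 (2*I.2)) →
    ∀ δ : ℝ, 0 < δ → δ < 1/100 →
    ∀ D : Set (Euc (n+1)), D = {x ∈ Anl q r | x ∈ Ω ∧ δ * r < infDist x F} →
    ∃ B0 : Finset (Euc (n+1) × ℝ), ↑B0 ⊆ B ∧
      0 ≤ r⁻¹ * sSup ((fun y => greenFn n Ω p y / infDist y F) '' (D ∩ V)) *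
          ∫ x in D, greenFn n Ω q x ∧
      0 ≤ δ^((1:ℝ)/2/2) / r^(n+3) * (∫ x in Anl q r, greenFn n Ω p x) *
          ∫ x in Anl q r, greenFn n Ω q x ∧
      greenFn n Ω p q ≤ C * (r⁻¹ * sSup ((fun y => greenFn n Ω p y / infDist y F) '' (D ∩ V)) *
          (∫ x in D, greenFn n Ω q x) +
        δ^((1:ℝ)/2/2) / r^(n+3) * (∫ x in Anl q r, greenFn n Ω p x) *
          (∫ x in Anl q r, greenFn n Ω q x) +
        ∑ I ∈ B0, 1/I.2 * ∫ x in cubeSet I.1 (2*I.2), JJ n Ω p q x) := by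
  obtain ⟨C1, hC1, H⟩ := flux2 n hn
  have hcG := cG_pos (n+1)
  have hcS := cS_pos n
  have hcCa := cCa_pos n
  have hvB := vB_pos (n+1)
  set E := 2 * cG (n+1) * 3^n * A with hE
  have hE0 : 0 ≤ E := by positivity
  set t0 := min (1/100) (1 / (2 * C1 * (E+1))) with ht0
  have ht0p : 0 < t0 := lt_min (by norm_num) (by positivity)
  have ht01 : t0 ≤ 1/100 := min_le_left _ _
  have ht0E : C1 * (E * t0) ≤ 1/2 := by
    have h1 : t0 ≤ 1 / (2 * C1 * (E+1)) := min_le_right _ _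
    rw [le_div_iff₀ (by positivity)] at h1
    nlinarith [mul_pos ht0p hC1]
  set M := 9^n / ((t0^(n+1))^2 * (vB (n+1))^2) with hM
  have hM0 : 0 < M := by positivity
  have hq0 : 0 < t0^((1:ℝ)/2/2) := Real.rpow_pos_of_pos ht0p _
  refine ⟨2 * C1 * (1 + 20 * cG (n+1) + 2 * cS n * √(A * cCa n)) + M / t0^((1:ℝ)/2/2),
    by positivity, ?_⟩
  intro Ω F p q r G V hV hVc hVΩ hqV B hB hcov δ hδ hδ1 D hD
  have hr := G.hr
  obtain ⟨B0, K, hB0, hK, hKV, hK1, hflux⟩ := H Ω G.hΩ p G.hp q G.hq r hr G.far V hV hVΩ hqV B hB hcov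
  clear H
  have hg0 : 0 ≤ greenFn n Ω p q := (G.g_le G.hp G.hq (G.far q (by rw [dist_self]; linarith))).1
  have hKΩ := hKV.trans hVΩ
  have hpK : p ∉ K := fun h => G.ne_of_dist (G.dp p (G.K_Anl hK1 h)) rfl
  have k1 := G.K1_est hVΩ hKV hK hK1 hδ hD
  have hDA : D ⊆ Anl q r ∩ Ω := by rw [hD]; exact fun x hx => ⟨hx.1, hx.2.1⟩
  have hDm : MeasurableSet D := by
    have e : D = (Anl q r ∩ Ω) ∩ {x | δ * r < infDist x F} := by
      rw [hD]; ext x; simp only [mem_inter_iff, mem_ofPred_eq, and_assoc]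
    rw [e]
    exact ((Anl_meas q r).inter G.hΩ.measurableSet).inter
      (isOpen_lt continuous_const (continuous_infDist_pt F)).measurableSet
  have hS0 : 0 ≤ sSup ((fun y => greenFn n Ω p y / infDist y F) '' (D ∩ V)) := by
    refine Real.sSup_nonneg ?_
    rintro _ ⟨y, hy, rfl⟩
    exact div_nonneg (G.g_le G.hp (hDA hy.1).2 (G.dp y (hDA hy.1).1)).1 infDist_nonneg
  have hW0 : 0 ≤ ∫ x in D, greenFn n Ω q x := setIntegral_nonneg hDm
    (fun x hx => (G.g_le G.hq (hDA hx).2 (G.dq x (hDA hx).1)).1)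
  have hT : ∀ s ∈ Ω, (∀ x ∈ Anl q r, r ≤ dist x s) → 0 ≤ ∫ x in Anl q r, greenFn n Ω s x := by
    intro s hs hd
    exact (integral_nonneg fun y => gO_nonneg G.hn1 G.hΩ hs y).trans (G.gO_le_int hs hd)
  have hTp := hT p G.hp G.dp
  have hTq := hT q G.hq G.dq
  have hSg0 : 0 ≤ ∑ I ∈ B0, 1/I.2 * ∫ x in cubeSet I.1 (2*I.2), JJ n Ω p q x := by
    refine Finset.sum_nonneg (fun I h => mul_nonneg ?_ ?_)
    · have := (hB I (hB0 h)).1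
      positivity
    · exact integral_nonneg (fun x => JJ_nonneg _ _ _ _ _)
  have hdp : 0 < δ^((1:ℝ)/2/2) := Real.rpow_pos_of_pos hδ _
  have hrn : 0 < r^(n+3) := pow_pos hr _
  have hX0 := mul_nonneg (mul_nonneg (inv_nonneg.2 hr.le) hS0) hW0
  have hY0 := mul_nonneg (mul_nonneg (div_nonneg hdp.le hrn.le) hTp) hTq
  refine ⟨B0, hB0, hX0, hY0, ?_⟩
  have k2raw := fun (h4 : K ⊆ OSet Ω) => G.K2_est
    (hK.inter_right (isClosed_le (continuous_infDist_pt F) continuous_const))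
    (K := K ∩ {x | infDist x F ≤ δ * r}) (δ := δ) (fun x hx => hK1 x hx.1)
    (inter_subset_left.trans hKΩ) (inter_subset_left.trans h4) hδ hδ1.le (fun x hx => hx.2)
  have k3raw : ∀ y ∈ K, y ∈ Ω \ OSet Ω → q ∈ Ω \ OSet Ω → t0 * r ≤ infDist y F →
      greenFn n Ω p q ≤ M / r^(n+3) *
      ((∫ x in Anl q r, greenFn n Ω p x) * ∫ x in Anl q r, greenFn n Ω q x) :=
    fun y hyK h1 h2 h3 => G.D2_lower h1 h2 (hK1 y hyK).1 (hK1 y hyK).2 ht0p (by linarith) h3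
  clear_value M t0 E
  generalize sSup ((fun y => greenFn n Ω p y / infDist y F) '' (D ∩ V)) = S at *
  generalize (∫ x in D, greenFn n Ω q x) = W at *
  generalize (∫ x in Anl q r, greenFn n Ω p x) = Tp at *
  generalize (∫ x in Anl q r, greenFn n Ω q x) = Tq at *
  generalize (∑ I ∈ B0, 1/I.2 * ∫ x in cubeSet I.1 (2*I.2), JJ n Ω p q x) = Sg at *
  generalize hX : r⁻¹ * S * W = X at *
  generalize hY : δ^((1:ℝ)/2/2) / r^(n+3) * Tp * Tq = Y at *
  have hs1 : 0 ≤ √(A * cCa n) := Real.sqrt_nonneg _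
  have hfin : ∀ a b c : ℝ, 0 ≤ a → a ≤ 2 * C1 * 20 * cG (n+1) → 0 ≤ b →
      b ≤ 2 * C1 * 2 * cS n * √(A * cCa n) + M / t0^((1:ℝ)/2/2) → 0 ≤ c → c ≤ 2 * C1 →
      greenFn n Ω p q ≤ a * X + b * Y + c * Sg →
      greenFn n Ω p q ≤ (2 * C1 * (1 + 20 * cG (n+1) + 2 * cS n * √(A * cCa n)) +
        M / t0^((1:ℝ)/2/2)) * (X + Y + Sg) := by
    intro a b c ha ha1 hb hb1 hc hc1 h
    have hm1 : 0 ≤ M / t0^((1:ℝ)/2/2) := by positivity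
    have hm2 : 0 ≤ 2 * C1 * 20 * cG (n+1) := by positivity
    have hm3 : 0 ≤ 2 * C1 * 2 * cS n * √(A * cCa n) := by positivity
    have q1 := mul_le_mul_of_nonneg_right (show a ≤ 2 * C1 * (1 + 20 * cG (n+1) +
      2 * cS n * √(A * cCa n)) + M / t0^((1:ℝ)/2/2) by linarith) hX0
    have q2 := mul_le_mul_of_nonneg_right (show b ≤ 2 * C1 * (1 + 20 * cG (n+1) +
      2 * cS n * √(A * cCa n)) + M / t0^((1:ℝ)/2/2) by linarith) hY0
    have q3 := mul_le_mul_of_nonneg_right (show c ≤ 2 * C1 * (1 + 20 * cG (n+1) +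
      2 * cS n * √(A * cCa n)) + M / t0^((1:ℝ)/2/2) by linarith) hSg0
    rw [mul_add, mul_add]
    linarith
  have hsplit : ∫ x in K, JJ n Ω p q x = (∫ x in K ∩ {x | δ * r < infDist x F}, JJ n Ω p q x) +
      ∫ x in K ∩ {x | infDist x F ≤ δ * r}, JJ n Ω p q x := by
    have hm : MeasurableSet {x : Euc (n+1) | δ * r < infDist x F} :=
      (isOpen_lt continuous_const (continuous_infDist_pt F)).measurableSet
    rw [← integral_inter_add_sdiff hm (JJ_int G.hn1 G.hΩ G.hp G.hq hK hKΩ hpK)]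
    congr 3
    ext x
    simp only [Set.mem_sdiff, mem_inter_iff, mem_ofPred_eq, not_lt]
  have hK2 : IsCompact (K ∩ {x | infDist x F ≤ δ * r}) :=
    hK.inter_right (isClosed_le (continuous_infDist_pt F) continuous_const)
  have hk1' : 1/r * ∫ x in K ∩ {x | δ * r < infDist x F}, JJ n Ω p q x ≤ 20 * cG (n+1) * X := by
    refine (mul_le_mul_of_nonneg_left k1 (by positivity)).trans (le_of_eq ?_)
    rw [← hX]
    field_simp
  have hd4 : √δ ≤ δ^((1:ℝ)/2/2) := by
    rw [Real.sqrt_eq_rpow]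
    exact Real.rpow_le_rpow_of_exponent_ge hδ (by linarith) (by norm_num)
  by_cases hqO : q ∈ OSet Ω
  · have hVO : V ⊆ OSet Ω := ball_OSet G.hΩ hVc hVΩ hqV hqO
    have k2 := k2raw (hKV.trans hVO)
    have hk2' : 1/r * ∫ x in K ∩ {x | infDist x F ≤ δ * r}, JJ n Ω p q x ≤
        2 * cS n * √(A * cCa n) * Y := by
      refine (mul_le_mul_of_nonneg_left k2 (by positivity)).trans ?_
      rw [Real.sqrt_mul (by positivity)]
      have e : 1/r * (2 * cS n * (√(A * cCa n) * √δ) / r^(n+2) * (Tp * Tq)) =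
          √δ * (2 * cS n * √(A * cCa n) / r^(n+3) * (Tp * Tq)) := by
        field_simp
        try ring
      rw [e]
      refine (mul_le_mul_of_nonneg_right hd4 (by positivity)).trans (le_of_eq ?_)
      rw [← hY]
      ring
    refine hfin (C1 * (20 * cG (n+1))) (C1 * (2 * cS n * √(A * cCa n))) C1 (by positivity) ?_
      (by positivity) ?_ hC1.le (by linarith) ?_
    · nlinarith [mul_pos hC1 hcG]
    · have hm1 : 0 ≤ M / t0^((1:ℝ)/2/2) := by positivity
      have hm3 : 0 ≤ C1 * 2 * cS n * √(A * cCa n) := by positivity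
      linarith
    · rw [hsplit, mul_add] at hflux
      have := mul_le_mul_of_nonneg_left (add_le_add hk1' hk2') hC1.le
      linarith
  · have hqU : q ∈ Ω \ OSet Ω := ⟨G.hq, hqO⟩
    have hVU : V ⊆ Ω \ OSet Ω := fun x hx =>
      ⟨hVΩ hx, fun hxO => hqO (ball_OSet G.hΩ hVc hVΩ hx hxO hqV)⟩
    have habs : ∀ t, 0 < t → t ≤ t0 → ∀ K' ⊆ K, IsCompact K' → (∀ x ∈ K', infDist x F ≤ t * r) →
        C1 * (1/r * ∫ x in K', JJ n Ω p q x) ≤ greenFn n Ω p q / 2 := by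
      intro t ht htt K' hK' hK'c hKt
      have h1 := G.D2_layer hK'c (fun x hx => hK1 x (hK' hx)) (hK'.trans (hKV.trans hVU)) hqU ht
        (by linarith) hKt
      rw [← hE] at h1
      have h2 : E * t * greenFn n Ω p q ≤ E * t0 * greenFn n Ω p q :=
        mul_le_mul_of_nonneg_right (mul_le_mul_of_nonneg_left htt hE0) hg0
      have h3 := mul_le_mul_of_nonneg_left (h1.trans h2) hC1.le
      have h4 := mul_le_mul_of_nonneg_right ht0E hg0
      linarith
    by_cases hdt : δ ≤ t0
    · have h1 := habs δ hδ hdt _ inter_subset_left hK2 (fun x hx => hx.2)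
      refine hfin (2 * C1 * 20 * cG (n+1)) 0 (2 * C1) (by positivity) le_rfl le_rfl (by positivity)
        (by positivity) le_rfl ?_
      rw [hsplit, mul_add] at hflux
      have := mul_le_mul_of_nonneg_left hk1' hC1.le
      linarith
    · push Not at hdt
      by_cases hy : ∃ y ∈ K, t0 * r ≤ infDist y F
      · obtain ⟨y, hyK, hyt⟩ := hy
        have h1 := k3raw y hyK (hVU (hKV hyK)) hqU hyt
        have hm3 : 0 ≤ 2 * C1 * 2 * cS n * √(A * cCa n) := by positivity
        refine hfin 0 (M / t0^((1:ℝ)/2/2)) 0 le_rfl (by positivity) (by positivity) (by linarith)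
          le_rfl (by positivity) ?_
        rw [zero_mul, zero_mul, zero_add, add_zero]
        refine h1.trans ?_
        have h5 : t0^((1:ℝ)/2/2) ≤ δ^((1:ℝ)/2/2) :=
          Real.rpow_le_rpow ht0p.le hdt.le (by norm_num)
        calc M / r^(n+3) * (Tp * Tq) =
            M / t0^((1:ℝ)/2/2) * (t0^((1:ℝ)/2/2) * (Tp * Tq / r^(n+3))) := by field_simp
          _ ≤ M / t0^((1:ℝ)/2/2) * (δ^((1:ℝ)/2/2) * (Tp * Tq / r^(n+3))) :=
            mul_le_mul_of_nonneg_left (mul_le_mul_of_nonneg_right h5 (by positivity)) (by positivity)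
          _ = M / t0^((1:ℝ)/2/2) * Y := by rw [← hY]; ring
      · push Not at hy
        have h1 := habs t0 ht0p le_rfl K subset_rfl hK (fun x hx => (hy x hx).le)
        have hm1 : 0 ≤ M / t0^((1:ℝ)/2/2) := by positivity
        refine hfin 0 0 (2 * C1) le_rfl (by positivity) le_rfl (by positivity) (by positivity) le_rfl ?_
        rw [mul_add] at hflux
        linarith


lemma wh_front {d : ℕ} {Ω : Set (Euc d)} {M₀ D₀ : ℝ} (Wh : Whitney Ω M₀ D₀)
    {W : Set (Euc d × ℝ)} (hW : W ⊆ Wh.fam) {x : Euc d} (hx : x ∈ Ω)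
    (hxV : x ∈ closure (⋃ I ∈ W, openCube I.1 (1.1 * I.2))) :
    ∃ I ∈ W, x ∈ cubeSet I.1 (1.1 * I.2) := by
  rw [← Wh.cover] at hx
  obtain ⟨J, hJ, hxJ⟩ := mem_iUnion₂.1 hx
  have hJ0 := Wh.pos J hJ
  have hxU : x ∈ openCube J.1 (10 * J.2) := cubeSet_sub_open J.1 (by linarith) hxJ
  have h1 := (isOpen_openCube J.1 (10 * J.2)).inter_closure ⟨hxU, hxV⟩
  have hfin : ({K | K ∈ Wh.fam ∧ ¬ Disjoint (cubeSet J.1 (10 * J.2)) (cubeSet K.1 (10 * K.2))} ∩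
      W).Finite := (Wh.overlap J hJ).1.inter_of_left _
  have hcl : IsClosed (⋃ K ∈ ({K | K ∈ Wh.fam ∧
      ¬ Disjoint (cubeSet J.1 (10 * J.2)) (cubeSet K.1 (10 * K.2))} ∩ W),
      cubeSet K.1 (1.1 * K.2)) := hfin.isClosed_biUnion (fun K _ => isClosed_cubeSet _ _)
  have hsub : openCube J.1 (10 * J.2) ∩ (⋃ I ∈ W, openCube I.1 (1.1 * I.2)) ⊆
      ⋃ K ∈ ({K | K ∈ Wh.fam ∧
      ¬ Disjoint (cubeSet J.1 (10 * J.2)) (cubeSet K.1 (10 * K.2))} ∩ W),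
      cubeSet K.1 (1.1 * K.2) := by
    rintro y ⟨hy1, hy2⟩
    obtain ⟨I, hI, hyI⟩ := mem_iUnion₂.1 hy2
    have hI0 := Wh.pos I (hW hI)
    have hyI' := openCube_subset _ _ hyI
    refine mem_iUnion₂.2 ⟨I, ⟨⟨hW hI, ?_⟩, hI⟩, hyI'⟩
    exact not_disjoint_iff.2 ⟨y, openCube_subset _ _ hy1, cubeSet_mono I.1 (by linarith) hyI'⟩
  obtain ⟨I, hI, hxI⟩ := mem_iUnion₂.1 (closure_minimal hsub hcl h1)
  exact ⟨I, hI.2, hxI⟩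

lemma cube_diam {d : ℕ} {c y : Euc d} {l t : ℝ} (ht : 0 ≤ t)
    (hd : EMetric.diam (cubeSet c l) ≤ ENNReal.ofReal t)
    (hy : y ∈ cubeSet c (2*l)) : dist y c ≤ t := by
  have e1 : c + (1/2:ℝ) • (y - c) ∈ cubeSet c l := by
    intro i
    have := hy i
    simp only [PiLp.add_apply, PiLp.smul_apply, PiLp.sub_apply, smul_eq_mul]
    rw [show c i + 1/2 * (y i - c i) - c i = 1/2 * (y i - c i) by ring, abs_mul,
      abs_of_pos (by norm_num : (0:ℝ) < 1/2)]
    linarith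
  have e2 : c - (1/2:ℝ) • (y - c) ∈ cubeSet c l := by
    intro i
    have := hy i
    simp only [PiLp.smul_apply, PiLp.sub_apply, smul_eq_mul]
    rw [show c i - 1/2 * (y i - c i) - c i = - (1/2 * (y i - c i)) by ring, abs_neg, abs_mul,
      abs_of_pos (by norm_num : (0:ℝ) < 1/2)]
    linarith
  have h := (Metric.edist_le_ediam_of_mem e1 e2).trans hd
  rw [edist_dist, ENNReal.ofReal_le_ofReal_iff ht] at h
  refine le_trans (le_of_eq ?_) h
  rw [dist_eq_norm, dist_eq_norm]
  congr 1
  module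

lemma setD_le {d : ℕ} {S T : Set (Euc d)} {x y : Euc d} (hx : x ∈ S) (hy : y ∈ T) :
    0 ≤ setD S T ∧ setD S T ≤ dist x y := by
  unfold setD
  have h0 : ∀ t ∈ Set.image2 dist S T, (0:ℝ) ≤ t := by
    rintro _ ⟨a, _, b, _, rfl⟩
    exact dist_nonneg
  exact ⟨Real.sInf_nonneg h0, csInf_le ⟨0, h0⟩ (mem_image2_of_mem hx hy)⟩

lemma sideLen_pos {n : ℕ} (Q : Cube n) : 0 < sideLen Q := by
  unfold sideLen
  positivity

section
variable {n : ℕ} {F : Set (Euc (n+1))} {μ : Measure (Euc (n+1))} {Cl : ℝ}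

lemma InD_len {L : DSLattice n F μ Cl} {R Q : Cube n} (h : InD L R Q) : sideLen Q ≤ sideLen R := by
  unfold sideLen
  exact zpow_le_zpow_right₀ (by norm_num) (neg_le_neg h.2.2)

lemma mem_dist {L : DSLattice n F μ Cl} {R : Cube n} (h : L.mem R) {x y : Euc (n+1)}
    (hx : x ∈ R.2) (hy : y ∈ R.2) : dist x y ≤ sideLen R := by
  have h1 := (Metric.edist_le_ediam_of_mem hx hy).trans (L.diam_le _ _ h)
  rw [edist_dist] at h1
  exact (ENNReal.ofReal_le_ofReal_iff (sideLen_pos R).le).1 h1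

lemma InD_center {L : DSLattice n F μ Cl} {R Q : Cube n} (h : InD L R Q) :
    L.center Q.2 ∈ R.2 := h.2.1 (L.center_mem _ _ h.1)

lemma InD_trans {L : DSLattice n F μ Cl} {R Q S : Cube n} (h : InD L R Q) (h' : InD L Q S) :
    InD L R S := ⟨h'.1, h'.2.1.trans h.2.1, h.2.2.trans h'.2.2⟩

lemma top_InD {Ω : Set (Euc (n+1))} {L : DSLattice n F μ Cl} {p : Euc (n+1)} {R₀ R : Cube n}
    {A ε : ℝ} {N : ℕ} (h : R ∈ TopbN Ω μ L p R₀ A ε N) : InD L R₀ R := by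
  obtain ⟨⟨k, hk⟩, -⟩ := h
  cases k with
  | zero => exact hk.1.1
  | succ k =>
    obtain ⟨S, -, -, hG⟩ := hk
    exact hG.1

end

/-- The geometric hypotheses of the analytic part hold for the configuration of the theorem. -/
lemma mk_Geo {n : ℕ} (hn : 2 ≤ n) {C₀ Cl : ℝ} (hC₀ : 1 ≤ C₀) (hCl : 1 ≤ Cl)
    {Ω F : Set (Euc (n+1))} (hF : IsClosed F) (hAD : ADRegular n C₀ F) (hΩF : Ω = Fᶜ)
    {μ : Measure (Euc (n+1))} (hμ : μ = (μH[n]).restrict F)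
    {L : DSLattice n F μ Cl} {R₀ R' Q : Cube n} {p q : Euc (n+1)}
    (hR₀ : L.mem R₀) (hp : p ∈ Ω) (hpB : p ∉ cubeBall L 4 R₀) (hR' : InD L R₀ R')
    (hQ : InD L R' Q) (hq : q ∈ cubeBall L 2 Q ∩ Ω) :
    dist q (L.center R'.2) ≤ 9 * sideLen R' ∧
    Geo n Ω F p q (2 * sideLen R') (cLay n C₀ Cl) := by
  have hl := sideLen_pos R'
  have hl0 := sideLen_pos R₀
  have hll := InD_len hR'
  have hlQ := InD_len hQ
  have hzF : L.center R'.2 ∈ F := L.subset_F _ _ hR'.1 (L.center_mem _ _ hR'.1)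
  have d1 : dist q (L.center R'.2) ≤ 9 * sideLen R' := by
    have h1 : dist q (L.center Q.2) < 2 * (4 * sideLen Q) := hq.1
    have h2 := mem_dist hR'.1 (InD_center hQ) (L.center_mem _ _ hR'.1)
    linarith [dist_triangle q (L.center Q.2) (L.center R'.2)]
  have d2 : ∀ x, dist x q < 2 * (2 * sideLen R') → dist x (L.center R'.2) < 13 * sideLen R' := by
    intro x hx
    linarith [dist_triangle x q (L.center R'.2)]
  have hmeas : ENNReal.ofReal (Cl⁻¹ * (sideLen R')^n) ≤ μH[n] R'.2 := by
    refine (L.measure_lb _ _ hR'.1).trans ?_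
    rw [hμ]
    exact Measure.restrict_apply_le _ _
  have hRF := L.subset_F _ _ hR'.1
  have hball : ball q (2 * (2 * sideLen R')) ⊆ ball (L.center R'.2) (13 * sideLen R') :=
    fun x hx => d2 x hx
  have hc := cLay_pos n hC₀ hCl
  refine ⟨d1, ?_⟩
  refine ⟨hn, ?_, hΩF, ⟨_, hzF⟩, hp, hq.2, by positivity, hc.le, ?_, ?_, ?_, ?_⟩
  · rw [hΩF]; exact hF.isOpen_compl
  · intro x hx
    have h1 := d2 x hx
    have h2 : 4 * (4 * sideLen R₀) ≤ dist p (L.center R₀.2) := not_lt.1 hpB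
    have h3 := mem_dist hR₀ (InD_center hR') (L.center_mem _ _ hR₀)
    have h4 := dist_triangle p x (L.center R₀.2)
    have h5 := dist_triangle x (L.center R'.2) (L.center R₀.2)
    rw [dist_comm p x] at h4
    linarith
  · intro x hx
    linarith [infDist_le_dist_of_mem (x := x) hzF, d2 x hx]
  · intro t ht htr
    have h1 := layer (by omega) hC₀ hCl hF hAD hRF hl hmeas hzF ht (by linarith)
    have h2 : volume.real {x ∈ ball q (2 * (2 * sideLen R')) | infDist x F ≤ t} ≤
        volume.real {x ∈ ball (L.center R'.2) (13 * sideLen R') | infDist x F ≤ t} := by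
      refine measureReal_mono (fun x hx => ⟨hball hx.1, hx.2⟩) ?_
      exact ((measure_mono (fun x hx => hx.1)).trans_lt measure_ball_lt_top).ne
    refine h2.trans (h1.trans ?_)
    exact mul_le_mul_of_nonneg_left (pow_le_pow_left₀ hl.le (by linarith) n) (by positivity)
  · exact measure_mono_null (inter_subset_inter_right _ hball)
      (layer_null (by omega) hC₀ hCl hF hAD hRF hl hmeas hzF)

/-- The boundary of `V_i` near `q` is covered by the dilated cubes of `Bdy(R')`. -/
lemma bdy_cover {n : ℕ} {F : Set (Euc (n+1))} {Cl M₀ D₀ : ℝ}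
    {Ω : Set (Euc (n+1))} {μ : Measure (Euc (n+1))} {L : DSLattice n F μ Cl}
    {Wh : Whitney Ω M₀ D₀} {p : Euc (n+1)} {R₀ : Cube n} {A ε C₄ Γ : ℝ} {N : ℕ}
    {x1 x2 : Cube n → Euc (n+1)} {κ₁ γ C₅ CV Cch cb Cpk CP : ℝ}
    {R R' : Cube n} {V₁ V₂ : Set (Euc (n+1))} {y1 y2 : Cube n → Euc (n+1)}
    (hFr : frontier Ω = F) (hR' : L.mem R')
    (hV1 : IsOpen V₁) (hV2 : IsOpen V₂)
    (hGP : GLProps Ω μ L Wh p R₀ A ε C₄ Γ N x1 x2 κ₁ γ C₅ CV Cch cb Cpk CP R R' V₁ V₂ y1 y2)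
    {V : Set (Euc (n+1))} (hV : V = V₁ ∨ V = V₂) {x : Euc (n+1)} (hx : x ∈ frontier V)
    (hxz : dist x (L.center R'.2) < 13 * sideLen R') (hxp : 2 * sideLen R' ≤ dist x p) :
    ∃ I ∈ BdyFam Ω μ L Wh p R₀ A ε C₄ Γ N x1 x2 R R' V₁ V₂, x ∈ cubeSet I.1 (1.1*I.2) ∧
      p ∉ cubeSet I.1 (2*I.2) := by
  obtain ⟨-, -, -, -, hdis, ⟨W₁, hW₁, eV1⟩, ⟨W₂, hW₂, eV2⟩, -, -, hcov, hWP⟩ := hGP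
  have hl := sideLen_pos R'
  have hxB : x ∈ cubeBall L 10 R' := by
    show dist x (L.center R'.2) < 10 * (4 * sideLen R')
    linarith
  have hxU : x ∈ frontier V₁ ∪ frontier V₂ := by
    rcases hV with rfl | rfl
    · exact Or.inl hx
    · exact Or.inr hx
  obtain ⟨e, he, hxe⟩ := mem_iUnion₂.1 (hcov ⟨hxU, hxB⟩)
  have hne : (cubeBall L 2 e ∩ cubeBall L 10 R').Nonempty := ⟨x, hxe, hxB⟩
  obtain ⟨WP, hWPf, c1, c2, -⟩ := hWP e he hne
  have hxJ : x ∈ ⋃ I ∈ WP, cubeSet I.1 I.2 := by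
    rcases hxU with h | h
    · exact c1 ⟨h, hxe⟩
    · exact c2 ⟨h, hxe⟩
  have hxΩ : x ∈ Ω := by
    rw [← Wh.cover]
    obtain ⟨J, hJ, h⟩ := mem_iUnion₂.1 hxJ
    exact mem_iUnion₂.2 ⟨J, hWPf hJ, h⟩
  obtain ⟨W, hW, eV, hVsub, hVo, hxfr⟩ : ∃ W ⊆ Wh.fam, V = (⋃ I ∈ W, openCube I.1 (1.1 * I.2)) ∧
      V ⊆ V₁ ∪ V₂ ∧ IsOpen V ∧ x ∈ frontier (V₁ ∪ V₂) := by
    have hopen := hV1.union hV2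
    rcases hV with rfl | rfl
    · refine ⟨W₁, hW₁, eV1, subset_union_left, hV1, ?_⟩
      rw [hopen.frontier_eq]
      rw [hV1.frontier_eq] at hx
      refine ⟨closure_mono subset_union_left hx.1, ?_⟩
      rintro (h | h)
      · exact hx.2 h
      · exact disjoint_left.1 hdis hx.1 (subset_closure h)
    · refine ⟨W₂, hW₂, eV2, subset_union_right, hV2, ?_⟩
      rw [hopen.frontier_eq]
      rw [hV2.frontier_eq] at hx
      refine ⟨closure_mono subset_union_right hx.1, ?_⟩
      rintro (h | h)
      · exact disjoint_left.1 hdis (subset_closure h) hx.1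
      · exact hx.2 h
  obtain ⟨I, hI, hxI⟩ := wh_front Wh hW hxΩ (by rw [← eV]; exact hx.1)
  have hI0 := Wh.pos I (hW hI)
  refine ⟨I, ⟨e, he, hne, hW hI, ?_, ⟨x, ⟨hxI, hxfr⟩, hxe⟩⟩, hxI, ?_⟩
  · refine subset_trans ?_ hVsub
    rw [eV]
    exact (cubeSet_sub_open I.1 (by linarith)).trans
      (subset_biUnion_of_mem (u := fun I : Euc (n+1) × ℝ => openCube I.1 (1.1 * I.2)) hI)
  · intro hpI
    have hcI : I.1 ∈ cubeSet I.1 I.2 := by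
      intro i
      simp only [sub_self, abs_zero]
      linarith
    have hzF : L.center R'.2 ∈ frontier Ω := by
      rw [hFr]; exact L.subset_F _ _ hR' (L.center_mem _ _ hR')
    obtain ⟨s0, s1⟩ := setD_le hcI hzF
    have hds := Wh.diam_small I (hW hI)
    have a1 := cube_diam (by linarith) hds hpI
    have a2 := cube_diam (by linarith) hds (cubeSet_mono I.1 (by linarith) hxI)
    have a3 := dist_triangle x I.1 p
    rw [dist_comm I.1 p] at a3
    have a4 := dist_triangle I.1 x (L.center R'.2)
    rw [dist_comm I.1 x] at a4
    linarith


/-- Under the assumptions and notation of the Geometric Lemma, for a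
corkscrew point `q ∈ V_i` of a cube `Q ∈ Stop_WSBC(R) ∩ D_μ(R') ∩ G`, with
`r := 2ℓ(R')` and `A_r^δ := {x ∈ A(q,r,2r) ∩ Ω : δ_Ω(x) > δ r}`, the Green function
satisfies
`g(p,q) ≲ r⁻¹ sup_{A_r^δ ∩ V_i} (g(p,·)/δ_Ω) ∫_{A_r^δ} g(q,·)
 + δ^{α/2} r^{-(n+3)} ∫_{A(q,r,2r)} g(p,·) ∫_{A(q,r,2r)} g(q,·)
 + ∑_{I ∈ Bdy(R')} ℓ(I)⁻¹ ∫_{2I} |g(p,·)∇g(q,·) − ∇g(p,·) g(q,·)|`,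
where `α` is the boundary Hölder exponent, depending only on `n` and the AD-regularity
constant. -/
theorem green_function_boundary_estimate
    (n : ℕ) (hn : 2 ≤ n) (C₀ Cl c c' A ε C₄ M₀ D₀ C₅ κ₁ Γ γ CV Cch cb Cpk CP : ℝ)
    (hC₀ : 1 ≤ C₀) (hCl : 1 ≤ Cl) (hc : 0 < c) (hc' : 0 < c') (hA : 1 ≤ A)
    (hε : ε ∈ Set.Ioo (0:ℝ) 1) (hC₄ : 1 ≤ C₄) (hM₀ : 20 < M₀) (hD₀ : 1 ≤ D₀)
    (hC₅ : 1 ≤ C₅) (hκ₁ : 0 < κ₁) (hΓ : 1 ≤ Γ) (hγ : γ ∈ Set.Ioo (0:ℝ) 1)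
    (D : ℝ → ℝ) (N : ℕ) :
    ∃ α ∈ Set.Ioo (0:ℝ) 1, ∃ Cc : ℝ, 0 < Cc ∧
      ∀ (F : Set (Euc (n+1))), IsClosed F → ADRegular n C₀ F →
      ∀ Ω : Set (Euc (n+1)), Ω = Fᶜ → frontier Ω = F →
      ∀ μ : Measure (Euc (n+1)), μ = (μH[n]).restrict (frontier Ω) →
      ∀ (L : DSLattice n (frontier Ω) μ Cl) (R₀ : Cube n) (p : Euc (n+1)),
        L.mem R₀ → p ∈ Ω → p ∉ cubeBall L 4 R₀ →
        c * sideLen R₀ ≤ infDist p (frontier Ω) →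
        infDist p (frontier Ω) ≤ infDist p R₀.2 →
        infDist p R₀.2 ≤ c⁻¹ * sideLen R₀ →
        c' ≤ hMeasure Ω p R₀.2 →
        WeakAInftyBallWith n Ω p (L.center R₀.2) (4 * sideLen R₀) D →
      ∀ (Wh : Whitney Ω M₀ D₀) (Lpl : Cube n → AffineSubspace ℝ (Euc (n+1)))
        (x1 x2 : Cube n → Euc (n+1)),
        BigCorkData n L (frontier Ω) ε C₄ Lpl x1 x2 →
      ∀ R : Cube n, R ∈ TopbN Ω μ L p R₀ A ε N → R ∈ WSBCfam Ω L ε C₄ Γ x1 x2 →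
      ∀ R' ∈ TreeW Ω μ L p R₀ A ε C₄ Γ N x1 x2 R,
      ∀ (V₁ V₂ : Set (Euc (n+1))) (y1 y2 : Cube n → Euc (n+1)),
        IsOpen V₁ → IsOpen V₂ →
        GLProps Ω μ L Wh p R₀ A ε C₄ Γ N x1 x2 κ₁ γ C₅ CV Cch cb Cpk CP
          R R' V₁ V₂ y1 y2 →
      ∀ Vi : Set (Euc (n+1)), Vi = V₁ ∨ Vi = V₂ →
      ∀ Q : Cube n, Q ∈ StopW Ω μ L p R₀ A ε C₄ Γ N x1 x2 R → InD L R' Q →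
        Q ∈ Gfam Ω μ L p R₀ A →
      ∀ q ∈ Vi, q ∈ cubeBall L 2 Q ∩ Ω → κ₁ * sideLen Q ≤ infDist q (frontier Ω) →
      ∀ δ ∈ Set.Ioo (0:ℝ) (1/100),
      ∀ Ann Arδ : Set (Euc (n+1)),
        Ann = ball q (2 * (2 * sideLen R')) \ closedBall q (2 * sideLen R') →
        Arδ = {x ∈ Ann | x ∈ Ω ∧ δ * (2 * sideLen R') < infDist x (frontier Ω)} →
        ENNReal.ofReal (greenFn n Ω p q) ≤
          ENNReal.ofReal Cc *
            (ENNReal.ofReal ((2 * sideLen R')⁻¹ *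
                sSup ((fun y => greenFn n Ω p y / infDist y (frontier Ω)) ''
                  (Arδ ∩ Vi)) *
                ∫ x in Arδ, greenFn n Ω q x) +
              ENNReal.ofReal (δ ^ (α / 2) / (2 * sideLen R') ^ (n + 3) *
                (∫ x in Ann, greenFn n Ω p x) * ∫ x in Ann, greenFn n Ω q x) +
              ∑' I : BdyFam Ω μ L Wh p R₀ A ε C₄ Γ N x1 x2 R R' V₁ V₂,
                ENNReal.ofReal ((1 / (I : Euc (n+1) × ℝ).2) *
                  ∫ x in cubeSet (I : Euc (n+1) × ℝ).1 (2 * (I : Euc (n+1) × ℝ).2),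
                    ‖greenFn n Ω p x • gradient (greenFn n Ω q) x -
                      greenFn n Ω q x • gradient (greenFn n Ω p) x‖)) := by
  have hcl := cLay_pos n hC₀ hCl
  obtain ⟨C, hC, H⟩ := main_analytic n hn (cLay n C₀ Cl) hcl.le
  refine ⟨1/2, ⟨by norm_num, by norm_num⟩, C, hC, ?_⟩
  intro F hF hAD Ω hΩF hfr μ hμ L R₀ p hR₀ hp hpB _ _ _ _ _ Wh Lpl x1 x2 _ R hR _ R' hR' V₁ V₂
    y1 y2 hV1 hV2 hGP Vi hVi Q _ hQ _ q hqV hq _ δ hδ Ann Arδ hAnn hAr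
  have hR'D : InD L R₀ R' := InD_trans (top_InD hR) hR'.1
  obtain ⟨d1, G⟩ := mk_Geo (F := frontier Ω) hn hC₀ hCl isClosed_frontier (hfr ▸ hAD)
    (by rw [hfr]; exact hΩF) hμ hR₀ hp hpB hR'D hQ hq
  have hl := sideLen_pos R'
  have hVo : IsOpen Vi := by rcases hVi with rfl | rfl <;> assumption
  have hVc : IsPreconnected Vi := by
    rcases hVi with rfl | rfl
    · exact hGP.1.isPreconnected
    · exact hGP.2.1.isPreconnected
  have hVΩ : Vi ⊆ Ω := by
    rcases hVi with rfl | rfl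
    · exact hGP.2.2.1.trans inter_subset_right
    · exact hGP.2.2.2.1.trans inter_subset_right
  obtain ⟨B0, hB0, hX, hY, hmain⟩ := H Ω (frontier Ω) p q (2 * sideLen R') G Vi hVo hVc hVΩ hqV
    (BdyFam Ω μ L Wh p R₀ A ε C₄ Γ N x1 x2 R R' V₁ V₂)
    (by
      rintro I ⟨e, -, -, hI, -⟩
      exact ⟨Wh.pos I hI, Wh.inside I hI⟩)
    (fun x hx hxq => bdy_cover rfl hR'D.1 hV1 hV2 hGP hVi hx
      (by linarith [dist_triangle x q (L.center R'.2)]) (G.far x (by linarith)))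
    δ hδ.1 hδ.2 Arδ (by rw [hAr, hAnn]; rfl)
  have eAnn : Ann = Anl q (2 * sideLen R') := hAnn
  rw [← eAnn] at hmain hY
  have hpos : ∀ I ∈ B0, 0 ≤ 1/I.2 * ∫ x in cubeSet I.1 (2*I.2), JJ n Ω p q x := by
    intro I hI
    obtain ⟨e, -, -, hIf, -⟩ := hB0 hI
    have := Wh.pos I hIf
    exact mul_nonneg (by positivity) (integral_nonneg (fun x => JJ_nonneg _ _ _ _ _))
  refine (ENNReal.ofReal_le_ofReal hmain).trans ?_
  rw [ENNReal.ofReal_mul hC.le, ENNReal.ofReal_add (add_nonneg hX hY) (Finset.sum_nonneg hpos),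
    ENNReal.ofReal_add hX hY, ENNReal.ofReal_sum_of_nonneg hpos]
  refine mul_le_mul_right (add_le_add le_rfl ?_) _
  have h1 : ∑ I ∈ B0, ENNReal.ofReal (1/I.2 * ∫ x in cubeSet I.1 (2*I.2), JJ n Ω p q x) =
      ∑' I : (B0 : Set (Euc (n+1) × ℝ)), ENNReal.ofReal (1/(I : Euc (n+1) × ℝ).2 *
        ∫ x in cubeSet (I : Euc (n+1) × ℝ).1 (2*(I : Euc (n+1) × ℝ).2), JJ n Ω p q x) :=
    (Finset.tsum_subtype' B0 (fun I : Euc (n+1) × ℝ =>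
      ENNReal.ofReal (1/I.2 * ∫ x in cubeSet I.1 (2*I.2), JJ n Ω p q x))).symm
  rw [h1]
  exact ENNReal.tsum_mono_subtype (fun I : Euc (n+1) × ℝ =>
      ENNReal.ofReal (1/I.2 * ∫ x in cubeSet I.1 (2*I.2), JJ n Ω p q x)) hB0


end HarmMeas
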